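/- Let S be a set and let R be a symmetrized subset of the free group F(S) satisfying the C(6) small-cancellation condition, and let G = ⟨S | R⟩ be the presented group. Then for all sets A and B each having at least two elements, G contains no subgroup isomorphic to F(A) × F(B), the direct product of the free group on A with the free group on B. -/

import Mathlib

/-- Length of the reduced word of an element of a free group. -/
def FG.len {S : Type*} [DecidableEq S] (g : FreeGroup S) : ℕ :=
  g.toWord.length

/-- `r` is cyclically reduced: every conjugate is at least as long. -/
def FG.CyclicallyReduced {S : Type*} [DecidableEq S] (r : FreeGroup S) : Prop :=
  ∀ g : FreeGroup S, FG.len r ≤ FG.len (g⁻¹ * r * g)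

/-- `R` is a symmetrized subset: every element is nontrivial and cyclically
reduced, `R` is closed under inversion and under cyclic permutation. -/
def FG.Symmetrized {S : Type*} [DecidableEq S] (R : Set (FreeGroup S)) : Prop :=
  (∀ r ∈ R, r ≠ 1 ∧ FG.CyclicallyReduced r) ∧
  (∀ r ∈ R, r⁻¹ ∈ R) ∧
  (∀ r ∈ R, ∀ u v : FreeGroup S,
      r = u * v → FG.len r = FG.len u + FG.len v → v * u ∈ R)

/-- `p` is a piece relative to `R`. -/
def FG.IsPiece {S : Type*} [DecidableEq S] (R : Set (FreeGroup S))
    (p : FreeGroup S) : Prop :=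
  p ≠ 1 ∧
  ∃ r₁ ∈ R, ∃ r₂ ∈ R, r₁ ≠ r₂ ∧
    (∃ v₁ : FreeGroup S, r₁ = p * v₁ ∧ FG.len r₁ = FG.len p + FG.len v₁) ∧
    (∃ v₂ : FreeGroup S, r₂ = p * v₂ ∧ FG.len r₂ = FG.len p + FG.len v₂)

/-- The C(6) small-cancellation condition: no relator is a reduced
concatenation of at most 5 pieces. -/
def FG.C6 {S : Type*} [DecidableEq S] (R : Set (FreeGroup S)) : Prop :=
  ¬ ∃ r ∈ R, ∃ ps : List (FreeGroup S),
      ps.length ≤ 5 ∧ (∀ p ∈ ps, FG.IsPiece R p) ∧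
      r = ps.prod ∧ FG.len r = (ps.map FG.len).sum

namespace C6
open Finset Equiv Module
set_option linter.unusedSectionVars false
set_option linter.unusedVariables false

/-- words in the letters of `S` and their inverses -/
abbrev Wd (S : Type*) := List (S × Bool)

section
variable {S : Type*}

/-- inverse letter -/
def li (a : S × Bool) : S × Bool := (a.1, !a.2)

@[simp] theorem li_li (a : S × Bool) : li (li a) = a := by simp [li]
theorem li_ne (a : S × Bool) : li a ≠ a := by
  intro h; have := congrArg Prod.snd h; simp [li] at this
theorem li_inj {a b : S × Bool} (h : li a = li b) : a = b := by
  rw [← li_li a, h, li_li]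

/-- inverse word -/
def iw (w : Wd S) : Wd S := (w.map li).reverse

@[simp] theorem iw_iw (w : Wd S) : iw (iw w) = w := by
  simp [iw, Function.comp_def]
@[simp] theorem iw_length (w : Wd S) : (iw w).length = w.length := by simp [iw]
theorem iw_append (u v : Wd S) : iw (u ++ v) = iw v ++ iw u := by simp [iw]
theorem iw_inj {u v : Wd S} (h : iw u = iw v) : u = v := by
  rw [← iw_iw u, h, iw_iw]

/-- p is a piece -/
def Piece (Rw : Set (Wd S)) (p : Wd S) : Prop :=
  p ≠ [] ∧ ∃ r₁ ∈ Rw, ∃ r₂ ∈ Rw, r₁ ≠ r₂ ∧ p <+: r₁ ∧ p <+: r₂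

/-- abstract small cancellation data on words -/
structure SC (Rw : Set (Wd S)) : Prop where
  ne : ∀ l ∈ Rw, l ≠ []
  rot1 : ∀ l ∈ Rw, l.rotate 1 ∈ Rw
  inv : ∀ l ∈ Rw, iw l ∈ Rw
  red : ∀ a b t, (a :: b :: t) ∈ Rw → b ≠ li a
  c6 : ∀ l ∈ Rw, ∀ ps : List (Wd S), ps.length ≤ 5 →
    (∀ p ∈ ps, Piece Rw p) → ps.flatten ≠ l

theorem SC.rot {Rw : Set (Wd S)} (h : SC Rw) {l} (hl : l ∈ Rw) (i : ℕ) :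
    l.rotate i ∈ Rw := by
  induction i with
  | zero => simpa using hl
  | succ n ih => rw [← List.rotate_rotate]; exact h.rot1 _ ih

theorem SC.pf {Rw : Set (Wd S)} (h : SC Rw) {l l'} (hl : l ∈ Rw) (hl' : l' ∈ Rw)
    (hp : l <+: l') : l = l' := by
  by_contra hne
  refine h.c6 l hl [l] (by simp) ?_ (by simp)
  intro p hp'
  simp only [List.mem_singleton] at hp'
  subst hp'
  exact ⟨h.ne _ hl, _, hl, l', hl', hne, List.prefix_refl _, hp⟩

section fromFG
variable [DecidableEq S]

theorem red_append {u v : Wd S} (h : FreeGroup.IsReduced (u ++ v)) :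
    (FreeGroup.mk (u ++ v)).toWord = u ++ v ∧ (FreeGroup.mk u).toWord = u ∧
    (FreeGroup.mk v).toWord = v := by
  have hu : FreeGroup.IsReduced u := List.IsChain.left_of_append h
  have hv : FreeGroup.IsReduced v := List.IsChain.right_of_append h
  simp only [FreeGroup.toWord_mk]
  exact ⟨h.reduce_eq, hu.reduce_eq, hv.reduce_eq⟩

theorem sc_of_FG {R : Set (FreeGroup S)} (hS : FG.Symmetrized R) (hC : FG.C6 R) :
    SC (FreeGroup.toWord '' R) := by
  obtain ⟨h1, h2, h3⟩ := hS
  constructor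
  · rintro _ ⟨r, hr, rfl⟩ h
    exact (h1 r hr).1 (FreeGroup.toWord_eq_nil_iff.1 h)
  · rintro _ ⟨r, hr, rfl⟩
    rcases hw : r.toWord with _ | ⟨a, t⟩
    · exact absurd (FreeGroup.toWord_eq_nil_iff.1 hw) (h1 r hr).1
    have hrd : FreeGroup.IsReduced ([a] ++ t) := by
      have := FreeGroup.isReduced_toWord (x := r); rwa [hw] at this
    obtain ⟨e1, e2, e3⟩ := red_append hrd
    have hr' : r = FreeGroup.mk [a] * FreeGroup.mk t := by
      rw [FreeGroup.mul_mk, ← FreeGroup.mk_toWord (x := r), hw]; rfl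
    have hm := h3 r hr _ _ hr' (by
      simp only [FG.len, e2, e3, hw]; simp; omega)
    refine ⟨_, hm, ?_⟩
    have hc := (h1 r hr).2 (FreeGroup.mk [a])
    have : (FreeGroup.mk [a])⁻¹ * r * FreeGroup.mk [a] = FreeGroup.mk t * FreeGroup.mk [a] := by
      rw [hr']; group
    rw [this] at hc
    simp only [FG.len, hw, FreeGroup.mul_mk, FreeGroup.toWord_mk] at hc
    have hs : (FreeGroup.reduce (t ++ [a])).Sublist (t ++ [a]) :=
      FreeGroup.Red.sublist FreeGroup.reduce.red
    simp only [FreeGroup.mul_mk, FreeGroup.toWord_mk]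
    rw [hs.eq_of_length (le_antisymm hs.length_le (by simpa using hc))]
    simp
  · rintro _ ⟨r, hr, rfl⟩
    exact ⟨_, h2 r hr, by rw [FreeGroup.toWord_inv]; rfl⟩
  · rintro a b t ⟨r, hr, h⟩ hb
    have := FreeGroup.isReduced_toWord (x := r)
    rw [h, FreeGroup.IsReduced.eq_1] at this
    simp only [List.isChain_cons_cons] at this
    have := this.1 (by simp [hb, li])
    simp [hb, li] at this
  · rintro _ ⟨r, hr, rfl⟩ ps hlen hps hfl
    apply hC
    have key : ∀ qs : List (Wd S), (∀ p ∈ qs, Piece (FreeGroup.toWord '' R) p) →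
        (qs.map FreeGroup.mk).prod = FreeGroup.mk qs.flatten ∧
        ((qs.map FreeGroup.mk).map FG.len).sum = qs.flatten.length ∧
        ∀ p ∈ qs.map FreeGroup.mk, FG.IsPiece R p := by
      intro qs hq
      induction qs with
      | nil => simp [FreeGroup.one_eq_mk]
      | cons p qs ih =>
        obtain ⟨i1, i2, i3⟩ := ih (fun q hq' => hq q (by simp [hq']))
        obtain ⟨hne, _, ⟨s₁, hs₁, rfl⟩, _, ⟨s₂, hs₂, rfl⟩, hne', ⟨v₁, hv₁⟩, ⟨v₂, hv₂⟩⟩ := hq p (by simp)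
        have q1 : FreeGroup.IsReduced (p ++ v₁) := hv₁ ▸ FreeGroup.isReduced_toWord
        have q2 : FreeGroup.IsReduced (p ++ v₂) := hv₂ ▸ FreeGroup.isReduced_toWord
        obtain ⟨a1, a2, a3⟩ := red_append q1
        obtain ⟨b1, b2, b3⟩ := red_append q2
        refine ⟨by simp [i1, FreeGroup.mul_mk], ?_, ?_⟩
        · rw [List.map_cons, List.map_cons, List.sum_cons, i2, FG.len, a2]
          simp
        · intro q hq'
          rw [List.map_cons, List.mem_cons] at hq'
          rcases hq' with rfl | hq'
          · refine ⟨?_, s₁, hs₁, s₂, hs₂, fun h => hne' (by rw [h]), ⟨FreeGroup.mk v₁, ?_, ?_⟩,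
              ⟨FreeGroup.mk v₂, ?_, ?_⟩⟩
            · intro h
              rw [h] at a2; simp at a2; exact hne a2
            · rw [FreeGroup.mul_mk, hv₁, FreeGroup.mk_toWord]
            · rw [FG.len, FG.len, FG.len, ← hv₁, a2, a3]; simp
            · rw [FreeGroup.mul_mk, hv₂, FreeGroup.mk_toWord]
            · rw [FG.len, FG.len, FG.len, ← hv₂, b2, b3]; simp
          · exact i3 q hq'
    obtain ⟨k1, k2, k3⟩ := key ps hps
    refine ⟨r, hr, ps.map FreeGroup.mk, by simpa using hlen, k3, ?_, ?_⟩
    · rw [k1, hfl, FreeGroup.mk_toWord]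
    · rw [k2, hfl, FG.len]
end fromFG

/-! ### covering lemma -/

variable {Rw : Set (Wd S)}

theorem cover_aux (h : SC Rw) {r : Wd S} (hr : r ∈ Rw)
    (comp : ℕ → Wd S) (mark : ℕ → Prop)
    (hc1 : ∀ i < r.length, comp i ∈ Rw) (hc2 : ∀ i < r.length, comp i ≠ r.rotate i)
    (hc3 : ∀ i < r.length, (comp i).head? = r[i]?)
    (hu : ∀ i, i + 1 < r.length → ¬ mark (i + 1) → comp (i + 1) = (comp i).rotate 1)
    (i j : ℕ) (hij : i < j) (hj : j ≤ r.length) (hm : ∀ t, i < t → t < j → ¬ mark t) :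
    Piece Rw ((r.drop i).take (j - i)) := by
  have hrot : ∀ t, i + t < j → comp (i + t) = (comp i).rotate t := by
    intro t
    induction t with
    | zero => simp
    | succ t ih =>
      intro ht
      rw [← List.rotate_rotate, ← ih (by omega)]
      exact hu (i + t) (by omega) (hm _ (by omega) (by omega))
  have hlet : ∀ t, i + t < j → t < (comp i).length → (comp i)[t]? = r[i + t]? := by
    intro t ht ht'
    rw [← hc3 (i + t) (by omega), hrot t ht, List.head?_rotate ht']
  have hdr : r.drop i <+: r.rotate i := by
    rw [List.rotate_eq_drop_append_take (by omega)]
    exact List.prefix_append _ _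
  have htk : ∀ t, t ≤ j - i → t ≤ (comp i).length → (comp i).take t = (r.drop i).take t := by
    intro t ht ht'
    apply List.ext_getElem?
    intro k
    simp only [List.getElem?_take, List.getElem?_drop]
    split_ifs with hk
    · exact hlet k (by omega) (by omega)
    · rfl
  have hlen : j - i ≤ (comp i).length := by
    by_contra hcon
    push Not at hcon
    have := htk _ hcon.le le_rfl
    rw [List.take_length] at this
    refine hc2 i (by omega) (h.pf (hc1 i (by omega)) (h.rot hr i) ?_)
    rw [this]
    exact (List.IsPrefix.trans ⟨_, List.take_append_drop _ _⟩) hdr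
  refine ⟨?_, comp i, hc1 i (by omega), r.rotate i, h.rot hr i, hc2 i (by omega), ?_,
    (List.IsPrefix.trans ⟨_, List.take_append_drop _ _⟩) hdr⟩
  · intro h0
    have := congrArg List.length h0
    simp at this
    omega
  · rw [← htk _ le_rfl hlen]; exact ⟨_, List.take_append_drop _ _⟩

open Classical in
theorem cover_lin (h : SC Rw) {r : Wd S} (hr : r ∈ Rw)
    (comp : ℕ → Wd S) (mark : ℕ → Prop)
    (hc1 : ∀ i < r.length, comp i ∈ Rw) (hc2 : ∀ i < r.length, comp i ≠ r.rotate i)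
    (hc3 : ∀ i < r.length, (comp i).head? = r[i]?)
    (hu : ∀ i, i + 1 < r.length → ¬ mark (i + 1) → comp (i + 1) = (comp i).rotate 1) :
    5 ≤ #{i ∈ range r.length | 0 < i ∧ mark i} := by
  have key : ∀ m i, r.length - i = m → i < r.length → ∃ ps : List (Wd S),
      (∀ p ∈ ps, Piece Rw p) ∧ ps.flatten = r.drop i ∧
      ps.length ≤ 1 + #{t ∈ range r.length | i < t ∧ mark t} := by
    intro m
    induction m using Nat.strong_induction_on with
    | _ m ih =>
    intro i hm hi
    by_cases hex : ∃ j, i < j ∧ j < r.length ∧ mark j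
    · classical
      let j := Nat.find hex
      obtain ⟨hj1, hj2, hj3⟩ := Nat.find_spec hex
      change i < j at hj1
      change j < r.length at hj2
      change mark j at hj3
      have hjm : ∀ t, i < t → t < j → ¬ mark t := fun t h1 h2 h3 =>
        Nat.find_min hex h2 ⟨h1, by omega, h3⟩
      obtain ⟨ps, p1, p2, p3⟩ := ih (r.length - j) (by omega) j rfl hj2
      refine ⟨((r.drop i).take (j - i)) :: ps, ?_, ?_, ?_⟩
      · intro p hp
        rcases List.mem_cons.1 hp with rfl | hp
        · exact cover_aux h hr comp mark hc1 hc2 hc3 hu i j hj1 hj2.le hjm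
        · exact p1 p hp
      · rw [List.flatten_cons, p2]
        have : r.drop j = (r.drop i).drop (j - i) := by rw [List.drop_drop]; congr 1; omega
        rw [this, List.take_append_drop]
      · have : #{t ∈ range r.length | j < t ∧ mark t} + 1 ≤ #{t ∈ range r.length | i < t ∧ mark t} := by
          rw [← card_insert_of_notMem (a := j) (by simp)]
          apply card_le_card
          intro t ht
          simp only [mem_insert, mem_filter, mem_range] at ht ⊢
          rcases ht with rfl | ht
          · exact ⟨hj2, hj1, hj3⟩
          · exact ⟨ht.1, by omega, ht.2.2⟩
        simp only [List.length_cons]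
        omega
    · push Not at hex
      refine ⟨[r.drop i], ?_, by simp, by simp⟩
      intro p hp
      rw [List.mem_singleton] at hp
      subst hp
      have := cover_aux h hr comp mark hc1 hc2 hc3 hu i r.length hi le_rfl
        (fun t h1 h2 => hex t h1 h2)
      rwa [List.take_of_length_le (by simp)] at this
  have hpos : 0 < r.length := List.length_pos_iff.2 (h.ne r hr)
  obtain ⟨ps, p1, p2, p3⟩ := key _ 0 rfl hpos
  by_contra hcon
  push Not at hcon
  exact h.c6 r hr ps (by omega) p1 (by simpa using p2)

end

section

/-! ### averages over orbits and the Euler inequality -/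

section euler
variable {D : Type} [Fintype D]

theorem avg_sum (σ : Perm D) (n : D → ℕ) (hn : ∀ d, 0 < n d) (hσ : ∀ d, n (σ d) = n d)
    (g : D → ℚ) :
    ∑ d, (1 / (n d : ℚ)) * ∑ i ∈ range (n d), g ((σ ^ i) d) = ∑ d, g d := by
  classical
  have hni : ∀ i d, n ((σ ^ i) d) = n d := by
    intro i
    induction i with
    | zero => simp
    | succ i ih => intro d; rw [pow_succ', Perm.mul_apply, hσ, ih]
  let M := ∑ d, n d
  have hM : ∀ d, n d ≤ M := fun d => Finset.single_le_sum (f := n) (fun _ _ => Nat.zero_le _) (mem_univ d)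
  have h1 : ∀ d, (1 / (n d : ℚ)) * ∑ i ∈ range (n d), g ((σ ^ i) d)
      = ∑ i ∈ range M, if i < n ((σ ^ i) d) then g ((σ ^ i) d) / n ((σ ^ i) d) else 0 := by
    intro d
    rw [← sum_filter, Finset.mul_sum]
    apply sum_congr
    · ext i
      simp only [mem_range, mem_filter, hni]
      have := hM d
      constructor
      · intro h; exact ⟨by omega, h⟩
      · exact fun h => h.2
    · intro i _
      rw [hni]; ring
  simp only [h1]
  rw [sum_comm]
  have h2 : ∀ i, (∑ d, if i < n ((σ ^ i) d) then g ((σ ^ i) d) / n ((σ ^ i) d) else 0)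
      = ∑ d, if i < n d then g d / n d else 0 := fun i =>
    Equiv.sum_comp (σ ^ i) (fun d => if i < n d then g d / n d else 0)
  simp only [h2]
  rw [sum_comm]
  apply sum_congr rfl
  intro d _
  rw [← sum_filter]
  have : (range M).filter (fun i => i < n d) = range (n d) := by
    ext i; have := hM d; simp only [mem_range, mem_filter]; omega
  rw [this, sum_const, card_range, nsmul_eq_mul]
  have := hn d
  field_simp

/-- period of a dart -/
noncomputable def per (σ : Perm D) (d : D) : ℕ := Function.minimalPeriod σ d

theorem per_pos (σ : Perm D) (d : D) : 0 < per σ d := by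
  apply Function.minimalPeriod_pos_of_mem_periodicPts
  classical
  exact ⟨orderOf σ, orderOf_pos σ, by
    rw [Function.IsPeriodicPt, Function.IsFixedPt, ← Perm.coe_pow, pow_orderOf_eq_one]; rfl⟩

theorem per_apply (σ : Perm D) (d : D) : per σ (σ d) = per σ d := by
  apply Function.minimalPeriod_apply
  have := per_pos σ d
  exact Function.minimalPeriod_pos_iff_mem_periodicPts.1 this

theorem pow_per (σ : Perm D) (d : D) : (σ ^ per σ d) d = d := by
  rw [Perm.coe_pow]; exact Function.iterate_minimalPeriod

theorem per_dvd (σ : Perm D) (d : D) (n : ℕ) : (σ ^ n) d = d ↔ per σ d ∣ n := by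
  rw [Perm.coe_pow]; exact Function.isPeriodicPt_iff_minimalPeriod_dvd

/-- coboundary operator of a permutation -/
def cob (σ : Perm D) : (D → ℚ) →ₗ[ℚ] (D → ℚ) where
  toFun f := fun d => f (σ d) - f d
  map_add' f g := by ext d; simp; ring
  map_smul' a f := by ext d; simp; ring

@[simp] theorem cob_apply (σ : Perm D) (f : D → ℚ) (d : D) : cob σ f d = f (σ d) - f d := rfl

noncomputable def avgop (σ : Perm D) : (D → ℚ) →ₗ[ℚ] (D → ℚ) where
  toFun f := fun d => (1 / (per σ d : ℚ)) * ∑ i ∈ range (per σ d), f ((σ ^ i) d)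
  map_add' f g := by ext d; simp [sum_add_distrib]; ring
  map_smul' a f := by ext d; simp [← Finset.mul_sum]; ring

theorem orb_count (σ : Perm D) :
    (finrank ℚ (LinearMap.ker (cob σ)) : ℚ) = ∑ d, 1 / (per σ d : ℚ) := by
  classical
  have hp : LinearMap.IsProj (LinearMap.ker (cob σ)) (avgop σ) := by
    constructor
    · intro f
      rw [LinearMap.mem_ker]
      ext d
      simp only [cob_apply, avgop, LinearMap.coe_mk, AddHom.coe_mk, per_apply, Pi.zero_apply]
      rw [← mul_sub]
      have : ∑ i ∈ range (per σ d), f ((σ ^ i) (σ d)) = ∑ i ∈ range (per σ d), f ((σ ^ i) d) := by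
        have h1 : ∀ i, (σ ^ i) (σ d) = (σ ^ (i + 1)) d := by
          intro i; rw [pow_succ, Perm.mul_apply]
        simp only [h1]
        have h2 := sum_range_succ (fun i => f ((σ ^ i) d)) (per σ d)
        rw [sum_range_succ', pow_per] at h2
        simpa using h2
      rw [this]; simp
    · intro f hf
      rw [LinearMap.mem_ker] at hf
      have hf1 : ∀ d, f (σ d) = f d := fun d => by
        have := congrFun hf d; simp at this; linarith
      have hf2 : ∀ i d, f ((σ ^ i) d) = f d := by
        intro i
        induction i with
        | zero => simp
        | succ i ih => intro d; rw [pow_succ', Perm.mul_apply, hf1, ih]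
      ext d
      simp only [avgop, LinearMap.coe_mk, AddHom.coe_mk, hf2, sum_const, card_range, nsmul_eq_mul]
      have := per_pos σ d
      field_simp
  rw [← hp.trace, LinearMap.trace_eq_matrix_trace ℚ (Pi.basisFun ℚ D), Matrix.trace]
  apply sum_congr rfl
  intro d _
  simp only [Matrix.diag_apply, LinearMap.toMatrix_apply, Pi.basisFun_repr, Pi.basisFun_apply,
    avgop, LinearMap.coe_mk, AddHom.coe_mk]
  have : ∑ i ∈ range (per σ d), (Pi.single d (1 : ℚ) : D → ℚ) ((σ ^ i) d) = 1 := by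
    rw [sum_eq_single 0]
    · rw [pow_zero, Perm.one_apply, Pi.single_eq_same]
    · intro i hi hi0
      rw [Pi.single_apply, if_neg]
      rw [per_dvd]
      intro hd
      have := Nat.le_of_dvd (by omega) hd
      simp at hi; omega
    · have := per_pos σ d
      intro h0
      exact absurd (mem_range.2 this) h0
  rw [this]; ring

/-- first cohomology bound -/
def H1 (φ α : Perm D) (h : ℕ) : Prop :=
  ∃ L : (D → ℚ) →ₗ[ℚ] (Fin h → ℚ), ∀ c : D → ℚ, (∀ d, c (α d) = - c d) →
    (∃ p : D → ℚ, ∀ d, p (φ d) = p d + c d) → L c = 0 →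
    ∃ p : D → ℚ, (∀ d, p (φ d) = p d + c d) ∧ (∀ d, p (α d) = p d + c d)

theorem euler [Nonempty D] (φ α : Perm D) (hα : ∀ d, α (α d) = d) (hα' : ∀ d, α d ≠ d)
    (h : ℕ) (H : H1 φ α h) :
    (2 - h : ℚ) ≤ ∑ d, (1 / (per (φ * α) d : ℚ) + 1 / (per φ d : ℚ) - 1 / 2) := by
  obtain ⟨L, hL⟩ := H
  have hα1 : ∑ d, 1 / (per α d : ℚ) = Fintype.card D / 2 := by
    have : ∀ d, per α d = 2 := by
      intro d
      have h1 : per α d ∣ 2 := by rw [← per_dvd]; simp [pow_two, hα]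
      have h2 : per α d ≠ 1 := by
        intro h; have := pow_per α d; rw [h] at this; exact hα' d (by simpa using this)
      exact (Nat.prime_two.eq_one_or_self_of_dvd _ h1).resolve_left h2
    simp [this]; ring
  have r1 := LinearMap.finrank_range_add_finrank_ker (cob α)
  have r2 := LinearMap.finrank_range_add_finrank_ker (cob φ)
  rw [finrank_fintype_fun_eq_card] at r1 r2
  -- sum zero hyperplane
  let sm : (D → ℚ) →ₗ[ℚ] ℚ := ∑ d, LinearMap.proj d
  have hsm : ∀ f, sm f = ∑ d, f d := by intro f; simp [sm]
  have r3 := LinearMap.finrank_range_add_finrank_ker sm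
  have hr3 : finrank ℚ (LinearMap.range sm) = 1 := by
    have : LinearMap.range sm = ⊤ := by
      rw [LinearMap.range_eq_top]
      intro q
      obtain ⟨d⟩ := ‹Nonempty D›
      classical
      refine ⟨Pi.single d q, ?_⟩
      rw [hsm]; simp
    rw [this]; simp
  rw [finrank_fintype_fun_eq_card, hr3] at r3
  have hσ : ∀ σ : Perm D, LinearMap.range (cob σ) ≤ LinearMap.ker sm := by
    rintro σ _ ⟨f, rfl⟩
    rw [LinearMap.mem_ker, hsm]
    simp only [cob_apply, sum_sub_distrib]
    rw [Equiv.sum_comp σ f]; ring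
  have r4 := Submodule.finrank_sup_add_finrank_inf_eq (LinearMap.range (cob α)) (LinearMap.range (cob φ))
  have r5 : finrank ℚ ↥(LinearMap.range (cob α) ⊔ LinearMap.range (cob φ)) ≤
      finrank ℚ (LinearMap.ker sm) :=
    Submodule.finrank_mono (sup_le (hσ α) (hσ φ))
  -- the intersection
  let I := LinearMap.range (cob α) ⊓ LinearMap.range (cob φ)
  have r6 := LinearMap.finrank_range_add_finrank_ker (L.domRestrict I)
  have r7 : finrank ℚ (LinearMap.range (L.domRestrict I)) ≤ h := by
    have := Submodule.finrank_le (LinearMap.range (L.domRestrict I))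
    simpa using this
  let K := LinearMap.ker (cob (φ * α))
  have r8 := LinearMap.finrank_range_add_finrank_ker ((cob φ).domRestrict K)
  have r9 : 1 ≤ finrank ℚ (LinearMap.ker ((cob φ).domRestrict K)) := by
    rw [Nat.one_le_iff_ne_zero]
    intro h0
    rw [Submodule.finrank_eq_zero] at h0
    have h1 : (fun _ => (1 : ℚ)) ∈ K := by
      rw [LinearMap.mem_ker]; ext d; simp
    have h2 : (⟨_, h1⟩ : K) ∈ LinearMap.ker ((cob φ).domRestrict K) := by
      rw [LinearMap.mem_ker]; ext d; simp [LinearMap.domRestrict_apply]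
    rw [h0, Submodule.mem_bot] at h2
    obtain ⟨d⟩ := ‹Nonempty D›
    have := congrFun (congrArg Subtype.val h2) d
    simp at this
  have r10 : finrank ℚ (LinearMap.ker (L.domRestrict I)) ≤
      finrank ℚ (LinearMap.range ((cob φ).domRestrict K)) := by
    rw [← Submodule.finrank_map_subtype_eq I (LinearMap.ker (L.domRestrict I))]
    apply Submodule.finrank_mono
    rintro c ⟨⟨c', hc'⟩, hcL, rfl⟩
    obtain ⟨⟨f, rfl⟩, ⟨p, hp⟩⟩ := hc'
    have := hL (cob α f) (by intro d; simp [hα]) ⟨p, fun d => by rw [← hp]; simp⟩ (by simpa using hcL)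
    obtain ⟨q, hq1, hq2⟩ := this
    have hqK : q ∈ K := by
      rw [LinearMap.mem_ker]
      ext d
      simp only [cob_apply, Perm.mul_apply, Pi.zero_apply]
      rw [hq1, hq2 d]; simp [hα]; ring
    refine ⟨⟨q, hqK⟩, ?_⟩
    ext d
    simp [LinearMap.domRestrict_apply, hq1]
  have o1 := orb_count α
  have o2 := orb_count φ
  have o3 := orb_count (φ * α)
  rw [hα1] at o1
  rw [sum_sub_distrib, sum_add_distrib, ← o2, ← o3]
  simp only [sum_const, card_univ, nsmul_eq_mul]
  have q1 : ((finrank ℚ (LinearMap.range (cob α)) + finrank ℚ (LinearMap.ker (cob α)) : ℕ) : ℚ) = Fintype.card D := by rw [r1]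
  push_cast at q1
  rw [o1] at q1
  have z : (2 : ℚ) * finrank ℚ (LinearMap.range (cob α)) = Fintype.card D := by linarith
  have hI : finrank ℚ I ≤ h + finrank ℚ (LinearMap.range ((cob φ).domRestrict K)) := by
    omega
  have zz : finrank ℚ (LinearMap.range (cob α)) + finrank ℚ (LinearMap.range (cob φ)) + 2 ≤
    Fintype.card D + h + finrank ℚ K := by
    have : finrank ℚ I = finrank ℚ ↥(LinearMap.range (cob α) ⊓ LinearMap.range (cob φ)) := rfl
    omega
  have zq : (finrank ℚ (LinearMap.range (cob α)) : ℚ) + finrank ℚ (LinearMap.range (cob φ)) + 2 ≤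
    Fintype.card D + h + finrank ℚ K := by exact_mod_cast zz
  have r2q : (finrank ℚ (LinearMap.range (cob φ)) : ℚ) + finrank ℚ (LinearMap.ker (cob φ)) = Fintype.card D := by
    exact_mod_cast r2
  have : (finrank ℚ K : ℚ) = finrank ℚ (LinearMap.ker (cob (φ * α))) := rfl
  linarith
end euler

section cyc
variable {D : Type} [Fintype D]

theorem zper_dvd (σ : Perm D) (d : D) (k : ℤ) : (σ ^ k) d = d ↔ (per σ d : ℤ) ∣ k := by
  have e : ∀ j : ℤ, (σ ^ ((per σ d : ℤ) * j)) d = d := by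
    intro j
    rw [zpow_mul]
    exact Perm.zpow_apply_eq_self_of_apply_eq_self (by rw [zpow_natCast]; exact pow_per σ d) j
  have hp := per_pos σ d
  constructor
  · intro h
    rw [← Int.emod_add_mul_ediv k (per σ d), zpow_add, Perm.mul_apply, e] at h
    have h0 : 0 ≤ k % (per σ d : ℤ) := Int.emod_nonneg _ (by omega)
    obtain ⟨m, hm⟩ := Int.eq_ofNat_of_zero_le h0
    rw [hm, zpow_natCast, per_dvd] at h
    apply Int.dvd_of_emod_eq_zero
    have hlt : k % (per σ d : ℤ) < per σ d := Int.emod_lt_of_pos _ (by omega)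
    rw [hm] at hlt ⊢
    have := Nat.eq_zero_of_dvd_of_lt h (by omega)
    omega
  · rintro ⟨j, rfl⟩
    exact e j

theorem zpow_congr (σ : Perm D) (d e : D) (h : per σ d = per σ e) (i j : ℤ)
    (hij : (σ ^ i) d = (σ ^ j) d) : (σ ^ i) e = (σ ^ j) e := by
  have h1 : (σ ^ (i - j)) d = d := by
    rw [sub_eq_neg_add, zpow_add, Perm.mul_apply, hij, ← Perm.mul_apply, ← zpow_add]; simp
  rw [zper_dvd, h, ← zper_dvd, sub_eq_neg_add, zpow_add, Perm.mul_apply, zpow_neg,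
    Perm.inv_eq_iff_eq] at h1
  exact h1

/-- sum over the cycle -/
noncomputable def csum (σ : Perm D) (c : D → ℚ) (d : D) : ℚ :=
  ∑ i ∈ range (per σ d), c ((σ ^ i) d)

theorem csum_apply (σ : Perm D) (c : D → ℚ) (d : D) : csum σ c (σ d) = csum σ c d := by
  unfold csum
  rw [per_apply]
  have h1 : ∀ i, (σ ^ i) (σ d) = (σ ^ (i + 1)) d := by
    intro i; rw [pow_succ, Perm.mul_apply]
  simp only [h1]
  have h2 := sum_range_succ (fun i => c ((σ ^ i) d)) (per σ d)
  rw [sum_range_succ', pow_per] at h2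
  simpa using h2

theorem csum_zpow (σ : Perm D) (c : D → ℚ) (d : D) (k : ℤ) :
    csum σ c ((σ ^ k) d) = csum σ c d := by
  induction k using Int.induction_on with
  | zero => simp
  | succ i ih => rw [add_comm, zpow_add, Perm.mul_apply, zpow_one, csum_apply, ih]
  | pred i ih =>
    rw [← ih, ← csum_apply σ c ((σ ^ (-(i : ℤ) - 1)) d), ← Perm.mul_apply, ← zpow_one_add]
    congr 3; ring_nf

theorem pot_iff (σ : Perm D) (c : D → ℚ) :
    (∃ p : D → ℚ, ∀ d, p (σ d) = p d + c d) ↔ ∀ d, csum σ c d = 0 := by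
  constructor
  · rintro ⟨p, hp⟩ d
    have : ∀ n, p ((σ ^ n) d) = p d + ∑ i ∈ range n, c ((σ ^ i) d) := by
      intro n
      induction n with
      | zero => simp
      | succ n ih => rw [pow_succ', Perm.mul_apply, hp, ih, sum_range_succ]; ring
    have h := this (per σ d)
    rw [pow_per] at h
    unfold csum; linarith
  · intro h
    refine ⟨fun d => (1 / (per σ d : ℚ)) * ∑ i ∈ range (per σ d), (i : ℚ) * c ((σ ^ i) d), ?_⟩
    intro d
    simp only [per_apply]
    have h1 : ∀ i, (σ ^ i) (σ d) = (σ ^ (i + 1)) d := by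
      intro i; rw [pow_succ, Perm.mul_apply]
    simp only [h1]
    have h2 := sum_range_succ (fun i : ℕ => ((i : ℚ) - 1) * c ((σ ^ i) d)) (per σ d)
    rw [sum_range_succ', pow_per] at h2
    have h3 := h d
    unfold csum at h3
    have h4 : ∑ i ∈ range (per σ d), ((i : ℚ) - 1) * c ((σ ^ i) d) =
      ∑ i ∈ range (per σ d), (i : ℚ) * c ((σ ^ i) d) - ∑ i ∈ range (per σ d), c ((σ ^ i) d) := by
      rw [← sum_sub_distrib]; apply sum_congr rfl; intros; ring
    rw [h4, h3] at h2
    simp only [Nat.cast_add, Nat.cast_one, add_sub_cancel_right, Nat.cast_zero, pow_zero,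
      Perm.one_apply] at h2
    have hp : (per σ d : ℚ) ≠ 0 := by have := per_pos σ d; positivity
    field_simp
    linarith

theorem csum_neg (σ : Perm D) (c : D → ℚ) (d : D) :
    ∑ i ∈ range (per σ d), c ((σ ^ (-(i : ℤ))) d) = csum σ c d := by
  rw [← csum_apply, csum, per_apply]
  conv_rhs => rw [← sum_range_reflect]
  apply sum_congr rfl
  intro i hi
  simp only [mem_range] at hi
  congr 1
  have : ((per σ d - 1 - i : ℕ) : ℤ) = (per σ d : ℤ) + (-(i : ℤ) + - 1) := by omega
  rw [← zpow_natCast, this]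
  have : σ d = (σ ^ (1 : ℤ)) d := by simp
  rw [this, ← Perm.mul_apply, ← zpow_add]
  have : ((per σ d : ℤ) + (-(i : ℤ) + - 1) + 1) = -(i : ℤ) + per σ d := by ring
  rw [this, zpow_add, Perm.mul_apply, zpow_natCast, pow_per]

theorem flip_exists (φ : Perm D) (d e : D) (hp : per φ d = per φ e)
    (hne : ¬ φ.SameCycle d e) :
    ∃ φ' : Perm D, (∀ i : ℤ, φ' ((φ ^ i) d) = (φ ^ (-i)) e) ∧
      (∀ i : ℤ, φ' ((φ ^ i) e) = (φ ^ (-i)) d) ∧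
      (∀ x, ¬ φ.SameCycle d x → ¬ φ.SameCycle e x → φ' x = φ x) := by
  classical
  let F : D → D := fun x => if h : φ.SameCycle d x then (φ ^ (- h.choose)) e else
    if h : φ.SameCycle e x then (φ ^ (- h.choose)) d else φ x
  have F1 : ∀ i : ℤ, F ((φ ^ i) d) = (φ ^ (-i)) e := by
    intro i
    have h : φ.SameCycle d ((φ ^ i) d) := ⟨i, rfl⟩
    simp only [F, dif_pos h]
    have := h.choose_spec
    have h1 := zpow_congr φ d e hp _ _ this
    have h2 := zpow_congr φ e e rfl (-i) (-h.choose) (by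
      have e1 := congrArg (φ ^ (-i - h.choose)) h1
      rw [← Perm.mul_apply, ← Perm.mul_apply, ← zpow_add, ← zpow_add] at e1
      ring_nf at e1 ⊢
      exact e1)
    exact h2.symm
  have F2 : ∀ i : ℤ, F ((φ ^ i) e) = (φ ^ (-i)) d := by
    intro i
    have h : φ.SameCycle e ((φ ^ i) e) := ⟨i, rfl⟩
    have h' : ¬ φ.SameCycle d ((φ ^ i) e) := fun h' => hne (h'.trans h.symm)
    simp only [F, dif_pos h, dif_neg h']
    have := h.choose_spec
    have h1 := zpow_congr φ e d hp.symm _ _ this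
    have h2 := zpow_congr φ d d rfl (-i) (-h.choose) (by
      have e1 := congrArg (φ ^ (-i - h.choose)) h1
      rw [← Perm.mul_apply, ← Perm.mul_apply, ← zpow_add, ← zpow_add] at e1
      ring_nf at e1 ⊢
      exact e1)
    exact h2.symm
  have F3 : ∀ x, ¬ φ.SameCycle d x → ¬ φ.SameCycle e x → F x = φ x := by
    intro x h1 h2
    simp only [F, dif_neg h1, dif_neg h2]
  have hs : Function.Surjective F := by
    intro y
    by_cases h1 : φ.SameCycle d y
    · obtain ⟨i, rfl⟩ := h1
      exact ⟨(φ ^ (-i)) e, by rw [F2]; simp⟩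
    by_cases h2 : φ.SameCycle e y
    · obtain ⟨i, rfl⟩ := h2
      exact ⟨(φ ^ (-i)) d, by rw [F1]; simp⟩
    refine ⟨φ⁻¹ y, ?_⟩
    rw [F3]
    · simp
    · intro h; apply h1; have := Perm.sameCycle_apply_right.2 h; simpa using this
    · intro h; apply h2; have := Perm.sameCycle_apply_right.2 h; simpa using this
  exact ⟨Equiv.ofBijective F ⟨Finite.injective_iff_surjective.2 hs, hs⟩, F1, F2, F3⟩
end cyc

/-! ### diagrams -/

variable {S : Type*} {X : Type*}

structure IsDg (Rw : Set (Wd S)) (st : S × Bool → X → X) {D : Type} [Fintype D]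
    (φ α : Perm D) (lab : D → S × Bool) (pos : D → X) (Z N : D → Prop)
    (rw : D → Wd S) : Prop where
  αα : ∀ d, α (α d) = d
  labα : ∀ d, lab (α d) = li (lab d)
  posα : ∀ d, pos (α d) = st (lab d) (pos d)
  posφ : ∀ d, pos (φ d) = st (lab d) (pos d)
  Zφ : ∀ d, Z (φ d) ↔ Z d
  Nφ : ∀ d, N (φ d) ↔ N d
  ZN : ∀ d, Z d → ¬ N d
  Nb : ∀ d, N d → φ (φ d) = d ∧ lab (φ d) = li (lab d)
  Rm : ∀ d, ¬ Z d → ¬ N d → rw d ∈ Rw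
  Rh : ∀ d, ¬ Z d → ¬ N d → (rw d).head? = some (lab d)
  Rr : ∀ d, ¬ Z d → ¬ N d → rw (φ d) = (rw d).rotate 1
  Rp : ∀ d, ¬ Z d → ¬ N d → per φ d = (rw d).length

namespace IsDg
variable {Rw : Set (Wd S)} {st : S × Bool → X → X} {D : Type} [Fintype D]
    {φ α : Perm D} {lab : D → S × Bool} {pos : D → X} {Z N : D → Prop}
    {rw : D → Wd S}

theorem αne (B : IsDg Rw st φ α lab pos Z N rw) (d : D) : α d ≠ d := by
  intro h; have := B.labα d; rw [h] at this; exact li_ne _ this.symm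

theorem Zz (B : IsDg Rw st φ α lab pos Z N rw) (d : D) (k : ℤ) : Z ((φ ^ k) d) ↔ Z d := by
  induction k using Int.induction_on with
  | zero => simp
  | succ i ih => rw [add_comm, zpow_add, Perm.mul_apply, zpow_one, B.Zφ, ih]
  | pred i ih =>
    rw [← ih, ← B.Zφ ((φ ^ (-(i : ℤ) - 1)) d), ← Perm.mul_apply, ← zpow_one_add]
    congr! 3; ring_nf

theorem Nz (B : IsDg Rw st φ α lab pos Z N rw) (d : D) (k : ℤ) : N ((φ ^ k) d) ↔ N d := by
  induction k using Int.induction_on with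
  | zero => simp
  | succ i ih => rw [add_comm, zpow_add, Perm.mul_apply, zpow_one, B.Nφ, ih]
  | pred i ih =>
    rw [← ih, ← B.Nφ ((φ ^ (-(i : ℤ) - 1)) d), ← Perm.mul_apply, ← zpow_one_add]
    congr! 3; ring_nf

theorem rwpow (B : IsDg Rw st φ α lab pos Z N rw) {d : D} (hZ : ¬ Z d) (hN : ¬ N d) (i : ℕ) :
    rw ((φ ^ i) d) = (rw d).rotate i := by
  induction i with
  | zero => simp
  | succ i ih =>
    have h1 := B.Zz d i
    have h2 := B.Nz d i
    rw [zpow_natCast] at h1 h2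
    rw [pow_succ', Perm.mul_apply, B.Rr _ (by rwa [h1]) (by rwa [h2]), ih, List.rotate_rotate]

theorem labs (B : IsDg Rw st φ α lab pos Z N rw) {d : D} (hZ : ¬ Z d) (hN : ¬ N d) (i : ℕ)
    (hi : i < (rw d).length) : (rw d)[i]? = some (lab ((φ ^ i) d)) := by
  have h1 := B.Zz d i
  have h2 := B.Nz d i
  rw [zpow_natCast] at h1 h2
  rw [← B.Rh _ (by rwa [h1]) (by rwa [h2]), B.rwpow hZ hN, List.head?_rotate hi]

theorem adj (h : SC Rw) (B : IsDg Rw st φ α lab pos Z N rw) {d : D} (hZ : ¬ Z d) (hN : ¬ N d) :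
    lab (φ d) ≠ li (lab d) := by
  intro hl
  have hm := B.Rm d hZ hN
  rcases hr : rw d with _ | ⟨a, _ | ⟨b, t⟩⟩
  · exact h.ne _ hm hr
  · have hp := B.Rp d hZ hN
    have := pow_per φ d
    rw [hp, hr] at this
    simp at this
    rw [this] at hl
    exact li_ne _ hl.symm
  · have h0 := B.labs hZ hN 0 (by simp [hr])
    have h1 := B.labs hZ hN 1 (by simp [hr])
    rw [hr] at h0 h1 hm
    simp at h0 h1
    rw [← h0, ← h1] at hl
    exact h.red _ _ _ hm hl

/-- mirrored relator words give inverse labels -/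
theorem invlab (h : SC Rw) (B : IsDg Rw st φ α lab pos Z N rw) {d e : D} (hZ : ¬ Z d) (hN : ¬ N d)
    (hZ' : ¬ Z e) (hN' : ¬ N e) (hr : rw d = iw (rw (φ e))) :
    per φ d = per φ e ∧ ∀ i : ℤ, lab ((φ ^ (-i)) e) = li (lab ((φ ^ i) d)) := by
  have hlen : (rw d).length = (rw (φ e)).length := by rw [hr]; simp
  have hlen' : (rw (φ e)).length = (rw e).length := by rw [B.Rr e hZ' hN']; simp
  have hp : per φ d = per φ e := by rw [B.Rp d hZ hN, B.Rp e hZ' hN']; omega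
  refine ⟨hp, ?_⟩
  have hpos := per_pos φ d
  have key : ∀ i : ℕ, i < per φ d → lab ((φ ^ (-(i : ℤ))) e) = li (lab ((φ ^ (i : ℤ)) d)) := by
    intro i hi
    have hi' : i < (rw d).length := by rw [← B.Rp d hZ hN]; exact hi
    have h1 := B.labs hZ hN i hi'
    have h2 := B.labs (d := φ e) (by rwa [B.Zφ]) (by rwa [B.Nφ]) ((rw (φ e)).length - 1 - i) (by omega)
    rw [hr] at h1
    unfold iw at h1
    rw [List.getElem?_reverse (by simp; omega)] at h1
    simp only [List.length_map, List.getElem?_map] at h1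
    rw [h2] at h1
    simp only [Option.map_some, Option.some.injEq] at h1
    rw [zpow_natCast, ← h1, li_li]
    congr 1
    have hpe := B.Rp e hZ' hN'
    have : (((rw (φ e)).length - 1 - i : ℕ) : ℤ) = (-(i : ℤ) - 1) + (per φ e : ℤ) := by omega
    rw [← zpow_natCast, this]
    have e1 : φ e = (φ ^ (1 : ℤ)) e := by simp
    rw [e1, ← Perm.mul_apply, ← zpow_add]
    have : -(i : ℤ) - 1 + (per φ e : ℤ) + 1 = -(i : ℤ) + per φ e := by ring
    rw [this, zpow_add, Perm.mul_apply, zpow_natCast φ (per φ e), pow_per]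
  intro i
  have h0 : 0 ≤ i % (per φ d : ℤ) := Int.emod_nonneg _ (by omega)
  have h1 : i % (per φ d : ℤ) < per φ d := Int.emod_lt_of_pos _ (by omega)
  obtain ⟨m, hm⟩ := Int.eq_ofNat_of_zero_le h0
  have hk := key m (by omega)
  have hi : i = m + (per φ d : ℤ) * (i / per φ d) := by rw [← hm]; exact (Int.emod_add_mul_ediv i _).symm
  have a1 : (φ ^ i) d = (φ ^ (m : ℤ)) d := by
    conv_lhs => rw [hi]
    rw [zpow_add, Perm.mul_apply, (zper_dvd φ d _).2 ⟨_, rfl⟩]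
  have a2 : (φ ^ (-i)) e = (φ ^ (-(m : ℤ))) e := by
    have : -i = -(m : ℤ) + (per φ e : ℤ) * (- (i / per φ d)) := by
      rw [← hp]; conv_lhs => rw [hi]
      ring
    conv_lhs => rw [this]
    rw [zpow_add, Perm.mul_apply, (zper_dvd φ e _).2 ⟨_, rfl⟩]
  rw [a1, a2, hk]

theorem mirror_ne (h : SC Rw) (B : IsDg Rw st φ α lab pos Z N rw) {d e : D} (hZ : ¬ Z d) (hN : ¬ N d)
    (hZ' : ¬ Z e) (hN' : ¬ N e) (hr : rw d = iw (rw (φ e))) : ¬ φ.SameCycle d e := by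
  rintro ⟨m, rfl⟩
  obtain ⟨_, hl⟩ := B.invlab h hZ hN hZ' hN' hr
  rcases Int.even_or_odd' m with ⟨j, rfl | rfl⟩
  · have := hl j
    rw [← Perm.mul_apply, ← zpow_add] at this
    have e : -j + 2 * j = j := by ring
    rw [e] at this
    exact li_ne _ this.symm
  · have := hl j
    rw [← Perm.mul_apply, ← zpow_add] at this
    have e : -j + (2 * j + 1) = 1 + j := by ring
    rw [e, zpow_add, Perm.mul_apply, zpow_one] at this
    exact B.adj h (by rwa [B.Zz]) (by rwa [B.Nz]) this
end IsDg

end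

section
variable {S : Type*} {X : Type*}

/-- anchored antisymmetric functionals -/
def Anti (st : S × Bool → X → X) (f : X → Wd S → ℚ) : Prop :=
  ∀ x a t, f (st a x) (iw (t ++ [a])) = - f x (a :: t)

theorem iw_rot_eq (a : S × Bool) (t : Wd S) : (a :: t).rotate 1 = t ++ [a] := by simp

section
variable {D : Type} [Fintype D]

theorem cyc_nat (σ : Perm D) {d x : D} (h : σ.SameCycle d x) : ∃ i : ℕ, x = (σ ^ (i : ℤ)) d := by
  obtain ⟨k, rfl⟩ := h
  have hp := per_pos σ d
  have h0 : 0 ≤ k % (per σ d : ℤ) := Int.emod_nonneg _ (by omega)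
  obtain ⟨m, hm⟩ := Int.eq_ofNat_of_zero_le h0
  refine ⟨m, ?_⟩
  rw [← hm]
  conv_lhs => rw [← Int.emod_add_mul_ediv k (per σ d)]
  rw [zpow_add, Perm.mul_apply, (zper_dvd σ d _).2 ⟨_, rfl⟩]

theorem cyc_negnat (σ : Perm D) {d x : D} (h : σ.SameCycle d x) :
    ∃ i : ℕ, x = (σ ^ (-(i : ℤ))) d := by
  obtain ⟨k, rfl⟩ := h
  have h2 : σ.SameCycle d ((σ ^ (-k)) d) := ⟨-k, rfl⟩
  obtain ⟨i, hi⟩ := cyc_nat σ h2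
  refine ⟨i, ?_⟩
  have e1 := congrArg (σ ^ (k - i)) hi
  rw [← Perm.mul_apply, ← Perm.mul_apply, ← zpow_add, ← zpow_add] at e1
  ring_nf at e1
  exact e1.symm

theorem zsucc (σ : Perm D) (d : D) (i : ℤ) : (σ ^ (i + 1)) d = σ ((σ ^ i) d) := by
  rw [add_comm, zpow_add, Perm.mul_apply, zpow_one]

theorem csum_congr (σ : Perm D) (c c' : D → ℚ) (d : D) (h : ∀ x, σ.SameCycle d x → c x = c' x) :
    csum σ c d = csum σ c' d := by
  unfold csum
  apply sum_congr rfl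
  intro i _
  exact h _ ⟨i, by simp⟩

theorem csum_eq_zero_of_pot (σ : Perm D) (c : D → ℚ) (d : D) (p : D → ℚ)
    (h : ∀ x, σ.SameCycle d x → p (σ x) = p x + c x) : csum σ c d = 0 := by
  classical
  let p1 : D → ℚ := fun x => if σ.SameCycle d x then p x else 0
  let c1 : D → ℚ := fun x => if σ.SameCycle d x then c x else 0
  have : csum σ c d = csum σ c1 d := csum_congr _ _ _ _ (by intro x hx; simp [c1, hx])
  rw [this]
  refine (pot_iff σ c1).1 ⟨p1, ?_⟩ d
  intro x
  simp only [p1, c1, Perm.sameCycle_apply_right]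
  split_ifs with hx
  · exact h x hx
  · simp

theorem csum_update (σ : Perm D) [DecidableEq D] (c : D → ℚ) (d : D) (s : ℚ) :
    csum σ (fun x => c x + if x = d then s else 0) d = csum σ c d + s := by
  unfold csum
  rw [sum_add_distrib]
  congr 1
  rw [sum_eq_single_of_mem 0 (by simpa using per_pos σ d)]
  · simp
  · intro i hi h0
    rw [if_neg]
    intro h
    rw [per_dvd] at h
    exact h0 (Nat.eq_zero_of_dvd_of_lt h (by simpa using hi))
end

namespace IsDg
variable {Rw : Set (Wd S)} {st : S × Bool → X → X} {D : Type} [Fintype D]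
    {φ α : Perm D} {lab : D → S × Bool} {pos : D → X} {Z N : D → Prop}
    {rw : D → Wd S}

open Classical in
/-- chain functional -/
noncomputable def Ch (pos : D → X) (Z N : D → Prop) (rw : D → Wd S)
    (f : X → Wd S → ℚ) : ℚ := ∑ d, if Z d ∨ N d then 0 else f (pos d) (rw d)

theorem mirror_symm (h : SC Rw) (B : IsDg Rw st φ α lab pos Z N rw) {d e : D} (hZ : ¬ Z d) (hN : ¬ N d)
    (hZ' : ¬ Z e) (hN' : ¬ N e) (hr : rw d = iw (rw (φ e))) : rw e = iw (rw (φ d)) := by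
  rw [B.Rr d hZ hN, hr, B.Rr e hZ' hN']
  rcases h1 : rw e with _ | ⟨a, t⟩
  · simp [iw]
  · rw [iw_rot_eq, iw_append]
    simp [iw, Function.comp_def]

theorem mirror_step (h : SC Rw) (B : IsDg Rw st φ α lab pos Z N rw) {d e : D} (hZ : ¬ Z d) (hN : ¬ N d)
    (hZ' : ¬ Z e) (hN' : ¬ N e) (hr : rw d = iw (rw (φ e))) (i : ℕ) :
    rw ((φ ^ (i : ℤ)) d) = iw (rw ((φ ^ (-(i : ℤ) + 1)) e)) := by
  induction i with
  | zero => simpa using hr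
  | succ i ih =>
    have e1 : ∀ k : ℤ, ¬ Z ((φ ^ k) d) := by intro k; rwa [B.Zz]
    have e2 : ∀ k : ℤ, ¬ N ((φ ^ k) d) := by intro k; rwa [B.Nz]
    have e3 : ∀ k : ℤ, ¬ Z ((φ ^ k) e) := by intro k; rwa [B.Zz]
    have e4 : ∀ k : ℤ, ¬ N ((φ ^ k) e) := by intro k; rwa [B.Nz]
    rw [zsucc] at ih
    have := B.mirror_symm h (e1 _) (e2 _) (e3 _) (e4 _) ih
    push_cast
    rw [zsucc, ← iw_iw (rw (φ _)), ← this]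
    congr 4; ring

theorem mirror_pos (h : SC Rw) (hst : ∀ a x, st (li a) (st a x) = x)
    (B : IsDg Rw st φ α lab pos Z N rw) {d e : D} (hZ : ¬ Z d) (hN : ¬ N d)
    (hZ' : ¬ Z e) (hN' : ¬ N e) (hr : rw d = iw (rw (φ e))) (hp : pos e = pos (φ d)) (i : ℕ) :
    pos ((φ ^ (-(i : ℤ))) e) = pos (φ ((φ ^ (i : ℤ)) d)) := by
  obtain ⟨_, hl⟩ := B.invlab h hZ hN hZ' hN' hr
  induction i with
  | zero => simpa using hp
  | succ i ih =>
    have e1 : (φ ^ (-(i : ℤ))) e = φ ((φ ^ (-((i + 1 : ℕ) : ℤ))) e) := by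
      rw [← zsucc]; congr 2; push_cast; ring
    rw [e1, B.posφ] at ih
    have e2 : φ ((φ ^ (i : ℤ)) d) = (φ ^ ((i + 1 : ℕ) : ℤ)) d := by rw [← zsucc]; push_cast; rfl
    rw [e2] at ih
    rw [B.posφ, ← ih, hl]
    have := hst (li (lab ((φ ^ ((i + 1 : ℕ) : ℤ)) d))) (pos ((φ ^ (-((i + 1 : ℕ) : ℤ))) e))
    rw [li_li] at this
    exact this.symm

theorem M1 (h : SC Rw) (hst : ∀ a x, st (li a) (st a x) = x) {g : ℕ}
    (B : IsDg Rw st φ α lab pos Z N rw) (H : H1 φ α g) {d : D} (hZ : ¬ Z d) (hN : ¬ N d)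
    (hZ' : ¬ Z (α d)) (hN' : ¬ N (α d)) (hr : rw d = iw (rw (φ (α d)))) :
    ∃ (φ' : Perm D) (N' : D → Prop), IsDg Rw st φ' α lab pos Z N' rw ∧ H1 φ' α g ∧
      (∀ x, Z x → φ' x = φ x) ∧ (∀ x, N x → N' x) ∧ N' d ∧
      ∀ f, Anti st f → Ch pos Z N' rw f = Ch pos Z N rw f := by
  classical
  obtain ⟨e, he⟩ : ∃ e, e = α d := ⟨_, rfl⟩
  rw [← he] at hZ' hN' hr
  have he' : α e = d := by rw [he, B.αα]
  have hne := B.mirror_ne h hZ hN hZ' hN' hr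
  have hde : d ≠ e := by rw [he]; exact (B.αne d).symm
  obtain ⟨hper, hl⟩ := B.invlab h hZ hN hZ' hN' hr
  have hr' := B.mirror_symm h hZ hN hZ' hN' hr
  have hl' := (B.invlab h hZ' hN' hZ hN hr').2
  obtain ⟨φ', F1, F2, F3⟩ := flip_exists φ d e hper hne
  have hposd : pos e = pos (φ d) := by rw [he, B.posα, B.posφ]
  have hpose : pos d = pos (φ e) := by rw [← he', B.posα, B.posφ]
  let K : D → Prop := fun x => φ.SameCycle d x ∨ φ.SameCycle e x
  have KZ : ∀ x, K x → ¬ Z x := by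
    rintro x (⟨k, rfl⟩ | ⟨k, rfl⟩)
    · rwa [B.Zz]
    · rwa [B.Zz]
  have KN : ∀ x, K x → ¬ N x := by
    rintro x (⟨k, rfl⟩ | ⟨k, rfl⟩)
    · rwa [B.Nz]
    · rwa [B.Nz]
  have nK : ∀ x, ¬ K x → φ' x = φ x := by
    intro x hx; simp only [K, not_or] at hx; exact F3 x hx.1 hx.2
  have Kφ : ∀ x, K (φ x) ↔ K x := by intro x; simp [K, Perm.sameCycle_apply_right]
  have Kφ' : ∀ x, K x → K (φ' x) := by
    rintro x (⟨k, rfl⟩ | ⟨k, rfl⟩)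
    · rw [F1]; exact Or.inr ⟨_, rfl⟩
    · rw [F2]; exact Or.inl ⟨_, rfl⟩
  have Kφ'' : ∀ x, K (φ' x) ↔ K x := by
    intro x
    by_cases hx : K x
    · simp [hx, Kφ' x hx]
    · rw [nK x hx, Kφ]
  have Kinv : ∀ x, K x → φ' (φ' x) = x := by
    rintro x (⟨k, rfl⟩ | ⟨k, rfl⟩)
    · rw [F1, F2, neg_neg]
    · rw [F2, F1, neg_neg]
  have Klab : ∀ x, K x → lab (φ' x) = li (lab x) := by
    rintro x (⟨k, rfl⟩ | ⟨k, rfl⟩)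
    · rw [F1, hl]
    · rw [F2, hl']
  have Kpos : ∀ x, K x → pos (φ' x) = pos (φ x) := by
    rintro x (hx | hx)
    · obtain ⟨i, rfl⟩ := cyc_nat φ hx
      rw [F1]; exact B.mirror_pos h hst hZ hN hZ' hN' hr hposd i
    · obtain ⟨i, rfl⟩ := cyc_nat φ hx
      rw [F2]; exact B.mirror_pos h hst hZ' hN' hZ hN hr' hpose i
  have Krw : ∀ x, K x → rw (φ' x) = iw (rw (φ x)) := by
    rintro x (hx | hx)
    · obtain ⟨i, rfl⟩ := cyc_nat φ hx
      have := B.mirror_step h hZ' hN' hZ hN hr'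
      have h3 := B.mirror_step h hZ hN hZ' hN' hr (i + 1)
      rw [F1, ← zsucc, ← iw_iw (rw ((φ ^ (-(i:ℤ))) e))]
      congr 1
      push_cast at h3
      rw [h3]
      congr 4; ring
    · obtain ⟨i, rfl⟩ := cyc_nat φ hx
      have h3 := B.mirror_step h hZ' hN' hZ hN hr' (i + 1)
      rw [F2, ← zsucc, ← iw_iw (rw ((φ ^ (-(i:ℤ))) d))]
      congr 1
      push_cast at h3
      rw [h3]
      congr 4; ring
  refine ⟨φ', fun x => N x ∨ K x, ?_, ?_, ?_, fun x hx => Or.inl hx, Or.inr (Or.inl ⟨0, rfl⟩), ?_⟩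
  · refine ⟨B.αα, B.labα, B.posα, ?_, ?_, ?_, ?_, ?_, ?_, ?_, ?_, ?_⟩
    · intro x
      by_cases hx : K x
      · rw [Kpos x hx, B.posφ]
      · rw [nK x hx, B.posφ]
    · intro x
      by_cases hx : K x
      · simp [KZ x hx, KZ _ (Kφ' x hx)]
      · rw [nK x hx, B.Zφ]
    · intro x
      simp only [Kφ'']
      by_cases hx : K x
      · simp [hx]
      · rw [nK x hx, B.Nφ]
    · rintro x hx (h1 | h1)
      · exact B.ZN x hx h1
      · exact KZ x h1 hx
    · intro x hx
      by_cases hK : K x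
      · exact ⟨Kinv x hK, Klab x hK⟩
      · have hx' : N x := hx.resolve_right hK
        rw [nK x hK, nK _ (by rwa [Kφ])]
        exact B.Nb x hx'
    · intro x h1 h2
      exact B.Rm x h1 (fun h => h2 (Or.inl h))
    · intro x h1 h2
      exact B.Rh x h1 (fun h => h2 (Or.inl h))
    · intro x h1 h2
      rw [nK x (fun h => h2 (Or.inr h))]
      exact B.Rr x h1 (fun h => h2 (Or.inl h))
    · intro x h1 h2
      rw [← B.Rp x h1 (fun h => h2 (Or.inl h))]
      have hx : ¬ K x := fun h => h2 (Or.inr h)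
      have : ∀ n : ℕ, (φ' ^ n) x = (φ ^ n) x ∧ ¬ K ((φ ^ n) x) := by
        intro n
        induction n with
        | zero => simpa using hx
        | succ n ih =>
          rw [pow_succ', Perm.mul_apply, ih.1, nK _ ih.2, pow_succ', Perm.mul_apply, Kφ]
          exact ⟨rfl, ih.2⟩
      apply Nat.dvd_antisymm
      · rw [← per_dvd, (this _).1, pow_per]
      · rw [← per_dvd, ← (this _).1, pow_per]
  · obtain ⟨L, hL⟩ := H
    let U : (D → ℚ) →ₗ[ℚ] (D → ℚ) :=
      { toFun := fun c x => (c x + if x = d then - csum φ c d else 0) + if x = e then csum φ c d else 0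
        map_add' := by
          intro c c'
          ext x
          have : csum φ (c + c') d = csum φ c d + csum φ c' d := by
            simp [csum, sum_add_distrib]
          simp only [Pi.add_apply, this]
          split_ifs <;> ring
        map_smul' := by
          intro r c
          ext x
          have : csum φ (r • c) d = r * csum φ c d := by
            simp [csum, Finset.mul_sum]
          simp only [Pi.smul_apply, this, smul_eq_mul, RingHom.id_apply]
          split_ifs <;> ring }
    refine ⟨L ∘ₗ U, ?_⟩
    rintro c hc ⟨p', hp'⟩ hLc
    have hU : ∀ x, U c x = (c x + if x = d then - csum φ c d else 0) + if x = e then csum φ c d else 0 :=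
      fun x => rfl
    have hcK : ∀ x, K x → c (φ' x) = - c x := by
      intro x hx
      have h1 := hp' x
      have h2 := hp' (φ' x)
      rw [Kinv x hx] at h2
      linarith
    have hcs : csum φ c e = - csum φ c d := by
      rw [← csum_neg, csum, ← hper, ← sum_neg_distrib]
      apply sum_congr rfl
      intro i _
      rw [← F1, hcK _ (Or.inl ⟨_, rfl⟩), zpow_natCast]
    have hUd : U c d = c d - csum φ c d := by rw [hU]; simp [hde]; ring
    have hUe : U c e = c e + csum φ c d := by rw [hU]; simp [hde.symm]
    have hUo : ∀ x, x ≠ d → x ≠ e → U c x = c x := by intro x h1 h2; rw [hU]; simp [h1, h2]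
    have hce : c e = - c d := by rw [he, hc]
    have hUα : ∀ x, U c (α x) = - U c x := by
      intro x
      by_cases h1 : x = d
      · subst h1; rw [← he, hUd, hUe, hce]; ring
      by_cases h2 : x = e
      · subst h2; rw [he', hUd, hUe, hce]; ring
      · rw [hUo x h1 h2, hUo, hc]
        · intro h; apply h2; rw [← B.αα x, h, he]
        · intro h; apply h1; rw [← B.αα x, h, he']
    have hUK : ∀ x, K x → U c (φ' x) = - U c x := by
      have hd' : φ' d = e := by simpa using F1 0
      have he'' : φ' e = d := by simpa using F2 0
      intro x hx
      by_cases h1 : x = d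
      · subst h1; rw [hd', hUd, hUe, hce]; ring
      by_cases h2 : x = e
      · subst h2; rw [he'', hUd, hUe, hce]; ring
      · rw [hUo x h1 h2, hUo, hcK x hx]
        · intro h; apply h2; rw [← Kinv x hx, h, hd']
        · intro h; apply h1; rw [← Kinv x hx, h, he'']
    have hpot : ∃ p : D → ℚ, ∀ x, p (φ x) = p x + U c x := by
      rw [pot_iff]
      intro x
      by_cases hx1 : φ.SameCycle d x
      · obtain ⟨k, rfl⟩ := hx1
        rw [csum_zpow, csum_congr φ (U c) (fun x => c x + if x = d then - csum φ c d else 0),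
          csum_update]
        · ring
        · intro x hx
          have : x ≠ e := by rintro rfl; exact hne hx
          rw [hU]; simp [this]
      by_cases hx2 : φ.SameCycle e x
      · obtain ⟨k, rfl⟩ := hx2
        rw [csum_zpow, csum_congr φ (U c) (fun x => c x + if x = e then csum φ c d else 0),
          csum_update, hcs]
        · ring
        · intro x hx
          have : x ≠ d := by rintro rfl; exact hne hx.symm
          rw [hU]; simp [this]
      · apply csum_eq_zero_of_pot φ (U c) x p'
        intro y hy
        have hy1 : ¬ φ.SameCycle d y := fun h => hx1 (h.trans hy.symm)
        have hy2 : ¬ φ.SameCycle e y := fun h => hx2 (h.trans hy.symm)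
        rw [← F3 y hy1 hy2, hp', hUo]
        · rintro rfl; exact hy1 ⟨0, rfl⟩
        · rintro rfl; exact hy2 ⟨0, rfl⟩
    obtain ⟨p, hp1, hp2⟩ := hL (U c) hUα hpot hLc
    have hstep : ∀ i : ℕ, p ((φ ^ (-(i : ℤ))) e) = p (φ ((φ ^ (i : ℤ)) d)) := by
      intro i
      induction i with
      | zero => simp [hp1, ← hp2, he]
      | succ i ih =>
        have e1 : (φ ^ (-(i : ℤ))) e = φ ((φ ^ (-((i + 1 : ℕ) : ℤ))) e) := by
          rw [← zsucc]; congr 2; push_cast; ring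
        have e2 : φ ((φ ^ (i : ℤ)) d) = (φ ^ ((i + 1 : ℕ) : ℤ)) d := by rw [← zsucc]; push_cast; rfl
        rw [e1, hp1, e2] at ih
        rw [hp1, ← ih]
        have := hUK ((φ ^ ((i + 1 : ℕ) : ℤ)) d) (Or.inl ⟨_, rfl⟩)
        rw [F1] at this
        linarith
    have hstepK : ∀ x, K x → p (φ' x) = p (φ x) := by
      rintro x (hx | hx)
      · obtain ⟨i, rfl⟩ := cyc_nat φ hx
        rw [F1, hstep]
      · obtain ⟨i, rfl⟩ := cyc_negnat φ hx
        rw [F2, neg_neg]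
        have h1 := hstep i
        have h2 := hUK ((φ ^ (i : ℤ)) d) (Or.inl ⟨_, rfl⟩)
        rw [F1] at h2
        rw [hp1] at h1 ⊢
        linarith
    refine ⟨fun x => if x = e then p d + c d else p x, ?_, ?_⟩
    · intro x
      have hd' : φ' d = e := by simpa using F1 0
      have he'' : φ' e = d := by simpa using F2 0
      by_cases h1 : x = d
      · subst h1; simp [hd', hde]
      by_cases h2 : x = e
      · subst h2; simp [he'', hde, hce]
      have h3 : φ' x ≠ e := by
        intro h; apply h1; rw [← hd'] at h; exact φ'.injective h
      simp only [h2, h3, if_false]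
      by_cases hx : K x
      · rw [hstepK x hx, hp1, hUo x h1 h2]
      · rw [nK x hx, hp1, hUo x h1 h2]
    · intro x
      by_cases h1 : x = d
      · subst h1; simp [← he, hde]
      by_cases h2 : x = e
      · subst h2; simp [he', hde, hce]
      have h3 : α x ≠ e := by
        intro h; apply h1; rw [he] at h; exact α.injective h
      simp only [h2, h3, if_false]
      rw [hp2, hUo x h1 h2]
  · intro x hx
    exact nK x (fun hK => KZ x hK hx)
  · intro f hf
    unfold Ch
    rw [← sub_eq_zero, ← sum_sub_distrib]
    rw [sum_congr rfl (g := fun x => if K x then - f (pos x) (rw x) else 0) (by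
      intro x _
      by_cases hx : K x
      · simp [hx, KZ x hx, KN x hx]
      · simp [hx])]
    apply sum_ninvolution (fun x => if K x then φ' x else x)
    · intro x
      by_cases hx : K x
      · simp only [hx, if_true, Kφ' x hx]
        rw [Krw x hx, Kpos x hx, B.posφ, B.Rr x (KZ x hx) (KN x hx)]
        have h4 := B.Rh x (KZ x hx) (KN x hx)
        rcases hrx : rw x with _ | ⟨a, t⟩
        · rw [hrx] at h4; simp at h4
        · rw [hrx] at h4; simp at h4; subst h4
          rw [iw_rot_eq, hf]; ring
      · simp [hx]
    · intro x hx
      have hK : K x := by by_contra hK; simp [hK] at hx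
      simp only [hK, if_true]
      intro h
      have := Klab x hK
      rw [h] at this
      exact li_ne _ this.symm
    · intro x; simp
    · intro x
      by_cases hx : K x
      · simp [hx, Kφ' x hx, Kinv x hx]
      · simp [hx]
end IsDg

open Classical in
/-- number of relator darts -/
noncomputable def nrel {D : Type} [Fintype D] (Z N : D → Prop) : ℕ :=
  (univ.filter (fun d => ¬ Z d ∧ ¬ N d)).card

namespace IsDg
variable {Rw : Set (Wd S)} {st : S × Bool → X → X} {D : Type} [Fintype D]
    {φ α : Perm D} {lab : D → S × Bool} {pos : D → X} {Z N : D → Prop}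
    {rw : D → Wd S}

theorem per_of_emb {D' : Type} [Fintype D'] (v : D' → D) (hv : Function.Injective v)
    (σ' : Perm D') (σ : Perm D) (h : ∀ x, v (σ' x) = σ (v x)) (x : D') :
    per σ' x = per σ (v x) := by
  have : ∀ n : ℕ, v ((σ' ^ n) x) = (σ ^ n) (v x) := by
    intro n
    induction n with
    | zero => simp
    | succ n ih => rw [pow_succ', Perm.mul_apply, h, ih, pow_succ', Perm.mul_apply]
  apply Nat.dvd_antisymm
  · rw [← per_dvd]; apply hv; rw [this, pow_per]
  · rw [← per_dvd, ← this, pow_per]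

theorem Elim (hst : ∀ a x, st (li a) (st a x) = x) {g : ℕ}
    (B : IsDg Rw st φ α lab pos Z N rw) (H : H1 φ α g) {d : D} (hN : N d) :
    ∃ (D' : Type) (_ : Fintype D') (v : D' → D) (φ' α' : Perm D'),
      Function.Injective v ∧ (∀ x, v (φ' x) = φ (v x)) ∧ (∀ x, ¬ N x → ∃ y, v y = x) ∧
      IsDg Rw st φ' α' (lab ∘ v) (pos ∘ v) (Z ∘ v) (N ∘ v) (rw ∘ v) ∧ H1 φ' α' g ∧
      Fintype.card D' < Fintype.card D ∧ nrel (Z ∘ v) (N ∘ v) = nrel Z N ∧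
      ∀ f, Ch (pos ∘ v) (Z ∘ v) (N ∘ v) (rw ∘ v) f = Ch pos Z N rw f := by
  classical
  obtain ⟨hb, hbl⟩ := B.Nb d hN
  obtain ⟨e, he⟩ : ∃ e, e = φ d := ⟨_, rfl⟩
  rw [← he] at hb hbl
  have hNe : N e := by rw [he, B.Nφ]; exact hN
  have hde : e ≠ d := by rintro rfl; exact li_ne _ hbl.symm
  let Q : D → Prop := fun x => x ≠ d ∧ x ≠ e
  have Qφ : ∀ x, Q (φ x) ↔ Q x := by
    intro x
    have e1 : φ x = d ↔ x = e := by rw [← hb]; exact φ.injective.eq_iff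
    have e2 : φ x = e ↔ x = d := by rw [he]; exact φ.injective.eq_iff
    simp only [Q, Ne, e1, e2]; tauto
  let φ' : Perm {x // Q x} := φ.subtypePerm (fun x => by rw [Qφ])
  have hα0 : ∀ x, Q x → Q (if α x = d then α e else if α x = e then α d else α x) := by
    intro x hx
    split_ifs with h1 h2
    · refine ⟨fun h => hx.2 ?_, B.αne e⟩
      rw [← B.αα x, h1, ← h, B.αα]
    · refine ⟨B.αne d, fun h => hx.1 ?_⟩
      rw [← B.αα x, h2, ← h, B.αα]
    · exact ⟨h1, h2⟩
  let fα : {x // Q x} → {x // Q x} := fun x =>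
    ⟨if α x = d then α e else if α x = e then α d else α x, hα0 x x.2⟩
  have fαv : ∀ x, (fα x : D) = if α x = d then α e else if α x = e then α d else α x := fun x => rfl
  have fα1 : ∀ x : {x // Q x}, α (x : D) = d → (fα x : D) = α e := by intro x h; rw [fαv, if_pos h]
  have fα2 : ∀ x : {x // Q x}, α (x : D) = e → (fα x : D) = α d := by
    intro x h; rw [fαv, if_neg (by rw [h]; exact hde), if_pos h]
  have fα3 : ∀ x : {x // Q x}, α (x : D) ≠ d → α (x : D) ≠ e → (fα x : D) = α x := by
    intro x h h'; rw [fαv, if_neg h, if_neg h']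
  have hinv : Function.Involutive fα := by
    intro x
    apply Subtype.ext
    by_cases h1 : α (x : D) = d
    · rw [fα2 _ (by rw [fα1 x h1, B.αα]), ← h1, B.αα]
    by_cases h2 : α (x : D) = e
    · rw [fα1 _ (by rw [fα2 x h2, B.αα]), ← h2, B.αα]
    · rw [fα3 _, fα3 x h1 h2, B.αα]
      · rw [fα3 x h1 h2, B.αα]; exact x.2.1
      · rw [fα3 x h1 h2, B.αα]; exact x.2.2
  let α' : Perm {x // Q x} := hinv.toPerm
  have hα' : ∀ x, α' x = fα x := fun x => rfl
  have hφ' : ∀ x, ((φ' x : {x // Q x}) : D) = φ x := fun x => rfl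
  have hle : lab (α e) = lab d := by rw [B.labα, hbl, li_li]
  have hld : lab (α d) = lab e := by rw [B.labα, hbl]
  have hpe : pos e = st (lab d) (pos d) := by rw [he, B.posφ]
  have hpe' : pos (α e) = pos d := by rw [B.posα, hbl, hpe, hst]
  have hpd' : pos (α d) = pos e := by rw [B.posα, hpe]
  refine ⟨{x // Q x}, inferInstance, Subtype.val, φ', α', Subtype.val_injective, hφ', ?_, ?_, ?_,
    ?_, ?_, ?_⟩
  · intro x hx
    refine ⟨⟨x, ?_, ?_⟩, rfl⟩
    · rintro rfl; exact hx hN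
    · rintro rfl; exact hx hNe
  · refine ⟨hinv, ?_, ?_, fun x => B.posφ _, fun x => B.Zφ _, fun x => B.Nφ _, fun x => B.ZN _, ?_,
      fun x => B.Rm _, fun x => B.Rh _, fun x => B.Rr _, ?_⟩
    · intro x
      simp only [Function.comp_apply, hα']
      by_cases h1 : α (x : D) = d
      · rw [fα1 x h1, hle, ← h1, B.labα]
      by_cases h2 : α (x : D) = e
      · rw [fα2 x h2, hld, ← h2, B.labα]
      · rw [fα3 x h1 h2, B.labα]
    · intro x
      simp only [Function.comp_apply, hα']
      by_cases h1 : α (x : D) = d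
      · rw [fα1 x h1, hpe', ← h1, B.posα]
      by_cases h2 : α (x : D) = e
      · rw [fα2 x h2, hpd', ← h2, B.posα]
      · rw [fα3 x h1 h2, B.posα]
    · intro x hx
      exact ⟨Subtype.ext (B.Nb x hx).1, (B.Nb x hx).2⟩
    · intro x h1 h2
      refine Eq.trans ?_ (B.Rp x h1 h2)
      exact per_of_emb Subtype.val Subtype.val_injective φ' φ hφ' x
  · obtain ⟨L, hL⟩ := H
    let U : ({x // Q x} → ℚ) →ₗ[ℚ] (D → ℚ) :=
      { toFun := fun c x => if h : Q x then c ⟨x, h⟩ else if h : Q (α x) then - c ⟨α x, h⟩ else 0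
        map_add' := by
          intro c c'; ext x; simp only [Pi.add_apply]; split_ifs <;> simp [add_comm]
        map_smul' := by
          intro r c; ext x; simp only [Pi.smul_apply, RingHom.id_apply]; split_ifs <;> simp }
    have hU : ∀ c x, U c x = if h : Q x then c ⟨x, h⟩ else if h : Q (α x) then - c ⟨α x, h⟩ else 0 :=
      fun c x => rfl
    refine ⟨L ∘ₗ U, ?_⟩
    rintro c hc ⟨p', hp'⟩ hLc
    have hUx : ∀ x (h : Q x), U c x = c ⟨x, h⟩ := by intro x h; rw [hU, dif_pos h]
    have hUα : ∀ x, U c (α x) = - U c x := by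
      intro x
      by_cases h1 : Q x
      · by_cases h2 : Q (α x)
        · rw [hUx _ h1, hUx _ h2, ← hc]
          congr 1
          apply Subtype.ext
          exact (fα3 ⟨x, h1⟩ h2.1 h2.2).symm
        · rw [hU, dif_neg h2]
          simp only [B.αα, dif_pos h1]
          rw [hUx _ h1]
      · by_cases h2 : Q (α x)
        · rw [hU c x, dif_neg h1, dif_pos h2, hUx _ h2]; simp
        · rw [hU, hU, dif_neg h1, dif_neg h2, dif_neg h2]
          simp only [B.αα, dif_neg h1]; simp
    have hnd : ¬ Q d := fun h => h.1 rfl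
    have hne : ¬ Q e := fun h => h.2 rfl
    have hUde : U c d + U c e = 0 := by
      by_cases h1 : α d = e
      · have h2 : α e = d := by rw [← h1, B.αα]
        rw [hU, hU, dif_neg hnd, dif_neg hne]
        simp only [h1, h2, dif_neg hnd, dif_neg hne]; simp
      · have h2 : Q (α d) := ⟨B.αne d, h1⟩
        have h3 : Q (α e) := ⟨fun h => h1 (by rw [← h, B.αα]), B.αne e⟩
        rw [hU c d, hU c e, dif_neg hnd, dif_neg hne, dif_pos h2, dif_pos h3]
        have := hc ⟨α d, h2⟩
        have e1 : α' ⟨α d, h2⟩ = ⟨α e, h3⟩ := by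
          apply Subtype.ext; rw [hα', fα1 _ (B.αα d)]
        rw [e1] at this
        rw [this]; ring
    have hpot : ∃ p : D → ℚ, ∀ x, p (φ x) = p x + U c x := by
      refine ⟨fun x => if h : Q x then p' ⟨x, h⟩ else if x = e then U c d else 0, ?_⟩
      intro x
      by_cases h1 : Q x
      · have h2 := (Qφ x).2 h1
        simp only [dif_pos h1, dif_pos h2]
        rw [hUx x h1, ← hp']; rfl
      · have h2 := fun h => h1 ((Qφ x).1 h)
        simp only [dif_neg h1, dif_neg h2]
        have : x = d ∨ x = e := by
          by_contra h; exact h1 (not_or.1 h)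
        rcases this with h | h
        · subst h; rw [← he]; simp [hde.symm]
        · subst h; rw [hb]; simp [hde.symm]; linarith
    obtain ⟨p, hp1, hp2⟩ := hL (U c) hUα hpot hLc
    refine ⟨fun x => p x, ?_, ?_⟩
    · intro x
      show p (φ x) = p x + c x
      rw [hp1, hUx _ x.2]
    · intro x
      show p (fα x : D) = p x + c x
      have h0 := hp2 x
      rw [hUx _ x.2] at h0
      have hed := hp1 d
      rw [← he] at hed
      have h3 := hp2 d
      have h4 := hp2 e
      by_cases h1 : α (x : D) = d
      · rw [fα1 x h1]; rw [h1] at h0; linarith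
      by_cases h2 : α (x : D) = e
      · rw [fα2 x h2]; rw [h2] at h0; linarith
      · rw [fα3 x h1 h2, h0]
  · exact Fintype.card_subtype_lt (x := d) (fun h => h.1 rfl)
  · unfold nrel
    apply card_bij (fun (x : {x // Q x}) _ => (x : D))
    · intro x hx; simpa using hx
    · intro x _ y _ h; exact Subtype.ext h
    · intro x hx
      simp only [mem_filter, mem_univ, true_and] at hx
      refine ⟨⟨x, ?_, ?_⟩, by simpa using hx, rfl⟩
      · rintro rfl; exact hx.2 hN
      · rintro rfl; exact hx.2 hNe
  · intro f
    unfold Ch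
    simp only [Function.comp_apply]
    rw [← sum_subtype (univ.filter Q) (by simp) (fun d => if Z d ∨ N d then 0 else f (pos d) (rw d))]
    apply sum_subset (Finset.subset_univ (univ.filter Q))
    · intro x _ hx
      have : x = d ∨ x = e := by
        by_contra h; exact hx (by simpa [Q] using h)
      rcases this with h | h
      · subst h; simp [hN]
      · subst h; simp [hNe]
end IsDg

/-- existence of a diagram with a special face reading `w` based at `x0` -/
def HasD (Rw : Set (Wd S)) (st : S × Bool → X → X) (g : ℕ) (x0 : X)
    (w : Wd S) (C : (X → Wd S → ℚ) → ℚ) (n m : ℕ) : Prop :=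
  ∃ (D : Type) (_ : Fintype D) (φ α : Perm D) (lab : D → S × Bool) (pos : D → X)
    (Z N : D → Prop) (rw : D → Wd S) (sp : List D),
    IsDg Rw st φ α lab pos Z N rw ∧ H1 φ α g ∧ sp.Nodup ∧ (∀ d, Z d ↔ d ∈ sp) ∧
    sp.map φ = sp.rotate 1 ∧ sp.map lab = w ∧ (∀ z ∈ sp.head?, pos z = x0) ∧
    (∀ f, Anti st f → IsDg.Ch pos Z N rw f = C f) ∧ nrel Z N = n ∧ Fintype.card D = m

/-- reduced version -/
def HasDr (Rw : Set (Wd S)) (st : S × Bool → X → X) (g : ℕ) (x0 : X)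
    (w : Wd S) (C : (X → Wd S → ℚ) → ℚ) (n : ℕ) : Prop :=
  ∃ (D : Type) (_ : Fintype D) (φ α : Perm D) (lab : D → S × Bool) (pos : D → X)
    (Z N : D → Prop) (rw : D → Wd S) (sp : List D),
    IsDg Rw st φ α lab pos Z N rw ∧ H1 φ α g ∧ sp.Nodup ∧ (∀ d, Z d ↔ d ∈ sp) ∧
    sp.map φ = sp.rotate 1 ∧ sp.map lab = w ∧ (∀ z ∈ sp.head?, pos z = x0) ∧
    (∀ f, Anti st f → IsDg.Ch pos Z N rw f = C f) ∧ nrel Z N = n ∧ 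
    (∀ d, ¬ N d) ∧ (∀ d, ¬ Z d → ¬ Z (α d) → rw d ≠ iw (rw (φ (α d))))

theorem HasD.reduce {Rw : Set (Wd S)} {st : S × Bool → X → X} (h : SC Rw)
    (hst : ∀ a x, st (li a) (st a x) = x) {g : ℕ} {x0 : X}
    {w : Wd S} {C : (X → Wd S → ℚ) → ℚ} :
    ∀ (s n m : ℕ), n + m ≤ s → HasD Rw st g x0 w C n m → ∃ n' ≤ n, HasDr Rw st g x0 w C n' := by
  intro s
  induction s with
  | zero =>
    rintro n m hs ⟨D, _, φ, α, lab, pos, Z, N, rw, sp, B, H, h1, h2, h3, h4, h5, h6, h7, h8⟩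
    have : IsEmpty D := Fintype.card_eq_zero_iff.1 (by omega)
    exact ⟨n, le_rfl, D, _, φ, α, lab, pos, Z, N, rw, sp, B, H, h1, h2, h3, h4, h5, h6, h7,
      fun d => isEmptyElim d, fun d => isEmptyElim d⟩
  | succ s ih =>
    rintro n m hs ⟨D, _, φ, α, lab, pos, Z, N, rw, sp, B, H, h1, h2, h3, h4, h5, h6, h7, h8⟩
    by_cases hN : ∃ d, N d
    · obtain ⟨d, hN⟩ := hN
      obtain ⟨D', _, v, φ', α', hv, hvφ, hvs, B', H', hcard, hnr, hch⟩ := B.Elim hst H hN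
      have hsp : ∀ z ∈ sp, ∃ y, v y = z := by
        intro z hz
        exact hvs z (B.ZN z ((h2 z).2 hz))
      obtain ⟨sp', rfl⟩ : ∃ sp' : List D', sp'.map v = sp := by
        have : sp ∈ Set.range (List.map v) := by
          rw [Set.range_list_map]; intro z hz; exact hsp z hz
        exact this
      apply ih n (Fintype.card D') (by omega)
      refine ⟨D', _, φ', α', _, _, _, _, _, sp', B', H', List.Nodup.of_map _ h1, ?_, ?_, ?_, ?_, ?_, ?_, rfl⟩
      · intro x
        simp only [Function.comp_apply, h2]
        exact List.mem_map_of_injective hv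
      · apply List.map_injective_iff.2 hv
        rw [List.map_map, List.map_rotate, ← h3, List.map_map]
        congr 1
        funext x; exact hvφ x
      · rw [← h4, List.map_map]
      · intro z hz
        apply h5
        rw [List.head?_map, hz]; simp
      · intro f hf; rw [hch, h6 f hf]
      · rw [hnr, h7]
    by_cases hM : ∃ d, ¬ Z d ∧ ¬ Z (α d) ∧ rw d = iw (rw (φ (α d)))
    · obtain ⟨d, hd1, hd2, hd3⟩ := hM
      obtain ⟨φ', N', B', H', k1, k2, k3, k4⟩ := B.M1 h hst H hd1 (fun h => hN ⟨_, h⟩) hd2 (fun h => hN ⟨_, h⟩) hd3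
      have hlt : nrel Z N' < nrel Z N := by
        unfold nrel
        apply card_lt_card
        constructor
        · intro x hx
          simp only [mem_filter, mem_univ, true_and] at hx ⊢
          exact ⟨hx.1, fun h => hx.2 (k2 x h)⟩
        · intro hsub
          have := hsub (x := d) (by simp only [mem_filter, mem_univ, true_and]; exact ⟨hd1, fun h => hN ⟨_, h⟩⟩)
          simp only [mem_filter, mem_univ, true_and] at this
          exact this.2 k3
      obtain ⟨n', hn', hh⟩ := ih (nrel Z N') m (by omega) ⟨D, _, φ', α, lab, pos, Z, N', rw, sp, B', H', h1, h2, by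
        rw [← h3]; apply List.map_congr_left; intro z hz; exact k1 z ((h2 z).2 hz), h4, h5, by
        intro f hf; rw [k4 f hf, h6 f hf], rfl, h8⟩
      exact ⟨n', by omega, hh⟩
    · push Not at hN hM
      exact ⟨n, le_rfl, D, _, φ, α, lab, pos, Z, N, rw, sp, B, H, h1, h2, h3, h4, h5, h6, h7,
        hN, hM⟩

section lists
variable {D : Type}

theorem lsum_pot {φ : D → D} {c p : D → ℚ} (hp : ∀ x, p (φ x) = p x + c x) :
    ∀ (t : List D) (a b : D), (a :: t).map φ = t ++ [b] → p b = p a + ((a :: t).map c).sum := by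
  intro t
  induction t with
  | nil => intro a b h; simp at h; subst h; simp [hp]
  | cons a' t ih =>
    intro a b h
    simp only [List.map_cons, List.cons_append, List.cons.injEq] at h
    obtain ⟨h1, h2⟩ := h
    have := ih a' b (by simpa using h2)
    rw [this, ← h1, hp]
    simp; ring

theorem cyc_get {φ : Perm D} {s : List D} (hs : s.map φ = s.rotate 1) (i : ℕ) (hi : i < s.length) :
    φ s[i] = s[(i + 1) % s.length]'(Nat.mod_lt _ (by omega)) := by
  have h1 : (s.map φ)[i]? = (s.rotate 1)[i]? := by rw [hs]
  rw [List.getElem?_map, List.getElem?_rotate hi, List.getElem?_eq_getElem hi,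
    List.getElem?_eq_getElem (Nat.mod_lt _ (by omega))] at h1
  simpa using h1

theorem cyc_get_pow {φ : Perm D} {s : List D} (hs : s.map φ = s.rotate 1) (i : ℕ) (hi : i < s.length)
    (k : ℕ) : (φ ^ k) s[i] = s[(i + k) % s.length]'(Nat.mod_lt _ (by omega)) := by
  induction k with
  | zero => simp [Nat.mod_eq_of_lt hi]
  | succ k ih =>
    rw [pow_succ', Perm.mul_apply, ih, cyc_get hs]
    congr 1
    rw [Nat.mod_add_mod]; rfl

theorem cyc_per [Fintype D] {φ : Perm D} {s : List D} (hn : s.Nodup)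
    (hs : s.map φ = s.rotate 1) {x : D} (hx : x ∈ s) : per φ x = s.length := by
  obtain ⟨i, hi, rfl⟩ := List.getElem_of_mem hx
  have key : ∀ k : ℕ, (φ ^ k) s[i] = s[i] ↔ s.length ∣ k := by
    intro k
    rw [cyc_get_pow hs, hn.getElem_inj_iff]
    constructor
    · intro h
      have h2 : (i + k) % s.length = (i + 0) % s.length := by rw [h]; simp [Nat.mod_eq_of_lt hi]
      have : i + k ≡ i + 0 [MOD s.length] := h2
      exact (Nat.modEq_zero_iff_dvd.1 (Nat.ModEq.add_left_cancel' i this))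
    · rintro ⟨j, rfl⟩
      simp [Nat.mod_eq_of_lt hi]
  apply Nat.dvd_antisymm
  · rw [← per_dvd, key]
  · rw [← key, pow_per]

theorem mem_cyc {φ : Perm D} {s : List D} (hs : s.map φ = s.rotate 1) (x : D) :
    φ x ∈ s ↔ x ∈ s := by
  rw [← List.mem_rotate (n := 1), ← hs]
  exact List.mem_map_of_injective φ.injective

theorem split_core [Fintype D] {φ α : Perm D} {g : ℕ} (H : H1 φ α g) {pos : D → X} {s1 s2 : List D}
    (hs : (s1 ++ s2).map φ = (s1 ++ s2).rotate 1) (hn : (s1 ++ s2).Nodup) (h2 : s2 ≠ [])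
    (hpos : ∀ a ∈ s1.head?, ∀ b ∈ s2.head?, pos a = pos b) :
    ∃ φ' : Perm D, (∀ x, x ∉ s1 ++ s2 → φ' x = φ x) ∧ s1.map φ' = s1.rotate 1 ∧
      s2.map φ' = s2.rotate 1 ∧ (∀ x, pos (φ' x) = pos (φ x)) ∧ H1 φ' α g := by
  classical
  rcases s1 with _ | ⟨a1, t1⟩
  · exact ⟨φ, fun _ _ => rfl, by simp, by simpa using hs, fun _ => rfl, H⟩
  rcases s2 with _ | ⟨a2, t2⟩
  · exact absurd rfl h2
  have hp12 : pos a1 = pos a2 := hpos a1 (by simp) a2 (by simp)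
  have hs' : (a1 :: t1).map φ ++ (a2 :: t2).map φ = (t1 ++ [a2]) ++ (t2 ++ [a1]) := by
    rw [← List.map_append, hs]; simp
  obtain ⟨e1, e2⟩ := List.append_inj hs' (by simp)
  simp only [List.cons_append, List.nodup_cons, List.mem_append, List.mem_cons, List.nodup_append,
    not_or] at hn
  obtain ⟨⟨n1, n2, n3⟩, n4, ⟨n5, n6⟩, n7⟩ := hn
  have n8 : a2 ∉ t1 := fun h => n7 a2 h a2 (by simp) rfl
  have sw : ∀ t : List D, a1 ∉ t → a2 ∉ t → t.map (swap a1 a2) = t := by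
    intro t h1 h2
    conv_rhs => rw [← List.map_id t]
    apply List.map_congr_left
    intro x hx
    exact swap_apply_of_ne_of_ne (by rintro rfl; exact h1 hx) (by rintro rfl; exact h2 hx)
  let φ' : Perm D := swap a1 a2 * φ
  have hφ' : ∀ x, φ' x = swap a1 a2 (φ x) := fun x => rfl
  have m1 : (a1 :: t1).map φ' = t1 ++ [a1] := by
    have : (a1 :: t1).map φ' = ((a1 :: t1).map φ).map (swap a1 a2) := by rw [List.map_map]; rfl
    rw [this, e1, List.map_append, sw t1 n1 n8]; simp
  have m2 : (a2 :: t2).map φ' = t2 ++ [a2] := by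
    have : (a2 :: t2).map φ' = ((a2 :: t2).map φ).map (swap a1 a2) := by rw [List.map_map]; rfl
    rw [this, e2, List.map_append, sw t2 n3 n5]; simp
  refine ⟨φ', ?_, by rw [m1]; simp, by rw [m2]; simp, ?_, ?_⟩
  · intro x hx
    rw [hφ']
    have hx' := mt (mem_cyc hs x).1 hx
    apply swap_apply_of_ne_of_ne
    · rintro h; apply hx'; rw [h]; simp
    · rintro h; apply hx'; rw [h]; simp
  · intro x
    rw [hφ']
    by_cases h1 : φ x = a1
    · rw [h1]; simp [hp12]
    by_cases h2 : φ x = a2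
    · rw [h2]; simp [hp12]
    · rw [swap_apply_of_ne_of_ne h1 h2]
  · obtain ⟨L, hL⟩ := H
    refine ⟨L, ?_⟩
    rintro c hc ⟨p', hp'⟩ hLc
    have hm2 : ∀ x, φ' x ∈ a2 :: t2 ↔ x ∈ a2 :: t2 := mem_cyc (by rw [m2]; simp)
    have h12 : ¬ (a1 ∈ a2 :: t2) := by simp [n2, n3]
    have hpot : ∃ p : D → ℚ, ∀ x, p (φ x) = p x + c x := by
      refine ⟨fun x => p' x + if x ∈ a2 :: t2 then p' a1 - p' a2 else 0, ?_⟩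
      intro x
      beta_reduce
      have hx := hp' x
      have hx2 := hm2 x
      rw [hφ'] at hx hx2
      by_cases h1 : φ x = a1
      · rw [h1] at hx hx2 ⊢
        rw [swap_apply_left] at hx hx2
        rw [if_neg h12, if_pos (hx2.1 (by simp))]
        linarith
      by_cases h2 : φ x = a2
      · rw [h2] at hx hx2 ⊢
        rw [swap_apply_right] at hx hx2
        rw [if_pos (by simp), if_neg (fun h => h12 (hx2.2 h))]
        linarith
      · rw [swap_apply_of_ne_of_ne h1 h2] at hx hx2
        simp only [hx2]
        linarith
    obtain ⟨p, hp1, hp2⟩ := hL c hc hpot hLc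
    refine ⟨p, ?_, hp2⟩
    have q1 := lsum_pot hp' t2 a2 a2 m2
    have q2 := lsum_pot hp1 t2 a2 a1 e2
    have q3 : p a1 = p a2 := by linarith
    intro x
    rw [← hp1, hφ']
    by_cases h1 : φ x = a1
    · rw [h1]; simp [q3]
    by_cases h2 : φ x = a2
    · rw [h2]; simp [q3]
    · rw [swap_apply_of_ne_of_ne h1 h2]
end lists

/-- run a word -/
def run (st : S × Bool → X → X) : Wd S → X → X
  | [], x => x
  | a :: w, x => run st w (st a x)

theorem run_append (st : S × Bool → X → X) (u v : Wd S) (x : X) :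
    run st (u ++ v) x = run st v (run st u x) := by
  induction u generalizing x with
  | nil => rfl
  | cons a u ih => exact ih _

/-- face chain -/
noncomputable def fc (st : S × Bool → X → X) (f : X → Wd S → ℚ) (x : X) (r : Wd S) : ℚ :=
  ∑ i ∈ range r.length, f (run st (r.take i) x) (r.rotate i)

variable {Rw : Set (Wd S)} {st : S × Bool → X → X}

theorem HasD.nil (x0 : X) : HasD Rw st 0 x0 [] (fun _ => 0) 0 0 := by
  refine ⟨Empty, inferInstance, 1, 1, (fun e => nomatch e), (fun e => nomatch e), (fun e => nomatch e), (fun e => nomatch e), (fun e => nomatch e), [], ?_, ?_, ?_, ?_, ?_, ?_, ?_, ?_, ?_, ?_⟩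
  · constructor <;> intro d <;> exact nomatch d
  · refine ⟨0, fun c _ _ _ => ⟨(fun e => nomatch e), (fun e => nomatch e), (fun e => nomatch e)⟩⟩
  · simp
  · intro d; exact nomatch d
  · simp
  · simp
  · simp
  · intro f _; simp [IsDg.Ch]
  · simp [nrel]
  · simp

theorem run_pos {D : Type} {φ : Perm D} {lab : D → S × Bool} {pos : D → X}
    (hpos : ∀ d, pos (φ d) = st (lab d) (pos d)) :
    ∀ (t : List D) (a b : D), (a :: t).map φ = t ++ [b] → pos b = run st ((a :: t).map lab) (pos a) := by
  intro t
  induction t with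
  | nil => intro a b h; simp at h; subst h; simp [hpos, run]
  | cons a' t ih =>
    intro a b h
    simp only [List.map_cons, List.cons_append, List.cons.injEq] at h
    obtain ⟨h1, h2⟩ := h
    have := ih a' b (by simpa using h2)
    rw [this, ← h1, hpos]
    simp [run]

theorem HasD.rot1 {g : ℕ} {x0 : X} {a : S × Bool} {w : Wd S} {C n m}
    (h : HasD Rw st g x0 (a :: w) C n m) : HasD Rw st g (st a x0) (w ++ [a]) C n m := by
  obtain ⟨D, _, φ, α, lab, pos, Z, N, rw, sp, B, H, h1, h2, h3, h4, h5, h6, h7, h8⟩ := h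
  refine ⟨D, _, φ, α, lab, pos, Z, N, rw, sp.rotate 1, B, H, List.nodup_rotate.2 h1, ?_, ?_, ?_, ?_, h6, h7, h8⟩
  · intro d; rw [List.mem_rotate]; exact h2 d
  · rw [List.map_rotate, h3]
  · rw [List.map_rotate, h4]; simp
  · rcases sp with _ | ⟨z, t⟩
    · simp at h4
    · intro y hy
      rw [← h3] at hy
      simp at hy h4 h5
      rw [← hy, B.posφ, h5, h4.1]

theorem HasD.rot {g : ℕ} {C n m} (u v : Wd S) : ∀ {x0 : X},
    HasD Rw st g x0 (u ++ v) C n m → HasD Rw st g (run st u x0) (v ++ u) C n m := by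
  induction u generalizing v with
  | nil => intro x0 h; simpa [run] using h
  | cons a u ih =>
    intro x0 h
    have h1 := HasD.rot1 (a := a) (w := u ++ v) h
    rw [List.append_assoc] at h1
    have h2 := ih (v ++ [a]) h1
    simpa [run] using h2

theorem HasD.leaf {g : ℕ} {x0 : X} {w : Wd S} {C n m} (hst : ∀ a x, st (li a) (st a x) = x)
    (hcl : run st w x0 = x0) (h : HasD Rw st g x0 w C n m) (a : S × Bool) : ∃ m', HasD Rw st g x0 (w ++ [a, li a]) C n m' := by
  classical
  obtain ⟨D, _, φ, α, lab, pos, Z, N, rw, sp, B, H, h1, h2, h3, h4, h5, h6, h7, h8⟩ := h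
  -- first dart of the special face, if any
  let F : D ⊕ Bool → D ⊕ Bool := fun x => match x with
    | Sum.inl d => if sp.head? = some (φ d) then Sum.inr true else Sum.inl (φ d)
    | Sum.inr true => Sum.inr false
    | Sum.inr false => match sp.head? with
      | some z => Sum.inl z
      | none => Sum.inr true
  have F1 : ∀ d, sp.head? = some (φ d) → F (Sum.inl d) = Sum.inr true := by
    intro d h; simp only [F, if_pos h]
  have F2 : ∀ d, sp.head? ≠ some (φ d) → F (Sum.inl d) = Sum.inl (φ d) := by
    intro d h; simp only [F, if_neg h]
  have F3 : F (Sum.inr true) = Sum.inr false := rfl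
  have F4 : ∀ z, sp.head? = some z → F (Sum.inr false) = Sum.inl z := by
    intro z h; simp only [F, h]
  have F5 : sp.head? = none → F (Sum.inr false) = Sum.inr true := by
    intro h; simp only [F, h]
  have hsurj : Function.Surjective F := by
    rintro (d | _ | _)
    · by_cases h : sp.head? = some d
      · exact ⟨Sum.inr false, F4 d h⟩
      · exact ⟨Sum.inl (φ⁻¹ d), by rw [F2]; simp; simpa using h⟩
    · exact ⟨Sum.inr true, F3⟩
    · rcases h : sp.head? with _ | z
      · exact ⟨Sum.inr false, F5 h⟩
      · exact ⟨Sum.inl (φ⁻¹ z), by rw [F1]; simpa using h⟩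
  let φ' : Perm (D ⊕ Bool) := Equiv.ofBijective F ⟨Finite.injective_iff_surjective.2 hsurj, hsurj⟩
  have hφ' : ∀ x, φ' x = F x := fun x => rfl
  let α' : Perm (D ⊕ Bool) := Equiv.sumCongr α Equiv.boolNot
  have A1 : ∀ d, α' (Sum.inl d) = Sum.inl (α d) := fun d => rfl
  have A2 : ∀ b, α' (Sum.inr b) = Sum.inr (!b) := fun d => rfl
  let lab' : D ⊕ Bool → S × Bool := Sum.elim lab (fun b => if b then a else li a)
  let pos' : D ⊕ Bool → X := Sum.elim pos (fun b => if b then x0 else st a x0)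
  let Z' : D ⊕ Bool → Prop := Sum.elim Z (fun _ => True)
  let N' : D ⊕ Bool → Prop := Sum.elim N (fun _ => False)
  let rw' : D ⊕ Bool → Wd S := Sum.elim rw (fun _ => [])
  have hzZ : ∀ z, sp.head? = some z → Z z := fun z hz => (h2 z).2 (List.mem_of_mem_head? hz)
  have nZ : ∀ d, ¬ Z d → F (Sum.inl d) = Sum.inl (φ d) := by
    intro d hd; apply F2; intro h; exact hd ((B.Zφ d).1 (hzZ _ h))
  have hB : IsDg Rw st φ' α' lab' pos' Z' N' rw' := by
    constructor
    · rintro (d | d)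
      · rw [A1, A1, B.αα]
      · rw [A2, A2, Bool.not_not]
    · rintro (d | _ | _)
      · rw [A1]; exact B.labα d
      · rw [A2]; simp [lab']
      · rw [A2]; simp [lab']
    · rintro (d | _ | _)
      · rw [A1]; exact B.posα d
      · rw [A2]; simp [lab', pos', hst]
      · rw [A2]; simp [lab', pos']
    · rintro (d | _ | _)
      · rw [hφ']
        by_cases h : sp.head? = some (φ d)
        · rw [F1 d h]
          have := h5 _ h
          show x0 = st (lab d) (pos d)
          rw [← this, B.posφ]
        · rw [F2 d h]; exact B.posφ d
      · rw [hφ']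
        rcases h : sp.head? with _ | z
        · rw [F5 h]; simp [lab', pos', hst]
        · rw [F4 z h]; simp [lab', pos', hst, h5 z h]
      · rw [hφ', F3]; simp [lab', pos']
    · rintro (d | _ | _)
      · rw [hφ']
        by_cases h : sp.head? = some (φ d)
        · rw [F1 d h]; simp [Z', (B.Zφ d).1 (hzZ _ h)]
        · rw [F2 d h]; exact B.Zφ d
      · rw [hφ']
        rcases h : sp.head? with _ | z
        · rw [F5 h]; simp [Z']
        · rw [F4 z h]; simp [Z', hzZ z h]
      · rw [hφ', F3]; simp [Z']
    · rintro (d | _ | _)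
      · rw [hφ']
        by_cases h : sp.head? = some (φ d)
        · rw [F1 d h]; simp [N', B.ZN d ((B.Zφ d).1 (hzZ _ h))]
        · rw [F2 d h]; exact B.Nφ d
      · rw [hφ']
        rcases h : sp.head? with _ | z
        · rw [F5 h]; simp [N']
        · rw [F4 z h]; simp [N', B.ZN z (hzZ z h)]
      · rw [hφ', F3]; simp [N']
    · rintro (d | _ | _)
      · exact B.ZN d
      · simp [N']
      · simp [N']
    · rintro (d | _ | _) hd
      · have hd' : N d := hd
        have nz : ¬ Z d := fun h => B.ZN d h hd'
        have e1 : φ' (Sum.inl d) = Sum.inl (φ d) := nZ d nz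
        rw [e1, hφ', nZ _ (by rwa [B.Zφ])]
        exact ⟨congrArg _ (B.Nb d hd').1, (B.Nb d hd').2⟩
      · simp [N'] at hd
      · simp [N'] at hd
    · rintro (d | _ | _) h1 h2
      · exact B.Rm d h1 h2
      · simp [Z'] at h1
      · simp [Z'] at h1
    · rintro (d | _ | _) h1 h2
      · exact B.Rh d h1 h2
      · simp [Z'] at h1
      · simp [Z'] at h1
    · rintro (d | _ | _) h1 h2
      · rw [hφ', nZ d h1]; exact B.Rr d h1 h2
      · simp [Z'] at h1
      · simp [Z'] at h1
    · rintro (d | _ | _) k1 k2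
      · have k1' : ¬ Z d := k1
        refine Eq.trans ?_ (B.Rp d k1 k2)
        have : ∀ n : ℕ, (φ' ^ n) (Sum.inl d) = Sum.inl ((φ ^ n) d) := by
          intro n
          induction n with
          | zero => simp
          | succ n ih =>
            rw [pow_succ', Perm.mul_apply, ih, hφ', nZ, pow_succ', Perm.mul_apply]
            have := B.Zz d n
            rw [zpow_natCast] at this
            rwa [this]
        apply Nat.dvd_antisymm
        · rw [← per_dvd, this, pow_per]
        · rw [← per_dvd]
          have h9 := this (per φ' (Sum.inl d))
          rw [pow_per] at h9
          exact (Sum.inl_injective h9).symm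
      · simp [Z'] at k1
      · simp [Z'] at k1
  have hH : H1 φ' α' g := by
    obtain ⟨L, hL⟩ := H
    let U : (D ⊕ Bool → ℚ) →ₗ[ℚ] (D → ℚ) :=
      { toFun := fun c d => c (Sum.inl d), map_add' := fun _ _ => rfl, map_smul' := fun _ _ => rfl }
    refine ⟨L ∘ₗ U, ?_⟩
    rintro c hc ⟨p', hp'⟩ hLc
    have hct : c (Sum.inr false) = - c (Sum.inr true) := hc (Sum.inr true)
    obtain ⟨p, hp1, hp2⟩ := hL (U c) (fun d => hc (Sum.inl d)) (by
      refine ⟨fun d => p' (Sum.inl d), ?_⟩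
      intro d
      show p' (Sum.inl (φ d)) = p' (Sum.inl d) + c (Sum.inl d)
      have q1 := hp' (Sum.inl d)
      rw [hφ'] at q1
      by_cases h : sp.head? = some (φ d)
      · rw [F1 d h] at q1
        have q2 := hp' (Sum.inr true)
        have q3 := hp' (Sum.inr false)
        rw [hφ', F3] at q2
        rw [hφ', F4 _ h] at q3
        linarith
      · rw [F2 d h] at q1; exact q1) hLc
    obtain ⟨s, hs⟩ : ∃ s : ℚ, ∀ z, sp.head? = some z → p z = s := by
      rcases h : sp.head? with _ | z
      · exact ⟨0, by simp⟩
      · refine ⟨p z, ?_⟩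
        intro z' hz'
        simp at hz'; rw [hz']
    refine ⟨Sum.elim p (fun b => if b then s else s + c (Sum.inr true)), ?_, ?_⟩
    · rintro (d | _ | _)
      · rw [hφ']
        by_cases h : sp.head? = some (φ d)
        · rw [F1 d h]
          have := hp1 d
          rw [hs _ h] at this
          exact this
        · rw [F2 d h]; exact hp1 d
      · rw [hφ']
        rcases h : sp.head? with _ | z
        · rw [F5 h]; simp [hct]
        · rw [F4 z h]; simp [hct, hs z h]
      · rw [hφ', F3]; simp
    · rintro (d | _ | _)
      · rw [A1]; exact hp2 d
      · rw [A2]; simp [hct]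
      · rw [A2]; simp
  refine ⟨Fintype.card (D ⊕ Bool), D ⊕ Bool, inferInstance, φ', α', lab', pos', Z', N', rw',
    sp.map Sum.inl ++ [Sum.inr true, Sum.inr false], hB, hH, ?_, ?_, ?_, ?_, ?_, ?_, ?_, rfl⟩
  · rw [List.nodup_append]
    refine ⟨h1.map Sum.inl_injective, by simp, ?_⟩
    intro x hx y hy
    rw [List.mem_map] at hx
    obtain ⟨z, _, rfl⟩ := hx
    intro h
    rw [← h] at hy
    simp at hy
  · rintro (d | _ | _)
    · simp [Z', h2]
    · simp [Z']
    · simp [Z']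
  · rcases hsp : sp with _ | ⟨z, t⟩
    · have e0 : sp.head? = none := by rw [hsp]; rfl
      simp [hφ', F3, F5 e0]
    · have e0 : sp.head? = some z := by rw [hsp]; rfl
      rw [hsp] at h3 h1
      have h3' : (z :: t).map φ = t ++ [z] := by rw [h3]; simp
      have key : ∀ (t : List D) (y : D), z ∉ t → (y :: t).map φ = t ++ [z] →
          ((y :: t).map Sum.inl).map φ' = t.map Sum.inl ++ [Sum.inr true] := by
        intro t
        induction t with
        | nil => intro y _ hy; simp at hy; simp [hφ', F1 y (by rw [hy, e0])]
        | cons y' t ih =>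
          intro y hz hy
          simp only [List.map_cons, List.cons_append, List.cons.injEq] at hy
          simp only [List.mem_cons, not_or] at hz
          have := ih y' hz.2 (by simpa using hy.2)
          rw [List.map_cons, List.map_cons, this, hφ', F2 y, hy.1]
          · simp
          · rw [e0, hy.1]; intro h; exact hz.1 (Option.some.inj h)
      rw [List.map_append, key t z (by simpa using (List.nodup_cons.1 h1).1) h3']
      simp [hφ', F3, F4 z e0]
  · rw [List.map_append, List.map_map, ← h4]
    simp [lab', Function.comp_def]
  · intro y hy
    rcases hsp : sp with _ | ⟨z, t⟩
    · rw [hsp] at hy; simp at hy; subst hy; simp [pos']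
    · rw [hsp] at hy; simp at hy; subst hy; exact h5 z (by rw [hsp]; rfl)
  · intro f hf
    rw [← h6 f hf]
    unfold IsDg.Ch
    rw [Fintype.sum_sum_type]
    simp [Z', N', pos', rw']
    apply sum_congr rfl
    intro d _
    by_cases h : Z d ∨ N d <;> simp [h]
  · rw [← h7]
    unfold nrel
    symm
    apply card_bij (fun d _ => Sum.inl d)
    · intro d hd; simpa [Z', N'] using hd
    · intro d _ e _ h; exact Sum.inl_injective h
    · rintro (d | _ | _) hd
      · exact ⟨d, by simpa [Z', N'] using hd, rfl⟩
      · simp [Z'] at hd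
      · simp [Z'] at hd

end

section
variable {S : Type*} {X : Type*}
variable {Rw : Set (Wd S)} {st : S × Bool → X → X}

theorem per_agree {D : Type} [Fintype D] {φ φ' : Perm D} {x : D} (h : ∀ k : ℕ, φ' ((φ ^ k) x) = φ ((φ ^ k) x)) :
    per φ' x = per φ x := by
  have : ∀ n : ℕ, (φ' ^ n) x = (φ ^ n) x := by
    intro n
    induction n with
    | zero => simp
    | succ n ih => rw [pow_succ', Perm.mul_apply, ih, h, pow_succ', Perm.mul_apply]
  apply Nat.dvd_antisymm
  · rw [← per_dvd, this, pow_per]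
  · rw [← per_dvd, ← this, pow_per]

theorem run_pos_get {D : Type} {φ : Perm D} {lab : D → S × Bool} {pos : D → X}
    (hpos : ∀ d, pos (φ d) = st (lab d) (pos d)) (s : List D) (x0 : X) (b : List D)
    (hs : ∃ c, s.map φ ++ c = s.drop 1 ++ b) (h0 : ∀ z ∈ s.head?, pos z = x0) :
    ∀ i (hi : i < s.length), pos s[i] = run st ((s.map lab).take i) x0 := by
  obtain ⟨c, hc⟩ := hs
  intro i
  induction i with
  | zero => intro hi; simp [run]; apply h0; rw [List.head?_eq_getElem?, List.getElem?_eq_getElem hi]; rfl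
  | succ i ih =>
    intro hi
    have h1 := ih (by omega)
    have h2 : φ s[i] = s[i+1] := by
      have : (s.map φ ++ c)[i]? = (s.drop 1 ++ b)[i]? := by rw [hc]
      rw [List.getElem?_append_left (by simp; omega), List.getElem?_append_left (by simp; omega)] at this
      rw [List.getElem?_map, List.getElem?_eq_getElem (by omega), List.getElem?_drop,
        List.getElem?_eq_getElem (by omega)] at this
      simp only [Option.map_some, Option.some.injEq] at this
      rw [this]; congr 1; omega
    rw [← h2, hpos, h1, List.take_succ_eq_append_getElem (by simp; omega), run_append]
    simp [run]

theorem head_rot {β : Type*} (r : List β) (i : ℕ) (hi : i < r.length) : (r.rotate i).head? = some r[i] := by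
  rw [List.head?_eq_getElem?, List.getElem?_rotate (by omega), List.getElem?_eq_getElem (by simpa [Nat.mod_eq_of_lt hi])]
  simp [Nat.mod_eq_of_lt hi]

theorem split_data {g : ℕ} {x0 : X} {w r : Wd S} {C n m} (hr : r ≠ [])
    (hcl : run st w x0 = x0)
    (h : HasD Rw st g x0 (w ++ r) C n m) :
    ∃ (D : Type) (_ : Fintype D) (φ α : Perm D) (lab : D → S × Bool) (pos : D → X)
    (Z N : D → Prop) (rw : D → Wd S) (s1 s2 : List D) (φ' : Perm D),
    IsDg Rw st φ α lab pos Z N rw ∧ H1 φ' α g ∧ s1.Nodup ∧ s2.Nodup ∧ (∀ x ∈ s1, x ∉ s2) ∧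
    (∀ d, Z d ↔ d ∈ s1 ∨ d ∈ s2) ∧ s1.map φ' = s1.rotate 1 ∧ s2.map φ' = s2.rotate 1 ∧
    s1.map lab = w ∧ s2.map lab = r ∧ (∀ z ∈ s1.head?, pos z = x0) ∧
    (∀ i (hi : i < s2.length), pos s2[i] = run st (r.take i) x0) ∧
    (∀ x, ¬ Z x → φ' x = φ x) ∧ (∀ x, pos (φ' x) = pos (φ x)) ∧
    (∀ f, Anti st f → IsDg.Ch pos Z N rw f = C f) ∧ nrel Z N = n ∧ Fintype.card D = m := by
  obtain ⟨D, _, φ, α, lab, pos, Z, N, rw, sp, B, H, h1, h2, h3, h4, h5, h6, h7, h8⟩ := h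
  obtain ⟨s1, s2, rfl, e1, e2⟩ := List.map_eq_append_iff.1 h4
  have h2' : s2 ≠ [] := by rintro rfl; apply hr; rw [← e2]; rfl
  have hh1 : ∀ z ∈ s1.head?, pos z = x0 := by
    intro z hz; apply h5; rw [List.head?_append, Option.mem_def.1 hz]; rfl
  have hh2 : ∀ z ∈ s2.head?, pos z = x0 := by
    intro z hz
    rcases s1 with _ | ⟨a, t⟩
    · exact h5 z (by simpa using hz)
    · rcases s2 with _ | ⟨b, t2⟩
      · simp at hz
      · simp at hz; subst hz
        have : (a :: t).map φ = t ++ [b] := by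
          have hs' : (a :: t).map φ ++ (b :: t2).map φ = (t ++ [b]) ++ (t2 ++ [a]) := by
            rw [← List.map_append, h3]; simp
          exact (List.append_inj hs' (by simp)).1
        rw [run_pos B.posφ t a b this, hh1 a (by simp), e1, hcl]
  obtain ⟨φ', k1, k2, k3, k4, k5⟩ := split_core (pos := pos) H h3 h1 h2' (by
    intro a ha b hb; rw [hh1 a ha, hh2 b hb])
  rw [List.nodup_append] at h1
  refine ⟨D, _, φ, α, lab, pos, Z, N, rw, s1, s2, φ', B, k5, h1.1, h1.2.1, fun x hx hx' => h1.2.2 x hx x hx' rfl,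
    fun d => by rw [h2, List.mem_append], k2, k3, e1, e2, hh1, ?_, fun x hx => k1 x (by rwa [← h2]), k4, h6, h7, h8⟩
  rw [← e2]
  apply run_pos_get (φ := φ') (b := s2.take 1) (fun d => by rw [k4, B.posφ]) s2 x0
  · refine ⟨[], ?_⟩
    rcases s2 with _ | ⟨b, t⟩
    · simp
    · rw [k3]; simp
  · exact hh2

theorem HasD.splitN {g : ℕ} {x0 : X} {w : Wd S} {C n m} {a : S × Bool}
    (hcl : run st w x0 = x0)
    (h : HasD Rw st g x0 (w ++ [a, li a]) C n m) : HasD Rw st g x0 w C n m := by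
  obtain ⟨D, _, φ, α, lab, pos, Z, N, rw, s1, s2, φ', B, H, n1, n2, n12, hZ, m1, m2, l1, l2, p1, p2, hφ, hpos, hC, hn, hm⟩ :=
    split_data (by simp) hcl h
  obtain ⟨b1, b2, rfl⟩ : ∃ b1 b2, s2 = [b1, b2] := List.length_eq_two.1 (by simpa using congrArg List.length l2)
  simp at m2 l2
  have hb : ∀ x, x ∈ s1 → x ≠ b1 ∧ x ≠ b2 := by intro x hx; simpa using n12 x hx
  have hor : ∀ d, (d ∈ s1 ∨ (N d ∨ d = b1 ∨ d = b2)) ↔ (Z d ∨ N d) := by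
    intro d; rw [hZ]; simp; tauto
  have hr : ∀ d, ¬ d ∈ s1 → ¬ (N d ∨ d = b1 ∨ d = b2) → ¬ Z d ∧ ¬ N d := by
    intro d h1 h2
    have := (hor d).not.1 (by tauto)
    tauto
  refine ⟨D, _, φ', α, lab, pos, (· ∈ s1), fun d => N d ∨ d = b1 ∨ d = b2, rw, s1, ?_, H, n1, fun d => Iff.rfl,
    m1, l1, p1, ?_, ?_, hm⟩
  · constructor
    · exact B.αα
    · exact B.labα
    · exact B.posα
    · intro d; rw [hpos, B.posφ]
    · intro d; exact mem_cyc m1 d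
    · intro d
      have e1 : φ' d = b1 ↔ d = b2 := by rw [← m2.2, φ'.apply_eq_iff_eq]
      have e2 : φ' d = b2 ↔ d = b1 := by rw [← m2.1, φ'.apply_eq_iff_eq]
      have e3 : d ≠ b1 ∧ d ≠ b2 → (N (φ' d) ↔ N d) := by
        intro hd
        by_cases hz : Z d
        · have : d ∈ s1 := by simpa [hZ, hd] using hz
          have h2 : φ' d ∈ s1 := (mem_cyc m1 d).2 this
          have q1 := B.ZN d hz
          have q2 := B.ZN (φ' d) ((hZ _).2 (Or.inl h2))
          tauto
        · rw [hφ d hz, B.Nφ]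
      show (N (φ' d) ∨ φ' d = b1 ∨ φ' d = b2) ↔ (N d ∨ d = b1 ∨ d = b2)
      rw [e1, e2]
      by_cases h1 : d = b1
      · simp [h1]
      by_cases h2 : d = b2
      · simp [h2]
      rw [e3 ⟨h1, h2⟩]; simp [h1, h2]
    · intro d hd
      have := B.ZN d ((hZ d).2 (Or.inl hd))
      have := hb d hd
      tauto
    · rintro d (hd | rfl | rfl)
      · have hz : ¬ Z d := fun h => B.ZN d h hd
        rw [hφ d hz, hφ _ (by rwa [B.Zφ])]
        exact B.Nb d hd
      · rw [m2.1, m2.2, l2.1, l2.2]; simp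
      · rw [m2.2, m2.1, l2.1, l2.2]; simp
    · intro d h1 h2; have := hr d h1 h2; exact B.Rm d this.1 this.2
    · intro d h1 h2; have := hr d h1 h2; exact B.Rh d this.1 this.2
    · intro d h1 h2; have := hr d h1 h2; rw [hφ d this.1]; exact B.Rr d this.1 this.2
    · intro d h1 h2
      have := hr d h1 h2
      rw [← B.Rp d this.1 this.2]
      apply per_agree
      intro k
      apply hφ
      have q := B.Zz d k
      rw [zpow_natCast] at q
      rw [q]; exact this.1
  · intro f hf
    rw [← hC f hf]
    unfold IsDg.Ch
    apply sum_congr rfl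
    intro d _
    have := hor d
    by_cases h : Z d ∨ N d
    · rw [if_pos h, if_pos (this.2 h)]
    · rw [if_neg h, if_neg (fun k => h (this.1 k))]
  · rw [← hn]
    unfold nrel
    congr 1
    ext d
    simp only [mem_filter, mem_univ, true_and]
    have := hor d
    tauto

theorem HasD.splitR (h0 : SC Rw) {g : ℕ} {x0 : X} {w r : Wd S} {C n m} (hr : r ∈ Rw)
    (hcl : run st w x0 = x0)
    (h : HasD Rw st g x0 (w ++ r) C n m) : HasD Rw st g x0 w (fun f => C f + fc st f x0 r) (n + r.length) m := by
  classical
  obtain ⟨D, _, φ, α, lab, pos, Z, N, rw, s1, s2, φ', B, H, n1, n2, n12, hZ, m1, m2, l1, l2, p1, p2, hφ, hpos, hC, hn, hm⟩ :=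
    split_data (h0.ne r hr) hcl h
  have hlen : s2.length = r.length := by rw [← l2]; simp
  have hrot : ∀ i, r.rotate i ∈ Rw := fun i => h0.rot hr i
  have hidx : ∀ x ∈ s2, s2.idxOf x < s2.length := fun x hx => List.idxOf_lt_length_iff.2 hx
  let rw' : D → Wd S := fun x => if x ∈ s2 then r.rotate (s2.idxOf x) else rw x
  have rw1 : ∀ x, x ∈ s2 → rw' x = r.rotate (s2.idxOf x) := fun x hx => if_pos hx
  have rw2 : ∀ x, x ∉ s2 → rw' x = rw x := fun x hx => if_neg hx
  have hgi : ∀ i (hi : i < s2.length), s2.idxOf s2[i] = i := fun i hi => n2.idxOf_getElem i hi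
  have hs2Z : ∀ x ∈ s2, Z x := fun x hx => (hZ x).2 (Or.inr hx)
  have hs2N : ∀ x ∈ s2, ¬ N x := fun x hx => B.ZN x (hs2Z x hx)
  have hrr : ∀ d, d ∉ s1 → ¬ N d → d ∉ s2 → ¬ Z d ∧ ¬ N d := by
    intro d h1 h2 h3; rw [hZ]; tauto
  refine ⟨D, _, φ', α, lab, pos, (· ∈ s1), N, rw', s1, ?_, H, n1, fun d => Iff.rfl,
    m1, l1, p1, ?_, ?_, hm⟩
  · constructor
    · exact B.αα
    · exact B.labα
    · exact B.posα
    · intro d; rw [hpos, B.posφ]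
    · intro d; exact mem_cyc m1 d
    · intro d
      by_cases hz : Z d
      · have hz' : Z (φ' d) := by
          rw [hZ] at hz ⊢
          rw [mem_cyc m1, mem_cyc m2]; exact hz
        have := B.ZN _ hz
        have := B.ZN _ hz'
        tauto
      · rw [hφ d hz, B.Nφ]
    · intro d hd; exact B.ZN d ((hZ d).2 (Or.inl hd))
    · intro d hd
      have hz : ¬ Z d := fun h => B.ZN d h hd
      rw [hφ d hz, hφ _ (by rwa [B.Zφ])]
      exact B.Nb d hd
    · intro d h1 h2
      by_cases h3 : d ∈ s2
      · rw [rw1 d h3]; exact hrot _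
      · rw [rw2 d h3]; have := hrr d h1 h2 h3; exact B.Rm d this.1 this.2
    · intro d h1 h2
      by_cases h3 : d ∈ s2
      · obtain ⟨i, hi, rfl⟩ := List.getElem_of_mem h3
        rw [rw1 _ h3, hgi, head_rot r i (by omega)]
        simp [← l2]
      · rw [rw2 d h3]; have := hrr d h1 h2 h3; exact B.Rh d this.1 this.2
    · intro d h1 h2
      by_cases h3 : d ∈ s2
      · have h4 : φ' d ∈ s2 := (mem_cyc m2 d).2 h3
        obtain ⟨i, hi, rfl⟩ := List.getElem_of_mem h3
        rw [rw1 _ h3, rw1 _ h4, hgi]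
        simp only [cyc_get m2 i hi]
        rw [hgi, List.rotate_rotate, hlen, List.rotate_mod]
      · have h4 : φ' d ∉ s2 := fun h => h3 ((mem_cyc m2 d).1 h)
        rw [rw2 _ h3, rw2 _ h4]
        have := hrr d h1 h2 h3; rw [hφ d this.1]; exact B.Rr d this.1 this.2
    · intro d h1 h2
      by_cases h3 : d ∈ s2
      · rw [cyc_per n2 m2 h3, rw1 d h3]; simp [hlen]
      · rw [rw2 d h3]
        have := hrr d h1 h2 h3
        rw [← B.Rp d this.1 this.2]
        apply per_agree
        intro k
        apply hφ
        have q := B.Zz d k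
        rw [zpow_natCast] at q
        rw [q]; exact this.1
  · intro f hf
    show _ = C f + fc st f x0 r
    rw [← hC f hf]
    unfold IsDg.Ch
    have e1 : fc st f x0 r = ∑ d : D, if d ∈ s2 then f (pos d) (rw' d) else 0 := by
      rw [← sum_filter]
      unfold fc
      rw [← hlen]
      symm
      apply sum_bij (fun d _ => s2.idxOf d)
      · intro d hd; rw [mem_range]; exact hidx d (by simpa using hd)
      · intro d hd e he hde
        simp at hd he
        have q1 := List.getElem_idxOf (hidx d hd)
        have q2 := List.getElem_idxOf (hidx e he)
        rw [← q1, ← q2]; simp [hde]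
      · intro i hi
        rw [mem_range] at hi
        exact ⟨s2[i], by simp, hgi i hi⟩
      · intro d hd
        simp at hd
        obtain ⟨i, hi, rfl⟩ := List.getElem_of_mem hd
        rw [rw1 _ hd, hgi, p2]
    rw [e1, ← sum_add_distrib]
    apply sum_congr rfl
    intro d _
    by_cases h3 : d ∈ s2
    · have q1 := hs2Z d h3
      have q2 := hs2N d h3
      have q3 : d ∉ s1 := fun h => n12 d h h3
      simp [h3, q1, q2, q3]
    · rw [rw2 d h3]
      have : (d ∈ s1 ∨ N d) ↔ (Z d ∨ N d) := by rw [hZ]; tauto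
      rw [if_neg h3, add_zero]
      by_cases h : Z d ∨ N d
      · rw [if_pos h, if_pos (this.2 h)]
      · rw [if_neg h, if_neg (fun k => h (this.1 k))]
  · rw [← hn, ← hlen, ← List.toFinset_card_of_nodup n2]
    unfold nrel
    rw [← card_union_of_disjoint]
    · congr 1
      ext d
      simp only [mem_filter, mem_univ, true_and, mem_union, List.mem_toFinset]
      by_cases h3 : d ∈ s2
      · have q2 := hs2N d h3
        have q3 : d ∉ s1 := fun h => n12 d h h3
        tauto
      · rw [hZ]; tauto
    · rw [Finset.disjoint_left]
      intro d hd hd'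
      simp only [mem_filter, mem_univ, true_and, List.mem_toFinset] at hd hd'
      exact hd.1 (hs2Z d hd')

def Fl (Rw : Set (Wd S)) (st : S × Bool → X → X) (x0 : X)
    (w : Wd S) (C : (X → Wd S → ℚ) → ℚ) : Prop := ∃ n m, HasD Rw st 0 x0 w C n m

theorem run_pair (hst : ∀ a x, st (li a) (st a x) = x) (a : S × Bool) (x : X) : run st [a, li a] x = x := by
  simp [run, hst]

theorem run_iw (hst : ∀ a x, st (li a) (st a x) = x) (w : Wd S) (x : X) :
    run st (iw w) (run st w x) = x := by
  induction w generalizing x with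
  | nil => rfl
  | cons a w ih =>
    have : iw (a :: w) = iw w ++ [li a] := by simp [iw]
    rw [this, run_append]
    show run st [li a] (run st (iw w) (run st w (st a x))) = x
    rw [ih]; exact hst a x

theorem Fl.rot {x0 : X} {u v : Wd S} {C} (h : Fl Rw st x0 (u ++ v) C) : Fl Rw st (run st u x0) (v ++ u) C := by
  obtain ⟨n, m, h⟩ := h; exact ⟨n, m, h.rot u v⟩

theorem Fl.ins (hst : ∀ a x, st (li a) (st a x) = x) {x0 : X} {u v : Wd S} {C}
    (hcl : run st (u ++ v) x0 = x0)
    (a : S × Bool) (h : Fl Rw st x0 (u ++ v) C) : Fl Rw st x0 (u ++ a :: li a :: v) C := by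
  obtain ⟨n, m, h⟩ := h.rot
  rw [run_append] at hcl
  obtain ⟨m', h⟩ := h.leaf hst (by rw [run_append, hcl]) a
  rw [List.append_assoc] at h
  have := h.rot v _
  rw [hcl] at this
  exact ⟨n, m', by simpa using this⟩

theorem Fl.del (hst : ∀ a x, st (li a) (st a x) = x) {x0 : X} {u v : Wd S} {C}
    (hcl : run st (u ++ v) x0 = x0)
    (a : S × Bool) (h : Fl Rw st x0 (u ++ a :: li a :: v) C) : Fl Rw st x0 (u ++ v) C := by
  have h1 : Fl Rw st x0 ((u ++ [a, li a]) ++ v) C := by simpa using h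
  obtain ⟨n, m, h⟩ := h1.rot
  rw [run_append] at hcl
  rw [run_append, run_pair hst, ← List.append_assoc] at h
  have h := h.splitN (by rw [run_append, hcl])
  have := h.rot v _
  rw [hcl] at this
  exact ⟨n, m, this⟩

theorem Fl.red (hst : ∀ a x, st (li a) (st a x) = x) {x0 : X} {u v : Wd S} (h : FreeGroup.Red u v) :
    ∀ x, run st u x = run st v x := by
  induction h with
  | refl => intro x; rfl
  | tail h1 h ih =>
    intro x
    rw [ih]
    obtain ⟨⟩ := h
    rename_i L1 L2 y b
    rw [run_append, run_append]
    have := run_pair hst (y, b) (run st L1 x)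
    show run st L2 (run st [(y, b), li (y, b)] (run st L1 x)) = _
    rw [this]

theorem Fl.red1 (hst : ∀ a x, st (li a) (st a x) = x) {x0 : X} {u v : Wd S} {C} (h : FreeGroup.Red u v)
    (hcl : run st u x0 = x0) : Fl Rw st x0 u C ↔ Fl Rw st x0 v C := by
  induction h with
  | refl => rfl
  | tail h1 h ih =>
    rw [ih]
    have hcl' := Fl.red (x0 := x0) hst (h1.tail h) x0
    rw [hcl] at hcl'
    obtain ⟨⟩ := h
    rename_i L1 L2 y b
    constructor
    · intro h; exact Fl.del hst hcl'.symm (y, b) h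
    · intro h; exact Fl.ins hst hcl'.symm (y, b) h

theorem Fl.congr (hst : ∀ a x, st (li a) (st a x) = x) {x0 : X} {u v : Wd S} {C}
    (h : FreeGroup.mk u = FreeGroup.mk v) (hcl : run st u x0 = x0) (hu : Fl Rw st x0 u C) : Fl Rw st x0 v C := by
  obtain ⟨t, h1, h2⟩ := FreeGroup.Red.exact.1 h
  have e : run st v x0 = x0 := by
    rw [Fl.red (x0 := x0) hst h2, ← Fl.red (x0 := x0) hst h1, hcl]
  rw [Fl.red1 hst h2 e, ← Fl.red1 hst h1 hcl]; exact hu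

theorem mk_iw (w : Wd S) : FreeGroup.mk (iw w) = (FreeGroup.mk w)⁻¹ := by
  rw [FreeGroup.inv_mk]; rfl

theorem Fl.rel (h0 : SC Rw) (hst : ∀ a x, st (li a) (st a x) = x) (hR : ∀ r ∈ Rw, ∀ x, run st r x = x)
    {x0 : X} {w u r : Wd S} {C} (hr : r ∈ Rw) (hcl : run st w x0 = x0)
    (h : Fl Rw st x0 w C) :
    Fl Rw st x0 (w ++ u ++ r ++ iw u) (fun f => C f + fc st f (run st u x0) (iw r)) := by
  have h1 : Fl Rw st x0 ((w ++ u ++ r ++ iw r) ++ iw u) C := by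
    apply Fl.congr hst _ hcl h
    simp only [← FreeGroup.mul_mk, mk_iw]; group
  have e : run st (w ++ u ++ r ++ iw r) x0 = run st u x0 := by
    simp only [run_append, hcl, run_iw hst]
  have h2 := h1.rot
  rw [e, ← List.append_assoc] at h2
  obtain ⟨n, m, h2⟩ := h2
  have h3 := h2.splitR h0 (h0.inv r hr) (by
    simp only [run_append, run_iw hst, hcl, hR r hr])
  have h4 := h3.rot (iw u) _
  rw [run_iw hst] at h4
  exact ⟨_, _, h4⟩

/-- product of conjugates given by a list -/
def cprod (ls : List (Wd S × Wd S)) : FreeGroup S :=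
  (ls.map fun p => FreeGroup.mk p.1 * FreeGroup.mk p.2 * (FreeGroup.mk p.1)⁻¹).prod

noncomputable def cch (st : S × Bool → X → X) (x0 : X) (ls : List (Wd S × Wd S))
    (f : X → Wd S → ℚ) : ℚ :=
  (ls.map fun p => fc st f (run st p.1 x0) (iw p.2)).sum

theorem fill_aux (h0 : SC Rw) (hst : ∀ a x, st (li a) (st a x) = x) (hR : ∀ r ∈ Rw, ∀ x, run st r x = x)
    {x0 : X} (ls : List (Wd S × Wd S)) (hls : ∀ p ∈ ls, p.2 ∈ Rw) :
    ∀ (w : Wd S) C, run st w x0 = x0 → Fl Rw st x0 w C →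
    ∃ w', FreeGroup.mk w' = FreeGroup.mk w * cprod ls ∧ run st w' x0 = x0 ∧
      Fl Rw st x0 w' (fun f => C f + cch st x0 ls f) := by
  induction ls with
  | nil => intro w C hcl h; exact ⟨w, by simp [cprod], hcl, by simpa [cch] using h⟩
  | cons p ls ih =>
    intro w C hcl h
    have h1 := h.rel h0 hst hR (u := p.1) (hls p (by simp)) hcl
    obtain ⟨w', e1, e2, e3⟩ := ih (fun q hq => hls q (by simp [hq])) _ _ (by
      simp only [run_append, hcl, hR _ (hls p (by simp)), run_iw hst]) h1
    refine ⟨w', ?_, e2, ?_⟩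
    · rw [e1]; simp only [cprod, ← FreeGroup.mul_mk, mk_iw, List.map_cons, List.prod_cons]; group
    · simpa [cch, add_assoc] using e3

theorem fill (h0 : SC Rw) (hst : ∀ a x, st (li a) (st a x) = x) (hR : ∀ r ∈ Rw, ∀ x, run st r x = x)
    {x0 : X} (ls : List (Wd S × Wd S)) (hls : ∀ p ∈ ls, p.2 ∈ Rw)
    {w : Wd S} (hw : FreeGroup.mk w = cprod ls) :
    Fl Rw st x0 w (cch st x0 ls) ∧ run st w x0 = x0 := by
  obtain ⟨w', e1, e2, e3⟩ := fill_aux h0 hst hR (x0 := x0) ls hls [] _ rfl ⟨0, 0, HasD.nil x0⟩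
  have e : FreeGroup.mk w' = FreeGroup.mk w := by
    rw [e1, hw]; show 1 * _ = _; simp
  refine ⟨?_, ?_⟩
  · apply Fl.congr hst e e2
    simpa using e3
  · obtain ⟨t, h1, h2⟩ := FreeGroup.Red.exact.1 e
    rw [Fl.red (x0 := x0) hst h2, ← Fl.red (x0 := x0) hst h1, e2]

theorem cprod_append (l1 l2 : List (Wd S × Wd S)) : cprod (l1 ++ l2) = cprod l1 * cprod l2 := by
  simp [cprod]
theorem cch_append (x0 : X) (l1 l2 : List (Wd S × Wd S)) (f) :
    cch st x0 (l1 ++ l2) f = cch st x0 l1 f + cch st x0 l2 f := by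
  simp [cch]

theorem exists_ls (h0 : SC Rw) {g : FreeGroup S} (hg : g ∈ Subgroup.normalClosure (FreeGroup.mk '' Rw)) :
    ∃ ls : List (Wd S × Wd S), (∀ p ∈ ls, p.2 ∈ Rw) ∧ cprod ls = g := by
  unfold Subgroup.normalClosure at hg
  induction hg using Subgroup.closure_induction with
  | mem x hx =>
    obtain ⟨_, ⟨r, hr, rfl⟩, c, hc⟩ := Group.mem_conjugatesOfSet_iff.1 hx
    obtain ⟨u, hu⟩ := Quot.exists_rep (c : FreeGroup S)
    refine ⟨[(u, r)], by simpa using hr, ?_⟩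
    have hu' : FreeGroup.mk u = (c : FreeGroup S) := hu
    simp only [cprod, List.map_cons, List.map_nil, List.prod_cons, List.prod_nil, mul_one, hu']
    rw [hc.eq]; group
  | one => exact ⟨[], by simp, by simp [cprod]⟩
  | mul x y _ _ h1 h2 =>
    obtain ⟨l1, a1, a2⟩ := h1
    obtain ⟨l2, b1, b2⟩ := h2
    refine ⟨l1 ++ l2, ?_, by rw [cprod_append, a2, b2]⟩
    intro p hp; rcases List.mem_append.1 hp with h | h
    · exact a1 p h
    · exact b1 p h
  | inv x _ h1 =>
    obtain ⟨l1, a1, rfl⟩ := h1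
    refine ⟨(l1.map fun p => (p.1, iw p.2)).reverse, ?_, ?_⟩
    · intro p hp
      simp only [List.mem_reverse, List.mem_map] at hp
      obtain ⟨q, hq, rfl⟩ := hp
      exact h0.inv _ (a1 q hq)
    · unfold cprod
      rw [List.prod_inv_reverse, List.map_reverse, List.map_map, List.map_map]
      congr 2
      apply List.map_congr_left
      intro p hp
      simp [mk_iw, mul_assoc]
      rfl

end

section
variable {S X : Type*}
variable {Rw : Set (Wd S)} {st : S × Bool → X → X}

open Classical in
/-- every face with a deviating companion has six marks -/
theorem face_marks (h : SC Rw) {D : Type*} (φ : Perm D) (rw : D → Wd S) (d : D)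
    (hm : rw d ∈ Rw) (hrw : ∀ i : ℕ, rw ((φ ^ i) d) = (rw d).rotate i)
    (hper : (φ ^ (rw d).length) d = d) (comp : D → Wd S) (mark : D → Prop)
    (hc1 : ∀ i : ℕ, comp ((φ ^ i) d) ∈ Rw) (hc2 : ∀ i : ℕ, comp ((φ ^ i) d) ≠ rw ((φ ^ i) d))
    (hc3 : ∀ i : ℕ, (comp ((φ ^ i) d)).head? = (rw ((φ ^ i) d)).head?)
    (hu : ∀ i : ℕ, ¬ mark ((φ ^ (i + 1)) d) → comp ((φ ^ (i + 1)) d) = (comp ((φ ^ i) d)).rotate 1) :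
    6 ≤ #{i ∈ range (rw d).length | mark ((φ ^ i) d)} := by
  have key : ∀ j : ℕ, 5 ≤ #{i ∈ range (rw d).length | 0 < i ∧ mark ((φ ^ (i + j)) d)} := by
    intro j
    have hl : ((rw d).rotate j).length = (rw d).length := by simp
    have := cover_lin h (h.rot hm j) (fun i => comp ((φ ^ (i + j)) d)) (fun i => mark ((φ ^ (i + j)) d))
      (fun i _ => hc1 _) (fun i _ => by rw [List.rotate_rotate, add_comm j i, ← hrw]; exact hc2 _)
      (fun i hi => by
        rw [hc3, hrw, ← List.head?_rotate hi, List.rotate_rotate, add_comm j i])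
      (fun i _ hmk => by
        have e : i + 1 + j = i + j + 1 := by ring
        simp only [e] at hmk ⊢
        exact hu _ hmk)
    rw [hl] at this
    exact this
  obtain ⟨j, hj⟩ : ∃ j : ℕ, mark ((φ ^ j) d) := by
    have : 0 < #{i ∈ range (rw d).length | 0 < i ∧ mark ((φ ^ (i + 0)) d)} := by have := key 0; omega
    obtain ⟨i, hi⟩ := card_pos.1 this
    exact ⟨i, by simpa using (mem_filter.1 hi).2.2⟩
  have hlen : 0 < (rw d).length := List.length_pos_iff.2 (h.ne _ hm)
  have h6 : 6 ≤ #{i ∈ range (rw d).length | mark ((φ ^ (i + j)) d)} := by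
    have h1 := key j
    have : #{i ∈ range (rw d).length | 0 < i ∧ mark ((φ ^ (i + j)) d)} <
        #{i ∈ range (rw d).length | mark ((φ ^ (i + j)) d)} := by
      apply card_lt_card
      constructor
      · intro i hi
        simp only [mem_filter] at hi ⊢
        exact ⟨hi.1, hi.2.2⟩
      · intro hs
        have := hs (x := 0) (by simp [hlen, hj])
        simp at this
    omega
  have hpd : Function.Periodic (fun i : ℕ => mark ((φ ^ i) d)) (rw d).length := by
    intro i
    simp only [pow_add, Perm.mul_apply, hper]
  have c1 := Nat.filter_Ico_card_eq_of_periodic j (rw d).length (fun i : ℕ => mark ((φ ^ i) d)) hpd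
  have c2 := Nat.filter_Ico_card_eq_of_periodic 0 (rw d).length (fun i : ℕ => mark ((φ ^ i) d)) hpd
  have c3 : #{i ∈ range (rw d).length | mark ((φ ^ (i + j)) d)} =
      #{i ∈ Ico j (j + (rw d).length) | mark ((φ ^ i) d)} := by
    apply card_bij (fun i _ => i + j)
    · intro i hi
      simp only [mem_filter, mem_range, mem_Ico] at hi ⊢
      exact ⟨by omega, hi.2⟩
    · intro a _ b _ hab; omega
    · intro b hb
      simp only [mem_filter, mem_range, mem_Ico] at hb ⊢
      refine ⟨b - j, ⟨by omega, ?_⟩, by omega⟩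
      rw [Nat.sub_add_cancel hb.1.1]; exact hb.2
  rw [c3, c1, ← c2] at h6
  rw [zero_add] at h6; rw [Finset.range_eq_Ico]; exact h6

namespace IsDg
variable {D : Type} [Fintype D]
    {φ α : Perm D} {lab : D → S × Bool} {pos : D → X} {Z N : D → Prop}
    {rw : D → Wd S}
open Classical in
theorem GB (B : IsDg Rw st φ α lab pos Z N rw) {g : ℕ} (H : H1 φ α g) [Nonempty D]
    (mark : D → Prop) (hm : ∀ d, ¬ Z d → 6 ≤ #{i ∈ range (per φ d) | mark ((φ ^ i) d)}) :
    6 * (2 - g : ℚ) ≤ ∑ d, (6 / (per (φ * α) d : ℚ) - 3 +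
      (if Z d then 6 / (per φ d : ℚ) else if mark d then 1 else 0)) := by
  have e := euler φ α B.αα B.αne g H
  have a := avg_sum φ (per φ) (per_pos φ) (per_apply φ) (fun d => if ¬ Z d ∧ mark d then (1 : ℚ) else 0)
  have hpp : ∀ d, (0 : ℚ) < per φ d := fun d => by exact_mod_cast per_pos φ d
  have key : ∀ d, (if Z d then 0 else 6 / (per φ d : ℚ)) ≤
      (1 / (per φ d : ℚ)) * ∑ i ∈ range (per φ d), (fun d => if ¬ Z d ∧ mark d then (1 : ℚ) else 0) ((φ ^ i) d) := by
    intro d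
    have hZ : ∀ i : ℕ, Z ((φ ^ i) d) ↔ Z d := fun i => by
      have := B.Zz d i; rwa [zpow_natCast] at this
    by_cases hd : Z d
    · simp [hd, hZ]
    · simp only [hd, if_false, hZ, not_false_eq_true, true_and]
      rw [sum_ite, sum_const_zero, add_zero, sum_const, nsmul_eq_mul, mul_one]
      have := hm d hd
      have h6 : (6 : ℚ) ≤ (#{i ∈ range (per φ d) | mark ((φ ^ i) d)} : ℚ) := by exact_mod_cast this
      rw [div_eq_mul_one_div, mul_comm]
      exact mul_le_mul_of_nonneg_left h6 (by have := hpp d; positivity)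
  have key2 := sum_le_sum (fun d (_ : d ∈ univ) => key d)
  rw [a] at key2
  have : ∑ d, (6 / (per (φ * α) d : ℚ) - 3 +
      (if Z d then 6 / (per φ d : ℚ) else if mark d then 1 else 0)) =
      6 * ∑ d, (1 / (per (φ * α) d : ℚ) + 1 / (per φ d : ℚ) - 1 / 2) +
      (∑ d, (if ¬ Z d ∧ mark d then (1 : ℚ) else 0) - ∑ d, (if Z d then 0 else 6 / (per φ d : ℚ))) := by
    rw [Finset.mul_sum, ← sum_sub_distrib, ← sum_add_distrib]
    apply sum_congr rfl
    intro d _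
    by_cases hd : Z d <;> by_cases hk : mark d <;> simp [hd, hk] <;> ring
  rw [this]; linarith
end IsDg

open Classical in
/-- flat hexagonal structure -/
structure FS (Rw : Set (Wd S)) {D : Type*} (φ α : Perm D) (lab : D → S × Bool)
    (rw : D → Wd S) (nf : D → Prop) : Prop where
  αα : ∀ d, α (α d) = d
  labα : ∀ d, lab (α d) = li (lab d)
  Rm : ∀ d, rw d ∈ Rw
  Rh : ∀ d, (rw d).head? = some (lab d)
  Rr : ∀ d, rw (φ d) = (rw d).rotate 1
  Rp : ∀ d, (φ ^ (rw d).length) d = d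
  nα : ∀ d, nf (φ (α d)) ↔ nf d
  v2 : ∀ d, ¬ nf d → φ (α (φ (α d))) = d
  v3 : ∀ d, nf d → φ (α (φ (α (φ (α d))))) = d
  six : ∀ d, #{i ∈ range (rw d).length | nf ((φ ^ i) d)} = 6
  ne : ∀ d, rw d ≠ iw (rw (φ (α d)))

theorem iw_rot (r : Wd S) : (iw (r.rotate 1)).rotate 1 = iw r := by
  rcases r with _ | ⟨a, t⟩
  · simp [iw]
  · rw [iw_rot_eq, iw_append]; simp [iw]

theorem iw_head (r : Wd S) (a : S × Bool) (h : r.head? = some a) :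
    (iw (r.rotate 1)).head? = some (li a) := by
  rcases r with _ | ⟨b, t⟩
  · simp at h
  · simp at h; subst h
    rw [iw_rot_eq, iw_append]; simp [iw]

namespace IsDg
variable {D : Type} [Fintype D]
    {φ α : Perm D} {lab : D → S × Bool} {pos : D → X} {Z N : D → Prop}
    {rw : D → Wd S}

theorem flat (h : SC Rw) (B : IsDg Rw st φ α lab pos Z N rw) (H : H1 φ α 2) (hZ : ∀ d, ¬ Z d)
    (hN : ∀ d, ¬ N d) (hr : ∀ d, rw d ≠ iw (rw (φ (α d)))) :
    FS Rw φ α lab rw (fun d => per (φ * α) d = 3) ∧ (∀ d, per (φ * α) d = 2 ∨ per (φ * α) d = 3) ∧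
    ∑ d, (1 / (per (φ * α) d : ℚ) + 1 / (per φ d : ℚ) - 1 / 2) = 0 := by
  classical
  by_cases hD : IsEmpty D
  · refine ⟨by constructor <;> intro d <;> exact hD.elim d, fun d => hD.elim d, by simp⟩
  rw [not_isEmpty_iff] at hD
  have hp1 : ∀ d, per (φ * α) d ≠ 1 := by
    intro d h1
    have := pow_per (φ * α) d
    rw [h1, pow_one, Perm.mul_apply] at this
    have a := B.adj h (hZ (α d)) (hN _)
    rw [this, B.labα, li_li] at a
    exact a rfl
  have hp0 := per_pos (φ * α)
  have hp2 : ∀ d, per (φ * α) d = 2 ↔ φ (α (φ (α d))) = d := by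
    intro d
    have : ((φ * α) ^ 2) d = φ (α (φ (α d))) := by simp [pow_two]
    rw [← this, per_dvd, Nat.dvd_prime Nat.prime_two]
    have := hp1 d
    omega
  have hRp : ∀ d, (φ ^ (rw d).length) d = d := by
    intro d; rw [← B.Rp d (hZ d) (hN d)]; exact pow_per φ d
  obtain ⟨mk, hmk0⟩ : ∃ mk : D → Prop, ∀ d, mk d ↔ per (φ * α) d ≠ 2 := ⟨_, fun _ => Iff.rfl⟩
  have hmk : ∀ d, 6 ≤ #{i ∈ range (per φ d) | mk ((φ ^ i) d)} := by
    intro d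
    rw [B.Rp d (hZ d) (hN d)]
    apply face_marks h φ rw d (B.Rm _ (hZ _) (hN _)) (fun i => B.rwpow (hZ _) (hN _) i) (hRp d)
      (fun x => iw (rw (φ (α x)))) (fun x => mk x)
    · intro i; exact h.inv _ (B.Rm _ (hZ _) (hN _))
    · intro i; exact (hr _).symm
    · intro i
      rw [B.Rr _ (hZ _) (hN _), iw_head _ _ (B.Rh _ (hZ _) (hN _)), B.labα, li_li, B.Rh _ (hZ _) (hN _)]
    · intro i hi
      rw [hmk0, not_not, hp2] at hi
      rw [pow_succ', Perm.mul_apply] at hi ⊢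
      have h1 := φ.injective hi
      have h2 : φ (α (φ ((φ ^ i) d))) = α ((φ ^ i) d) := by rw [← B.αα (φ _), h1]
      rw [h2, B.Rr (α _) (hZ _) (hN _), iw_rot]
  have gb := B.GB H (fun x => mk x) (fun d _ => hmk d)
  simp only [hZ, if_false] at gb
  have pt : ∀ d, 6 / (per (φ * α) d : ℚ) - 3 + (if mk d then 1 else 0) ≤ 0 ∧
      (6 / (per (φ * α) d : ℚ) - 3 + (if mk d then 1 else 0) = 0 → 
        per (φ * α) d = 2 ∨ per (φ * α) d = 3) := by
    intro d
    have h0 := hp0 d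
    have h1 := hp1 d
    by_cases h2 : per (φ * α) d = 2
    · simp [h2, hmk0]; norm_num
    have h3 : (3 : ℚ) ≤ per (φ * α) d := by
      have : 3 ≤ per (φ * α) d := by omega
      exact_mod_cast this
    rw [if_pos ((hmk0 d).2 h2)]
    constructor
    · have : 6 / (per (φ * α) d : ℚ) ≤ 2 := by rw [div_le_iff₀ (by linarith)]; linarith
      linarith
    · intro he
      right
      have : 6 / (per (φ * α) d : ℚ) = 2 := by linarith
      rw [div_eq_iff (by linarith)] at this
      have : (per (φ * α) d : ℚ) = 3 := by linarith
      exact_mod_cast this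
  have hz : ∀ d, 6 / (per (φ * α) d : ℚ) - 3 + (if mk d then 1 else 0) = 0 := by
    have h0 : ∑ d, (6 / (per (φ * α) d : ℚ) - 3 + (if mk d then 1 else 0)) = 0 := by
      apply le_antisymm
      · exact sum_nonpos (fun d _ => (pt d).1)
      · norm_num at gb ⊢; exact gb
    intro d
    exact (sum_eq_zero_iff_of_nonpos (fun d _ => (pt d).1)).1 h0 d (mem_univ _)
  have h23 : ∀ d, per (φ * α) d = 2 ∨ per (φ * α) d = 3 := fun d => (pt d).2 (hz d)
  have eu := euler φ α B.αα B.αne 2 H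
  have a := avg_sum φ (per φ) (per_pos φ) (per_apply φ) (fun d => if mk d then (1 : ℚ) else 0)
  have hpp : ∀ d, (0 : ℚ) < per φ d := fun d => by exact_mod_cast per_pos φ d
  have hcount : ∀ d, ∑ i ∈ range (per φ d), (if mk ((φ ^ i) d) then (1 : ℚ) else 0) =
      #{i ∈ range (per φ d) | mk ((φ ^ i) d)} := by
    intro d; rw [sum_ite, sum_const_zero, add_zero, sum_const, nsmul_eq_mul, mul_one]
  have ge : ∀ d, 0 ≤ (1 / (per φ d : ℚ)) * ∑ i ∈ range (per φ d), (if mk ((φ ^ i) d) then (1 : ℚ) else 0)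
      - 6 * (1 / (per φ d : ℚ)) := by
    intro d
    rw [hcount]
    have h6 : (6 : ℚ) ≤ (#{i ∈ range (per φ d) | mk ((φ ^ i) d)} : ℚ) := by exact_mod_cast hmk d
    have : 0 ≤ (1 / (per φ d : ℚ)) * ((#{i ∈ range (per φ d) | mk ((φ ^ i) d)} : ℚ) - 6) := by
      have := hpp d
      apply mul_nonneg; positivity; linarith
    linarith
  have tot : ∑ d, (1 / (per (φ * α) d : ℚ) + 1 / (per φ d : ℚ) - 1 / 2) =
      - (1/6) * ∑ d, ((1 / (per φ d : ℚ)) * ∑ i ∈ range (per φ d), (if mk ((φ ^ i) d) then (1 : ℚ) else 0)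
      - 6 * (1 / (per φ d : ℚ))) := by
    rw [sum_sub_distrib (f := fun d => (1 / (per φ d : ℚ)) * _), a, ← sum_sub_distrib, Finset.mul_sum]
    apply sum_congr rfl
    intro d _
    have := hz d
    have e : 6 / (per (φ * α) d : ℚ) = 6 * (1 / (per (φ * α) d : ℚ)) := by ring
    rw [e] at this
    linarith
  have sz : ∑ d, ((1 / (per φ d : ℚ)) * ∑ i ∈ range (per φ d), (if mk ((φ ^ i) d) then (1 : ℚ) else 0)
      - 6 * (1 / (per φ d : ℚ))) = 0 := by
    apply le_antisymm _ (sum_nonneg (fun d _ => ge d))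
    rw [tot] at eu
    norm_num at eu ⊢
    linarith
  have s6 : ∀ d, #{i ∈ range (per φ d) | mk ((φ ^ i) d)} = 6 := by
    intro d
    have := (sum_eq_zero_iff_of_nonneg (fun d _ => ge d)).1 sz d (mem_univ _)
    rw [hcount] at this
    have h1 := hpp d
    field_simp at this
    have : (#{i ∈ range (per φ d) | mk ((φ ^ i) d)} : ℚ) = 6 := by linarith
    exact_mod_cast this
  refine ⟨⟨B.αα, B.labα, fun d => B.Rm _ (hZ _) (hN _), fun d => B.Rh _ (hZ _) (hN _),
    fun d => B.Rr _ (hZ _) (hN _), hRp, ?_, ?_, ?_, ?_, hr⟩, h23, by rw [tot, sz]; simp⟩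
  · intro d
    have := per_apply (φ * α) d
    rw [Perm.mul_apply] at this
    rw [this]
  · intro d hd
    exact (hp2 d).1 ((h23 d).resolve_right hd)
  · intro d hd
    have := pow_per (φ * α) d
    rw [hd] at this
    simpa [pow_succ] using this
  · intro d
    rw [← s6 d, B.Rp d (hZ d) (hN d)]
    congr 1
    ext i
    have := h23 ((φ ^ i) d)
    simp only [mem_filter, hmk0]
    constructor
    · rintro ⟨h, h'⟩; exact ⟨h, by omega⟩
    · rintro ⟨h, h'⟩; exact ⟨h, by omega⟩
end IsDg

end

section

section euler
variable {D : Type} [Fintype D]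
theorem two_le (W : Submodule ℚ (D → ℚ)) (h1 : (fun _ => (1 : ℚ)) ∈ W) (u : D → ℚ) (h2 : u ∈ W) (d1 d2 : D)
    (hu : u d1 ≠ u d2) : 2 ≤ finrank ℚ W := by
  have li : LinearIndependent ℚ ![(⟨_, h1⟩ : W), ⟨_, h2⟩] := by
    refine LinearIndependent.pair_iff.2 ?_
    intro s t hst
    have e : ∀ d, s + t * u d = 0 := by
      intro d
      have := congrFun (congrArg Subtype.val hst) d
      simpa using this
    have e1 := e d1
    have e2 := e d2
    have : t * (u d1 - u d2) = 0 := by linarith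
    rcases mul_eq_zero.1 this with h | h
    · subst h; simp at e1; exact ⟨e1, rfl⟩
    · exact absurd (sub_eq_zero.1 h) hu
  have := li.fintype_card_le_finrank
  simpa using this

theorem euler2 (φ α : Perm D) (hα : ∀ d, α (α d) = d) (hα' : ∀ d, α d ≠ d)
    (h : ℕ) (H : H1 φ α h)
    (u : D → ℚ) (huφ : ∀ d, u (φ d) = u d) (huα : ∀ d, u (α d) = u d) (d1 d2 : D) (hu : u d1 ≠ u d2) :
    (4 - h : ℚ) ≤ ∑ d, (1 / (per (φ * α) d : ℚ) + 1 / (per φ d : ℚ) - 1 / 2) := by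
  obtain ⟨L, hL⟩ := H
  have hα1 : ∑ d, 1 / (per α d : ℚ) = Fintype.card D / 2 := by
    have : ∀ d, per α d = 2 := by
      intro d
      have h1 : per α d ∣ 2 := by rw [← per_dvd]; simp [pow_two, hα]
      have h2 : per α d ≠ 1 := by
        intro h; have := pow_per α d; rw [h] at this; exact hα' d (by simpa using this)
      exact (Nat.prime_two.eq_one_or_self_of_dvd _ h1).resolve_left h2
    simp [this]; ring
  have r1 := LinearMap.finrank_range_add_finrank_ker (cob α)
  have r2 := LinearMap.finrank_range_add_finrank_ker (cob φ)
  rw [finrank_fintype_fun_eq_card] at r1 r2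
  -- sum zero hyperplane
  let sm : (D → ℚ) →ₗ[ℚ] ℚ × ℚ := (∑ d, LinearMap.proj d).prod (∑ d, u d • LinearMap.proj d)
  have hsm : ∀ f, sm f = (∑ d, f d, ∑ d, u d * f d) := by intro f; simp [sm]
  have r3 := LinearMap.finrank_range_add_finrank_ker sm
  have hne : d1 ≠ d2 := fun h => hu (by rw [h])
  have hr3 : finrank ℚ (LinearMap.range sm) = 2 := by
    have : LinearMap.range sm = ⊤ := by
      rw [LinearMap.range_eq_top]
      rintro ⟨p, q⟩
      classical
      have hu' : u d1 - u d2 ≠ 0 := sub_ne_zero.2 hu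
      refine ⟨Pi.single d1 ((q - p * u d2) / (u d1 - u d2)) + Pi.single d2 (p - (q - p * u d2) / (u d1 - u d2)), ?_⟩
      rw [hsm]
      simp only [Pi.add_apply, sum_add_distrib, mul_add]
      rw [sum_pi_single', sum_pi_single']
      simp only [Pi.single_apply, mul_ite, mul_zero, sum_ite_eq', mem_univ, if_true]
      ext
      · simp
      · simp only; field_simp; ring
    rw [this]; simp
  rw [finrank_fintype_fun_eq_card, hr3] at r3
  have hσ : ∀ σ : Perm D, (∀ d, u (σ d) = u d) → LinearMap.range (cob σ) ≤ LinearMap.ker sm := by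
    rintro σ hs _ ⟨f, rfl⟩
    rw [LinearMap.mem_ker, hsm]
    simp only [cob_apply, sum_sub_distrib, mul_sub]
    have := Equiv.sum_comp σ (fun d => u d * f d)
    simp only [hs] at this
    rw [Equiv.sum_comp σ f, this]; simp
  have r4 := Submodule.finrank_sup_add_finrank_inf_eq (LinearMap.range (cob α)) (LinearMap.range (cob φ))
  have r5 : finrank ℚ ↥(LinearMap.range (cob α) ⊔ LinearMap.range (cob φ)) ≤
      finrank ℚ (LinearMap.ker sm) :=
    Submodule.finrank_mono (sup_le (hσ α huα) (hσ φ huφ))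
  -- the intersection
  let I := LinearMap.range (cob α) ⊓ LinearMap.range (cob φ)
  have r6 := LinearMap.finrank_range_add_finrank_ker (L.domRestrict I)
  have r7 : finrank ℚ (LinearMap.range (L.domRestrict I)) ≤ h := by
    have := Submodule.finrank_le (LinearMap.range (L.domRestrict I))
    simpa using this
  let K := LinearMap.ker (cob (φ * α))
  have r8 := LinearMap.finrank_range_add_finrank_ker ((cob φ).domRestrict K)
  have r9 : 2 ≤ finrank ℚ (LinearMap.ker ((cob φ).domRestrict K)) := by
    have h1 : (fun _ => (1 : ℚ)) ∈ K := by
      rw [LinearMap.mem_ker]; ext d; simp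
    have h1' : u ∈ K := by
      rw [LinearMap.mem_ker]; ext d; simp [huφ, huα]
    have h2 : (⟨_, h1⟩ : K) ∈ LinearMap.ker ((cob φ).domRestrict K) := by
      rw [LinearMap.mem_ker]; ext d; simp [LinearMap.domRestrict_apply]
    have h2' : (⟨_, h1'⟩ : K) ∈ LinearMap.ker ((cob φ).domRestrict K) := by
      rw [LinearMap.mem_ker]; ext d; simp [LinearMap.domRestrict_apply, huφ]
    rw [← Submodule.finrank_map_subtype_eq K (LinearMap.ker ((cob φ).domRestrict K))]
    exact two_le _ ⟨_, h2, rfl⟩ u ⟨_, h2', rfl⟩ d1 d2 hu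
  have r10 : finrank ℚ (LinearMap.ker (L.domRestrict I)) ≤
      finrank ℚ (LinearMap.range ((cob φ).domRestrict K)) := by
    rw [← Submodule.finrank_map_subtype_eq I (LinearMap.ker (L.domRestrict I))]
    apply Submodule.finrank_mono
    rintro c ⟨⟨c', hc'⟩, hcL, rfl⟩
    obtain ⟨⟨f, rfl⟩, ⟨p, hp⟩⟩ := hc'
    have := hL (cob α f) (by intro d; simp [hα]) ⟨p, fun d => by rw [← hp]; simp⟩ (by simpa using hcL)
    obtain ⟨q, hq1, hq2⟩ := this
    have hqK : q ∈ K := by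
      rw [LinearMap.mem_ker]
      ext d
      simp only [cob_apply, Perm.mul_apply, Pi.zero_apply]
      rw [hq1, hq2 d]; simp [hα]; ring
    refine ⟨⟨q, hqK⟩, ?_⟩
    ext d
    simp [LinearMap.domRestrict_apply, hq1]
  have o1 := orb_count α
  have o2 := orb_count φ
  have o3 := orb_count (φ * α)
  rw [hα1] at o1
  rw [sum_sub_distrib, sum_add_distrib, ← o2, ← o3]
  simp only [sum_const, card_univ, nsmul_eq_mul]
  have q1 : ((finrank ℚ (LinearMap.range (cob α)) + finrank ℚ (LinearMap.ker (cob α)) : ℕ) : ℚ) = Fintype.card D := by rw [r1]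
  push_cast at q1
  rw [o1] at q1
  have z : (2 : ℚ) * finrank ℚ (LinearMap.range (cob α)) = Fintype.card D := by linarith
  have hI : finrank ℚ I ≤ h + finrank ℚ (LinearMap.range ((cob φ).domRestrict K)) := by
    omega
  have zz : finrank ℚ (LinearMap.range (cob α)) + finrank ℚ (LinearMap.range (cob φ)) + 4 ≤
    Fintype.card D + h + finrank ℚ K := by
    have : finrank ℚ I = finrank ℚ ↥(LinearMap.range (cob α) ⊓ LinearMap.range (cob φ)) := rfl
    omega
  have zq : (finrank ℚ (LinearMap.range (cob α)) : ℚ) + finrank ℚ (LinearMap.range (cob φ)) + 4 ≤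
    Fintype.card D + h + finrank ℚ K := by exact_mod_cast zz
  have r2q : (finrank ℚ (LinearMap.range (cob φ)) : ℚ) + finrank ℚ (LinearMap.ker (cob φ)) = Fintype.card D := by
    exact_mod_cast r2
  have : (finrank ℚ K : ℚ) = finrank ℚ (LinearMap.ker (cob (φ * α))) := rfl
  linarith
end euler

end

section
variable {S X : Type*}
variable {Rw : Set (Wd S)} {st : S × Bool → X → X}

/-- matching of positions of the commutator word -/
def tsig (p q k : ℕ) : ℕ := if k < p ∨ (p + q ≤ k ∧ k < 2 * p + q) then 2 * p + q - 1 - k else 3 * p + 2 * q - 1 - k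

theorem tsig_lt {p q k : ℕ} (h : k < 2 * p + 2 * q) : tsig p q k < 2 * p + 2 * q := by
  unfold tsig; split_ifs <;> omega
theorem tsig_tsig {p q k : ℕ} (h : k < 2 * p + 2 * q) : tsig p q (tsig p q k) = k := by
  unfold tsig; split_ifs <;> omega

theorem glue_seq {Y : Type*} (s : ℕ → Y) (f : ℕ → Y → Y) (p q : ℕ)
    (hs : ∀ k < 2 * p + 2 * q, s (k + 1) = f k (s k))
    (hinv : ∀ k < 2 * p + 2 * q, ∀ y, f (tsig p q k) (f k y) = y)
    (b1 : s p = s (p + q)) (b2 : s (p + q) = s (2 * p + q)) :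
    ∀ k < 2 * p + 2 * q, s (tsig p q k) = s (k + 1) := by
  have A : ∀ j ≤ p, s (p + q + j) = s (p - j) := by
    intro j
    induction j with
    | zero => intro _; simpa using b1.symm
    | succ j ih =>
      intro hj
      rw [← add_assoc, hs _ (by omega), ih (by omega)]
      have e1 : p - j = (p - (j + 1)) + 1 := by omega
      have e2 : tsig p q (p - (j + 1)) = p + q + j := by unfold tsig; rw [if_pos (by omega)]; omega
      rw [e1, hs _ (by omega), ← e2, hinv _ (by omega)]
  have B : ∀ j ≤ q, s (2 * p + q + j) = s (p + q - j) := by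
    intro j
    induction j with
    | zero => intro _; simpa using b2.symm
    | succ j ih =>
      intro hj
      rw [← add_assoc, hs _ (by omega), ih (by omega)]
      have e1 : p + q - j = (p + q - (j + 1)) + 1 := by omega
      have e2 : tsig p q (p + q - (j + 1)) = 2 * p + q + j := by unfold tsig; rw [if_neg (by omega)]; omega
      rw [e1, hs _ (by omega), ← e2, hinv _ (by omega)]
  intro k hk
  by_cases h1 : k < p
  · have := A (p - 1 - k) (by omega)
    have e1 : tsig p q k = p + q + (p - 1 - k) := by unfold tsig; rw [if_pos (by omega)]; omega
    rw [e1, this]; congr 1; omega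
  by_cases h2 : k < p + q
  · have := B (p + q - 1 - k) (by omega)
    have e1 : tsig p q k = 2 * p + q + (p + q - 1 - k) := by unfold tsig; rw [if_neg (by omega)]; omega
    rw [e1, this]; congr 1; omega
  by_cases h3 : k < 2 * p + q
  · have := A (k + 1 - (p + q)) (by omega)
    have e1 : tsig p q k = p - (k + 1 - (p + q)) := by unfold tsig; rw [if_pos (by omega)]; omega
    rw [e1, ← this]; congr 1; omega
  · have := B (k + 1 - (2 * p + q)) (by omega)
    have e1 : tsig p q k = p + q - (k + 1 - (2 * p + q)) := by unfold tsig; rw [if_neg (by omega)]; omega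
    rw [e1, ← this]; congr 1; omega

theorem iw_get (u : Wd S) (j : ℕ) (hj : j < u.length) : (iw u)[j]? = (u[u.length - 1 - j]?).map li := by
  unfold iw
  rw [List.getElem?_reverse (by simpa), List.length_map, List.getElem?_map]

theorem comm_lab (u v : Wd S) (k : ℕ) (hk : k < 2 * u.length + 2 * v.length) :
    (u ++ v ++ iw u ++ iw v)[tsig u.length v.length k]? = ((u ++ v ++ iw u ++ iw v)[k]?).map li := by
  obtain ⟨p, hp⟩ : ∃ p, p = u.length := ⟨_, rfl⟩
  obtain ⟨q, hq⟩ : ∃ q, q = v.length := ⟨_, rfl⟩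
  have g1 : ∀ j, j < p → (u ++ v ++ iw u ++ iw v)[j]? = u[j]? := by
    intro j hj
    rw [List.getElem?_append_left (by simp; omega), List.getElem?_append_left (by simp; omega),
      List.getElem?_append_left (by omega)]
  have g2 : ∀ j, p ≤ j → j < p + q → (u ++ v ++ iw u ++ iw v)[j]? = v[j - p]? := by
    intro j hj hj'
    rw [List.getElem?_append_left (by simp; omega), List.getElem?_append_left (by simp; omega),
      List.getElem?_append_right (by omega), hp]
  have g3 : ∀ j, p + q ≤ j → j < 2 * p + q → (u ++ v ++ iw u ++ iw v)[j]? = (u[2 * p + q - 1 - j]?).map li := by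
    intro j hj hj'
    rw [List.getElem?_append_left (by simp; omega), List.getElem?_append_right (by simp; omega), iw_get _ _ (by simp; omega)]
    congr 2; simp; omega
  have g4 : ∀ j, 2 * p + q ≤ j → j < 2 * p + 2 * q → (u ++ v ++ iw u ++ iw v)[j]? = (v[2 * p + 2 * q - 1 - j]?).map li := by
    intro j hj hj'
    rw [List.getElem?_append_right (by simp; omega), iw_get _ _ (by simp; omega)]
    congr 2; simp; omega
  have lili : ∀ o : Option (S × Bool), (o.map li).map li = o := by
    intro o; cases o <;> simp
  rw [← hp, ← hq] at hk ⊢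
  unfold tsig
  by_cases h1 : k < p
  · rw [if_pos (by omega), g3 _ (by omega) (by omega), g1 _ h1]
    congr 2; omega
  by_cases h2 : k < p + q
  · rw [if_neg (by omega), g4 _ (by omega) (by omega), g2 _ (by omega) h2]
    congr 2; omega
  by_cases h3 : k < 2 * p + q
  · rw [if_pos (by omega), g1 _ (by omega), g3 _ (by omega) h3, lili]
  · rw [if_neg (by omega), g2 _ (by omega) (by omega), g4 _ (by omega) (by omega), lili]
    congr 1; omega

theorem HasD.torus (hst : ∀ a x, st (li a) (st a x) = x) {x0 : X} {u v : Wd S}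
    (hu : run st u x0 = x0) (hv : run st v x0 = x0) {C n m}
    (h : HasD Rw st 0 x0 (u ++ v ++ iw u ++ iw v) C n m) : HasD Rw st 2 x0 [] C n m := by
  classical
  obtain ⟨D, _, φ, α, lab, pos, Z, N, rw, sp, B, ⟨L, hL⟩, h1, h2, h3, h4, h5, h6, h7, h8⟩ := h
  obtain ⟨p, hp⟩ : ∃ p, p = u.length := ⟨_, rfl⟩
  obtain ⟨q, hq⟩ : ∃ q, q = v.length := ⟨_, rfl⟩
  have hlen : sp.length = 2 * p + 2 * q := by
    have := congrArg List.length h4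
    simp at this; omega
  have hw := comm_lab u v
  rw [← hp, ← hq, ← h4] at hw
  rcases hsp : sp with _ | ⟨z0, t⟩
  · refine ⟨D, _, φ, α, lab, pos, Z, N, rw, [], B, ⟨0, fun c c1 c2 _ => hL c c1 c2 (Subsingleton.elim _ _)⟩,
      List.nodup_nil, by rw [← hsp]; exact h2, rfl, rfl, by simp, h6, h7, h8⟩
  have hpos0 : 0 < sp.length := by rw [hsp]; simp
  have hz0 : sp[0] = z0 := by simp [hsp]
  have hget : ∀ k (hk : k < sp.length), (φ ^ k) z0 = sp[k] := by
    intro k hk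
    rw [← hz0, cyc_get_pow h3 0 hpos0]
    congr 1; rw [zero_add, Nat.mod_eq_of_lt hk]
  have hz0m : z0 ∈ sp := by simp [hsp]
  have hper : per φ z0 = 2 * p + 2 * q := by rw [cyc_per h1 h3 hz0m, hlen]
  have hcl : (φ ^ (2 * p + 2 * q)) z0 = z0 := by rw [← hper, pow_per]
  have hlab : ∀ k < 2 * p + 2 * q, lab ((φ ^ (tsig p q k)) z0) = li (lab ((φ ^ k) z0)) := by
    intro k hk
    have := hw k hk
    rw [List.getElem?_map, List.getElem?_map, List.getElem?_eq_getElem (by have := tsig_lt hk; omega),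
      List.getElem?_eq_getElem (by omega)] at this
    simp only [Option.map_some, Option.some.injEq] at this
    rw [hget _ (by have := tsig_lt hk; omega), hget _ (by omega), this]
  have hp1 : pos z0 = x0 := h5 z0 (by simp [hsp])
  -- positions
  have hposr : ∀ k ≤ 2 * p + 2 * q, pos ((φ ^ k) z0) = run st ((u ++ v ++ iw u ++ iw v).take k) x0 := by
    intro k
    induction k with
    | zero => intro _; simpa [run] using hp1
    | succ k ih =>
      intro hk
      have hk' : k < sp.length := by omega
      have hk2 : k < (u ++ v ++ iw u ++ iw v).length := by rw [← h4]; simpa using hk'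
      rw [pow_succ', Perm.mul_apply, B.posφ, ih (by omega), List.take_succ_eq_append_getElem hk2, run_append]
      have : lab ((φ ^ k) z0) = (u ++ v ++ iw u ++ iw v)[k] := by
        rw [hget k hk', List.getElem_of_eq h4.symm hk2, List.getElem_map]
      rw [this]; rfl
  have t1 : (u ++ v ++ iw u ++ iw v).take p = u := by
    rw [List.append_assoc, List.append_assoc, List.take_append_of_le_length (by omega), hp, List.take_length]
  have t2 : (u ++ v ++ iw u ++ iw v).take (p + q) = u ++ v := by
    rw [List.append_assoc, List.take_append_of_le_length (by simp; omega), List.take_of_length_le (by simp; omega)]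
  have t3 : (u ++ v ++ iw u ++ iw v).take (2 * p + q) = u ++ v ++ iw u := by
    rw [List.take_append_of_le_length (by simp; omega), List.take_of_length_le (by simp; omega)]
  have hiu : run st (iw u) x0 = x0 := by
    have := run_iw hst u x0; rwa [hu] at this
  have gpos : ∀ k < 2 * p + 2 * q, pos ((φ ^ (tsig p q k)) z0) = pos ((φ ^ (k + 1)) z0) := by
    apply glue_seq (fun k => pos ((φ ^ k) z0)) (fun k => st (lab ((φ ^ k) z0))) p q
    · intro k _; simp only [pow_succ', Perm.mul_apply, B.posφ]
    · intro k hk y; simp only [hlab k hk, hst]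
    · rw [hposr _ (by omega), hposr _ (by omega), t1, t2, run_append, hu, hv]
    · rw [hposr _ (by omega), hposr _ (by omega), t2, t3]; simp only [run_append, hu, hv, hiu]
  -- the new permutation
  have hidx : ∀ x, ∃ k, Z x → k < 2 * p + 2 * q ∧ x = (φ ^ k) z0 := by
    intro x
    by_cases hx : Z x
    · obtain ⟨k, hk, rfl⟩ := List.getElem_of_mem ((h2 x).1 hx)
      exact ⟨k, fun _ => ⟨by omega, (hget k hk).symm⟩⟩
    · exact ⟨0, fun h => absurd h hx⟩
  choose idx hidx using hidx
  have hinj : ∀ k < 2 * p + 2 * q, ∀ l < 2 * p + 2 * q, (φ ^ k) z0 = (φ ^ l) z0 → k = l := by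
    intro k hk l hl e
    rw [hget k (by omega), hget l (by omega)] at e
    exact (h1.getElem_inj_iff).1 e
  have hZk : ∀ k < 2 * p + 2 * q, Z ((φ ^ k) z0) := by
    intro k hk; rw [hget k (by omega), h2]; exact List.getElem_mem _
  have hidx2 : ∀ k < 2 * p + 2 * q, idx ((φ ^ k) z0) = k := by
    intro k hk
    obtain ⟨a, b⟩ := hidx _ (hZk k hk)
    exact (hinj _ hk _ a b).symm
  let F : D → D := fun x => if Z x then (φ ^ (tsig p q (idx x))) z0 else φ x
  have F1 : ∀ k < 2 * p + 2 * q, F ((φ ^ k) z0) = (φ ^ (tsig p q k)) z0 := by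
    intro k hk; simp only [F, if_pos (hZk k hk), hidx2 k hk]
  have F2 : ∀ x, ¬ Z x → F x = φ x := fun x hx => by simp only [F, if_neg hx]
  have FZ : ∀ x, Z (F x) ↔ Z x := by
    intro x
    by_cases hx : Z x
    · obtain ⟨a, b⟩ := hidx x hx
      rw [b, F1 _ a]
      exact ⟨fun _ => hZk _ a, fun _ => hZk _ (tsig_lt a)⟩
    · rw [F2 x hx, B.Zφ]
  have FF : ∀ x, Z x → F (F x) = x := by
    intro x hx
    obtain ⟨a, b⟩ := hidx x hx
    conv_lhs => rw [b]
    rw [F1 _ a, F1 _ (tsig_lt a), tsig_tsig a, ← b]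
  have Finj : Function.Injective F := by
    intro x y hxy
    by_cases hx : Z x
    · have hy : Z y := by rw [← FZ, ← hxy, FZ]; exact hx
      rw [← FF x hx, hxy, FF y hy]
    · have hy : ¬ Z y := by rw [← FZ, ← hxy, FZ]; exact hx
      rw [F2 x hx, F2 y hy] at hxy
      exact φ.injective hxy
  let φ' : Perm D := Equiv.ofBijective F (Finite.injective_iff_bijective.1 Finj)
  have P1 : ∀ x, φ' x = F x := fun x => rfl
  have hper' : ∀ x, ¬ Z x → per φ' x = per φ x := by
    intro x hx
    apply per_agree
    intro k
    have := B.Zz x k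
    rw [zpow_natCast] at this
    rw [P1, F2 _ (by rwa [this])]
  refine ⟨D, _, φ', α, lab, pos, fun _ => False, fun x => N x ∨ Z x, rw, [], ?_, ?_, List.nodup_nil, by simp, rfl, rfl, by simp, ?_, ?_, h8⟩
  · refine ⟨B.αα, B.labα, B.posα, ?_, fun _ => Iff.rfl, ?_, fun _ h => h.elim, ?_, ?_, ?_, ?_, ?_⟩
    · intro x
      by_cases hx : Z x
      · obtain ⟨a, b⟩ := hidx x hx
        rw [P1, b, F1 _ a, gpos _ a, pow_succ', Perm.mul_apply, B.posφ]
      · rw [P1, F2 x hx, B.posφ]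
    · intro x
      rw [P1, FZ]
      by_cases hx : Z x
      · simp [hx]
      · rw [F2 x hx, B.Nφ]
    · intro x hx
      by_cases hz : Z x
      · refine ⟨FF x hz, ?_⟩
        obtain ⟨a, b⟩ := hidx x hz
        rw [P1, b, F1 _ a, hlab _ a]
      · have hn := hx.resolve_right hz
        rw [P1, P1, F2 x hz, F2 _ (by rwa [B.Zφ])]
        exact B.Nb x hn
    · intro x _ hx; exact B.Rm x (fun h => hx (Or.inr h)) (fun h => hx (Or.inl h))
    · intro x _ hx; exact B.Rh x (fun h => hx (Or.inr h)) (fun h => hx (Or.inl h))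
    · intro x _ hx
      rw [P1, F2 x (fun h => hx (Or.inr h))]
      exact B.Rr x (fun h => hx (Or.inr h)) (fun h => hx (Or.inl h))
    · intro x _ hx
      rw [hper' x (fun h => hx (Or.inr h))]
      exact B.Rp x (fun h => hx (Or.inr h)) (fun h => hx (Or.inl h))
  · let L' : (D → ℚ) →ₗ[ℚ] (Fin 2 → ℚ) := LinearMap.pi ![∑ k ∈ Ico p (p + q), LinearMap.proj ((φ ^ k) z0),
      ∑ k ∈ Ico (p + q) (2 * p + q), LinearMap.proj ((φ ^ k) z0)]
    refine ⟨L', ?_⟩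
    rintro c cα ⟨p', hp'⟩ hc
    have l0 : ∑ k ∈ Ico p (p + q), c ((φ ^ k) z0) = 0 := by
      have := congrFun hc 0; simpa [L'] using this
    have l1 : ∑ k ∈ Ico (p + q) (2 * p + q), c ((φ ^ k) z0) = 0 := by
      have := congrFun hc 1; simpa [L'] using this
    have cs : ∀ k < 2 * p + 2 * q, c ((φ ^ (tsig p q k)) z0) = - c ((φ ^ k) z0) := by
      intro k hk
      have a1 := hp' ((φ ^ k) z0)
      have a2 := hp' (φ' ((φ ^ k) z0))
      rw [P1, P1, FF _ (hZk k hk), F1 _ hk] at a2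
      rw [P1, F1 _ hk] at a1
      linarith
    have c0 : csum φ c z0 = 0 := by
      unfold csum
      rw [hper]
      have : ∑ i ∈ range (2 * p + 2 * q), c ((φ ^ i) z0) = ∑ i ∈ range (2 * p + 2 * q), - c ((φ ^ i) z0) := by
        apply sum_bij' (fun i _ => tsig p q i) (fun i _ => tsig p q i)
        · intro i hi; exact mem_range.2 (tsig_lt (mem_range.1 hi))
        · intro i hi; exact mem_range.2 (tsig_lt (mem_range.1 hi))
        · intro i hi; exact tsig_tsig (mem_range.1 hi)
        · intro i hi; exact tsig_tsig (mem_range.1 hi)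
        · intro i hi; rw [cs _ (mem_range.1 hi), neg_neg]
      rw [sum_neg_distrib] at this
      linarith
    have hpt : ∃ r : D → ℚ, ∀ d, r (φ d) = r d + c d := by
      rw [pot_iff]
      intro x
      by_cases hx : Z x
      · obtain ⟨a, b⟩ := hidx x hx
        have := csum_zpow φ c z0 (idx x)
        rw [zpow_natCast, ← b] at this
        rw [this, c0]
      · apply csum_eq_zero_of_pot φ c x p'
        rintro y ⟨j, rfl⟩
        have := hp' ((φ ^ j) x)
        rwa [P1, F2 _ (by rwa [B.Zz])] at this
    obtain ⟨r, hr1, hr2⟩ := hL c cα hpt (Subsingleton.elim _ _)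
    refine ⟨r, ?_, hr2⟩
    have rs : ∀ a b, a ≤ b → r ((φ ^ b) z0) = r ((φ ^ a) z0) + ∑ k ∈ Ico a b, c ((φ ^ k) z0) := by
      intro a b hab
      induction b, hab using Nat.le_induction with
      | base => simp
      | succ b hb ih => rw [sum_Ico_succ_top hb, pow_succ', Perm.mul_apply, hr1, ih]; ring
    have gr : ∀ k < 2 * p + 2 * q, r ((φ ^ (tsig p q k)) z0) = r ((φ ^ (k + 1)) z0) := by
      apply glue_seq (fun k => r ((φ ^ k) z0)) (fun k y => y + c ((φ ^ k) z0)) p q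
      · intro k _; simp only [pow_succ', Perm.mul_apply, hr1]
      · intro k hk y; simp only [cs k hk]; ring
      · rw [rs p (p + q) (by omega), l0]; ring
      · rw [rs (p + q) (2 * p + q) (by omega), l1]; ring
    intro x
    by_cases hx : Z x
    · obtain ⟨a, b⟩ := hidx x hx
      rw [P1]
      conv_lhs => rw [b]
      rw [F1 _ a, gr _ a, pow_succ', Perm.mul_apply, hr1, ← b]
    · rw [P1, F2 x hx, hr1]
  · intro f hf
    rw [← h6 f hf]
    unfold IsDg.Ch
    apply sum_congr rfl
    intro x _
    congr 1
    simp [or_comm]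
  · rw [← h7]; unfold nrel
    congr 1; ext x; simp; tauto

theorem merge [Subsingleton X] (h : SC Rw) {D : Type} [Fintype D]
    {φ α : Perm D} {lab : D → S × Bool} {pos : D → X} {Z N : D → Prop}
    {rw : D → Wd S} (B : IsDg Rw st φ α lab pos Z N rw) (H : H1 φ α 0) (z : D) (s2 : List D)
    (hn : (z :: s2).Nodup) (hZ : ∀ d, Z d ↔ d ∈ z :: s2) (hs : (z :: s2).map φ = (z :: s2).rotate 1)
    (hz : ¬ Z (α z)) (hN : ¬ N (α z)) (x0 : X) :
    ∃ C n m, n < nrel Z N ∧ HasD Rw st 0 x0 (s2.map lab ++ (rw (α z)).tail) C n m := by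
  classical
  obtain ⟨e, he⟩ : ∃ e, e = α z := ⟨_, rfl⟩
  rw [← he] at hz hN ⊢
  have hze : α e = z := by rw [he, B.αα]
  have hZz : Z z := (hZ z).2 (by simp)
  have nze : z ≠ e := fun h => hz (h ▸ hZz)
  have hφe : ¬ Z (φ e) := by rwa [B.Zφ]
  have nzφ : φ e ≠ z := fun h => hφe (h ▸ hZz)
  have hlz : lab e = li (lab z) := by rw [he, B.labα]
  obtain ⟨φ', hφ'⟩ : ∃ φ' : Perm D, φ' = swap z (φ e) * φ := ⟨_, rfl⟩
  have f1 : ∀ d, φ d = z → φ' d = φ e := by intro d hd; rw [hφ', Perm.mul_apply, hd, swap_apply_left]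
  have f2 : φ' e = z := by rw [hφ', Perm.mul_apply, swap_apply_right]
  have f3 : ∀ d, φ d ≠ z → d ≠ e → φ' d = φ d := by
    intro d h1 h2; rw [hφ', Perm.mul_apply, swap_apply_of_ne_of_ne h1]; simpa using h2
  have hL : per φ e = (rw e).length := B.Rp e hz hN
  have hL0 := per_pos φ e
  obtain ⟨k, hk⟩ : ∃ k, per φ e = k + 1 := ⟨per φ e - 1, by omega⟩
  obtain ⟨O, hO⟩ : ∃ O, O = (List.range k).map (fun i => (φ ^ (i+1)) e) := ⟨_, rfl⟩
  have hOZ : ∀ d ∈ O, ¬ Z d := by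
    intro d hd; rw [hO] at hd; simp only [List.mem_map] at hd
    obtain ⟨i, _, rfl⟩ := hd
    have := B.Zz e ((i+1 : ℕ) : ℤ); rw [zpow_natCast] at this; rwa [this]
  have hpw : ∀ i, (φ ^ i) e = e ↔ (k+1) ∣ i := by intro i; rw [per_dvd, hk]
  have hOe : ∀ d ∈ O, d ≠ e := by
    intro d hd hde; rw [hO] at hd; simp only [List.mem_map, List.mem_range] at hd
    obtain ⟨i, hi, h1⟩ := hd
    rw [hde, hpw] at h1
    have := Nat.le_of_dvd (by omega) h1
    omega
  have hOn : O.Nodup := by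
    rw [hO, List.nodup_map_iff_inj_on List.nodup_range]
    intro i hi j hj hij
    simp at hi hj
    have : ∀ i j, i ≤ j → j < k → (φ ^ (i+1)) e = (φ ^ (j+1)) e → i = j := by
      intro i j hij hj h1
      obtain ⟨t, rfl⟩ := Nat.exists_eq_add_of_le hij
      have h2 : (φ ^ (i+1)) ((φ ^ t) e) = (φ ^ (i+1)) e := by
        rw [h1, ← Perm.mul_apply, ← pow_add]; congr 2; ring
      have h3 := (φ ^ (i+1)).injective h2
      rw [hpw] at h3
      rcases Nat.eq_zero_or_pos t with h0 | h0
      · omega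
      · have := Nat.le_of_dvd h0 h3; omega
    rcases le_total i j with h1 | h1
    · exact this i j h1 hj hij
    · exact (this j i h1 hi hij.symm).symm
  have hlabO : O.map lab = (rw e).tail := by
    apply List.ext_getElem
    · simp [hO]; omega
    · intro i h1 h2
      simp [hO] at h1 ⊢
      have := B.labs hz hN (i+1) (by omega)
      rw [List.getElem?_eq_getElem (by omega)] at this
      simpa using this.symm
  -- cyc of O ++ [e]
  have hOc : φ e :: O.map φ = O ++ [e] := by
    apply List.ext_getElem
    · simp
    · intro i h1 h2
      have key : ∀ i (hi : i < k + 1), (O ++ [e])[i]'(by simp [hO]; omega) = (φ ^ (i+1)) e := by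
        intro i hi
        by_cases hik : i < k
        · rw [List.getElem_append_left (by simpa [hO] using hik)]; simp [hO]
        · have : i = k := by omega
          subst this
          rw [List.getElem_append_right (by simp [hO])]
          simp; exact ((hpw _).2 dvd_rfl).symm
      simp [hO] at h1
      rw [key i (by omega)]
      rcases i with _ | i
      · simp
      · simp [hO]; rw [← Perm.mul_apply, ← pow_succ']
  obtain ⟨Z', hZ'⟩ : ∃ Z' : D → Prop, Z' = fun d => Z d ∨ d ∈ O ++ [e] := ⟨_, rfl⟩
  have hOeZ : ∀ d ∈ O ++ [e], ¬ Z d ∧ ¬ N d := by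
    intro d hd
    refine ⟨?_, ?_⟩
    · simp at hd
      rcases hd with hd | rfl
      · exact hOZ d hd
      · exact hz
    · simp [hO] at hd
      rcases hd with ⟨i, _, rfl⟩ | rfl
      · have := B.Nz e ((i+1 : ℕ) : ℤ); rw [zpow_natCast] at this; rwa [this]
      · exact hN
  have hmemφ : ∀ d, φ d ∈ O ++ [e] ↔ d ∈ O ++ [e] := by
    intro d
    conv_lhs => rw [← hOc]
    rw [List.mem_cons, List.mem_append, List.mem_singleton, List.mem_map, or_comm]
    apply or_congr
    · constructor
      · rintro ⟨a, ha, h⟩; rwa [← φ.injective h]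
      · intro h; exact ⟨d, h, rfl⟩
    · exact φ.injective.eq_iff
  have hlist : (s2 ++ O ++ [e] ++ [z]).map φ' = (s2 ++ O ++ [e] ++ [z]).rotate 1 := by
    have hs' : φ z :: s2.map φ = s2 ++ [z] := by simpa using hs
    have hsw : ∀ t : List D, (∀ d ∈ t, d ≠ z ∧ d ≠ φ e) → t.map (swap z (φ e)) = t := by
      intro t ht
      conv_rhs => rw [← List.map_id t]
      apply List.map_congr_left
      intro d hd; exact swap_apply_of_ne_of_ne (ht d hd).1 (ht d hd).2
    have hmm : ∀ t : List D, t.map φ' = (t.map φ).map (swap z (φ e)) := by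
      intro t; rw [hφ', List.map_map]; rfl
    obtain ⟨O2, hO2⟩ : ∃ O2, O ++ [e] = φ e :: O2 := ⟨_, hOc.symm⟩
    have hO2' : O.map φ = O2 := by have := hOc; rw [hO2] at this; simpa using this
    have hOen : (O ++ [e]).Nodup := by
      rw [List.nodup_append]
      refine ⟨hOn, by simp, ?_⟩
      intro a ha b hb; simp at hb; subst hb; exact hOe a ha
    have hO2s : O2.map (swap z (φ e)) = O2 := by
      apply hsw
      intro d hd
      have hm : d ∈ O ++ [e] := by rw [hO2]; simp [hd]
      refine ⟨fun h => (hOeZ d hm).1 (h ▸ hZz), ?_⟩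
      rintro rfl
      rw [hO2] at hOen; simp at hOen; exact hOen.1 hd
    rcases s2 with _ | ⟨c, s2⟩
    · simp at hs'
      rw [List.nil_append, List.map_append, List.map_append, hmm O, hO2', hO2s, hO2]
      simp [f1 z hs', f2]
    · simp only [List.map_cons, List.cons_append, List.cons.injEq] at hs'
      obtain ⟨h1, h2⟩ := hs'
      have hc : φ z ≠ z := by rw [h1]; rintro rfl; simp at hn
      have e1 : (c :: s2).map φ' = s2 ++ [φ e] := by
        rw [hmm, List.map_cons, h2, List.map_append, hsw]
        · simp
        · intro d hd
          refine ⟨?_, ?_⟩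
          · rintro rfl; simp at hn; exact hn.1.2 hd
          · rintro rfl; exact hφe ((hZ _).2 (by simp [hd]))
      have e2 : [z].map φ' = [c] := by simp [f3 z hc nze, h1]
      have e3 : (O ++ [e]).map φ' = O2 ++ [z] := by
        rw [List.map_append, hmm O, hO2', hO2s]; simp [f2]
      rw [List.append_assoc (c :: s2) O, List.map_append, List.map_append, e1, e2, e3, hO2]
      simp
  have hφZ : ∀ d, ¬ Z' d → φ' d = φ d := by
    intro d hd
    rw [hZ'] at hd; simp only [not_or] at hd
    apply f3
    · intro h; apply hd.1; rw [← B.Zφ, h]; exact hZz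
    · rintro rfl; exact hd.2 (by simp)
  have hZ'φ : ∀ d, Z' (φ d) ↔ Z' d := by
    intro d; rw [hZ']; simp only [hmemφ, B.Zφ]
  have hZφ2 : ∀ d, Z' (φ' d) ↔ Z' d := by
    intro d
    by_cases h1 : φ d = z
    · rw [f1 d h1, hZ'φ, ← hZ'φ d, h1]
      refine iff_of_true ?_ ?_ <;> simp [hZ', hZz]
    · by_cases h2 : d = e
      · subst h2; rw [f2]
        refine iff_of_true ?_ ?_ <;> simp [hZ', hZz]
      · rw [f3 d h1 h2, hZ'φ]
  have hZN : ∀ d, Z' d → ¬ N d := by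
    intro d hd; rw [hZ'] at hd
    rcases hd with hd | hd
    · exact B.ZN d hd
    · exact (hOeZ d hd).2
  have hnz : ∀ d, ¬ Z' d → ¬ Z d := by intro d hd h; apply hd; rw [hZ']; exact Or.inl h
  have hB : IsDg Rw st φ' α lab pos Z' N rw := by
    refine ⟨B.αα, B.labα, B.posα, fun d => Subsingleton.elim _ _, hZφ2, ?_, hZN, ?_, fun d hd => B.Rm d (hnz d hd),
      fun d hd => B.Rh d (hnz d hd), ?_, ?_⟩
    · intro d
      by_cases hd : Z' d
      · exact iff_of_false (hZN _ ((hZφ2 d).2 hd)) (hZN _ hd)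
      · rw [hφZ d hd, B.Nφ]
    · intro d hd
      have h1 : ¬ Z' d := fun h => hZN d h hd
      rw [hφZ d h1, hφZ _ (by rwa [hZ'φ])]
      exact B.Nb d hd
    · intro d hd hd'; rw [hφZ d hd]; exact B.Rr d (hnz d hd) hd'
    · intro d hd hd'
      rw [← B.Rp d (hnz d hd) hd']
      apply per_agree
      intro k
      apply hφZ
      have : ∀ k : ℕ, ¬ Z' ((φ ^ k) d) := by
        intro k
        induction k with
        | zero => simpa
        | succ k ih => rw [pow_succ', Perm.mul_apply, hZ'φ]; exact ih
      exact this k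
  have hH : H1 φ' α 0 := by
    obtain ⟨L, hL⟩ := H
    refine ⟨0, ?_⟩
    rintro c hc ⟨p, hp⟩ -
    obtain ⟨s, hs⟩ : ∃ s, s = p z - p (φ e) := ⟨_, rfl⟩
    obtain ⟨c', hc'⟩ : ∃ c' : D → ℚ, c' = fun d => c d + (if d = z then s else 0) - (if d = e then s else 0) := ⟨_, rfl⟩
    have c1 : c' z = c z + s := by simp [hc', nze]
    have c2 : c' e = c e - s := by simp [hc', nze.symm]
    have c3 : ∀ d, d ≠ z → d ≠ e → c' d = c d := by intro d h1 h2; simp [hc', h1, h2]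
    have hce : c e = - c z := by rw [he, hc]
    obtain ⟨P, hP1, hP2⟩ := hL c' (by
      intro d
      by_cases h1 : d = z
      · subst h1; rw [← he, c1, c2, hce]; ring
      · by_cases h2 : d = e
        · subst h2; rw [hze, c1, c2, hce]; ring
        · rw [c3 d h1 h2, c3, hc]
          · intro h; apply h2; rw [he, ← h, B.αα]
          · intro h; apply h1; rw [← hze, ← h, B.αα]) ⟨fun d => if d = z then p (φ e) else p d, by
      intro d
      simp only
      by_cases h1 : d = z
      · rw [if_pos h1, h1, c1]
        by_cases h2 : φ z = z
        · rw [if_pos h2]; have := hp z; rw [f1 z h2] at this; rw [hs]; linarith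
        · rw [if_neg h2]; have := hp z; rw [f3 z h2 nze] at this; rw [hs]; linarith
      · rw [if_neg h1]
        by_cases h2 : d = e
        · rw [h2, if_neg nzφ, c2]; have := hp e; rw [f2] at this; rw [hs]; linarith
        · rw [c3 d h1 h2]
          by_cases h3 : φ d = z
          · rw [if_pos h3]; have := hp d; rwa [f1 d h3] at this
          · rw [if_neg h3]; have := hp d; rwa [f3 d h3 h2] at this⟩ (Subsingleton.elim _ _)
    have pe : P e = P z + c z + s := by rw [he, hP2, c1]; ring
    have pφ : P (φ e) = P z := by rw [hP1, pe, c2, hce]; ring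
    refine ⟨fun d => if d = z then P z + s else P d, ?_, ?_⟩
    · intro d
      simp only
      by_cases h1 : φ d = z
      · rw [f1 d h1, if_neg nzφ, pφ]
        have h4 := hP1 d
        rw [h1] at h4
        by_cases h2 : d = z
        · rw [if_pos h2]; rw [h2, c1] at h4; rw [h2]; linarith
        · rw [if_neg h2, h4, c3 d h2]
          rintro rfl; exact nzφ h1
      · by_cases h2 : d = e
        · rw [h2, f2, if_pos rfl, if_neg nze.symm, pe, hce]; ring
        · rw [f3 d h1 h2, if_neg h1, hP1]
          by_cases h3 : d = z
          · rw [if_pos h3, h3, c1]; ring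
          · rw [if_neg h3, c3 d h3 h2]
    · intro d
      simp only
      by_cases h1 : d = z
      · rw [h1, ← he, if_neg nze.symm, if_pos rfl, pe]; ring
      · by_cases h2 : d = e
        · rw [h2, hze, if_neg nze.symm, if_pos rfl, pe, hce]; ring
        · rw [if_neg h1, if_neg, hP2, c3 d h1 h2]
          intro h; apply h2; rw [he, ← h, B.αα]
  have key : HasD Rw st 0 x0 ((s2.map lab ++ (rw e).tail) ++ [lab e, li (lab e)]) (fun f => IsDg.Ch pos Z' N rw f)
      (nrel Z' N) (Fintype.card D) := by
    refine ⟨D, inferInstance, φ', α, lab, pos, Z', N, rw, s2 ++ O ++ [e] ++ [z], hB, hH, ?_, ?_, hlist, ?_,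
      fun _ _ => Subsingleton.elim _ _, fun _ _ => rfl, rfl, rfl⟩
    · have hn2 := List.nodup_cons.1 hn
      rw [List.append_assoc, List.append_assoc, List.nodup_append]
      refine ⟨hn2.2, ?_, ?_⟩
      · rw [← List.append_assoc, List.nodup_append]
        refine ⟨?_, by simp, ?_⟩
        · rw [List.nodup_append]
          refine ⟨hOn, by simp, ?_⟩
          intro a ha b hb; simp at hb; subst hb; exact hOe a ha
        · intro a ha b hb hab; simp at hb; rw [hb] at hab; exact (hOeZ a ha).1 (hab ▸ hZz)
      · intro a ha b hb hab
        subst hab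
        rw [← List.append_assoc, List.mem_append] at hb
        rcases hb with hb | hb
        · exact (hOeZ a hb).1 ((hZ a).2 (by simp [ha]))
        · simp at hb; subst hb; exact hn2.1 ha
    · intro d; rw [hZ']; simp only [hZ]; simp; tauto
    · simp [hlabO, hlz]
  refine ⟨_, _, _, ?_, HasD.splitN (Subsingleton.elim _ _) key⟩
  unfold nrel
  apply card_lt_card
  rw [Finset.ssubset_iff_of_subset]
  · refine ⟨e, by simp [hz, hN], by simp [hZ']⟩
  · intro d; simp only [mem_filter, mem_univ, true_and]
    exact fun h => ⟨hnz d h.1, h.2⟩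

theorem pinv_apply {E : Type*} (φ : Perm E) (x : E) : φ⁻¹ (φ x) = x := by simp
theorem papply_inv {E : Type*} (φ : Perm E) (x : E) : φ (φ⁻¹ x) = x := by simp

/-- same vertex -/
def SV {E : Type*} (φ α : Perm E) (d d' : E) : Prop := d' = d ∨ d' = φ (α d) ∨ d = φ (α d')

def Pth {E : Type*} (φ α : Perm E) : List E → E → E → Prop
  | [], d, d' => SV φ α d d'
  | q :: l, d, d' => SV φ α d q ∧ Pth φ α l (α q) d'

namespace FS
variable {E : Type*} {φ α : Perm E} {lab : E → S × Bool} {rw : E → Wd S} {nf : E → Prop}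

theorem rwpow (F : FS Rw φ α lab rw nf) (d : E) (i : ℕ) : rw ((φ ^ i) d) = (rw d).rotate i := by
  induction i with
  | zero => simp
  | succ n ih => rw [pow_succ', Perm.mul_apply, F.Rr, ih, List.rotate_rotate]

theorem rlen (F : FS Rw φ α lab rw nf) (d : E) (i : ℕ) : (rw ((φ ^ i) d)).length = (rw d).length := by
  rw [F.rwpow, List.length_rotate]

theorem len6 (F : FS Rw φ α lab rw nf) (d : E) : 6 ≤ (rw d).length := by
  classical
  have h1 := F.six d
  calc 6 = _ := h1.symm
    _ ≤ _ := card_filter_le _ _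
    _ = _ := by simp

theorem labs (F : FS Rw φ α lab rw nf) (d : E) (i : ℕ) (hi : i < (rw d).length) :
    (rw d)[i]? = some (lab ((φ ^ i) d)) := by
  have := F.Rh ((φ ^ i) d)
  rw [F.rwpow, head_rot _ _ hi] at this
  rw [List.getElem?_eq_getElem hi, this]

theorem adj (h : SC Rw) (F : FS Rw φ α lab rw nf) (d : E) : lab (φ d) ≠ li (lab d) := by
  intro hl
  have hm := F.Rm d
  have h6 := F.len6 d
  have h0 := F.labs d 0 (by omega)
  have h1 := F.labs d 1 (by omega)
  rcases hr : rw d with _ | ⟨a, _ | ⟨b, t⟩⟩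
  · simp [hr] at h6
  · simp [hr] at h6
  · rw [hr] at h0 h1 hm
    simp at h0 h1
    rw [← h0, ← h1] at hl
    exact h.red _ _ _ hm hl

theorem sv_refl (d : E) : SV φ α d d := Or.inl rfl
theorem sv_symm {d d' : E} (h : SV φ α d d') : SV φ α d' d := by
  rcases h with h | h | h
  · exact Or.inl h.symm
  · exact Or.inr (Or.inr h)
  · exact Or.inr (Or.inl h)

theorem nfα (F : FS Rw φ α lab rw nf) (d : E) : nf (α d) ↔ nf (φ d) := by
  rw [← F.nα (α d), F.αα]

theorem sv_nf (F : FS Rw φ α lab rw nf) {d d' : E} (h : SV φ α d d') : nf d' ↔ nf d := by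
  rcases h with rfl | rfl | rfl
  · rfl
  · exact F.nα d
  · exact (F.nα d').symm

theorem sv_pi (d : E) : SV φ α d (φ (α d)) := Or.inr (Or.inl rfl)

theorem sv_trans (F : FS Rw φ α lab rw nf) {d d' d'' : E} (h : SV φ α d d') (h' : SV φ α d' d'') : SV φ α d d'' := by
  have p2 : ∀ d, SV φ α d (φ (α (φ (α d)))) := by
    intro d
    by_cases hd : nf d
    · right; right; exact (F.v3 d hd).symm
    · left; exact F.v2 d hd
  rcases h with rfl | rfl | rfl
  · exact h'
  · rcases h' with rfl | rfl | h'
    · exact sv_pi _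
    · exact p2 d
    · left; exact (α.injective (φ.injective h')).symm
  · rcases h' with rfl | rfl | rfl
    · exact sv_symm (sv_pi _)
    · left; rfl
    · exact sv_symm (p2 _)

theorem sv_lab (h : SC Rw) (F : FS Rw φ α lab rw nf) {d d' : E} (h' : SV φ α d d') (hl : lab d = lab d') : d = d' := by
  have key : ∀ d, lab (φ (α d)) ≠ lab d := by
    intro d; have := F.adj h (α d); rwa [F.labα, li_li] at this
  rcases h' with rfl | rfl | rfl
  · rfl
  · exact absurd hl.symm (key d)
  · exact absurd hl (key d')

theorem sv_next (h : SC Rw) (F : FS Rw φ α lab rw nf) {q q' : E} (h' : SV φ α (α q) q') (hl : lab q' ≠ li (lab q)) :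
    q' = φ q ∨ q' = α (φ⁻¹ (α q)) := by
  rcases h' with rfl | rfl | h'
  · exact absurd (F.labα q) hl
  · left; rw [F.αα]
  · right; rw [h', pinv_apply, F.αα]

theorem nf_next (F : FS Rw φ α lab rw nf) (q : E) (hn : ¬ nf (φ q)) : φ q = α (φ⁻¹ (α q)) := by
  have := F.v2 (α q) (by rwa [F.nfα])
  rw [F.αα] at this
  rw [← this, pinv_apply, F.αα]

theorem pth_congr (F : FS Rw φ α lab rw nf) {l : List E} : ∀ {d d' e e' : E}, SV φ α d d' → SV φ α e e' →
    Pth φ α l d e → Pth φ α l d' e' := by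
  induction l with
  | nil => intro d d' e e' h1 h2 h; exact F.sv_trans (F.sv_trans (sv_symm h1) h) h2
  | cons q l ih => intro d d' e e' h1 h2 h; exact ⟨F.sv_trans (sv_symm h1) h.1, ih (sv_refl _) h2 h.2⟩

theorem pth_append (F : FS Rw φ α lab rw nf) {l1 l2 : List E} : ∀ {d d' : E},
    Pth φ α (l1 ++ l2) d d' ↔ ∃ e, Pth φ α l1 d e ∧ Pth φ α l2 e d' := by
  induction l1 with
  | nil => intro d d'; constructor
           · intro h; exact ⟨d, sv_refl _, h⟩
           · rintro ⟨e, h1, h2⟩; exact F.pth_congr (sv_symm h1) (sv_refl _) h2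
  | cons q l ih =>
    intro d d'
    simp only [List.cons_append, Pth, ih]
    constructor
    · rintro ⟨h1, e, h2, h3⟩; exact ⟨e, ⟨h1, h2⟩, h3⟩
    · rintro ⟨e, ⟨h1, h2⟩, h3⟩; exact ⟨h1, e, h2, h3⟩

/-- the path along a face -/
theorem pth_face (F : FS Rw φ α lab rw nf) (d : E) (k : ℕ) :
    Pth φ α ((List.range k).map (fun i => (φ ^ i) d)) d ((φ ^ k) d) := by
  induction k generalizing d with
  | zero => exact sv_refl _
  | succ k ih =>
    rw [List.range_succ_eq_map, List.map_cons, List.map_map]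
    refine ⟨by exact sv_refl _, ?_⟩
    have : ((fun i => (φ ^ i) d) ∘ Nat.succ) = fun i => (φ ^ i) (φ d) := by
      funext i; simp [pow_succ]
    rw [this, pow_succ, Perm.mul_apply]
    refine F.pth_congr ?_ (sv_refl _) (ih (φ d))
    right; right; simp [F.αα]

theorem mirror (h : SC Rw) (F : FS Rw φ α lab rw nf) :
    FS Rw (α * φ⁻¹ * α) α lab (fun d => iw (rw (φ (α d)))) nf := by
  classical
  have hpw : ∀ (i : ℕ) d, ((α * φ⁻¹ * α) ^ i) d = α ((φ⁻¹ ^ i) (α d)) := by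
    intro i
    induction i with
    | zero => intro d; simp [F.αα]
    | succ i ih => intro d; rw [pow_succ', Perm.mul_apply, ih]; simp [F.αα, pow_succ']
  have hlen : ∀ d, (iw (rw (φ (α d)))).length = (rw (α d)).length := by
    intro d; rw [iw_length, F.Rr, List.length_rotate]
  constructor
  · exact F.αα
  · exact F.labα
  · intro d; exact h.inv _ (F.Rm _)
  · intro d
    simp only [F.Rr]
    rw [iw_head _ _ (F.Rh (α d)), F.labα, li_li]
  · intro d
    simp only [Perm.mul_apply, F.αα, papply_inv]
    rw [F.Rr (α d), iw_rot]
  · intro d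
    simp only [hlen, hpw]
    have := F.Rp (α d)
    have h2 : (φ⁻¹ ^ (rw (α d)).length) (α d) = α d := by
      rw [inv_pow, Perm.inv_eq_iff_eq, this]
    rw [h2, F.αα]
  · intro d
    simp only [Perm.mul_apply, F.αα]
    rw [F.nfα, papply_inv]
  · intro d hd
    simp only [Perm.mul_apply, F.αα]
    have := F.v2 d hd
    conv_lhs => rw [← this]
    simp [F.αα]
  · intro d hd
    simp only [Perm.mul_apply, F.αα]
    have := F.v3 d hd
    conv_lhs => rw [← this]
    simp [F.αα]
  · intro d
    simp only [hlen, hpw]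
    have h6 := F.six ((φ ^ 2) (α d))
    rw [F.rlen] at h6
    rw [card_filter] at h6 ⊢
    rw [← sum_range_reflect] at h6
    rw [← h6]
    apply sum_congr rfl
    intro i hi
    rw [mem_range] at hi
    have e1 : φ ((φ⁻¹ ^ i) (α d)) = (φ ^ ((rw (α d)).length - 1 - i)) ((φ ^ 2) (α d)) := by
      apply (φ ^ i).injective
      have hh : (φ ^ i) (φ ((φ⁻¹ ^ i) (α d))) = φ (α d) := by
        have : φ ^ i * (φ * φ⁻¹ ^ i) = φ := by group
        conv_rhs => rw [← this]
        rfl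
      rw [hh, ← Perm.mul_apply (φ ^ i), ← pow_add, ← Perm.mul_apply _ (φ ^ 2), ← pow_add]
      have : i + ((rw (α d)).length - 1 - i) + 2 = 1 + (rw (α d)).length := by omega
      rw [this, pow_add, Perm.mul_apply, F.Rp, pow_one]
    rw [F.nfα, e1]
  · intro d he
    simp only [Perm.mul_apply, F.αα, papply_inv] at he
    rw [iw_iw] at he
    exact F.ne d he.symm

theorem mirror_sv (F : FS Rw φ α lab rw nf) (d d' : E) : SV (α * φ⁻¹ * α) α d d' ↔ SV φ α d d' := by
  have : ∀ d d', d' = (α * φ⁻¹ * α) (α d) ↔ d = φ (α d') := by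
    intro d d'
    simp only [Perm.mul_apply, F.αα]
    constructor
    · rintro rfl; simp [F.αα]
    · rintro rfl; simp [F.αα]
  unfold SV
  rw [this, this]; tauto

theorem mirror_pth (F : FS Rw φ α lab rw nf) {l : List E} : ∀ d d', Pth (α * φ⁻¹ * α) α l d d' ↔ Pth φ α l d d' := by
  induction l with
  | nil => intro d d'; exact F.mirror_sv d d'
  | cons q l ih => intro d d'; simp only [Pth, F.mirror_sv, ih]

/-- two full sides can not be covered by one piece -/
theorem three (h : SC Rw) (F : FS Rw φ α lab rw nf) (q : ℕ → E) (ρ : ℕ → Wd S) (K t : ℕ) (ht : 0 < t)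
    (htK : t < K) (hq : ∀ k, k + 1 < K → q (k+1) = φ (q k)) (n0 : nf (q 0)) (nt : nf (q t)) (nK : nf (φ (q (K-1))))
    (h1 : ∀ k < K, ρ k ∈ Rw) (h2 : ∀ k < K, (ρ k).head? = some (li (lab (q k))))
    (h3 : ∀ k, k + 1 < K → ρ k = (ρ (k+1)).rotate 1) (h4 : ∀ k < K, ρ k ≠ iw (rw (φ (q k)))) : False := by
  classical
  have hqk : ∀ k, k < K → q k = (φ ^ k) (q 0) := by
    intro k
    induction k with
    | zero => intro _; rfl
    | succ k ih => intro hk; rw [hq k hk, ih (by omega), pow_succ', Perm.mul_apply]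
  obtain ⟨d0, hd0⟩ : ∃ d0, d0 = q 0 := ⟨_, rfl⟩
  rw [← hd0] at hqk n0
  have key := cover_lin h (F.Rm d0) (fun k => if k < K then iw ((ρ k).rotate 1) else iw (rw (φ (α ((φ ^ k) d0)))))
    (fun k => nf ((φ ^ k) d0) ∧ K ≤ k) ?_ ?_ ?_ ?_
  · have sub : #{i ∈ range (rw d0).length | 0 < i ∧ nf ((φ ^ i) d0) ∧ K ≤ i} ≤ 4 := by
      by_cases hL : t < (rw d0).length
      · have h6 := F.six d0
        have hsub : {i ∈ range (rw d0).length | 0 < i ∧ nf ((φ ^ i) d0) ∧ K ≤ i} ⊆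
            (({i ∈ range (rw d0).length | nf ((φ ^ i) d0)}.erase 0).erase t) := by
          intro i; simp only [mem_filter, mem_erase, mem_range]
          rintro ⟨a, b, c, d⟩; exact ⟨by omega, by omega, a, c⟩
        refine (card_le_card hsub).trans ?_
        rw [card_erase_of_mem, card_erase_of_mem]
        · have : #{i ∈ range (rw d0).length | nf ((φ ^ i) d0)} = 6 := by convert h6
          omega
        · simp [n0]; omega
        · simp only [mem_erase, mem_filter, mem_range]
          refine ⟨by omega, hL, ?_⟩
          rw [← hqk t htK]; exact nt
      · have : {i ∈ range (rw d0).length | 0 < i ∧ nf ((φ ^ i) d0) ∧ K ≤ i} = ∅ := by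
          apply filter_false_of_mem
          intro i hi; simp at hi; omega
        rw [this]; simp
    refine absurd (Nat.le_trans key (le_of_eq_of_le ?_ sub)) (by norm_num)
    congr 1
    ext i; simp only [mem_filter]
  · intro k _
    split_ifs with hk
    · exact h.inv _ (h.rot1 _ (h1 k hk))
    · exact h.inv _ (F.Rm _)
  · intro k _
    rw [← F.rwpow]
    split_ifs with hk
    · intro he
      apply h4 k hk
      rw [← hqk k hk] at he
      have : rw (q k) = iw ((ρ k).rotate 1) := he.symm
      rw [F.Rr, this, ← iw_iw ((iw ((ρ k).rotate 1)).rotate 1), iw_rot, iw_iw, iw_iw]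
    · intro he; exact F.ne _ he.symm
  · intro k hkL
    rw [F.labs d0 k hkL]
    split_ifs with hk
    · rw [iw_head _ _ (h2 k hk), li_li, hqk k hk]
    · rw [F.Rr, iw_head _ _ (F.Rh _), F.labα, li_li]
  · intro k hk hn
    by_cases c1 : k + 1 < K
    · rw [if_pos c1, if_pos (by omega), iw_rot, ← h3 k c1]
    · rw [if_neg c1]
      have hn' : ¬ nf ((φ ^ (k+1)) d0) := fun hh => hn ⟨hh, by omega⟩
      have hne : k + 1 ≠ K := by
        intro he; apply hn'
        rw [pow_succ', Perm.mul_apply, ← hqk k (by omega)]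
        have : k = K - 1 := by omega
        rw [this]; exact nK
      rw [if_neg (by omega)]
      obtain ⟨y, hy⟩ : ∃ y, y = (φ ^ k) d0 := ⟨_, rfl⟩
      rw [pow_succ', Perm.mul_apply, ← hy] at hn' ⊢
      rw [F.Rr (α y), iw_rot, F.nf_next y hn', F.αα, papply_inv]

end FS

theorem lastP (P : ℕ → Prop) (a b : ℕ) (hab : a < b) (ha : P a) :
    ∃ t, a ≤ t ∧ t < b ∧ P t ∧ ∀ k, t < k → k < b → ¬ P k := by
  induction b with
  | zero => omega
  | succ b ih =>
    by_cases hb : P b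
    · exact ⟨b, by omega, by omega, hb, by intro k h1 h2; omega⟩
    · have : a ≠ b := by rintro rfl; exact hb ha
      obtain ⟨t, h1, h2, h3, h4⟩ := ih (by omega)
      refine ⟨t, h1, by omega, h3, ?_⟩
      intro k h5 h6
      by_cases hk : k = b
      · subst hk; exact hb
      · exact h4 k h5 (by omega)

section
variable {E : Type*} {φ α : Perm E} {lab : E → S × Bool} {rw : E → Wd S} {nf : E → Prop}

theorem Fcore (h : SC Rw) (F : FS Rw φ α lab rw nf) {D : Type} [Fintype D] {ψ β : Perm D}
    {labD : D → S × Bool} {pos : D → X} {Z N : D → Prop} {rwD : D → Wd S}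
    (B : IsDg Rw st ψ β labD pos Z N rwD) (H : H1 ψ β 0) (hN : ∀ d, ¬ N d)
    (hr : ∀ d, ¬ Z d → ¬ Z (β d) → rwD d ≠ iw (rwD (ψ (β d)))) (z : ℕ → D) (n : ℕ) (hn : 0 < n)
    (hz : ∀ i, z (i+1) = ψ (z i)) (hzn : z n = z 0) (hinj : ∀ i < n, ∀ j < n, z i = z j → i = j)
    (hZ : ∀ d, Z d ↔ ∃ i < n, d = z i) (q : ℕ → E) (hl : ∀ i < n, labD (z i) = lab (q i))
    (hV : ∀ i, i + 1 < n → SV φ α (α (q i)) (q (i+1))) (hb : ∀ i, i + 1 < n → lab (q (i+1)) ≠ li (lab (q i)))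
    (hA : ∀ i < n, ¬ Z (β (z i)) → rwD (β (z i)) ≠ rw (α (q i)))
    (hBv : ∀ i < n, ¬ Z (β (z i)) → rwD (β (z i)) ≠ iw (rw (φ (q i)))) : False := by
  classical
  have ββ := B.αα
  have hZz : ∀ i < n, Z (z i) := fun i hi => (hZ _).2 ⟨i, hi, rfl⟩
  have pern : ∀ i < n, per ψ (z i) = n := by
    have hp0 : ∀ k, (ψ ^ k) (z 0) = z k := by
      intro k
      induction k with
      | zero => rfl
      | succ k ih => rw [pow_succ', Perm.mul_apply, ih, hz]
    have h0 : per ψ (z 0) = n := by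
      have hd : per ψ (z 0) ∣ n := by rw [← per_dvd, hp0, hzn]
      have hle := Nat.le_of_dvd hn hd
      by_contra hne
      have := pow_per ψ (z 0)
      rw [hp0] at this
      have := hinj _ (by omega) _ hn this
      have := per_pos ψ (z 0)
      omega
    intro i _
    induction i with
    | zero => exact h0
    | succ i ih => rw [hz, per_apply, ih (by omega)]
  have d1 : ∀ d, per (ψ * β) d = 1 → ψ (β d) = d := by
    intro d hd; have := pow_per (ψ * β) d; rwa [hd, pow_one, Perm.mul_apply] at this
  have d2 : ∀ d, per (ψ * β) d = 2 → ψ (β (ψ (β d))) = d := by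
    intro d hd; have := pow_per (ψ * β) d; rwa [hd, pow_two] at this
  have dpi : ∀ d, per (ψ * β) (ψ (β d)) = per (ψ * β) d := fun d => per_apply (ψ * β) d
  have dpos : ∀ d, 0 < per (ψ * β) d := fun d => per_pos (ψ * β) d
  obtain ⟨plain, hplain⟩ : ∃ P : ℕ → Prop, ∀ i, P i ↔ per (ψ * β) (z i) = 2 ∧ ¬ Z (ψ (β (z i))) :=
    ⟨_, fun _ => Iff.rfl⟩
  have pl : ∀ k, plain (k+1) → ψ (β (z (k+1))) = β (z k) ∧ ¬ Z (β (z k)) ∧ ¬ Z (β (z (k+1))) := by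
    intro k hk
    obtain ⟨h1, h2⟩ := (hplain _).1 hk
    have h3 := d2 _ h1
    rw [hz k] at h3
    have h4 := ψ.injective h3
    rw [← hz k] at h4
    have h5 : ψ (β (z (k+1))) = β (z k) := by rw [← h4, ββ]
    refine ⟨h5, h5 ▸ h2, ?_⟩
    rwa [B.Zφ] at h2
  obtain ⟨rs, rs0, rs1, rs2⟩ : ∃ rs : ℕ → ℕ, rs 0 = 0 ∧ (∀ i, plain (i+1) → rs (i+1) = rs i) ∧
      (∀ i, ¬ plain (i+1) → rs (i+1) = i+1) := by
    refine ⟨fun i => Nat.rec 0 (fun i r => if plain (i+1) then r else i+1) i, rfl, ?_, ?_⟩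
    · intro i hi; simp [hi]
    · intro i hi; simp [hi]
  have rsle : ∀ i, rs i ≤ i := by
    intro i
    induction i with
    | zero => omega
    | succ i ih =>
      by_cases hp : plain (i+1)
      · rw [rs1 i hp]; omega
      · rw [rs2 i hp]
  have rsrun : ∀ i j, rs i < j → j ≤ i → plain j ∧ rs j = rs i := by
    intro i
    induction i with
    | zero => intro j; omega
    | succ i ih =>
      intro j h1 h2
      by_cases hp : plain (i+1)
      · rw [rs1 i hp] at h1 ⊢
        by_cases hj : j = i + 1
        · subst hj; exact ⟨hp, rs1 i hp⟩
        · exact ih j h1 (by omega)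
      · rw [rs2 i hp] at h1; omega
  -- turning types
  have nx : ∀ k, k + 1 < n → q (k+1) = φ (q k) ∨ q (k+1) = α (φ⁻¹ (α (q k))) :=
    fun k hk => F.sv_next h (hV k hk) (hb k hk)
  have nfx : ∀ k, k + 1 < n → (nf (φ (q k)) ↔ nf (q (k+1))) := by
    intro k hk; rw [← F.nfα, F.sv_nf (hV k hk)]
  have nx2 : ∀ k, k + 1 < n → ¬ nf (q (k+1)) → q (k+1) = φ (q k) ∧ q (k+1) = α (φ⁻¹ (α (q k))) := by
    intro k hk hh
    have := F.nf_next (q k) (by rwa [nfx k hk])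
    rcases nx k hk with h1 | h1
    · exact ⟨h1, by rw [h1, this]⟩
    · exact ⟨by rw [h1, this], h1⟩
  have rwDβ : ∀ i < n, ¬ Z (β (z i)) → rwD (β (z i)) ∈ Rw ∧ (rwD (β (z i))).head? = some (li (lab (q i))) := by
    intro i hi hh
    refine ⟨B.Rm _ hh (hN _), ?_⟩
    rw [B.Rh _ hh (hN _), B.labα, hl i hi]
  have no3 : ∀ t1 t2 t3, t1 < t2 → t2 < t3 → t3 < n → (∀ k, t1 < k → k ≤ t3 → plain k) → nf (q t1) → nf (q t2) →
      nf (q t3) → (∀ k, t1 < k → k < t2 → ¬ nf (q k)) → (∀ k, t2 < k → k < t3 → ¬ nf (q k)) → False := by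
    intro t1 t2 t3 h12 h23 h3n hp n1 n2 n3 m1 m2
    have hnZ : ∀ k, k < t3 - t1 → ¬ Z (β (z (t1 + k))) := by
      intro k hk; exact (pl (t1 + k) (hp _ (by omega) (by omega))).2.1
    have hρ : ∀ k, k + 1 < t3 - t1 → rwD (β (z (t1 + k))) = (rwD (β (z (t1 + (k+1))))).rotate 1 := by
      intro k hk
      have := pl (t1 + k) (hp _ (by omega) (by omega))
      rw [← this.1]
      exact B.Rr _ this.2.2 (hN _)
    have hnb : ∀ k, k + 1 < t3 - t1 → t1 + k + 1 ≠ t2 → ¬ nf (q (t1 + k + 1)) := by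
      intro k hk hne
      rcases lt_or_gt_of_ne hne with h1 | h1
      · exact m1 _ (by omega) h1
      · exact m2 _ h1 (by omega)
    obtain ⟨s, rfl⟩ : ∃ s, t2 = s + 1 := ⟨t2 - 1, by omega⟩
    obtain ⟨s3, rfl⟩ : ∃ s, t3 = s + 1 := ⟨t3 - 1, by omega⟩
    have e3 : t1 + (s3 + 1 - t1 - 1) = s3 := by omega
    rcases nx s (by omega) with hty | hty
    · refine F.three h (fun k => q (t1 + k)) (fun k => rwD (β (z (t1 + k)))) (s3 + 1 - t1) (s + 1 - t1) (by omega) (by omega)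
        ?_ n1 ?_ ?_ (fun k hk => (rwDβ _ (by omega) (hnZ k hk)).1) (fun k hk => (rwDβ _ (by omega) (hnZ k hk)).2) hρ
        (fun k hk => hBv _ (by omega) (hnZ k hk))
      · intro k hk
        by_cases hc : t1 + k + 1 = s + 1
        · have : t1 + k = s := by omega
          show q (t1 + k + 1) = φ (q (t1 + k))
          rw [this]; exact hty
        · exact (nx2 _ (by omega) (hnb k hk hc)).1
      · show nf (q (t1 + (s + 1 - t1)))
        rw [show t1 + (s + 1 - t1) = s + 1 by omega]; exact n2
      · show nf (φ (q (t1 + (s3 + 1 - t1 - 1))))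
        rw [e3, nfx _ (by omega)]; exact n3
    · refine (F.mirror h).three h (fun k => q (t1 + k)) (fun k => rwD (β (z (t1 + k)))) (s3 + 1 - t1) (s + 1 - t1) (by omega) (by omega)
        ?_ n1 ?_ ?_ (fun k hk => (rwDβ _ (by omega) (hnZ k hk)).1) (fun k hk => (rwDβ _ (by omega) (hnZ k hk)).2) hρ
        (fun k hk => ?_)
      · intro k hk
        by_cases hc : t1 + k + 1 = s + 1
        · have : t1 + k = s := by omega
          show q (t1 + k + 1) = α (φ⁻¹ (α (q (t1 + k))))
          rw [this]; exact hty
        · exact (nx2 _ (by omega) (hnb k hk hc)).2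
      · show nf (q (t1 + (s + 1 - t1)))
        rw [show t1 + (s + 1 - t1) = s + 1 by omega]; exact n2
      · show nf (α (φ⁻¹ (α (q (t1 + (s3 + 1 - t1 - 1))))))
        rw [e3, F.nfα, papply_inv, F.nfα, nfx _ (by omega)]; exact n3
      · simp only [Perm.mul_apply, F.αα, papply_inv, iw_iw]
        exact hA _ (by omega) (hnZ k hk)
  obtain ⟨M, hM⟩ : ∃ M : ℕ → Prop, ∀ i, M i ↔ nf (q i) ∧ ∃ j, rs i < j ∧ j < i ∧ nf (q j) := ⟨_, fun _ => Iff.rfl⟩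
  obtain ⟨tf, htf⟩ : ∃ tf : ℕ → Prop, ∀ s, tf s ↔ ∃ j, s < j ∧ nf (q j) ∧
      (∀ k, s < k → k < j → ¬ nf (q k)) ∧ q j = φ (q (j-1)) := ⟨_, fun _ => Iff.rfl⟩
  obtain ⟨mark, hmark⟩ : ∃ mark : D → Prop, ∀ d, mark d ↔ 3 ≤ per (ψ * β) d ∨
      ∃ i < n, d = ψ (β (z i)) ∧ plain i ∧ (i = 0 ∨ M i) := ⟨_, fun _ => Iff.rfl⟩
  obtain ⟨idx, hidx⟩ : ∃ idx : D → ℕ, ∀ i < n, idx (z i) = i := by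
    choose! f hf using fun d => (hZ d).1
    refine ⟨f, fun i hi => ?_⟩
    have := hf (z i) (hZz i hi)
    exact (hinj i hi _ this.1 this.2).symm
  obtain ⟨comp, comp1, comp2, comp3⟩ : ∃ comp : D → Wd S,
      (∀ y, ¬ Z (β y) → comp y = iw (rwD (ψ (β y)))) ∧
      (∀ i < n, tf (rs i) → comp (β (z i)) = iw (rw (φ (q i)))) ∧
      (∀ i < n, ¬ tf (rs i) → comp (β (z i)) = rw (α (q i))) := by
    refine ⟨fun y => if Z (β y) then (if tf (rs (idx (β y))) then iw (rw (φ (q (idx (β y))))) else rw (α (q (idx (β y)))))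
      else iw (rwD (ψ (β y))), ?_, ?_, ?_⟩
    · intro y hy; simp only; rw [if_neg hy]
    · intro i hi ht; simp only; rw [ββ, if_pos (hZz i hi), hidx i hi, if_pos ht]
    · intro i hi ht; simp only; rw [ββ, if_pos (hZz i hi), hidx i hi, if_neg ht]
  have relZ : ∀ y, Z (β y) → ∃ i < n, y = β (z i) := by
    intro y hy; obtain ⟨i, hi, h1⟩ := (hZ _).1 hy
    exact ⟨i, hi, by rw [← h1, ββ]⟩
  have hc1 : ∀ y, ¬ Z y → comp y ∈ Rw := by
    intro y hy
    by_cases hb : Z (β y)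
    · obtain ⟨i, hi, rfl⟩ := relZ y hb
      by_cases ht : tf (rs i)
      · rw [comp2 i hi ht]; exact h.inv _ (F.Rm _)
      · rw [comp3 i hi ht]; exact F.Rm _
    · rw [comp1 y hb]; exact h.inv _ (B.Rm _ (by rwa [B.Zφ]) (hN _))
  have hc2 : ∀ y, ¬ Z y → comp y ≠ rwD y := by
    intro y hy
    by_cases hb : Z (β y)
    · obtain ⟨i, hi, rfl⟩ := relZ y hb
      by_cases ht : tf (rs i)
      · rw [comp2 i hi ht]; exact (hBv i hi hy).symm
      · rw [comp3 i hi ht]; exact (hA i hi hy).symm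
    · rw [comp1 y hb]; exact (hr y hy hb).symm
  have hc3 : ∀ y, ¬ Z y → (comp y).head? = (rwD y).head? := by
    intro y hy
    rw [B.Rh y hy (hN _)]
    by_cases hb : Z (β y)
    · obtain ⟨i, hi, rfl⟩ := relZ y hb
      rw [B.labα, hl i hi]
      by_cases ht : tf (rs i)
      · rw [comp2 i hi ht, F.Rr, iw_head _ _ (F.Rh _)]
      · rw [comp3 i hi ht, F.Rh, F.labα]
    · rw [comp1 y hb, B.Rr _ hb (hN _), iw_head _ _ (B.Rh _ hb (hN _)), B.labα, li_li]
  have hdeg1 : ∀ x, ¬ Z x → per (ψ * β) x ≠ 1 := by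
    intro x hx h1
    have h2 := d1 x h1
    have hb : ¬ Z (β x) := by rw [← B.Zφ, h2]; exact hx
    have := B.adj h hb (hN _)
    rw [h2, B.labα, li_li] at this
    exact this rfl
  have hu : ∀ y, ¬ Z y → ¬ mark (ψ y) → comp (ψ y) = (comp y).rotate 1 := by
    intro y hy hm
    rw [hmark, not_or] at hm
    obtain ⟨m1, m2⟩ := hm
    have hx : ¬ Z (ψ y) := by rwa [B.Zφ]
    have hd : per (ψ * β) (ψ y) = 2 := by
      have := hdeg1 _ hx; have := dpos (ψ y); omega
    have h2 := d2 _ hd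
    have h3 : β (ψ (β (ψ y))) = y := ψ.injective h2
    have h4 : ψ (β (ψ y)) = β y := by rw [← h3, ββ, h3]
    by_cases hb : Z (β (ψ y))
    · -- partner special
      have hby : Z (β y) := by rw [← h4, B.Zφ]; exact hb
      obtain ⟨i, hi, hyi⟩ := relZ y hby
      have hyi' : β y = z i := by rw [hyi, ββ]
      have hxi : ψ y = ψ (β (z i)) := by rw [hyi]
      have hpi : plain i := by
        rw [hplain]
        refine ⟨?_, hxi ▸ hx⟩
        rw [← dpi, ← hxi]; exact hd
      have hnm : ¬ (i = 0 ∨ M i) := fun hh => m2 ⟨i, hi, hxi, hpi, hh⟩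
      rw [not_or] at hnm
      obtain ⟨k, rfl⟩ : ∃ k, i = k + 1 := ⟨i - 1, by omega⟩
      obtain ⟨p1, -, -⟩ := pl k hpi
      have hrs := rs1 k hpi
      rw [hxi, p1, hyi]
      by_cases hnf : nf (q (k+1))
      · have nonf : ∀ j, rs (k+1) < j → j < k + 1 → ¬ nf (q j) := by
          intro j a b c; exact hnm.2 ((hM _).2 ⟨hnf, j, a, b, c⟩)
        have hlt : rs (k+1) < k + 1 := by rw [hrs]; have := rsle k; omega
        by_cases ht : tf (rs (k+1))
        · rw [comp2 (k+1) hi ht, comp2 k (by omega) (hrs ▸ ht)]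
          obtain ⟨j, j1, j2, j3, j4⟩ := (htf _).1 ht
          have : j = k + 1 := by
            rcases lt_trichotomy j (k+1) with hh | hh | hh
            · exact absurd j2 (nonf j j1 hh)
            · exact hh
            · exact absurd hnf (j3 _ hlt hh)
          subst this
          simp only [Nat.add_sub_cancel] at j4
          rw [F.Rr (q (k+1)), iw_rot, j4]
        · rw [comp3 (k+1) hi ht, comp3 k (by omega) (hrs ▸ ht)]
          have : q (k+1) ≠ φ (q k) := by
            intro hh; apply ht; rw [htf]
            exact ⟨k+1, hlt, hnf, nonf, by simpa using hh⟩
          have := (nx k hi).resolve_left this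
          rw [← F.Rr, this, F.αα, papply_inv]
      · obtain ⟨e1, e2⟩ := nx2 k hi hnf
        by_cases ht : tf (rs (k+1))
        · rw [comp2 (k+1) hi ht, comp2 k (by omega) (hrs ▸ ht), F.Rr (q (k+1)), iw_rot, e1]
        · rw [comp3 (k+1) hi ht, comp3 k (by omega) (hrs ▸ ht), ← F.Rr, e2, F.αα, papply_inv]
    · have hby : ¬ Z (β y) := by rw [← h4, B.Zφ]; exact hb
      rw [comp1 _ hb, comp1 _ hby, h4, B.Rr _ hby (hN _), iw_rot]
  have Zpow : ∀ d, ¬ Z d → ∀ i : ℕ, ¬ Z ((ψ ^ i) d) := by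
    intro d hd i
    have := B.Zz d (i : ℤ); rw [zpow_natCast] at this; rwa [this]
  haveI : Nonempty D := ⟨z 0⟩
  have gb := B.GB H mark (by
    intro d hd
    rw [B.Rp d hd (hN d)]
    refine face_marks h ψ rwD d (B.Rm d hd (hN d)) (fun i => B.rwpow hd (hN d) i) ?_ comp mark
      (fun i => hc1 _ (Zpow d hd i)) (fun i => hc2 _ (Zpow d hd i)) (fun i => hc3 _ (Zpow d hd i)) ?_
    · rw [← B.Rp d hd (hN d)]; exact pow_per ψ d
    · intro i hm
      rw [pow_succ', Perm.mul_apply] at hm ⊢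
      exact hu _ (Zpow d hd i) hm)
  obtain ⟨b, hbdef⟩ : ∃ b : ℕ → ℚ, b = fun i => 6 / (per (ψ * β) (z i) : ℚ) - 3 +
    (if plain i ∧ (i = 0 ∨ M i) then 1 else 0) := ⟨_, rfl⟩
  have bound : ∑ d, (6 / (per (ψ * β) d : ℚ) - 3 +
      (if Z d then 6 / (per ψ d : ℚ) else if mark d then 1 else 0)) ≤ 6 + ∑ i ∈ range n, b i := by
    have hpt : ∀ d, (6 / (per (ψ * β) d : ℚ) - 3 +
      (if Z d then 6 / (per ψ d : ℚ) else if mark d then 1 else 0)) ≤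
      ∑ i ∈ range n, (if d = z i then (6 / (per (ψ * β) (z i) : ℚ) - 3 + 6 / n) else 0) +
      ∑ i ∈ range n, (if d = ψ (β (z i)) then (if plain i ∧ (i = 0 ∨ M i) then (1:ℚ) else 0) else 0) := by
      intro d
      have pos2 : 0 ≤ ∑ i ∈ range n, (if d = ψ (β (z i)) then (if plain i ∧ (i = 0 ∨ M i) then (1:ℚ) else 0) else 0) := by
        apply sum_nonneg; intro i _; split_ifs <;> norm_num
      by_cases hd : Z d
      · obtain ⟨j, hj, rfl⟩ := (hZ d).1 hd
        have : ∑ i ∈ range n, (if z j = z i then (6 / (per (ψ * β) (z i) : ℚ) - 3 + 6 / n) else 0) =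
            6 / (per (ψ * β) (z j) : ℚ) - 3 + 6 / n := by
          rw [sum_eq_single j]
          · simp
          · intro i hi hne; rw [if_neg]; intro hh; exact hne (hinj _ hj _ (mem_range.1 hi) hh).symm
          · intro hh; exact absurd (mem_range.2 hj) hh
        rw [this, if_pos hd, pern j hj]; linarith
      · have : ∑ i ∈ range n, (if d = z i then (6 / (per (ψ * β) (z i) : ℚ) - 3 + 6 / n) else 0) = 0 := by
          apply sum_eq_zero; intro i hi; rw [if_neg]; rintro rfl; exact hd (hZz i (mem_range.1 hi))
        rw [this, if_neg hd, zero_add]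
        by_cases h3 : 3 ≤ per (ψ * β) d
        · have : (6 : ℚ) / (per (ψ * β) d : ℚ) ≤ 2 := by
            rw [div_le_iff₀ (by exact_mod_cast dpos d)]
            have : (3 : ℚ) ≤ per (ψ * β) d := by exact_mod_cast h3
            linarith
          have : (if mark d then (1:ℚ) else 0) ≤ 1 := by split_ifs <;> norm_num
          linarith
        · have h2 : per (ψ * β) d = 2 := by
            have := hdeg1 _ hd; have := dpos d; omega
          rw [h2]
          by_cases hm : mark d
          · obtain ⟨i, hi, h4, h5⟩ := ((hmark d).1 hm).resolve_left h3
            rw [if_pos hm]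
            have : (1:ℚ) ≤ ∑ i ∈ range n, (if d = ψ (β (z i)) then (if plain i ∧ (i = 0 ∨ M i) then (1:ℚ) else 0) else 0) := by
              refine le_trans ?_ (single_le_sum (fun i _ => ?_) (mem_range.2 hi))
              · rw [if_pos h4, if_pos h5]
              · split_ifs <;> norm_num
            norm_num; linarith
          · rw [if_neg hm]; norm_num; exact pos2
    refine (sum_le_sum (fun d _ => hpt d)).trans ?_
    rw [sum_add_distrib, sum_comm, sum_comm (s := univ)]
    simp only [sum_ite_eq', sum_ite_eq, mem_univ, if_true]
    rw [← sum_add_distrib, hbdef]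
    have : (6:ℚ) = ∑ i ∈ range n, (6:ℚ) / n := by
      rw [sum_const, card_range, nsmul_eq_mul]; field_simp
    have e2 : ∀ T : ℚ, ∑ i ∈ range n, (6:ℚ) / n + T ≤ 6 + T := by intro T; rw [← this]
    refine le_trans ?_ (e2 _)
    rw [← sum_add_distrib]
    apply le_of_eq
    apply sum_congr rfl; intro i _; ring
  have b0 : b 0 ≤ 3 := by
    rw [hbdef]; simp only
    by_cases h1 : per (ψ * β) (z 0) = 1
    · rw [if_neg, h1]; norm_num
      intro hh; have := ((hplain 0).1 hh.1).1; omega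
    · have : (6 : ℚ) / (per (ψ * β) (z 0) : ℚ) ≤ 3 := by
        rw [div_le_iff₀ (by exact_mod_cast dpos _)]
        have : (2 : ℚ) ≤ per (ψ * β) (z 0) := by exact_mod_cast (by have := dpos (z 0); omega)
        linarith
      split_ifs <;> linarith
  have bi : ∀ i, i + 1 < n → 2 ≤ per (ψ * β) (z (i+1)) := by
    intro i hi
    by_contra hh
    have h1 := d1 (z (i+1)) (by have := dpos (z (i+1)); omega)
    rw [hz i] at h1
    have h2 := ψ.injective h1
    rw [← hz i] at h2
    have h3 := B.labα (z (i+1))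
    rw [h2, hl i (by omega), hl (i+1) hi] at h3
    apply hb i hi
    rw [h3, li_li]
  have part : ∀ i, i < n → ∑ j ∈ range i, b (j+1) ≤ if ∃ j, rs i < j ∧ j ≤ i ∧ M j then 1 else 0 := by
    intro i
    induction i with
    | zero => intro _; rw [sum_range_zero]; split_ifs <;> norm_num
    | succ i ih =>
      intro hi
      have ih := ih (by omega)
      rw [sum_range_succ]
      have hb1 : b (i+1) = 6 / (per (ψ * β) (z (i+1)) : ℚ) - 3 + (if plain (i+1) ∧ M (i+1) then 1 else 0) := by
        rw [hbdef]; simp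
      by_cases hp : plain (i+1)
      · rw [hb1, ((hplain _).1 hp).1, rs1 i hp]
        by_cases hMi : M (i+1)
        · rw [if_pos ⟨hp, hMi⟩]
          have hno : ¬ ∃ j, rs i < j ∧ j ≤ i ∧ M j := by
            rintro ⟨j', a, a', hMj⟩
            obtain ⟨nj', j, c1, c2, c3⟩ := (hM j').1 hMj
            rw [(rsrun i j' a a').2] at c1
            obtain ⟨t2, e1, e2, e3, e4⟩ := lastP (fun k => nf (q k)) j' (i+1) (by omega) nj'
            obtain ⟨t1, g1, g2, g3, g4⟩ := lastP (fun k => nf (q k)) j t2 (by omega) c3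
            refine no3 t1 t2 (i+1) g2 e2 hi ?_ g3 e3 ((hM _).1 hMi).1 g4 e4
            intro k k1 k2
            exact (rsrun (i+1) k (by rw [rs1 i hp]; omega) k2).1
          rw [if_neg hno] at ih
          rw [if_pos ⟨i+1, by have := rsle i; omega, le_rfl, hMi⟩]
          norm_num; linarith
        · rw [if_neg (fun hh => hMi hh.2)]
          norm_num
          refine ih.trans ?_
          by_cases hh : ∃ j, rs i < j ∧ j ≤ i ∧ M j
          · rw [if_pos hh, if_pos]
            obtain ⟨j, a, b, c⟩ := hh
            exact ⟨j, a, by omega, c⟩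
          · rw [if_neg hh]; split_ifs <;> norm_num
      · rw [hb1, if_neg (fun hh => hp hh.1), if_neg (by rintro ⟨j, a, b, c⟩; rw [rs2 i hp] at a; omega)]
        by_cases h3 : 3 ≤ per (ψ * β) (z (i+1))
        · have : (6 : ℚ) / (per (ψ * β) (z (i+1)) : ℚ) ≤ 2 := by
            rw [div_le_iff₀ (by exact_mod_cast dpos _)]
            have : (3 : ℚ) ≤ per (ψ * β) (z (i+1)) := by exact_mod_cast h3
            linarith
          have : (if ∃ j, rs i < j ∧ j ≤ i ∧ M j then (1:ℚ) else 0) ≤ 1 := by split_ifs <;> norm_num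
          linarith
        · have h2 : per (ψ * β) (z (i+1)) = 2 := by have := bi i hi; omega
          have hZp : Z (ψ (β (z (i+1)))) := by
            by_contra hh; exact hp ((hplain _).2 ⟨h2, hh⟩)
          have h4 := d2 _ h2
          rw [hz i] at h4
          have h5 := ψ.injective h4
          rw [← hz i] at h5
          have h6 : Z (β (z i)) := by rw [← h5, ββ]; exact hZp
          rw [h2]
          have hno : ¬ ∃ j, rs i < j ∧ j ≤ i ∧ M j := by
            rintro ⟨j, a, a', -⟩
            have hpi := (rsrun i i (by omega) le_rfl).1
            obtain ⟨k, rfl⟩ : ∃ k, i = k + 1 := ⟨i - 1, by omega⟩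
            exact (pl k hpi).2.2 h6
          rw [if_neg hno] at ih
          norm_num; exact ih
  obtain ⟨k, rfl⟩ : ∃ k, n = k + 1 := ⟨n - 1, by omega⟩
  have pk := part k (by omega)
  have : (if ∃ j, rs k < j ∧ j ≤ k ∧ M j then (1:ℚ) else 0) ≤ 1 := by split_ifs <;> norm_num
  rw [sum_range_succ'] at bound
  norm_num at gb
  have gb' := gb.trans bound
  linarith

end

end

section
variable {S X : Type*}
variable {Rw : Set (Wd S)}

/-- trivial position data -/
def st1 : S × Bool → Unit → Unit := fun _ _ => ()

theorem HasD.del1 {C n m} {u v : Wd S} {a : S × Bool}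
    (h : HasD Rw st1 0 () (u ++ [a, li a] ++ v) C n m) : HasD Rw st1 0 () (u ++ v) C n m := by
  have h1 := HasD.rot (u ++ [a, li a]) v h
  rw [← List.append_assoc] at h1
  exact HasD.rot v u (HasD.splitN rfl h1)

section
variable {E : Type*} {φ α : Perm E} {lab : E → S × Bool} {rw : E → Wd S} {nf : E → Prop}

theorem FS.tailpath (F : FS Rw φ α lab rw nf) (q : E) : ∃ m, Pth φ α m q (α q) ∧ m.map lab = (rw (α q)).tail := by
  have h6 := F.len6 (α q)
  obtain ⟨k, hk⟩ : ∃ k, (rw (α q)).length = k + 1 := ⟨(rw (α q)).length - 1, by omega⟩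
  refine ⟨(List.range k).map (fun i => (φ ^ i) (φ (α q))), ?_, ?_⟩
  · refine F.pth_congr (FS.sv_symm (FS.sv_pi q)) ?_ (F.pth_face (φ (α q)) k)
    have := F.Rp (α q)
    rw [hk, pow_succ, Perm.mul_apply] at this
    rw [this]; exact FS.sv_refl _
  · apply List.ext_getElem
    · simp; omega
    · intro i h1 h2
      simp at h1 ⊢
      have := F.labs (α q) (i+1) (by omega)
      rw [List.getElem?_eq_getElem (by omega), pow_succ, Perm.mul_apply] at this
      simpa using this.symm

theorem Flem (h : SC Rw) (F : FS Rw φ α lab rw nf) : ∀ (n k : ℕ) (l : List E) (d d' : E) C m, l.length = k →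
    HasD Rw st1 0 () (l.map lab) C n m → Pth φ α l d d' → SV φ α d d' := by
  intro n
  induction n using Nat.strong_induction_on with
  | _ n IHn =>
  intro k
  induction k using Nat.strong_induction_on with
  | _ k IHk =>
  intro l d d' C m hlk hD hp
  by_contra hcon
  obtain ⟨n', hn', hD'⟩ := HasD.reduce h (fun _ _ => rfl) _ _ _ le_rfl hD
  obtain ⟨D, _, ψ, β, labD, pos, Z, N, rwD, sp, B, H, h1, h2, h3, h4, h5, h6, h7, h8, h9⟩ := hD'
  have hnn : n' = n := by
    rcases lt_or_eq_of_le hn' with hlt | he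
    · exact absurd (IHn n' hlt _ l d d' C _ rfl ⟨D, inferInstance, ψ, β, labD, pos, Z, N, rwD, sp, B, H, h1, h2, h3, h4, h5, h6, h7, rfl⟩ hp) hcon
    · exact he
  subst hnn
  have hlen : sp.length = l.length := by have := congrArg List.length h4; simpa using this
  have hl0 : 0 < l.length := by
    rcases l with _ | ⟨a, l⟩
    · exact absurd hp hcon
    · simp
  obtain ⟨x0, hx0⟩ : ∃ x0, x0 = sp[0]'(by omega) := ⟨_, rfl⟩
  have hget : ∀ i (hi : i < sp.length), (ψ ^ i) x0 = sp[i] := by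
    intro i hi; rw [hx0]
    have := cyc_get_pow h3 0 (by omega) i
    simp only [zero_add, Nat.mod_eq_of_lt hi] at this
    exact this
  have hget' : ∀ i (hi : i < l.length), l.getD i d = l[i] := by
    intro i hi; simp [List.getD, hi]
  have hlabs : ∀ i (hi : i < l.length), labD (sp[i]'(by omega)) = lab l[i] := by
    intro i hi
    have : (sp.map labD)[i]'(by simp; omega) = (l.map lab)[i]'(by simp; omega) := by simp only [h4]
    simpa using this
  -- replacement
  have rep : ∀ i (hi : i < l.length), ¬ Z (β (sp[i]'(by omega))) → ∀ mm, Pth φ α mm l[i] (α l[i]) →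
      mm.map lab = (rwD (β (sp[i]'(by omega)))).tail → False := by
    intro i hi hz mm hm1 hm2
    have hdr : sp.rotate i = sp[i]'(by omega) :: (sp.drop (i+1) ++ sp.take i) := by
      rw [List.rotate_eq_drop_append_take (by omega), List.drop_eq_getElem_cons (by omega)]; rfl
    obtain ⟨C', n'', m', hlt, hD2⟩ := merge (st := st1) h B H (sp[i]'(by omega)) (sp.drop (i+1) ++ sp.take i)
      (by rw [← hdr]; exact List.nodup_rotate.2 h1) (by intro y; rw [← hdr, List.mem_rotate]; exact h2 y)
      (by rw [← hdr, List.map_rotate, h3, List.rotate_rotate, List.rotate_rotate, add_comm]) hz (h8 _) ()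
    rw [h7] at hlt
    have hsplit : l = l.take i ++ l[i] :: l.drop (i+1) := by
      rw [← List.drop_eq_getElem_cons hi, List.take_append_drop]
    have e1 : (sp.drop (i+1) ++ sp.take i).map labD = (l.drop (i+1)).map lab ++ (l.take i).map lab := by
      rw [List.map_append, List.map_drop, List.map_take, h4, List.map_drop, List.map_take]
    rw [e1, ← hm2, List.append_assoc] at hD2
    have hD3 := HasD.rot _ _ hD2
    have hp' := hp
    rw [hsplit, F.pth_append] at hp'
    obtain ⟨e, p1, p2, p3⟩ := hp'
    apply hcon
    refine IHn n'' hlt _ (l.take i ++ mm ++ l.drop (i+1)) d d' C' m' rfl ?_ ?_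
    · rw [List.map_append, List.map_append]; exact hD3
    · rw [F.pth_append]
      refine ⟨α l[i], ?_, p3⟩
      rw [F.pth_append]
      exact ⟨e, p1, F.pth_congr (FS.sv_symm p2) (FS.sv_refl _) hm1⟩
  have two : ∀ i (hi : i + 1 < l.length), SV φ α (α l[i]) l[i+1] ∧ lab l[i+1] ≠ li (lab l[i]) := by
    intro i hi
    have hsplit : l = l.take i ++ l[i] :: l[i+1] :: l.drop (i+2) := by
      rw [← List.drop_eq_getElem_cons hi, ← List.drop_eq_getElem_cons (by omega), List.take_append_drop]
    have hp' := hp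
    rw [hsplit, F.pth_append] at hp'
    obtain ⟨e, p1, p2, p3, p4⟩ := hp'
    refine ⟨p3, fun hl => ?_⟩
    have : α l[i] = l[i+1] := F.sv_lab h p3 (by rw [F.labα, hl])
    apply hcon
    refine IHk (l.take i ++ l.drop (i+2)).length ?_ (l.take i ++ l.drop (i+2)) d d' C (Fintype.card D) rfl ?_ ?_
    · simp; omega
    · rw [List.map_append]
      apply HasD.del1 (a := lab l[i])
      have : (l.take i).map lab ++ [lab l[i], li (lab l[i])] ++ (l.drop (i+2)).map lab = l.map lab := by
        have h0 := congrArg (List.map lab) hsplit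
        rw [List.map_append, List.map_cons, List.map_cons, hl] at h0
        rw [h0]
        simp only [List.append_assoc, List.cons_append, List.nil_append]
      rw [this]; exact ⟨D, inferInstance, ψ, β, labD, pos, Z, N, rwD, sp, B, H, h1, h2, h3, h4, h5, h6, h7, rfl⟩
    · rw [F.pth_append]
      refine ⟨e, p1, F.pth_congr ?_ (FS.sv_refl _) p4⟩
      rw [← this, F.αα]
      exact FS.sv_symm p2
  refine Fcore h F B H h8 h9 (fun i => (ψ ^ i) x0) l.length hl0 (fun i => by rw [pow_succ', Perm.mul_apply]) ?_ ?_ ?_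
    (fun i => l.getD i d) ?_ ?_ ?_ ?_ ?_
  · have := cyc_per h1 h3 (show x0 ∈ sp by rw [hx0]; exact List.getElem_mem _)
    rw [← hlen, ← this]; exact pow_per ψ x0
  · intro i hi j hj hij
    rw [hget i (by omega), hget j (by omega)] at hij
    exact (List.Nodup.getElem_inj_iff h1).1 hij
  · intro y
    rw [h2, List.mem_iff_getElem]
    constructor
    · rintro ⟨i, hi, rfl⟩; exact ⟨i, by omega, (hget i hi).symm⟩
    · rintro ⟨i, hi, rfl⟩; exact ⟨i, by omega, (hget i (by omega)).symm⟩
  · intro i hi; rw [hget i (by omega), hget' i hi, hlabs i hi]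
  · intro i hi; rw [hget' i (by omega), hget' _ hi]; exact (two i hi).1
  · intro i hi; rw [hget' i (by omega), hget' _ hi]; exact (two i hi).2
  · intro i hi hz he
    rw [hget i (by omega)] at hz he
    rw [hget' i hi] at he
    obtain ⟨mm, m1, m2⟩ := F.tailpath l[i]
    exact rep i hi hz mm m1 (by rw [m2, he])
  · intro i hi hz he
    rw [hget i (by omega)] at hz he
    rw [hget' i hi] at he
    obtain ⟨mm, m1, m2⟩ := (F.mirror h).tailpath l[i]
    rw [F.mirror_pth] at m1
    rw [F.αα] at m2
    exact rep i hi hz mm m1 (by rw [m2, he])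

/-- closed words on a flat structure are closed paths -/
theorem Fthm (h : SC Rw) (F : FS Rw φ α lab rw nf) (l : List E) (d d' : E) (hp : Pth φ α l d d')
    (hl : FreeGroup.mk (l.map lab) ∈ Subgroup.normalClosure (FreeGroup.mk '' Rw)) : SV φ α d d' := by
  obtain ⟨ls, hls, hc⟩ := exists_ls h hl
  obtain ⟨⟨n, m, hD⟩, -⟩ := fill (st := st1) (x0 := ()) h (fun _ _ => rfl) (fun _ _ _ => rfl) ls hls hc.symm
  exact Flem h F n _ l d d' _ m rfl hD hp
end

/-- value of a letter -/
def gl {G : Type*} [Group G] (ι : FreeGroup S →* G) (a : S × Bool) : G := ι (FreeGroup.mk [a])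

section
variable {G : Type*} [Group G] {ι : FreeGroup S →* G}

theorem gl_li (a : S × Bool) : gl ι a * gl ι (li a) = 1 := by
  rw [gl, gl, ← map_mul, FreeGroup.mul_mk]
  have : FreeGroup.mk ([a] ++ [li a]) = (1 : FreeGroup S) := by
    have := FreeGroup.Red.Step.not (L₁ := []) (L₂ := []) (x := a.1) (b := a.2)
    have := FreeGroup.Red.exact.2 ⟨_, Relation.ReflTransGen.single this, Relation.ReflTransGen.refl⟩
    simpa [li, FreeGroup.one_eq_mk] using this
  rw [this, map_one]

theorem gl_cons (a : S × Bool) (l : Wd S) : ι (FreeGroup.mk (a :: l)) = gl ι a * ι (FreeGroup.mk l) := by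
  rw [gl, ← map_mul, FreeGroup.mul_mk]; rfl

theorem gl_app (l l' : Wd S) : ι (FreeGroup.mk (l ++ l')) = ι (FreeGroup.mk l) * ι (FreeGroup.mk l') := by
  rw [← map_mul, FreeGroup.mul_mk]

theorem gl_nil : ι (FreeGroup.mk []) = 1 := map_one ι

/-- perm lifted to a skew product -/
def skew {D : Type*} (φ : Perm D) (c : D → G) : Perm (D × G) where
  toFun e := (φ e.1, e.2 * c e.1)
  invFun e := (φ⁻¹ e.1, e.2 * (c (φ⁻¹ e.1))⁻¹)
  left_inv e := by simp
  right_inv e := by simp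

theorem skew_apply {D : Type*} (φ : Perm D) (c : D → G) (e : D × G) : skew φ c e = (φ e.1, e.2 * c e.1) := rfl

theorem skew_fst {D : Type*} (φ : Perm D) (c : D → G) (i : ℕ) (e : D × G) : ((skew φ c ^ i) e).1 = (φ ^ i) e.1 := by
  induction i with
  | zero => rfl
  | succ n ih => rw [pow_succ', pow_succ', Perm.mul_apply, Perm.mul_apply, skew_apply]; simp [ih]

variable {D : Type*} {φ α : Perm D} {lab : D → S × Bool} {rw : D → Wd S} {nf : D → Prop}

theorem FS.skew_snd (F : FS Rw φ α lab rw nf) (e : D × G) (i : ℕ) (hi : i ≤ (rw e.1).length) :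
    ((skew φ (fun d => gl ι (lab d)) ^ i) e).2 = e.2 * ι (FreeGroup.mk ((rw e.1).take i)) := by
  induction i with
  | zero => simp [gl_nil]
  | succ n ih =>
    rw [pow_succ', Perm.mul_apply, skew_apply]
    simp only [skew_fst]
    rw [ih (by omega), List.take_add_one, F.labs _ n (by omega), gl_app, mul_assoc]
    rfl

/-- lift to the group -/
theorem FS.lift (F : FS Rw φ α lab rw nf) (hR : ∀ r ∈ Rw, ι (FreeGroup.mk r) = 1) :
    FS Rw (skew φ (fun d => gl ι (lab d))) (skew α (fun d => gl ι (lab d)))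
      (fun e => lab e.1) (fun e => rw e.1) (fun e => nf e.1) := by
  have key : ∀ e : D × G, skew φ (fun d => gl ι (lab d)) (skew α (fun d => gl ι (lab d)) e) = (φ (α e.1), e.2) := by
    intro e; simp only [skew_apply]; rw [F.labα, mul_assoc, gl_li, mul_one]
  refine ⟨?_, fun e => F.labα _, fun e => F.Rm _, fun e => F.Rh _, fun e => F.Rr _, ?_, ?_, ?_, ?_, ?_, ?_⟩
  · intro e; simp only [skew_apply]; rw [F.labα, mul_assoc, gl_li, mul_one, F.αα]
  · intro e
    refine Prod.ext ?_ ?_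
    · rw [skew_fst]; exact F.Rp _
    · rw [F.skew_snd e _ le_rfl, List.take_length, hR _ (F.Rm _), mul_one]
  · intro e; rw [key]; exact F.nα _
  · intro e h; rw [key, key]; exact Prod.ext (F.v2 _ h) rfl
  · intro e h; rw [key, key, key]; exact Prod.ext (F.v3 _ h) rfl
  · intro e; rw [← F.six e.1]; congr 1; ext i; simp only [skew_fst, mem_filter]
  · intro e; rw [key]; exact F.ne _
end

/-- reachability -/
def Reach {E : Type*} (φ α : Perm E) : E → E → Prop :=
  Relation.ReflTransGen (fun e e' => e' = φ e ∨ e' = α e)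

section
variable {E : Type*} {φ α : Perm E} {lab : E → S × Bool} {rw : E → Wd S} {nf : E → Prop}

theorem Reach.stφ {e e' : E} (h : Reach φ α e e') : Reach φ α e (φ e') := h.tail (Or.inl rfl)
theorem Reach.stα {e e' : E} (h : Reach φ α e e') : Reach φ α e (α e') := h.tail (Or.inr rfl)
theorem Reach.pow {e e' : E} (h : Reach φ α e e') (i : ℕ) : Reach φ α e ((φ ^ i) e') := by
  induction i with
  | zero => exact h
  | succ n ih => rw [pow_succ', Perm.mul_apply]; exact Reach.stφ ih

theorem FS.reach_symm (F : FS Rw φ α lab rw nf) {e e' : E} (h : Reach φ α e e') : Reach φ α e' e := by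
  induction h with
  | refl => exact Relation.ReflTransGen.refl
  | @tail b c hb hc ih =>
    refine Relation.ReflTransGen.trans ?_ ih
    rcases hc with rfl | rfl
    · have h6 := F.len6 b
      have : b = (φ ^ ((rw b).length - 1)) (φ b) := by
        rw [← Perm.mul_apply, ← pow_succ, Nat.sub_add_cancel (by omega), F.Rp]
      conv_rhs => rw [this]
      exact Reach.pow Relation.ReflTransGen.refl _
    · have := Reach.stα (φ := φ) (α := α) (e := α b) (e' := α b) Relation.ReflTransGen.refl
      rwa [F.αα] at this

theorem FS.reach_pth (F : FS Rw φ α lab rw nf) {e e' : E} (h : Reach φ α e e') {G : Type*} [Group G] {ι : FreeGroup S →* G}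
    (gg : E → G) (gφ : ∀ d, gg (φ d) = gg d * gl ι (lab d)) (gα : ∀ d, gg (α d) = gg d * gl ι (lab d)) :
    ∃ l, Pth φ α l e e' ∧ gg e' = gg e * ι (FreeGroup.mk (l.map lab)) := by
  induction h with
  | refl => exact ⟨[], FS.sv_refl _, by simp [gl_nil]⟩
  | @tail b c hb hc ih =>
    obtain ⟨l, h1, h2⟩ := ih
    refine ⟨l ++ [b], F.pth_append.2 ⟨b, h1, FS.sv_refl _, ?_⟩, ?_⟩
    · rcases hc with rfl | rfl
      · have := FS.sv_pi (φ := φ) (α := α) (α b)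
        rwa [F.αα] at this
      · exact FS.sv_refl _
    · rw [List.map_append, gl_app, ← mul_assoc, ← h2]
      rcases hc with rfl | rfl
      · exact gφ b
      · exact gα b

theorem FS.reach_inj (h : SC Rw) (F : FS Rw φ α lab rw nf) {G : Type*} [Group G] {ι : FreeGroup S →* G}
    (hk : ∀ g, ι g = 1 → g ∈ Subgroup.normalClosure (FreeGroup.mk '' Rw))
    (gg : E → G) (gφ : ∀ d, gg (φ d) = gg d * gl ι (lab d)) (gα : ∀ d, gg (α d) = gg d * gl ι (lab d))
    {e e' : E} (hr : Reach φ α e e') (hg : gg e = gg e') (hl : lab e = lab e') : e = e' := by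
  obtain ⟨l, h1, h2⟩ := F.reach_pth hr gg gφ gα
  refine F.sv_lab h (Fthm h F l e e' h1 (hk _ ?_)) hl
  rw [← hg] at h2
  exact left_eq_mul.1 h2
end

section area
variable {G : Type*} [Group G] (ι : FreeGroup S →* G) (T H : G → ℚ)

/-- twice the area swept by a path -/
noncomputable def ar : Wd S → G → ℚ
  | [], _ => 0
  | a :: l, g => (T g + T (g * gl ι a)) * (H (g * gl ι a) - H g) + ar l (g * gl ι a)

theorem ar_append (l l' : Wd S) (g : G) :
    ar ι T H (l ++ l') g = ar ι T H l g + ar ι T H l' (g * ι (FreeGroup.mk l)) := by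
  induction l generalizing g with
  | nil => simp [ar, gl_nil]
  | cons a l ih => rw [List.cons_append, ar, ar, ih, gl_cons, mul_assoc]; ring

/-- area on the free group -/
noncomputable def arF (g : G) : FreeGroup S → ℚ :=
  Quot.lift (fun l => ar ι T H l g) (by
    rintro _ _ ⟨⟩
    rename_i L1 L2 x b
    show ar ι T H _ g = ar ι T H _ g
    rw [ar_append, ar_append]
    congr 1
    have : gl ι (x, b) * gl ι (x, !b) = 1 := gl_li (ι := ι) (x, b)
    simp only [ar]
    have e : g * ι (FreeGroup.mk L1) * gl ι (x, b) * gl ι (x, !b) = g * ι (FreeGroup.mk L1) := by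
      rw [mul_assoc, this, mul_one]
    rw [e]
    ring)

theorem arF_mk (g : G) (l) : arF ι T H g (FreeGroup.mk l) = ar ι T H l g := rfl

theorem arF_mul (g : G) (u v : FreeGroup S) : arF ι T H g (u * v) = arF ι T H g u + arF ι T H (g * ι u) v := by
  induction u using Quot.inductionOn with | _ u
  induction v using Quot.inductionOn with | _ v
  exact ar_append ι T H u v g

theorem arF_one (g : G) : arF ι T H g 1 = 0 := rfl

theorem arF_inv (g : G) (u : FreeGroup S) : arF ι T H (g * ι u) u⁻¹ = - arF ι T H g u := by
  have := arF_mul ι T H g u u⁻¹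
  rw [mul_inv_cancel, arF_one] at this
  linarith

theorem arF_conj (g : G) (a u : FreeGroup S) (hu : ι u = 1) :
    arF ι T H g (a * u * a⁻¹) = arF ι T H (g * ι a) u := by
  rw [arF_mul, arF_mul, map_mul, hu, mul_one, arF_inv]; ring

theorem arF_tr (lam g : G) (t h : ℚ) (hT : ∀ g, T (lam * g) = t + T g) (hH : ∀ g, H (lam * g) = h + H g)
    (u : FreeGroup S) : arF ι T H (lam * g) u = arF ι T H g u + 2 * t * (H (g * ι u) - H g) := by
  induction u using Quot.inductionOn with | _ u
  show ar ι T H u (lam * g) = ar ι T H u g + 2 * t * (H (g * ι (FreeGroup.mk u)) - H g)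
  induction u generalizing g with
  | nil => simp [ar, gl_nil]
  | cons a l ih =>
    rw [ar, ar, gl_cons, mul_assoc, ih, hT, hT, hH, hH, ← mul_assoc]
    ring

theorem arF_cprod (ls : List (Wd S × Wd S)) (hls : ∀ p ∈ ls, ι (FreeGroup.mk p.2) = 1) (g : G) :
    ι (cprod ls) = 1 ∧
    arF ι T H g (cprod ls) = (ls.map fun p => arF ι T H (g * ι (FreeGroup.mk p.1)) (FreeGroup.mk p.2)).sum := by
  induction ls with
  | nil => exact ⟨map_one _, rfl⟩
  | cons p ls ih =>
    have hp := hls p (by simp)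
    obtain ⟨i1, i2⟩ := ih (fun q hq => hls q (by simp [hq]))
    have e : cprod (p :: ls) = FreeGroup.mk p.1 * FreeGroup.mk p.2 * (FreeGroup.mk p.1)⁻¹ * cprod ls := by
      simp [cprod]
    have e1 : ι (FreeGroup.mk p.1 * FreeGroup.mk p.2 * (FreeGroup.mk p.1)⁻¹) = 1 := by
      rw [map_mul, map_mul, hp, map_inv]; group
    constructor
    · rw [e, map_mul, i1, mul_one, e1]
    · rw [e, arF_mul, e1, mul_one, i2, arF_conj _ _ _ _ _ _ hp, List.map_cons, List.sum_cons]

theorem arF_comm (u v : FreeGroup S) (huv : ι u * ι v = ι v * ι u) (t1 t2 h1 h2 : ℚ)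
    (hT1 : ∀ g, T (ι u * g) = t1 + T g) (hT2 : ∀ g, T (ι v * g) = t2 + T g)
    (hH1 : ∀ g, H (ι u * g) = h1 + H g) (hH2 : ∀ g, H (ι v * g) = h2 + H g) :
    arF ι T H 1 (u * v * u⁻¹ * v⁻¹) = 2 * (t1 * h2 - t2 * h1) := by
  have e1 : (1 : G) * ι (u * v) = ι v * ι u := by rw [map_mul, one_mul, huv]
  have e2 : (1 : G) * ι (u * v * u⁻¹) = 1 * ι v := by rw [map_mul, map_mul, map_inv, huv]; group
  rw [arF_mul, arF_mul, arF_mul, e1, arF_inv, e2, arF_inv, one_mul]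
  have a := arF_tr ι T H (ι u) 1 t1 h1 hT1 hH1 v
  have b := arF_tr ι T H (ι v) 1 t2 h2 hT2 hH2 u
  rw [mul_one] at a b
  rw [a, b]
  have c1 := hH1 1
  have c2 := hH2 1
  rw [mul_one] at c1 c2
  rw [one_mul, one_mul, c1, c2]
  ring
end area

/-- consistent sections over cycles -/
theorem section_exists {D E : Type*} (φ : Perm D) (ψ : Perm E) (π : E → D) (hπ : ∀ e, π (ψ e) = φ (π e))
    (hz : ∀ (n : ℤ) e, (φ ^ n) (π e) = π e → (ψ ^ n) e = e) (K : E → Prop) (hK : ∀ e (n : ℤ), K e → K ((ψ ^ n) e))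
    (s0 : ∀ d, ∃ e, π e = d ∧ K e) : ∃ s : D → E, (∀ d, π (s d) = d) ∧ (∀ d, s (φ d) = ψ (s d)) ∧ ∀ d, K (s d) := by
  choose s h1 h2 using s0
  have hπz : ∀ (n : ℤ) e, π ((ψ ^ n) e) = (φ ^ n) (π e) := by
    intro n
    induction n using Int.induction_on with
    | zero => intro e; rfl
    | succ n ih => intro e; rw [zpow_add_one, zpow_add_one, Perm.mul_apply, Perm.mul_apply, ih, hπ]
    | pred n ih =>
      intro e
      rw [zpow_sub_one, zpow_sub_one, Perm.mul_apply, Perm.mul_apply, ih]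
      congr 1
      rw [Perm.eq_inv_iff_eq, ← hπ, papply_inv]
  let r : D → D := fun d => (Quotient.mk (Perm.SameCycle.setoid φ) d).out
  have hr : ∀ d, φ.SameCycle (r d) d := fun d => Quotient.exact (s := Perm.SameCycle.setoid φ) (Quotient.out_eq _)
  have hr' : ∀ d, r (φ d) = r d := by
    intro d
    show (Quotient.mk _ _).out = (Quotient.mk _ _).out
    congr 1
    exact Quotient.sound (s := Perm.SameCycle.setoid φ) (⟨-1, by simp⟩ : φ.SameCycle (φ d) d)
  choose n hn using hr
  refine ⟨fun d => (ψ ^ n d) (s (r d)), ?_, ?_, fun d => hK _ _ (h2 _)⟩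
  · intro d; rw [hπz, h1, hn]
  · intro d
    show (ψ ^ n (φ d)) (s (r (φ d))) = ψ ((ψ ^ n d) (s (r d)))
    have a := hn (φ d)
    rw [hr'] at a ⊢
    rw [← Perm.mul_apply, ← zpow_one_add]
    have : (ψ ^ (-(1 + n d) + n (φ d))) (s (r d)) = s (r d) := by
      apply hz
      rw [h1, zpow_add, Perm.mul_apply, a, zpow_neg, Perm.inv_eq_iff_eq, zpow_add, Perm.mul_apply, hn, zpow_one]
    rw [zpow_add, Perm.mul_apply, zpow_neg, Perm.inv_eq_iff_eq] at this
    exact this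

section lat
variable {G : Type*} [Group G]

/-- free abelian pairs -/
structure Lat (x y : G) : Prop where
  comm : Commute x y
  free : ∀ i j : ℤ, x ^ i * y ^ j = 1 → i = 0 ∧ j = 0

def lam (x y : G) (i j : ℤ) : G := x ^ i * y ^ j

variable {x y : G}

theorem Lat.lam_mul (h : Lat x y) (i j i' j' : ℤ) : lam x y i j * lam x y i' j' = lam x y (i + i') (j + j') := by
  unfold lam
  rw [zpow_add, zpow_add]
  have := (h.comm.symm.zpow_zpow j i').eq
  rw [mul_assoc, ← mul_assoc (y ^ j), this]; group

theorem Lat.lam_inv (h : Lat x y) (i j : ℤ) : lam x y (-i) (-j) * lam x y i j = 1 := by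
  rw [h.lam_mul]; simp [lam]

theorem Lat.lam_inj (h : Lat x y) {i j i' j' : ℤ} {g : G} (e : lam x y i j * g = lam x y i' j' * g) : i = i' ∧ j = j' := by
  have e := mul_right_cancel e
  have : lam x y (i' + -i) (j' + -j) = 1 := by
    rw [← h.lam_mul, ← e, h.lam_mul]; simp [lam]
  have := h.free _ _ this
  omega

/-- the orbit relation -/
def latSetoid (h : Lat x y) : Setoid G where
  r g g' := ∃ i j, g' = lam x y i j * g
  iseqv := by
    refine ⟨fun g => ⟨0, 0, by simp [lam]⟩, ?_, ?_⟩
    · rintro g g' ⟨i, j, rfl⟩; exact ⟨-i, -j, by rw [← mul_assoc, h.lam_inv, one_mul]⟩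
    · rintro g g' g'' ⟨i, j, rfl⟩ ⟨i', j', rfl⟩; exact ⟨i' + i, j' + j, by rw [← h.lam_mul, mul_assoc]⟩

/-- orbit space -/
def LX (h : Lat x y) : Type _ := Quotient (latSetoid h)

def cls (h : Lat x y) (g : G) : LX h := Quotient.mk (latSetoid h) g

theorem cls_eq (h : Lat x y) {g g' : G} : cls h g = cls h g' ↔ ∃ i j, g' = lam x y i j * g :=
  ⟨fun e => Quotient.exact e, fun e => Quotient.sound e⟩

theorem cls_surj (h : Lat x y) (p : LX h) : ∃ g, cls h g = p := Quotient.exists_rep p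

variable (ι : FreeGroup S →* G)

def lst (h : Lat x y) (a : S × Bool) : LX h → LX h :=
  Quotient.map (fun g => g * gl ι a) (by rintro g g' ⟨i, j, rfl⟩; exact ⟨i, j, mul_assoc _ _ _⟩)

theorem lst_cls (h : Lat x y) (a : S × Bool) (g : G) : lst ι h a (cls h g) = cls h (g * gl ι a) := rfl

theorem lrun_cls (h : Lat x y) (l : Wd S) (g : G) : run (lst ι h) l (cls h g) = cls h (g * ι (FreeGroup.mk l)) := by
  induction l generalizing g with
  | nil => simp [run, gl_nil]
  | cons a l ih => rw [run, lst_cls, ih, gl_cons, mul_assoc]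

theorem lhst (h : Lat x y) (a : S × Bool) (p : LX h) : lst ι h (li a) (lst ι h a p) = p := by
  obtain ⟨g, rfl⟩ := cls_surj h p
  rw [lst_cls, lst_cls, mul_assoc, gl_li, mul_one]

theorem lat_coord (h : Lat x y) : ∃ p q : G → ℤ, ∀ i j g, p (lam x y i j * g) = i + p g ∧ q (lam x y i j * g) = j + q g := by
  have : ∀ g, ∃ i j, g = lam x y i j * (cls h g).out := by
    intro g
    apply (cls_eq h).1
    exact Quotient.out_eq _
  choose p q hpq using this
  refine ⟨p, q, fun i j g => ?_⟩
  have e := hpq (lam x y i j * g)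
  have e1 : cls h (lam x y i j * g) = cls h g := ((cls_eq h).2 ⟨i, j, rfl⟩).symm
  rw [e1] at e
  have e2 : lam x y i j * g = lam x y (i + p g) (j + q g) * (cls h g).out := by
    rw [← h.lam_mul, mul_assoc, ← hpq g]
  have := h.lam_inj (e.symm.trans e2)
  exact this

open Classical in
/-- area function on faces -/
noncomputable def fA (h : Lat x y) (T H : G → ℚ) : LX h → Wd S → ℚ :=
  fun p r => if ι (FreeGroup.mk r) = 1 then arF ι T H p.out (FreeGroup.mk r) / r.length else 0

theorem fA_cls (h : Lat x y) {T H : G → ℚ} {th et : ℤ → ℤ → ℚ} (hT : ∀ i j g, T (lam x y i j * g) = th i j + T g)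
    (hH : ∀ i j g, H (lam x y i j * g) = et i j + H g) (g : G) (r) (hr : ι (FreeGroup.mk r) = 1) :
    fA ι h T H (cls h g) r = arF ι T H g (FreeGroup.mk r) / r.length := by
  obtain ⟨i, j, e⟩ := (cls_eq h (g := g) (g' := (cls h g).out)).1 (Quotient.out_eq _).symm
  rw [fA, if_pos hr, e, arF_tr ι T H _ g _ _ (hT i j) (hH i j), hr, mul_one]
  ring

theorem fA_anti (h : Lat x y) {T H : G → ℚ} {th et : ℤ → ℤ → ℚ} (hT : ∀ i j g, T (lam x y i j * g) = th i j + T g)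
    (hH : ∀ i j g, H (lam x y i j * g) = et i j + H g) : Anti (lst ι h) (fA ι h T H) := by
  intro p a t
  obtain ⟨g, rfl⟩ := cls_surj h p
  have e1 : ι (FreeGroup.mk (iw (t ++ [a]))) = (ι (FreeGroup.mk t) * gl ι a)⁻¹ := by
    rw [mk_iw, map_inv, gl_app]; rfl
  have e2 : ι (FreeGroup.mk (a :: t)) = gl ι a * ι (FreeGroup.mk t) := gl_cons _ _
  by_cases hr : ι (FreeGroup.mk (a :: t)) = 1
  · have hr2 : ι (FreeGroup.mk t) * gl ι a = 1 := by
      rw [e2] at hr; rw [mul_eq_one_iff_eq_inv] at hr ⊢; rw [hr, inv_inv]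
    have hr3 : ι (FreeGroup.mk (iw (t ++ [a]))) = 1 := by rw [e1, hr2, inv_one]
    rw [lst_cls, fA_cls ι h hT hH _ _ hr, fA_cls ι h hT hH _ _ hr3, mk_iw]
    have l : (iw (t ++ [a])).length = (a :: t).length := by rw [iw_length]; simp
    rw [l]
    have e3 : ι (FreeGroup.mk (t ++ [a])) = 1 := by rw [gl_app]; exact hr2
    have := arF_inv ι T H (g * gl ι a) (FreeGroup.mk (t ++ [a]))
    rw [e3, mul_one] at this
    rw [this]
    have e4 : FreeGroup.mk (a :: t) = FreeGroup.mk [a] * FreeGroup.mk (t ++ [a]) * (FreeGroup.mk [a])⁻¹ := by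
      rw [← FreeGroup.mul_mk (L₁ := t), ← mul_assoc, mul_inv_cancel_right, FreeGroup.mul_mk]; rfl
    rw [e4, arF_conj _ _ _ _ _ _ e3, neg_div]; rfl
  · have hr3 : ¬ ι (FreeGroup.mk (iw (t ++ [a]))) = 1 := by
      rw [e1, inv_eq_one]; rw [e2] at hr
      intro h; apply hr; rw [mul_eq_one_iff_eq_inv] at h ⊢; rw [h, inv_inv]
    simp only [fA, if_neg hr, if_neg hr3, neg_zero]

theorem fA_fc (h : Lat x y) {T H : G → ℚ} {th et : ℤ → ℤ → ℚ} (hT : ∀ i j g, T (lam x y i j * g) = th i j + T g)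
    (hH : ∀ i j g, H (lam x y i j * g) = et i j + H g) (g : G) (r) (hr : ι (FreeGroup.mk r) = 1) (h0 : r ≠ []) :
    fc (lst ι h) (fA ι h T H) (cls h g) r = arF ι T H g (FreeGroup.mk r) := by
  have : ∀ i ∈ range r.length, fA ι h T H (run (lst ι h) (r.take i) (cls h g)) (r.rotate i) = arF ι T H g (FreeGroup.mk r) / r.length := by
    intro i hi
    rw [mem_range] at hi
    have e : r.rotate i = r.drop i ++ r.take i := List.rotate_eq_drop_append_take (by omega)
    have e0 : FreeGroup.mk r = FreeGroup.mk (r.take i) * FreeGroup.mk (r.drop i) := by rw [FreeGroup.mul_mk, List.take_append_drop]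
    have e1 : FreeGroup.mk r = FreeGroup.mk (r.take i) * FreeGroup.mk (r.rotate i) * (FreeGroup.mk (r.take i))⁻¹ := by
      rw [e, ← FreeGroup.mul_mk, e0]; group
    have e2 : ι (FreeGroup.mk (r.rotate i)) = 1 := by
      have := congrArg ι e1
      rw [hr, map_mul, map_mul, map_inv, eq_comm, mul_inv_eq_one, mul_eq_left] at this
      exact this
    rw [lrun_cls, fA_cls ι h hT hH _ _ e2, e1, arF_conj _ _ _ _ _ _ e2, List.length_rotate]
  rw [fc, sum_congr rfl this, sum_const, card_range, nsmul_eq_mul, mul_div_cancel₀]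
  have := List.length_pos_iff.2 h0
  positivity

theorem fA_cch (h : Lat x y) {T H : G → ℚ} {th et : ℤ → ℤ → ℚ} (hT : ∀ i j g, T (lam x y i j * g) = th i j + T g)
    (hH : ∀ i j g, H (lam x y i j * g) = et i j + H g) (ls : List (Wd S × Wd S))
    (hls : ∀ p ∈ ls, ι (FreeGroup.mk p.2) = 1 ∧ p.2 ≠ []) (u v : FreeGroup S) (hu : ι u = x) (hv : ι v = y)
    (e : cprod ls = u * v * u⁻¹ * v⁻¹) :
    cch (lst ι h) (cls h 1) ls (fA ι h T H) = - (2 * (th 1 0 * et 0 1 - th 0 1 * et 1 0)) := by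
  have a := (arF_cprod ι T H ls (fun p hp => (hls p hp).1) 1).2
  have lx : lam x y 1 0 = x := by simp [lam]
  have ly : lam x y 0 1 = y := by simp [lam]
  have b := arF_comm ι T H u v (by rw [hu, hv]; exact h.comm) (th 1 0) (th 0 1) (et 1 0) (et 0 1)
    (by intro g; rw [hu]; have := hT 1 0 g; rwa [lx] at this)
    (by intro g; rw [hv]; have := hT 0 1 g; rwa [ly] at this)
    (by intro g; rw [hu]; have := hH 1 0 g; rwa [lx] at this)
    (by intro g; rw [hv]; have := hH 0 1 g; rwa [ly] at this)
  rw [← b, ← e, a, cch, List.sum_neg, List.map_map]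
  congr 1
  apply List.map_congr_left
  intro p hp
  obtain ⟨h1, h2⟩ := hls p hp
  rw [lrun_cls, fA_fc ι h hT hH, mk_iw, Function.comp]
  · have := arF_inv ι T H (1 * ι (FreeGroup.mk p.1)) (FreeGroup.mk p.2)
    rwa [h1, mul_one] at this
  · rw [mk_iw, map_inv, h1, inv_one]
  · intro h; apply h2; have := congrArg List.length h; rw [iw_length] at this; exact List.length_eq_zero_iff.1 this

/-- face sums of areas via consistent lifts -/
theorem fA_face {D : Type} {φ α : Perm D} {lab : D → S × Bool} {rw : D → Wd S} {nf : D → Prop}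
    (F : FS Rw φ α lab rw nf) (T H : G → ℚ) (s : D → G) (hs : ∀ d, s (φ d) = s d * gl ι (lab d)) (d : D) :
    ar ι T H (rw d) (s d) = ∑ i ∈ range (rw d).length, (fun d => (T (s d) + T (s (φ d))) * (H (s (φ d)) - H (s d))) ((φ ^ i) d) := by
  have : ∀ (l : Wd S) d, (∀ i (hi : i < l.length), l[i]? = some (lab ((φ ^ i) d))) → ar ι T H l (s d) =
      ∑ i ∈ range l.length, (fun d => (T (s d) + T (s (φ d))) * (H (s (φ d)) - H (s d))) ((φ ^ i) d) := by
    intro l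
    induction l with
    | nil => intro d _; simp [ar]
    | cons a l ih =>
      intro d hd
      have ha : a = lab d := by simpa using hd 0 (by simp)
      rw [List.length_cons, sum_range_succ', ar, ha, ← hs, ih (φ d)]
      · simp only [pow_succ, Perm.mul_apply, pow_zero, Perm.one_apply]
        ring
      · intro i hi
        have := hd (i+1) (by simp; omega)
        rw [pow_succ, Perm.mul_apply] at this
        simpa using this
  exact this _ d (fun i hi => F.labs d i hi)
end lat

section
variable {G : Type*} [Group G] {ι : FreeGroup S →* G}
variable {D : Type} {φ α : Perm D} {lab : D → S × Bool} {rw : D → Wd S} {nf : D → Prop}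

/-- lifted permutations -/
abbrev lift (ι : FreeGroup S →* G) (φ : Perm D) (lab : D → S × Bool) : Perm (D × G) := skew φ (fun d => gl ι (lab d))

theorem reach_tr (h : G) {d d' : D} {g g' : G} (hr : Reach (lift ι φ lab) (lift ι α lab) (d, g) (d', g')) :
    Reach (lift ι φ lab) (lift ι α lab) (d, h * g) (d', h * g') := by
  have : ∀ e e' : D × G, Reach (lift ι φ lab) (lift ι α lab) e e' →
      Reach (lift ι φ lab) (lift ι α lab) (e.1, h * e.2) (e'.1, h * e'.2) := by
    intro e e' hr
    induction hr with
    | refl => exact Relation.ReflTransGen.refl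
    | tail _ hc ih =>
      refine ih.tail ?_
      rcases hc with rfl | rfl
      · left; simp [skew_apply, mul_assoc]
      · right; simp [skew_apply, mul_assoc]
  exact this _ _ hr

theorem reach_lift {d d' : D} (hr : Reach φ α d d') (g : G) :
    ∃ g', Reach (lift ι φ lab) (lift ι α lab) (d, g) (d', g') := by
  induction hr with
  | refl => exact ⟨g, Relation.ReflTransGen.refl⟩
  | tail _ hc ih =>
    obtain ⟨g', h'⟩ := ih
    rcases hc with rfl | rfl
    · exact ⟨_, h'.stφ⟩
    · exact ⟨_, h'.stα⟩

theorem reach_pos {x y : G} {h : Lat x y} {pos : D → LX h} (pφ : ∀ d, pos (φ d) = lst ι h (lab d) (pos d))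
    (pα : ∀ d, pos (α d) = lst ι h (lab d) (pos d)) {e e' : D × G}
    (hr : Reach (lift ι φ lab) (lift ι α lab) e e') (h0 : pos e.1 = cls h e.2) : pos e'.1 = cls h e'.2 := by
  induction hr with
  | refl => exact h0
  | tail _ hc ih =>
    rcases hc with rfl | rfl
    · simp only [skew_apply]; rw [pφ, ih, lst_cls]
    · simp only [skew_apply]; rw [pα, ih, lst_cls]

/-- area sum is an even integer -/
theorem area_even [Fintype D] (F : FS Rw φ α lab rw nf) (T H : G → ℚ) (s : D → G)
    (hα : ∀ d, ∃ k : ℤ, (T (s (α d)) + T (s (φ (α d)))) * (H (s (φ (α d))) - H (s (α d))) =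
      - ((T (s d) + T (s (φ d))) * (H (s (φ d)) - H (s d))) + 2 * k) :
    ∃ k : ℤ, ∑ d, (T (s d) + T (s (φ d))) * (H (s (φ d)) - H (s d)) = 2 * k := by
  let Q := ℚ ⧸ (AddSubgroup.zmultiples (2 : ℚ))
  let π : ℚ →+ Q := QuotientAddGroup.mk' _
  have hπ : ∀ q, π q = 0 ↔ ∃ k : ℤ, q = 2 * k := by
    intro q
    rw [QuotientAddGroup.mk'_apply, QuotientAddGroup.eq_zero_iff, AddSubgroup.mem_zmultiples_iff]
    constructor
    · rintro ⟨k, rfl⟩; exact ⟨k, by simp [mul_comm]⟩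
    · rintro ⟨k, rfl⟩; exact ⟨k, by simp [mul_comm]⟩
  rw [← hπ, map_sum]
  apply sum_involution (fun d _ => α d)
  · intro d _
    obtain ⟨k, hk⟩ := hα d
    rw [hk, ← map_add, hπ]; exact ⟨k, by ring⟩
  · intro d _ _ h; have := F.labα d; rw [h] at this; exact li_ne _ this.symm
  · intro d _; exact mem_univ _
  · intro d _; exact F.αα d

theorem char_exists (L : AddSubgroup (ℤ × ℤ)) (hL : L ≠ ⊤) : ∃ t1 t2 : ℚ,
    (∀ i j : ℤ, (i, j) ∈ L → ∃ k : ℤ, t1 * i + t2 * j = k) ∧ ¬ ((∃ k : ℤ, t1 = k) ∧ (∃ k : ℤ, t2 = k)) := by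
  obtain ⟨v, hv⟩ : ∃ v, v ∉ L := by
    by_contra hc; push Not at hc; exact hL (by ext v; simp [hc v])
  have : (QuotientAddGroup.mk' L v) ≠ 0 := by
    rw [QuotientAddGroup.mk'_apply, Ne, QuotientAddGroup.eq_zero_iff]; exact hv
  obtain ⟨c, hc⟩ := CharacterModule.exists_character_apply_ne_zero_of_ne_zero this
  obtain ⟨t1, h1⟩ := QuotientAddGroup.mk_surjective (c (QuotientAddGroup.mk' L (1, 0)))
  obtain ⟨t2, h2⟩ := QuotientAddGroup.mk_surjective (c (QuotientAddGroup.mk' L (0, 1)))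
  let π : ℚ →+ AddCircle (1 : ℚ) := QuotientAddGroup.mk' _
  have hπ : ∀ q, π q = 0 ↔ ∃ k : ℤ, q = k := by
    intro q
    rw [QuotientAddGroup.mk'_apply, QuotientAddGroup.eq_zero_iff, AddSubgroup.mem_zmultiples_iff]
    constructor
    · rintro ⟨k, rfl⟩; exact ⟨k, by simp⟩
    · rintro ⟨k, rfl⟩; exact ⟨k, by simp⟩
  have key : ∀ i j : ℤ, c (QuotientAddGroup.mk' L (i, j)) = π (t1 * i + t2 * j) := by
    intro i j
    have : ((i, j) : ℤ × ℤ) = i • (1, 0) + j • (0, 1) := by simp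
    rw [this, map_add, map_add, map_zsmul, map_zsmul, map_zsmul, map_zsmul]
    rw [← h1, ← h2]
    have e : t1 * i + t2 * j = i • t1 + j • t2 := by simp; ring
    rw [e, map_add, map_zsmul, map_zsmul]; rfl
  refine ⟨t1, t2, ?_, ?_⟩
  · intro i j hij
    rw [← hπ, ← key]
    have : (QuotientAddGroup.mk' L (i, j)) = 0 := by
      rw [QuotientAddGroup.mk'_apply, QuotientAddGroup.eq_zero_iff]; exact hij
    rw [this, map_zero]
  · rintro ⟨⟨k1, rfl⟩, ⟨k2, rfl⟩⟩
    apply hc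
    rw [show v = (v.1, v.2) from rfl, key, hπ]
    exact ⟨k1 * v.1 + k2 * v.2, by push_cast; ring⟩
end

section
variable {G : Type*} [Group G] {ι : FreeGroup S →* G}

theorem torus_out (h0 : SC Rw) (hR : ∀ r ∈ Rw, ι (FreeGroup.mk r) = 1)
    {x y : G} (h : Lat x y) (u v : FreeGroup S) (hu : ι u = x) (hv : ι v = y)
    (ls : List (Wd S × Wd S)) (hls : ∀ p ∈ ls, p.2 ∈ Rw)
    (hc : cprod ls = u * v * u⁻¹ * v⁻¹) :
    ∃ (D : Type) (_ : Fintype D) (φ α : Perm D) (lab : D → S × Bool) (rw : D → Wd S)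
      (nf : D → Prop) (pos : D → LX h), FS Rw φ α lab rw nf ∧
      (∀ d, pos (φ d) = lst ι h (lab d) (pos d)) ∧ (∀ d, pos (α d) = lst ι h (lab d) (pos d)) ∧
      (∀ f, Anti (lst ι h) f → ∑ d, f (pos d) (rw d) = cch (lst ι h) (cls h 1) ls f) ∧
      ∃ e0 : D × G, ∀ d g, pos d = cls h g ↔ Reach (lift ι φ lab) (lift ι α lab) e0 (d, g) := by
  classical
  have hst := lhst ι h
  have hR' : ∀ r ∈ Rw, ∀ p, run (lst ι h) r p = p := by
    intro r hr p
    obtain ⟨g, rfl⟩ := cls_surj h p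
    rw [lrun_cls, hR r hr, mul_one]
  obtain ⟨uw, rfl⟩ := Quot.exists_rep u
  obtain ⟨vw, rfl⟩ := Quot.exists_rep v
  have hx : run (lst ι h) uw (cls h 1) = cls h 1 := by
    rw [lrun_cls]; symm; apply (cls_eq h).2; refine ⟨1, 0, ?_⟩
    have : ι (FreeGroup.mk uw) = x := hu
    rw [this]; simp [lam]
  have hy : run (lst ι h) vw (cls h 1) = cls h 1 := by
    rw [lrun_cls]; symm; apply (cls_eq h).2; refine ⟨0, 1, ?_⟩
    have : ι (FreeGroup.mk vw) = y := hv
    rw [this]; simp [lam]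
  have hw : FreeGroup.mk (uw ++ vw ++ iw uw ++ iw vw) = cprod ls := by
    rw [hc, ← FreeGroup.mul_mk, ← FreeGroup.mul_mk, ← FreeGroup.mul_mk, mk_iw, mk_iw]; rfl
  obtain ⟨⟨n, m, h1⟩, -⟩ := fill h0 hst hR' (x0 := cls h 1) ls hls hw
  have h2 := HasD.torus hst hx hy h1
  obtain ⟨n', -, D, _, φ, α, lab, pos, Z, N, rw, sp, B, H, -, hZ, -, hsp, -, hCh, -, hN, hr⟩ := h2.reduce h0 hst _ n m le_rfl
  have hsp : sp = [] := by simpa using hsp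
  have hZ : ∀ d, ¬ Z d := by intro d; rw [hZ, hsp]; simp
  obtain ⟨F, -, hE⟩ := B.flat h0 H hZ hN (fun d => hr d (hZ _) (hZ _))
  have hCh' : ∀ f, Anti (lst ι h) f → ∑ d, f (pos d) (rw d) = cch (lst ι h) (cls h 1) ls f := by
    intro f hf
    rw [← hCh f hf, IsDg.Ch]
    apply sum_congr rfl
    intro d _
    rw [if_neg]; simp [hZ d, hN d]
  refine ⟨D, _, φ, α, lab, rw, _, pos, F, B.posφ, B.posα, hCh', ?_⟩
  -- coordinates
  obtain ⟨p, q, hpq⟩ := lat_coord h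
  have hT : ∀ t1 t2 : ℚ, ∀ i j g, (fun g => t1 * p g + t2 * q g) (lam x y i j * g) =
      (fun i j : ℤ => t1 * i + t2 * j) i j + (fun g => t1 * p g + t2 * q g) g := by
    intro t1 t2 i j g
    simp only [(hpq i j g).1, (hpq i j g).2]; push_cast; ring
  have hls' : ∀ p ∈ ls, ι (FreeGroup.mk p.2) = 1 ∧ p.2 ≠ [] := fun p hp => ⟨hR _ (hls p hp), h0.ne _ (hls p hp)⟩
  have area : ∀ t1 t2 s1 s2 : ℚ, ∑ d, fA ι h (fun g => t1 * p g + t2 * q g) (fun g => s1 * p g + s2 * q g) (pos d) (rw d) =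
      - (2 * (t1 * s2 - t2 * s1)) := by
    intro t1 t2 s1 s2
    rw [hCh' _ (fA_anti ι h (hT t1 t2) (hT s1 s2)), fA_cch ι h (hT t1 t2) (hT s1 s2) ls hls' _ _ hu hv hc]
    simp
  -- nonempty
  obtain ⟨d0⟩ : Nonempty D := by
    by_contra he
    rw [not_nonempty_iff] at he
    have := area 1 0 0 1
    simp at this
  -- connected
  have conn : ∀ d, Reach φ α d0 d := by
    intro d
    by_contra hd
    have := euler2 φ α B.αα B.αne 2 H (fun d => if Reach φ α d0 d then 1 else 0) ?_ ?_ d0 d ?_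
    · rw [hE] at this; norm_num at this
    · intro d
      have : Reach φ α d0 (φ d) ↔ Reach φ α d0 d := by
        refine ⟨fun h => h.trans (F.reach_symm ?_), Reach.stφ⟩
        exact Reach.stφ Relation.ReflTransGen.refl
      simp [this]
    · intro d
      have : Reach φ α d0 (α d) ↔ Reach φ α d0 d := by
        refine ⟨fun h => h.trans (F.reach_symm ?_), Reach.stα⟩
        exact Reach.stα Relation.ReflTransGen.refl
      simp [this]
    · have : Reach φ α d0 d0 := Relation.ReflTransGen.refl
      simp [this, hd]
  obtain ⟨g0, hg0⟩ := cls_surj h (pos d0)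
  have FL := F.lift (ι := ι) hR
  let Lm : AddSubgroup (ℤ × ℤ) :=
    { carrier := {v | Reach (lift ι φ lab) (lift ι α lab) (d0, g0) (d0, lam x y v.1 v.2 * g0)}
      zero_mem' := by
        show Reach _ _ _ _
        have : lam x y (0 : ℤ × ℤ).1 (0 : ℤ × ℤ).2 * g0 = g0 := by simp [lam]
        rw [this]; exact Relation.ReflTransGen.refl
      add_mem' := by
        intro a b ha hb
        have := reach_tr (lam x y a.1 a.2) hb
        rw [← mul_assoc, h.lam_mul] at this
        exact Relation.ReflTransGen.trans ha this
      neg_mem' := by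
        intro a ha
        have := FL.reach_symm (reach_tr (lam x y (-a.1) (-a.2)) ha)
        rw [← mul_assoc, h.lam_inv, one_mul] at this
        exact this }
  have hLm : ∀ i j d g, Reach (lift ι φ lab) (lift ι α lab) (d0, g0) (d, g) →
      Reach (lift ι φ lab) (lift ι α lab) (d0, g0) (d, lam x y i j * g) → (i, j) ∈ Lm := by
    intro i j d g h1 h2
    exact h2.trans (FL.reach_symm (reach_tr (lam x y i j) h1))
  have hLtop : Lm = ⊤ := by
    by_contra hL
    obtain ⟨t1, t2, hk, hnot⟩ := char_exists Lm hL
    -- consistent lifts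
    obtain ⟨s, s1, s2, s3⟩ := section_exists φ (lift ι φ lab) Prod.fst (fun e => rfl) (by
        intro n e he
        rw [zper_dvd, B.Rp _ (hZ _) (hN _)] at he
        obtain ⟨k, rfl⟩ := he
        rw [zpow_mul]
        exact Perm.zpow_apply_eq_self_of_apply_eq_self (by rw [zpow_natCast]; exact FL.Rp e) k)
      (fun e => Reach (lift ι φ lab) (lift ι α lab) (d0, g0) e) (by
        have : ∀ e, Reach (lift ι φ lab) (lift ι α lab) (d0, g0) e ↔ Reach (lift ι φ lab) (lift ι α lab) (d0, g0) (lift ι φ lab e) := by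
          intro e
          exact ⟨Reach.stφ, fun h => h.trans (FL.reach_symm (Reach.stφ Relation.ReflTransGen.refl))⟩
        intro e n
        induction n using Int.induction_on with
        | zero => exact id
        | succ n ih => intro h; rw [add_comm, zpow_add, zpow_one, Perm.mul_apply]; exact (this _).1 (ih h)
        | pred n ih =>
          intro h; rw [this]
          have e1 : (lift ι φ lab) ((lift ι φ lab ^ (-(n : ℤ) - 1)) e) = (lift ι φ lab ^ (-(n : ℤ))) e := by
            rw [← Perm.mul_apply, ← zpow_one_add]; congr 2; ring
          rw [e1]; exact ih h)
      (fun d => by obtain ⟨g, hg⟩ := reach_lift (conn d) g0; exact ⟨(d, g), rfl, hg⟩)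
    have hs2 : ∀ d, (s (φ d)).2 = (s d).2 * gl ι (lab d) := by
      intro d; rw [s2, skew_apply, s1]
    have hpos : ∀ d, pos d = cls h (s d).2 := by
      intro d
      have := reach_pos B.posφ B.posα (s3 d) hg0.symm
      rwa [s1] at this
    have sum_eq : ∀ e1 e2 : ℤ, ∃ k : ℤ, - (2 * (t1 * e2 - t2 * e1)) = (2 * k : ℚ) := by
      intro e1 e2
      obtain ⟨T, hTd⟩ : ∃ T : G → ℚ, T = fun g => t1 * p g + t2 * q g := ⟨_, rfl⟩
      obtain ⟨Hh, hHd⟩ : ∃ T : G → ℚ, T = fun g => (e1 : ℚ) * p g + (e2 : ℚ) * q g := ⟨_, rfl⟩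
      have a := area t1 t2 e1 e2
      have b : ∀ d, fA ι h (fun g => t1 * p g + t2 * q g) (fun g => (e1 : ℚ) * p g + (e2 : ℚ) * q g) (pos d) (rw d) =
          (1 / ((rw d).length : ℚ)) * ∑ i ∈ range (rw d).length, (fun d => (T (s d).2 + T (s (φ d)).2) * (Hh (s (φ d)).2 - Hh (s d).2)) ((φ ^ i) d) := by
        intro d
        rw [hpos d, fA_cls ι h (hT t1 t2) (hT e1 e2) _ _ (hR _ (F.Rm d)), arF_mk, ← hTd, ← hHd,
          fA_face ι F T Hh (fun d => (s d).2) hs2]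
        ring
      have av := avg_sum φ (fun d => (rw d).length) (fun d => by have := F.len6 d; omega)
        (fun d => by rw [F.Rr, List.length_rotate]) (fun d => (T (s d).2 + T (s (φ d)).2) * (Hh (s (φ d)).2 - Hh (s d).2))
      rw [sum_congr rfl (fun d _ => b d)] at a
      have a := av.symm.trans a
      rw [← a]
      apply area_even F T Hh (fun d => (s d).2)
      intro d
      -- s (α d) = λ * (s d).2 * lab d, λ ∈ Lm
      have r1 : Reach (lift ι φ lab) (lift ι α lab) (d0, g0) (α d, (s (φ d)).2) := by
        have := Reach.stα (s3 d)
        rw [skew_apply, s1, ← hs2] at this; exact this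
      have r2 : Reach (lift ι φ lab) (lift ι α lab) (d0, g0) (α d, (s (α d)).2) := by
        have := s3 (α d); rwa [show s (α d) = ((s (α d)).1, (s (α d)).2) from rfl, s1] at this
      obtain ⟨i, j, hij⟩ : ∃ i j, (s (α d)).2 = lam x y i j * (s (φ d)).2 := by
        apply (cls_eq h).1; rw [← hpos, ← hpos, B.posφ, B.posα]
      obtain ⟨k, hk⟩ := hk i j (hLm i j _ _ r1 (by rw [← hij]; exact r2))
      have hφα : (s (φ (α d))).2 = lam x y i j * (s d).2 := by
        rw [hs2, hij, hs2, B.labα, mul_assoc, mul_assoc, gl_li, mul_one]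
      refine ⟨k * (e1 * (p (s d).2 - p (s (φ d)).2) + e2 * (q (s d).2 - q (s (φ d)).2)), ?_⟩
      simp only [hij, hφα, hTd, hHd, (hpq i j _).1, (hpq i j _).2]
      push_cast
      rw [← hk]; ring
    apply hnot
    constructor
    · obtain ⟨k, hk⟩ := sum_eq 0 1
      exact ⟨-k, by push_cast at hk ⊢; linarith⟩
    · obtain ⟨k, hk⟩ := sum_eq 1 0
      exact ⟨k, by push_cast at hk ⊢; linarith⟩
  refine ⟨(d0, g0), fun d g => ⟨fun hd => ?_, fun hd => reach_pos B.posφ B.posα hd hg0.symm⟩⟩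
  obtain ⟨g', hg'⟩ := reach_lift (ι := ι) (lab := lab) (conn d) g0
  have := reach_pos B.posφ B.posα hg' hg0.symm
  rw [hd] at this
  obtain ⟨i, j, rfl⟩ := (cls_eq h).1 this.symm
  have hm : (i, j) ∈ Lm := by rw [hLtop]; trivial
  exact Relation.ReflTransGen.trans hm (reach_tr _ hg')
end

/-- hexagonal directions -/
def hx : ZMod 6 → ℤ × ℤ := fun k => (![(1,0),(0,1),(-1,1),(-1,0),(0,-1),(1,-1)] : Fin 6 → ℤ × ℤ) k

theorem hx0 : hx 0 = (1, 0) := rfl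
theorem hx1 : hx 1 = (0, 1) := rfl
theorem hx_add3 : ∀ k, hx (k + 3) = - hx k := by decide
theorem hx_add2 : ∀ k, hx (k + 2) = hx (k + 1) - hx k := by decide
theorem hx_rt : ∀ k o, (hx k).1 • hx o + (hx k).2 • hx (o + 1) = hx (k + o) := by decide
theorem hx_refl : ∀ k, ((hx k).1 + (hx k).2, - (hx k).2) = hx (-k) := by decide
theorem hx_par : ∀ i j, hx i = hx j ∨ hx i = - hx j ∨ (hx i).1 * (hx j).2 - (hx i).2 * (hx j).1 ≠ 0 := by decide
theorem hx_inj : ∀ i j, hx i = hx j → i = j := by decide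

/-- rotations -/
def rt (o : ZMod 6) (v : ℤ × ℤ) : ℤ × ℤ := v.1 • hx o + v.2 • hx (o + 1)
theorem rt_add (o v w) : rt o (v + w) = rt o v + rt o w := by
  simp only [rt, Prod.fst_add, Prod.snd_add, add_smul]; abel
theorem rt_smul (o : ZMod 6) (c : ℤ) (v) : rt o (c • v) = c • rt o v := by
  simp only [rt, Prod.smul_fst, Prod.smul_snd, smul_add, smul_eq_mul, mul_smul]
theorem rt_hx (o k) : rt o (hx k) = hx (k + o) := hx_rt k o
theorem rt_zero (v) : rt 0 v = v := by
  ext <;> simp [rt, hx0, hx1]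
theorem v_eq (v : ℤ × ℤ) : v = v.1 • hx 0 + v.2 • hx 1 := by
  ext <;> simp [hx0, hx1]
theorem rt_rt (o o' v) : rt o (rt o' v) = rt (o' + o) v := by
  rw [v_eq v]
  simp only [rt_add, rt_smul, rt_hx, add_assoc]

section grp
variable {M Y : Type*} [Group M] {p a : M}

theorem grp_inv (h2 : a * a = 1) : a⁻¹ = a := inv_eq_of_mul_eq_one_left h2

theorem grp_U2 (h2 : a * a = 1) (h3 : p * a * (p * a) * (p * a) = 1) : a * p * a = p⁻¹ * a * p⁻¹ := by
  have : a * p * a = p⁻¹ * (p * a * (p * a) * (p * a)) * a⁻¹ * p⁻¹ := by group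
  rw [this, h3, mul_one, grp_inv h2]

theorem grp_comm (h6 : p ^ 6 = 1) (h2 : a * a = 1) (h3 : p * a * (p * a) * (p * a) = 1) :
    Commute (p ^ 3 * a) (p ^ 2 * a * p) := by
  have k := grp_U2 h2 h3
  have k' : a * p⁻¹ * a = p * a * p := by
    have := congrArg (·⁻¹) k
    simp only [mul_inv_rev, inv_inv, grp_inv h2, mul_assoc] at this ⊢
    exact this
  have h5 : p ^ 5 = p⁻¹ := by rw [eq_inv_iff_mul_eq_one, ← pow_succ, h6]
  -- U3 U1 = U1 U3 with U3 = a p^3 = U0⁻¹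
  have e : (p ^ 3 * a)⁻¹ = a * p ^ 3 := by
    rw [mul_inv_rev, grp_inv h2]; congr 1
    rw [inv_eq_iff_mul_eq_one, ← pow_add, h6]
  have c : Commute (p ^ 3 * a)⁻¹ (p ^ 2 * a * p) := by
    show _ * _ = _ * _
    rw [e]
    calc a * p ^ 3 * (p ^ 2 * a * p) = a * p ^ 5 * a * p := by group
      _ = a * p⁻¹ * a * p := by rw [h5]
      _ = p * a * p ^ 2 := by rw [k', pow_two]; simp only [mul_assoc]
      _ = p ^ 2 * (p⁻¹ * a * p⁻¹) * p ^ 3 := by group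
      _ = p ^ 2 * a * p * (a * p ^ 3) := by rw [← k]; group
  exact Commute.inv_left_iff.1 c

theorem grp_step (h6 : p ^ 6 = 1) (h2 : a * a = 1) (h3 : p * a * (p * a) * (p * a) = 1) (k : ZMod 6) :
    a * p ^ k.val = p ^ (k + 3).val * ((p ^ 3 * a) ^ (hx k).1 * (p ^ 2 * a * p) ^ (hx k).2) := by
  have hm : p ^ 3 * p ^ 3 = 1 := by rw [← pow_add, h6]
  have i3 : (p ^ 3)⁻¹ = p ^ 3 := inv_eq_of_mul_eq_one_left hm
  have k1 := grp_U2 h2 h3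
  have k' : a * p⁻¹ * a = p * a * p := by
    have := congrArg (·⁻¹) k1
    simp only [mul_inv_rev, inv_inv, grp_inv h2, mul_assoc] at this ⊢
    exact this
  have e0 : (p ^ 3 * a)⁻¹ = a * p ^ 3 := by rw [mul_inv_rev, grp_inv h2, i3]
  have ai := grp_inv h2
  have h5 : p ^ 5 = p⁻¹ := by rw [eq_inv_iff_mul_eq_one, ← pow_succ, h6]
  have h4 : p ^ 4 = p⁻¹ * p⁻¹ := by rw [← h5, ← pow_add]; rw [show 5 + 5 = 6 + 4 by rfl, pow_add, h6, one_mul]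
  have hU2 : (p ^ 3 * a)⁻¹ * (p ^ 2 * a * p) = p * a * p ^ 2 := by
    rw [e0]
    calc a * p ^ 3 * (p ^ 2 * a * p) = a * p ^ 5 * a * p := by group
      _ = a * p⁻¹ * a * p := by rw [h5]
      _ = p * a * p ^ 2 := by rw [k', pow_two]; simp only [mul_assoc]
  have cm := grp_comm h6 h2 h3
  fin_cases k
  · show a * p ^ 0 = p ^ 3 * ((p ^ 3 * a) ^ (1 : ℤ) * (p ^ 2 * a * p) ^ (0 : ℤ))
    rw [pow_zero, mul_one, zpow_one, zpow_zero, mul_one, ← mul_assoc, hm, one_mul]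
  · show a * p ^ 1 = p ^ 4 * ((p ^ 3 * a) ^ (0 : ℤ) * (p ^ 2 * a * p) ^ (1 : ℤ))
    rw [zpow_zero, zpow_one, one_mul, ← mul_assoc, ← mul_assoc, ← pow_add, h6, one_mul, pow_one]
  · show a * p ^ 2 = p ^ 5 * ((p ^ 3 * a) ^ (-1 : ℤ) * (p ^ 2 * a * p) ^ (1 : ℤ))
    rw [zpow_neg_one, zpow_one, hU2, h5]; group
  · show a * p ^ 3 = p ^ 0 * ((p ^ 3 * a) ^ (-1 : ℤ) * (p ^ 2 * a * p) ^ (0 : ℤ))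
    rw [zpow_neg_one, zpow_zero, e0, pow_zero, one_mul, mul_one]
  · show a * p ^ 4 = p ^ 1 * ((p ^ 3 * a) ^ (0 : ℤ) * (p ^ 2 * a * p) ^ (-1 : ℤ))
    rw [zpow_neg_one, zpow_zero, one_mul, mul_inv_rev, mul_inv_rev, ai, h4]; group
  · show a * p ^ 5 = p ^ 2 * ((p ^ 3 * a) ^ (1 : ℤ) * (p ^ 2 * a * p) ^ (-1 : ℤ))
    have : (p ^ 3 * a) ^ (1 : ℤ) * (p ^ 2 * a * p) ^ (-1 : ℤ) = ((p ^ 3 * a)⁻¹ * (p ^ 2 * a * p))⁻¹ := by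
      rw [mul_inv_rev, inv_inv, zpow_one, zpow_neg_one]
      exact (cm.inv_right).eq
    rw [this, hU2, h5, mul_inv_rev, mul_inv_rev, ai]; group

theorem hex_coords {Y : Type*} (p a : Perm Y) (h6 : p ^ 6 = 1) (h2 : a * a = 1) (h3 : p * a * (p * a) * (p * a) = 1) (y0 : Y) :
    ∃ ξ : (ℤ × ℤ) → ZMod 6 → Y, ξ 0 0 = y0 ∧ (∀ v k, ξ v (k + 1) = p (ξ v k)) ∧ ∀ v k, ξ (v + hx k) (k + 3) = a (ξ v k) := by
  have cm := grp_comm h6 h2 h3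
  refine ⟨fun v k => (p ^ k.val * ((p ^ 3 * a) ^ v.1 * (p ^ 2 * a * p) ^ v.2)) y0, ?_, ?_, ?_⟩
  · simp
  · intro v k
    have e : p ^ (k + 1).val = p ^ (k.val + 1) := by
      rw [pow_eq_pow_iff_modEq]
      have : (k + 1).val ≡ k.val + 1 [MOD 6] := by
        rw [ZMod.val_add]; exact Nat.mod_modEq _ _
      exact this.of_dvd (orderOf_dvd_of_pow_eq_one h6)
    show (p ^ (k + 1).val * _) y0 = (p * (p ^ k.val * _)) y0
    rw [e, pow_succ', mul_assoc]
  · intro v k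
    show _ = (a * (p ^ k.val * _)) y0
    rw [← mul_assoc, grp_step h6 h2 h3 k]
    simp only [mul_assoc, Prod.fst_add, Prod.snd_add]
    congr 2
    rw [add_comm v.1, add_comm v.2, zpow_add, zpow_add]
    have := ((cm.zpow_zpow v.1 (hx k).2).eq)
    simp only [mul_assoc]
    congr 1
    simp only [← mul_assoc]
    congr 1
end grp

end

section
open scoped Classical
variable {S X : Type*}
variable {Rw : Set (Wd S)}

/-- length of the side starting at `d` -/
noncomputable def nx {E : Type*} (φ : Perm E) (nf : E → Prop) (d : E) : ℕ := sInf {n | 0 < n ∧ nf ((φ ^ n) d)}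

namespace FS
variable {E : Type*} {φ α : Perm E} {lab : E → S × Bool} {rw : E → Wd S} {nf : E → Prop}

theorem ex_nx (F : FS Rw φ α lab rw nf) (d : E) : {n | 0 < n ∧ nf ((φ ^ n) d)}.Nonempty := by
  have h := F.six d
  have : ({i ∈ range (rw d).length | nf ((φ ^ i) d)} : Finset ℕ).Nonempty := by
    rw [← card_pos, h]; norm_num
  obtain ⟨i, hi⟩ := this
  simp only [mem_filter, mem_range] at hi
  refine ⟨i + (rw d).length, by have := hi.1; show 0 < _; omega, ?_⟩
  rw [pow_add, Perm.mul_apply, F.Rp]; exact hi.2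

theorem nx_pos (F : FS Rw φ α lab rw nf) (d : E) : 0 < nx φ nf d := (Nat.sInf_mem (F.ex_nx d)).1
theorem nx_nf (F : FS Rw φ α lab rw nf) (d : E) : nf ((φ ^ nx φ nf d) d) := (Nat.sInf_mem (F.ex_nx d)).2
theorem nx_lt {d : E} {j : ℕ} (h0 : 0 < j) (h : j < nx φ nf d) : ¬ nf ((φ ^ j) d) := fun hh =>
  Nat.notMem_of_lt_sInf h ⟨h0, hh⟩
theorem nx_eq {d : E} {n : ℕ} (h0 : 0 < n) (h : nf ((φ ^ n) d)) (hl : ∀ j, 0 < j → j < n → ¬ nf ((φ ^ j) d)) : nx φ nf d = n := by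
  apply le_antisymm
  · exact Nat.sInf_le ⟨h0, h⟩
  · by_contra hc
    have hm := Nat.sInf_mem (s := {n | 0 < n ∧ nf ((φ ^ n) d)}) ⟨n, h0, h⟩
    exact hl _ hm.1 (not_le.1 hc) hm.2

theorem nx_le_len (F : FS Rw φ α lab rw nf) {d : E} (hd : nf d) : nx φ nf d ≤ (rw d).length := by
  apply Nat.sInf_le
  refine ⟨by have := F.len6 d; omega, ?_⟩
  rw [F.Rp]; exact hd

/-- opposite dart of the side starting at `d` -/
noncomputable def op (φ α : Perm E) (nf : E → Prop) (d : E) : E := α ((φ ^ (nx φ nf d - 1)) d)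

theorem op_pow (F : FS Rw φ α lab rw nf) (d : E) (j : ℕ) (hj : j < nx φ nf d) :
    (φ ^ j) (op φ α nf d) = α ((φ ^ (nx φ nf d - 1 - j)) d) := by
  induction j with
  | zero => rfl
  | succ j ih =>
    rw [pow_succ', Perm.mul_apply, ih (by omega)]
    have hn : ¬ nf ((φ ^ (nx φ nf d - 1 - j)) d) := nx_lt (by omega) (by omega)
    rw [F.nf_next _ (by rwa [F.nα]), F.αα]
    have : nx φ nf d - 1 - j = (nx φ nf d - 1 - (j + 1)) + 1 := by omega
    rw [this, pow_succ', Perm.mul_apply, pinv_apply]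

theorem op_end (F : FS Rw φ α lab rw nf) (d : E) : (φ ^ nx φ nf d) (op φ α nf d) = φ (α d) := by
  have h0 := F.nx_pos d
  obtain ⟨n, hn⟩ : ∃ n, nx φ nf d = n + 1 := ⟨nx φ nf d - 1, by omega⟩
  have := F.op_pow d n (by omega)
  rw [hn, pow_succ', Perm.mul_apply, this, hn]; simp

theorem op_nf (F : FS Rw φ α lab rw nf) (d : E) : nf (op φ α nf d) := by
  rw [op, F.nfα, ← Perm.mul_apply, ← pow_succ']
  have h0 := F.nx_pos d
  rw [show nx φ nf d - 1 + 1 = nx φ nf d by omega]; exact F.nx_nf d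

theorem op_nx (F : FS Rw φ α lab rw nf) {d : E} (hd : nf d) : nx φ nf (op φ α nf d) = nx φ nf d := by
  apply nx_eq (F.nx_pos d)
  · rw [F.op_end, F.nα]; exact hd
  · intro j h0 hj
    rw [F.op_pow d j hj, F.nfα, ← Perm.mul_apply, ← pow_succ']
    exact nx_lt (by omega) (by omega)

theorem op_op (F : FS Rw φ α lab rw nf) {d : E} (hd : nf d) : op φ α nf (op φ α nf d) = d := by
  rw [op, F.op_nx hd]
  have h0 := F.nx_pos d
  rw [F.op_pow d _ (by omega)]; simp [F.αα]

theorem op_eq (F : FS Rw φ α lab rw nf) (d : E) : op φ α nf d = α (φ⁻¹ ((φ ^ nx φ nf d) d)) := by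
  have h0 := F.nx_pos d
  obtain ⟨n, hn⟩ : ∃ n, nx φ nf d = n + 1 := ⟨nx φ nf d - 1, by omega⟩
  rw [op, hn, pow_succ', Perm.mul_apply, pinv_apply]; rfl

theorem phi_op (F : FS Rw φ α lab rw nf) (d : E) : φ (α (op φ α nf d)) = (φ ^ nx φ nf d) d := by
  rw [F.op_eq, F.αα, papply_inv]

/-- the opposite permutation -/
noncomputable def opP (F : FS Rw φ α lab rw nf) : Perm {d // nf d} where
  toFun d := ⟨op φ α nf d.1, F.op_nf d.1⟩
  invFun d := ⟨op φ α nf d.1, F.op_nf d.1⟩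
  left_inv d := Subtype.ext (F.op_op d.2)
  right_inv d := Subtype.ext (F.op_op d.2)

/-- rotation around vertices -/
def piP (F : FS Rw φ α lab rw nf) : Perm {d // nf d} where
  toFun d := ⟨φ (α d.1), (F.nα _).2 d.2⟩
  invFun d := ⟨α (φ⁻¹ d.1), by rw [F.nfα, papply_inv]; exact d.2⟩
  left_inv d := Subtype.ext (by simp only [pinv_apply, F.αα])
  right_inv d := Subtype.ext (by simp only [papply_inv, F.αα])

/-- next corner -/
noncomputable def nxP (F : FS Rw φ α lab rw nf) : Perm {d // nf d} := F.piP * F.opP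

theorem nxP_apply (F : FS Rw φ α lab rw nf) (d : {d // nf d}) : (F.nxP d).1 = (φ ^ nx φ nf d.1) d.1 := by
  show φ (α (op φ α nf d.1)) = _
  exact F.phi_op _

theorem opP_sq (F : FS Rw φ α lab rw nf) : F.opP * F.opP = 1 := by
  ext d; exact F.op_op d.2

theorem nxP_op (F : FS Rw φ α lab rw nf) : F.nxP * F.opP = F.piP := by
  rw [nxP, mul_assoc, F.opP_sq, mul_one]

theorem piP_cube (F : FS Rw φ α lab rw nf) : F.piP * F.piP * F.piP = 1 := by
  ext d; exact F.v3 _ d.2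

theorem count (F : FS Rw φ α lab rw nf) (d : {d // nf d}) (k : ℕ) : ∃ N : ℕ, ((F.nxP ^ k) d).1 = (φ ^ N) d.1 ∧
    #{i ∈ range N | nf ((φ ^ i) d.1)} = k := by
  induction k with
  | zero => exact ⟨0, rfl, rfl⟩
  | succ k ih =>
    obtain ⟨N, h1, h2⟩ := ih
    set e := (F.nxP ^ k) d with he
    refine ⟨nx φ nf e.1 + N, ?_, ?_⟩
    · rw [pow_succ', Perm.mul_apply, ← he, nxP_apply, pow_add, Perm.mul_apply, ← h1]
    · have : ({i ∈ range (nx φ nf e.1 + N) | nf ((φ ^ i) d.1)} : Finset ℕ) = insert N {i ∈ range N | nf ((φ ^ i) d.1)} := by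
        ext i
        simp only [mem_filter, mem_range, mem_insert]
        constructor
        · rintro ⟨a, b⟩
          rcases lt_trichotomy i N with hh | hh | hh
          · exact Or.inr ⟨hh, b⟩
          · exact Or.inl hh
          · exfalso
            obtain ⟨j, rfl⟩ : ∃ j, i = j + N := ⟨i - N, by omega⟩
            rw [pow_add, Perm.mul_apply, ← h1] at b
            exact nx_lt (by omega) (by omega) b
        · have := F.nx_pos e.1
          rintro (rfl | ⟨a, b⟩)
          · refine ⟨by omega, ?_⟩
            rw [← h1]; exact e.2
          · exact ⟨by omega, b⟩
      rw [this, card_insert_of_notMem (by simp), h2]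

theorem nxP_six (F : FS Rw φ α lab rw nf) : F.nxP ^ 6 = 1 := by
  ext d
  obtain ⟨N, h1, h2⟩ := F.count d 6
  have hs := F.six d.1
  suffices h : N = (rw d.1).length by
    rw [h1, h, F.Rp]; rfl
  have key : ∀ a b : ℕ, a < b → nf ((φ ^ a) d.1) → #{i ∈ range a | nf ((φ ^ i) d.1)} < #{i ∈ range b | nf ((φ ^ i) d.1)} := by
    intro a b hab hn
    apply card_lt_card
    rw [ssubset_iff_of_subset]
    · exact ⟨a, by simp [hab, hn], by simp⟩
    · intro i; simp only [mem_filter, mem_range]; rintro ⟨x, y⟩; exact ⟨by omega, y⟩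
  rcases lt_trichotomy N (rw d.1).length with hh | hh | hh
  · have := key _ _ hh (by rw [← h1]; exact ((F.nxP ^ 6) d).2); omega
  · exact hh
  · have := key _ _ hh (by rw [F.Rp]; exact d.2); omega

theorem hexc (F : FS Rw φ α lab rw nf) (y0 : E) (hy : nf y0) (hc : ∀ e, Reach φ α y0 e) :
    ∃ ξ : (ℤ × ℤ) → ZMod 6 → E, (∀ v k, nf (ξ v k)) ∧
      (∀ v k, ξ v (k + 1) = (φ ^ nx φ nf (ξ v k)) (ξ v k)) ∧ (∀ v k, ξ (v + hx k) (k + 3) = op φ α nf (ξ v k)) ∧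
      ∀ d, ∃ v k j, j < nx φ nf (ξ v k) ∧ d = (φ ^ j) (ξ v k) := by
  obtain ⟨ξ, h0, h1, h2⟩ := hex_coords F.nxP F.opP F.nxP_six F.opP_sq (by rw [F.nxP_op]; exact F.piP_cube) ⟨y0, hy⟩
  have H1 : ∀ v k, (ξ v (k + 1)).1 = (φ ^ nx φ nf (ξ v k).1) (ξ v k).1 := fun v k => by rw [h1, nxP_apply]
  have H2 : ∀ v k, (ξ (v + hx k) (k + 3)).1 = op φ α nf (ξ v k).1 := fun v k => by rw [h2]; rfl
  refine ⟨fun v k => (ξ v k).1, fun v k => (ξ v k).2, H1, H2, ?_⟩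
  intro d
  induction hc d with
  | refl => exact ⟨0, 0, 0, F.nx_pos _, by show y0 = (ξ 0 0).1; rw [h0]⟩
  | @tail b c _ hbc ih =>
    obtain ⟨v, k, j, hj, rfl⟩ := ih
    replace hj : j < nx φ nf (ξ v k).1 := hj
    rcases hbc with rfl | rfl
    · by_cases hj' : j + 1 < nx φ nf (ξ v k).1
      · exact ⟨v, k, j + 1, hj', by rw [pow_succ', Perm.mul_apply]⟩
      · refine ⟨v, k + 1, 0, F.nx_pos _, ?_⟩
        show φ ((φ ^ j) (ξ v k).1) = (ξ v (k+1)).1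
        rw [H1, ← Perm.mul_apply, ← pow_succ', show j + 1 = nx φ nf (ξ v k).1 by omega]
    · refine ⟨v + hx k, k + 3, nx φ nf (ξ v k).1 - 1 - j, ?_, ?_⟩
      · show _ < nx φ nf (ξ (v + hx k) (k + 3)).1
        rw [H2, F.op_nx (ξ v k).2]; omega
      · show α ((φ ^ j) (ξ v k).1) = (φ ^ _) (ξ (v + hx k) (k + 3)).1
        rw [H2, F.op_pow _ _ (by omega)]; congr 3; omega
end FS

end

section
universe uG uS
variable {S : Type uS}
variable {Rw : Set (Wd S)}
variable {G : Type uG} [Group G] {ι : FreeGroup S →* G}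

/-- a flat plane -/
structure Pl (Rw : Set (Wd S)) (ι : FreeGroup S →* G) where
  E : Type uG
  φ : Perm E
  α : Perm E
  lab : E → S × Bool
  rw : E → Wd S
  nf : E → Prop
  gg : E → G
  F : FS Rw φ α lab rw nf
  gφ : ∀ d, gg (φ d) = gg d * gl ι (lab d)
  gα : ∀ d, gg (α d) = gg d * gl ι (lab d)
  inj : ∀ e e', gg e = gg e' → lab e = lab e' → e = e'
  ξ : (ℤ × ℤ) → ZMod 6 → E
  ξnf : ∀ v k, nf (ξ v k)
  ξφ : ∀ v k, ξ v (k + 1) = (φ ^ nx φ nf (ξ v k)) (ξ v k)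
  ξα : ∀ v k, ξ (v + hx k) (k + 3) = FS.op φ α nf (ξ v k)
  ξs : ∀ d, ∃ v k j, j < nx φ nf (ξ v k) ∧ d = (φ ^ j) (ξ v k)

/-- reflection of the coordinate lattice -/
def rf (v : ℤ × ℤ) : ℤ × ℤ := (v.1 + v.2, - v.2)
theorem rf_rf (v) : rf (rf v) = v := by ext <;> simp [rf]
theorem rf_add (v w) : rf (v + w) = rf v + rf w := by ext <;> simp [rf] <;> ring
theorem rf_smul (c : ℤ) (v) : rf (c • v) = c • rf v := by ext <;> simp [rf]; ring
theorem rf_hx (k) : rf (hx k) = hx (-k) := hx_refl k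

namespace Pl

/-- translate -/
def tr (x : G) (P : Pl Rw ι) : Pl Rw ι :=
  { P with
    gg := fun d => x * P.gg d
    gφ := fun d => by rw [P.gφ, mul_assoc]
    gα := fun d => by rw [P.gα, mul_assoc]
    inj := fun e e' h => P.inj e e' (mul_left_cancel h) }

theorem mir_pow (P : Pl Rw ι) (d : P.E) (j : ℕ) : ((P.α * P.φ⁻¹ * P.α) ^ j) (P.α ((P.φ ^ j) d)) = P.α d := by
  induction j with
  | zero => rfl
  | succ j ih =>
    rw [pow_succ, Perm.mul_apply, pow_succ' P.φ]
    simp only [Perm.mul_apply] at ih ⊢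
    rw [P.F.αα, pinv_apply]; exact ih

theorem mir_pow_op (P : Pl Rw ι) {d : P.E} (j : ℕ) (hj : j < nx P.φ P.nf d) :
    ((P.α * P.φ⁻¹ * P.α) ^ j) (FS.op P.φ P.α P.nf d) = P.α ((P.φ ^ (nx P.φ P.nf d - 1 - j)) d) := by
  rw [FS.op]
  obtain ⟨m, hm⟩ : ∃ m, nx P.φ P.nf d - 1 = j + m := ⟨nx P.φ P.nf d - 1 - j, by omega⟩
  rw [hm, pow_add, Perm.mul_apply, P.mir_pow, show j + m - j = m by omega]

theorem mir_end (P : Pl Rw ι) (d : P.E) :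
    ((P.α * P.φ⁻¹ * P.α) ^ (nx P.φ P.nf d)) (FS.op P.φ P.α P.nf d) = P.α (P.φ⁻¹ d) := by
  have h0 := P.F.nx_pos d
  obtain ⟨m, hm⟩ : ∃ m, nx P.φ P.nf d = m + 1 := ⟨nx P.φ P.nf d - 1, by omega⟩
  have := P.mir_pow_op (d := d) m (by omega)
  rw [hm, pow_succ', Perm.mul_apply, this, hm]
  simp [P.F.αα]

theorem mir_nx (P : Pl Rw ι) {d : P.E} (hd : P.nf d) :
    nx (P.α * P.φ⁻¹ * P.α) P.nf (FS.op P.φ P.α P.nf d) = nx P.φ P.nf d := by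
  apply FS.nx_eq (P.F.nx_pos d)
  · rw [P.mir_end, P.F.nfα, papply_inv]; exact hd
  · intro j h0 hj
    rw [P.mir_pow_op j hj, P.F.nfα, ← Perm.mul_apply, ← pow_succ']
    exact FS.nx_lt (by omega) (by omega)

/-- mirror image -/
noncomputable def mir (h : SC Rw) (P : Pl Rw ι) : Pl Rw ι :=
  { E := P.E
    φ := P.α * P.φ⁻¹ * P.α
    α := P.α
    lab := P.lab
    rw := fun d => iw (P.rw (P.φ (P.α d)))
    nf := P.nf
    gg := P.gg
    F := P.F.mirror h
    gφ := fun d => by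
      simp only [Perm.mul_apply]
      rw [P.gα]
      have := P.gφ (P.φ⁻¹ (P.α d))
      rw [papply_inv, P.gα] at this
      exact this.symm
    gα := P.gα
    inj := P.inj
    ξ := fun v k => FS.op P.φ P.α P.nf (P.ξ (rf v) (-k))
    ξnf := fun v k => P.F.op_nf _
    ξφ := fun v k => by
      rw [P.mir_nx (P.ξnf _ _), P.mir_end, P.F.op_eq, ← P.ξφ]
      congr 4; ring
    ξα := fun v k => by
      have e : P.ξ (rf (v + hx k)) (-(k + 3)) = FS.op P.φ P.α P.nf (P.ξ (rf v) (-k)) := by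
        rw [← P.ξα, rf_add, rf_hx]; congr 1
        have : (3 : ZMod 6) = - 3 := by decide
        rw [neg_add, ← this]
      rw [e, P.F.op_op (P.ξnf _ _)]
      have h0 := P.F.nx_pos (P.ξ (rf v) (-k))
      conv_rhs => rw [FS.op, P.mir_nx (P.ξnf _ _), P.mir_pow_op _ (by omega)]
      simp [P.F.αα]
    ξs := fun d => by
      obtain ⟨v, k, j, hj, hd⟩ := P.ξs (P.α d)
      refine ⟨rf v, -k, nx P.φ P.nf (P.ξ v k) - 1 - j, ?_, ?_⟩
      · rw [rf_rf, neg_neg, P.mir_nx (P.ξnf _ _)]; omega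
      · rw [rf_rf, neg_neg, P.mir_pow_op _ (by omega)]
        rw [show nx P.φ P.nf (P.ξ v k) - 1 - (nx P.φ P.nf (P.ξ v k) - 1 - j) = j by omega, ← hd, P.F.αα] }

/-- cells -/
def Cell (P : Pl Rw ι) (κ : G × Wd S) : Prop := ∃ d, P.gg d = κ.1 ∧ P.rw d = κ.2

theorem rw_inj (P : Pl Rw ι) {d e : P.E} (h1 : P.gg d = P.gg e) (h2 : P.rw d = P.rw e) : d = e := by
  refine P.inj _ _ h1 ?_
  have a := P.F.Rh d
  have b := P.F.Rh e
  rw [h2, b] at a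
  exact (Option.some.inj a).symm

theorem cell_mir (h : SC Rw) (P : Pl Rw ι) (g : G) (r) : (P.mir h).Cell (g, r) ↔ P.Cell (g, iw r) := by
  have key : ∀ d, P.gg (P.φ (P.α d)) = P.gg d := by
    intro d; rw [P.gφ, P.gα, P.F.labα, mul_assoc, gl_li, mul_one]
  constructor
  · rintro ⟨d, h1, h2⟩
    refine ⟨P.φ (P.α d), (key d).trans h1, ?_⟩
    have : iw (P.rw (P.φ (P.α d))) = r := h2
    rw [← this, iw_iw]
  · rintro ⟨d, h1, h2⟩
    refine ⟨P.α (P.φ⁻¹ d), ?_, ?_⟩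
    · show P.gg _ = _
      rw [← key, P.F.αα, papply_inv]; exact h1
    · show iw (P.rw _) = _
      rw [P.F.αα, papply_inv, h2, iw_iw]

theorem cell_not (P : Pl Rw ι) (g : G) (r) (h1 : P.Cell (g, r)) (h2 : P.Cell (g, iw r)) : False := by
  obtain ⟨d, a1, a2⟩ := h1
  obtain ⟨e, b1, b2⟩ := h2
  have hl : P.lab e = P.lab (P.α (P.φ⁻¹ d)) := by
    have hh := iw_head (P.rw (P.φ⁻¹ d)) _ (P.F.Rh _)
    rw [← P.F.Rr, papply_inv, a2] at hh
    have h3 := P.F.Rh e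
    rw [b2] at h3
    rw [P.F.labα]
    exact Option.some.inj (h3.symm.trans hh)
  have hg : P.gg e = P.gg (P.α (P.φ⁻¹ d)) := by
    rw [P.gα, ← P.gφ, papply_inv, a1, b1]
  have he := P.inj _ _ hg hl
  apply P.F.ne e
  rw [he, P.F.αα, papply_inv, ← he, a2, b2]
end Pl

namespace Pl
variable {Q P : Pl Rw ι}

/-- the same labelled cell position -/
def Same (Q P : Pl Rw ι) (d : Q.E) (e : P.E) : Prop := Q.gg d = P.gg e ∧ Q.rw d = P.rw e
/-- common dart -/
def Com (Q P : Pl Rw ι) (d : Q.E) : Prop := ∃ e, Same Q P d e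

theorem Same.symm {d : Q.E} {e : P.E} (h : Same Q P d e) : Same P Q e d := ⟨h.1.symm, h.2.symm⟩

theorem Same.lab {d : Q.E} {e : P.E} (h : Same Q P d e) : Q.lab d = P.lab e := by
  have a := Q.F.Rh d
  have b := P.F.Rh e
  rw [h.2, b] at a
  exact (Option.some.inj a).symm

theorem Same.phi {d : Q.E} {e : P.E} (h : Same Q P d e) : Same Q P (Q.φ d) (P.φ e) := by
  refine ⟨?_, ?_⟩
  · rw [Q.gφ, P.gφ, h.1, h.lab]
  · rw [Q.F.Rr, P.F.Rr, h.2]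

theorem Same.pow {d : Q.E} {e : P.E} (h : Same Q P d e) (j : ℕ) : Same Q P ((Q.φ ^ j) d) ((P.φ ^ j) e) := by
  induction j with
  | zero => exact h
  | succ j ih => rw [pow_succ', pow_succ']; exact ih.phi

theorem phi_inv (P : Pl Rw ι) (d : P.E) : P.φ⁻¹ d = (P.φ ^ ((P.rw d).length - 1)) d := by
  have h6 := P.F.len6 d
  apply P.φ.injective
  rw [papply_inv, ← Perm.mul_apply, ← pow_succ', Nat.sub_add_cancel (by omega), P.F.Rp]

theorem Same.inv {d : Q.E} {e : P.E} (h : Same Q P d e) : Same Q P (Q.φ⁻¹ d) (P.φ⁻¹ e) := by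
  rw [phi_inv, phi_inv, h.2]; exact h.pow _

theorem Same.uniq {d : Q.E} {e e' : P.E} (h : Same Q P d e) (h' : Same Q P d e') : e = e' :=
  P.rw_inj (h.1.symm.trans h'.1) (h.2.symm.trans h'.2)

theorem Com.pow {d : Q.E} (h : Com Q P d) (j : ℕ) : Com Q P ((Q.φ ^ j) d) := by
  obtain ⟨e, h⟩ := h; exact ⟨_, h.pow j⟩
theorem Com.inv {d : Q.E} (h : Com Q P d) : Com Q P (Q.φ⁻¹ d) := by
  obtain ⟨e, h⟩ := h; exact ⟨_, h.inv⟩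
theorem com_pow {d : Q.E} (j : ℕ) : Com Q P ((Q.φ ^ j) d) ↔ Com Q P d := by
  refine ⟨fun h => ?_, fun h => h.pow j⟩
  induction j with
  | zero => exact h
  | succ j ih =>
    apply ih
    have := h.inv
    rwa [pow_succ', Perm.mul_apply, pinv_apply] at this

theorem Same.alpha {d : Q.E} {e : P.E} (h : Same Q P d e) (hc : Com Q P (Q.α d)) : Same Q P (Q.α d) (P.α e) := by
  obtain ⟨e2, h2⟩ := hc
  have : e2 = P.α e := by
    apply P.inj
    · rw [← h2.1, Q.gα, P.gα, h.1, h.lab]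
    · rw [← h2.lab, Q.F.labα, P.F.labα, h.lab]
  rw [← this]; exact h2

theorem gg_pi (P : Pl Rw ι) (d : P.E) : P.gg (P.φ (P.α d)) = P.gg d := by
  rw [P.gφ, P.gα, P.F.labα, mul_assoc, gl_li, mul_one]

theorem gg_pii (P : Pl Rw ι) (d : P.E) : P.gg (P.α (P.φ⁻¹ d)) = P.gg d := by
  rw [← P.gg_pi, P.F.αα, papply_inv]

theorem nf_lab (h0 : SC Rw) (P : Pl Rw ι) (d : P.E) : P.nf d ↔ P.lab (P.φ (P.α d)) ≠ P.lab (P.α (P.φ⁻¹ d)) := by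
  constructor
  · intro hn hl
    have he := P.inj _ _ (by rw [gg_pi, gg_pii]) hl
    have h3 := P.F.v3 d hn
    have : P.φ (P.α (P.φ (P.α d))) = d := by rw [he, P.F.αα, papply_inv]
    rw [this] at h3
    have ha := P.F.adj h0 (P.α d)
    rw [h3, P.F.labα, li_li] at ha
    exact ha rfl
  · intro hl; by_contra hn
    apply hl
    have := P.F.v2 d hn
    congr 1
    have h2 : P.φ (P.α d) = P.α (P.φ⁻¹ (P.φ (P.α (P.φ (P.α d))))) := by rw [pinv_apply, P.F.αα]
    rw [h2, this]

theorem Same.nf (h0 : SC Rw) {d : Q.E} {e : P.E} (h : Same Q P d e) (h1 : Com Q P (Q.α d)) (h2 : Com Q P (Q.α (Q.φ⁻¹ d))) :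
    Q.nf d ↔ P.nf e := by
  rw [nf_lab h0, nf_lab h0, (h.alpha h1).phi.lab, (h.inv.alpha h2).lab]

/-- common face -/
def Cm (Q P : Pl Rw ι) (v : ℤ × ℤ) : Prop := Com Q P (Q.ξ v 0)

theorem xi_pow (Q : Pl Rw ι) (v : ℤ × ℤ) (k : ZMod 6) (i : ℕ) : ∃ N, Q.ξ v (k + i) = (Q.φ ^ N) (Q.ξ v k) := by
  induction i with
  | zero => exact ⟨0, by simp⟩
  | succ i ih =>
    obtain ⟨N, h⟩ := ih
    refine ⟨nx Q.φ Q.nf (Q.ξ v (k + i)) + N, ?_⟩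
    rw [pow_add, Perm.mul_apply, ← h, ← Q.ξφ]; push_cast; rw [add_assoc]

theorem cm_iff (v : ℤ × ℤ) (k : ZMod 6) : Com Q P (Q.ξ v k) ↔ Cm Q P v := by
  obtain ⟨N, h⟩ := Q.xi_pow v 0 k.val
  rw [zero_add, ZMod.natCast_rightInverse k] at h
  rw [h, com_pow, Cm]

theorem cm_alpha (v : ℤ × ℤ) (k : ZMod 6) (j : ℕ) (hj : j < nx Q.φ Q.nf (Q.ξ v k)) :
    Com Q P (Q.α ((Q.φ ^ j) (Q.ξ v k))) ↔ Cm Q P (v + hx k) := by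
  rw [← cm_iff (v + hx k) (k + 3), Q.ξα, ← com_pow (d := FS.op Q.φ Q.α Q.nf (Q.ξ v k)) (nx Q.φ Q.nf (Q.ξ v k) - 1 - j), Q.F.op_pow _ _ (by omega),
    show nx Q.φ Q.nf (Q.ξ v k) - 1 - (nx Q.φ Q.nf (Q.ξ v k) - 1 - j) = j by omega]

theorem side_same (h0 : SC Rw) {v : ℤ × ℤ} {k : ZMod 6} {e : P.E} (h : Same Q P (Q.ξ v k) e)
    (h1 : Cm Q P (v + hx k)) (h2 : Cm Q P (v + hx (k + 1))) : nx P.φ P.nf e = nx Q.φ Q.nf (Q.ξ v k) := by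
  have key : ∀ j, 0 < j → j ≤ nx Q.φ Q.nf (Q.ξ v k) → (Q.nf ((Q.φ ^ j) (Q.ξ v k)) ↔ P.nf ((P.φ ^ j) e)) := by
    intro j hj hj'
    apply (h.pow j).nf h0
    · rcases hj'.lt_or_eq with hh | hh
      · rwa [cm_alpha _ _ _ hh]
      · rw [hh, ← Q.ξφ]
        rw [← cm_alpha v (k + 1) 0 (Q.F.nx_pos _)] at h2; exact h2
    · obtain ⟨i, rfl⟩ : ∃ i, j = i + 1 := ⟨j - 1, by omega⟩
      rw [pow_succ', Perm.mul_apply, pinv_apply, cm_alpha _ _ _ (by omega)]; exact h1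
  apply FS.nx_eq (Q.F.nx_pos _)
  · rw [← key _ (Q.F.nx_pos _) le_rfl]; exact Q.F.nx_nf _
  · intro j hj hj'
    rw [← key _ hj hj'.le]; exact FS.nx_lt hj hj'

theorem same_next (h0 : SC Rw) {v w : ℤ × ℤ} {k l : ZMod 6} (h : Same Q P (Q.ξ v k) (P.ξ w l))
    (h1 : Cm Q P (v + hx k)) (h2 : Cm Q P (v + hx (k + 1))) : Same Q P (Q.ξ v (k + 1)) (P.ξ w (l + 1)) := by
  rw [Q.ξφ, P.ξφ, side_same h0 h h1 h2]; exact h.pow _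

theorem same_op (h0 : SC Rw) {v w : ℤ × ℤ} {k l : ZMod 6} (h : Same Q P (Q.ξ v k) (P.ξ w l))
    (h1 : Cm Q P (v + hx k)) (h2 : Cm Q P (v + hx (k + 1))) : Same Q P (Q.ξ (v + hx k) (k + 3)) (P.ξ (w + hx l) (l + 3)) := by
  rw [Q.ξα, P.ξα, FS.op, FS.op, side_same h0 h h1 h2]
  apply (h.pow _).alpha
  rw [cm_alpha _ _ _ (by have := Q.F.nx_pos (Q.ξ v k); omega)]; exact h1

theorem same_all (h0 : SC Rw) {v w : ℤ × ℤ} {k0 l0 : ZMod 6} (h : Same Q P (Q.ξ v k0) (P.ξ w l0))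
    (hc : ∀ k, Cm Q P (v + hx k)) (k : ZMod 6) : Same Q P (Q.ξ v (k0 + k)) (P.ξ w (l0 + k)) := by
  have : ∀ i : ℕ, Same Q P (Q.ξ v (k0 + i)) (P.ξ w (l0 + i)) := by
    intro i
    induction i with
    | zero => simpa using h
    | succ i ih =>
      have := same_next h0 ih (hc _) (hc _)
      push_cast; rwa [← add_assoc, ← add_assoc]
  have := this k.val
  rwa [ZMod.natCast_rightInverse k] at this

/-- matching at a face -/
def Mt (Q P : Pl Rw ι) (o : ZMod 6) (s v : ℤ × ℤ) : Prop := ∀ k, Same Q P (Q.ξ v k) (P.ξ (rt o v + s) (k + o))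

theorem mt_step (h0 : SC Rw) {o : ZMod 6} {s v : ℤ × ℤ} (k : ZMod 6) (h : Mt Q P o s v) (hc : ∀ k, Cm Q P (v + hx k))
    (hc' : ∀ l, Cm Q P (v + hx k + hx l)) : Mt Q P o s (v + hx k) := by
  have h1 := same_op h0 (h k) (hc _) (hc _)
  intro l
  have h2 := same_all h0 h1 hc' (l - (k + 3))
  convert h2 using 2
  · ring
  · rw [rt_add, rt_hx]; abel
  · ring

theorem nf_xi (P : Pl Rw ι) {e : P.E} (he : P.nf e) : ∃ w l, e = P.ξ w l := by
  obtain ⟨w, l, j, hj, rfl⟩ := P.ξs e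
  rcases Nat.eq_zero_or_pos j with rfl | hj0
  · exact ⟨w, l, rfl⟩
  · exact absurd he (FS.nx_lt hj0 hj)

theorem mt_start (h0 : SC Rw) {v : ℤ × ℤ} (hv : Cm Q P v) (hc : ∀ k, Cm Q P (v + hx k)) : ∃ o s, Mt Q P o s v := by
  obtain ⟨e, he⟩ := hv
  have hn : P.nf e := by
    rw [← he.nf h0]
    · exact Q.ξnf _ _
    · have := (cm_alpha (Q := Q) (P := P) v 0 0 (Q.F.nx_pos _)).2 (hc _); exact this
    · have := (cm_alpha (Q := Q) (P := P) v (-1) (nx Q.φ Q.nf (Q.ξ v (-1)) - 1) (by have := Q.F.nx_pos (Q.ξ v (-1)); omega)).2 (hc _)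
      have e2 := Q.F.op_eq (Q.ξ v (-1))
      rw [← Q.ξφ, neg_add_cancel] at e2
      rw [← e2]; exact this
  obtain ⟨w, l, rfl⟩ := P.nf_xi hn
  refine ⟨l, w - rt l v, fun k => ?_⟩
  have := same_all h0 he hc k
  rw [zero_add] at this
  convert this using 2
  · abel
  · ring

/-- two-dimensional determinant -/
def dt (v w : ℤ × ℤ) : ℤ := v.1 * w.2 - v.2 * w.1

theorem dt_add (u v w) : dt u (v + w) = dt u v + dt u w := by simp [dt]; ring
theorem dt_smul (u w) (c : ℤ) : dt u (c • w) = c * dt u w := by simp [dt]; ring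
theorem dt_self (u) : dt u u = 0 := by simp [dt]; ring
theorem dt_hx : ∀ i, dt (hx i) (hx (i + 1)) = 1 := by decide
theorem dt_comm (u v) : dt u v = - dt v u := by simp [dt]; ring

theorem coord (i : ZMod 6) (v : ℤ × ℤ) : ∃ p : ℤ, v = p • hx i + dt (hx i) v • hx (i + 1) := by
  refine ⟨- dt (hx (i + 1)) v, ?_⟩
  have h := dt_hx i
  simp only [dt] at h ⊢
  ext
  · simp; linear_combination (-v.1) * h
  · simp; linear_combination (-v.2) * h

theorem matching (h0 : SC Rw) (i : ZMod 6) (J : ℤ → Prop) (hJ : J 0) (hp : ∀ q, 0 ≤ q → J (q + 1) → J q)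
    (hn : ∀ q, q ≤ 0 → J (q - 1) → J q) (hc : ∀ v, J (dt (hx i) v) → Cm Q P v ∧ ∀ k, Cm Q P (v + hx k)) :
    ∃ o s, ∀ v, J (dt (hx i) v) → Mt Q P o s v := by
  have hz : J (dt (hx i) 0) := by simpa [dt] using hJ
  obtain ⟨o, s, h⟩ := mt_start h0 (hc 0 hz).1 (hc 0 hz).2
  refine ⟨o, s, ?_⟩
  have hd : ∀ p q : ℤ, dt (hx i) (p • hx i + q • hx (i + 1)) = q := by
    intro p q; rw [dt_add, dt_smul, dt_smul, dt_self, dt_hx]; ring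
  have hJc : ∀ p q : ℤ, J q → Cm Q P (p • hx i + q • hx (i + 1)) ∧ ∀ k, Cm Q P (p • hx i + q • hx (i + 1) + hx k) := by
    intro p q hq; apply hc; rwa [hd]
  have step : ∀ (p q p' q' : ℤ) (k : ZMod 6), J q → J q' → p' • hx i + q' • hx (i + 1) = p • hx i + q • hx (i + 1) + hx k →
      Mt Q P o s (p • hx i + q • hx (i + 1)) → Mt Q P o s (p' • hx i + q' • hx (i + 1)) := by
    intro p q p' q' k hq hq' e hm
    rw [e]
    refine mt_step h0 k hm (hJc p q hq).2 ?_
    rw [← e]; exact (hJc p' q' hq').2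
  have A : ∀ q : ℤ, J q → Mt Q P o s ((0 : ℤ) • hx i + q • hx (i + 1)) := by
    intro q
    induction q using Int.induction_on with
    | zero => intro _; simpa using h
    | succ q ih =>
      intro hq
      have hq' := hp q (by omega) hq
      refine step 0 q 0 (q + 1) (i + 1) hq' hq ?_ (ih hq')
      rw [add_smul, one_smul]; abel
    | pred q ih =>
      intro hq
      have hq' := hn (-q) (by omega) hq
      refine step 0 (-q) 0 (-q - 1) (i + 1 + 3) hq' hq ?_ (ih hq')
      rw [hx_add3, sub_smul, one_smul]; abel
  intro v hv
  obtain ⟨p, e⟩ := coord i v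
  generalize dt (hx i) v = q at *
  subst e
  induction p using Int.induction_on with
  | zero => exact A q hv
  | succ p ih =>
    refine step p q (p + 1) q i hv hv ?_ ih
    rw [add_smul, one_smul]; abel
  | pred p ih =>
    refine step (-p) q (-p - 1) q (i + 3) hv hv ?_ ih
    rw [hx_add3, sub_smul, one_smul]; abel
end Pl

namespace Pl
variable {Q P : Pl Rw ι}

/-- `x` acts by translation by `t` -/
def Tv (P : Pl Rw ι) (x : G) (t : ℤ × ℤ) : Prop :=
  ∀ v k, P.gg (P.ξ (v + t) k) = x * P.gg (P.ξ v k) ∧ P.rw (P.ξ (v + t) k) = P.rw (P.ξ v k)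

theorem Tv.add {x y : G} {t u : ℤ × ℤ} (h : Tv P x t) (h' : Tv P y u) : Tv P (x * y) (t + u) := by
  intro v k
  rw [add_comm t u, ← add_assoc]
  rw [(h _ k).1, (h' _ k).1, (h _ k).2, (h' _ k).2, mul_assoc]; exact ⟨rfl, rfl⟩

theorem Tv.neg {x : G} {t : ℤ × ℤ} (h : Tv P x t) : Tv P x⁻¹ (-t) := by
  intro v k
  have := h (v + -t) k
  rw [neg_add_cancel_right] at this
  rw [this.1, this.2, inv_mul_cancel_left]; exact ⟨rfl, rfl⟩

theorem tv_one : Tv P 1 0 := by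
  intro v k; rw [add_zero, one_mul]; exact ⟨rfl, rfl⟩

theorem Tv.npow {x : G} {t : ℤ × ℤ} (h : Tv P x t) (n : ℕ) : Tv P (x ^ n) (n • t) := by
  induction n with
  | zero => simpa using tv_one
  | succ n ih => rw [pow_succ, succ_nsmul]; exact ih.add h

theorem Tv.zpow {x : G} {t : ℤ × ℤ} (h : Tv P x t) (n : ℤ) : Tv P (x ^ n) (n • t) := by
  rcases n with n | n
  · simpa using h.npow n
  · have := (h.npow (n + 1)).neg
    rw [zpow_negSucc, negSucc_zsmul]; exact this

theorem Tv.eq {x y : G} {t : ℤ × ℤ} (h : Tv P x t) (h' : Tv P y t) : x = y := by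
  have a := (h 0 0).1
  have b := (h' 0 0).1
  rw [a] at b
  exact mul_right_cancel b

theorem Tv.tr {x p : G} {t : ℤ × ℤ} (h : Tv P x t) : Tv (P.tr p) (p * x * p⁻¹) t := by
  intro v k
  refine ⟨?_, (h v k).2⟩
  show p * P.gg (P.ξ (v + t) k) = p * x * p⁻¹ * (p * P.gg (P.ξ v k))
  rw [(h v k).1]; group

theorem Tv.mir (h0 : SC Rw) {x : G} {t : ℤ × ℤ} (h : Tv P x t) : Tv (P.mir h0) x (rf t) := by
  intro v k
  have e1 : ∀ w l, P.gg (FS.op P.φ P.α P.nf (P.ξ w l)) = P.gg (P.ξ w (l + 1)) := by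
    intro w l; rw [P.F.op_eq, ← P.ξφ, gg_pii]
  have e2 : ∀ w l, P.φ (P.α (FS.op P.φ P.α P.nf (P.ξ w l))) = P.ξ w (l + 1) := by
    intro w l; rw [P.F.phi_op, ← P.ξφ]
  have e3 : rf (v + rf t) = rf v + t := by rw [rf_add, rf_rf]
  constructor
  · show P.gg (FS.op P.φ P.α P.nf (P.ξ (rf (v + rf t)) (-k))) = x * P.gg (FS.op P.φ P.α P.nf (P.ξ (rf v) (-k)))
    rw [e1, e1, e3, (h _ _).1]
  · show iw (P.rw (P.φ (P.α (FS.op P.φ P.α P.nf (P.ξ (rf (v + rf t)) (-k)))))) = iw (P.rw (P.φ (P.α (FS.op P.φ P.α P.nf (P.ξ (rf v) (-k))))))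
    rw [e2, e2, e3, (h _ _).2]

theorem act6 (h0 : SC Rw) (x : G) (hx : ∀ g r, P.Cell (g, r) → P.Cell (x * g, r)) : ∃ t, Tv P (x ^ 6) t := by
  have hc : ∀ v, Cm (P.tr x) P v := by
    intro v
    obtain ⟨e, h1, h2⟩ := hx (P.gg (P.ξ v 0)) (P.rw (P.ξ v 0)) ⟨_, rfl, rfl⟩
    exact ⟨e, h1.symm, h2.symm⟩
  obtain ⟨o, s, h⟩ := matching (Q := P.tr x) (P := P) h0 0 (fun _ => True) trivial (fun _ _ _ => trivial) (fun _ _ _ => trivial)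
    (fun v _ => ⟨hc v, fun k => hc _⟩)
  have key : ∀ n : ℕ, ∃ s', ∀ v k, P.gg (P.ξ (rt (n • o) v + s') (k + n • o)) = x ^ n * P.gg (P.ξ v k) ∧
      P.rw (P.ξ (rt (n • o) v + s') (k + n • o)) = P.rw (P.ξ v k) := by
    intro n
    induction n with
    | zero => exact ⟨0, fun v k => by simp [rt_zero]⟩
    | succ n ih =>
      obtain ⟨s', ih⟩ := ih
      refine ⟨rt o s' + s, fun v k => ?_⟩
      have h1 := h (rt (n • o) v + s') trivial (k + n • o)
      have a1 : x * P.gg (P.ξ (rt (n • o) v + s') (k + n • o)) = _ := h1.1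
      have a2 : P.rw (P.ξ (rt (n • o) v + s') (k + n • o)) = _ := h1.2
      have e1 : rt o (rt (n • o) v + s') + s = rt ((n + 1) • o) v + (rt o s' + s) := by
        rw [rt_add, rt_rt, succ_nsmul, add_assoc]
      have e2 : k + n • o + o = k + (n + 1) • o := by rw [succ_nsmul, add_assoc]
      rw [e1, e2] at a1 a2
      rw [← a1, ← a2, (ih v k).1, (ih v k).2, pow_succ', mul_assoc]; exact ⟨rfl, rfl⟩
  obtain ⟨t, ht⟩ := key 6
  refine ⟨t, fun v k => ?_⟩
  have e6 : (6 : ℕ) • o = 0 := by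
    have : (6 : ZMod 6) = 0 := by decide
    rw [nsmul_eq_mul]; push_cast; rw [this, zero_mul]
  have := ht v k
  rwa [e6, rt_zero, add_zero] at this

theorem mt_all (h0 : SC Rw) {o : ZMod 6} {s u : ℤ × ℤ} (hc : ∀ v, Cm Q P v) (h : Mt Q P o s u) (v : ℤ × ℤ) : Mt Q P o s v := by
  have st : ∀ w k, Mt Q P o s w → Mt Q P o s (w + hx k) := fun w k hw =>
    mt_step h0 k hw (fun _ => hc _) (fun _ => hc _)
  have st2 : ∀ k (n : ℤ) w, Mt Q P o s w → Mt Q P o s (w + n • hx k) := by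
    intro k n w hw
    induction n using Int.induction_on with
    | zero => simpa using hw
    | succ n ih => rw [add_smul, one_smul, ← add_assoc]; exact st _ _ ih
    | pred n ih => rw [sub_smul, one_smul, sub_eq_add_neg, ← hx_add3, ← add_assoc]; exact st _ _ ih
  have e : v = u + (v - u).1 • hx 0 + (v - u).2 • hx 1 := by
    rw [add_assoc, ← v_eq]; abel
  rw [e]; exact st2 _ _ _ (st2 _ _ _ h)

theorem per_tv (h0 : SC Rw) {t u : ℤ × ℤ} {k : ZMod 6} (h : P.ξ (u + t) k = P.ξ u k) : Tv P 1 t := by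
  have hc : ∀ v, Cm P P v := fun v => ⟨_, rfl, rfl⟩
  have h1 : Same P P (P.ξ u k) (P.ξ (u + t) k) := by rw [h]; exact ⟨rfl, rfl⟩
  have h2 : Mt P P 0 t u := by
    intro l
    have := same_all h0 h1 (fun _ => hc _) (l - k)
    rw [rt_zero, add_zero]
    rwa [add_sub_cancel] at this
  intro v l
  have := mt_all h0 hc h2 v l
  rw [rt_zero, add_zero] at this
  rw [one_mul]; exact ⟨this.1.symm, this.2.symm⟩

theorem tv_indep {x y : G} (hL : Lat x y) {m n : ℤ} (hm : m ≠ 0) (hn : n ≠ 0) {t u : ℤ × ℤ} (hx : Tv P (x ^ m) t) (hy : Tv P (y ^ n) u) : dt t u ≠ 0 := by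
  have key : ∀ i l : ℤ, i • t + l • u = 0 → i = 0 ∧ l = 0 := by
    intro i l e
    have h1 := (hx.zpow i).add (hy.zpow l)
    rw [e] at h1
    have h2 := h1.eq tv_one
    rw [← zpow_mul, ← zpow_mul] at h2
    have := hL.free _ _ h2
    simpa [hm, hn] using this
  intro hd
  simp only [dt] at hd
  have a := key u.1 (-t.1) (by ext <;> simp <;> linarith)
  have b := key u.2 (-t.2) (by ext <;> simp <;> linarith)
  have : u = 0 := by ext; exact a.1; exact b.1
  have := key 0 1 (by rw [this]; simp)
  simp at this

theorem no_per (h0 : SC Rw) {x y : G} (hL : Lat x y) {m n : ℤ} (hm : m ≠ 0) (hn : n ≠ 0) {t u : ℤ × ℤ} (hx : Tv P (x ^ m) t) (hy : Tv P (y ^ n) u)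
    {s w : ℤ × ℤ} {k : ZMod 6} (h : P.ξ (w + s) k = P.ξ w k) : s = 0 := by
  have hN := tv_indep hL hm hn hx hy
  have h1 := (per_tv h0 h).zpow (dt t u)
  have h2 := (hx.zpow (dt s u)).add (hy.zpow (dt t s))
  have e : dt t u • s = dt s u • t + dt t s • u := by
    simp only [dt]; ext <;> simp <;> ring
  rw [← e] at h2
  have h3 := h2.eq h1
  rw [one_zpow, ← zpow_mul, ← zpow_mul] at h3
  have h4 := hL.free _ _ h3
  simp only [mul_eq_zero, hm, hn, false_or] at h4
  rw [h4.1, h4.2, zero_smul, zero_smul, add_zero, smul_eq_zero] at e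
  exact e.resolve_left hN
end Pl

end

section
open scoped Classical
universe uG uS
variable {S : Type uS}
variable {Rw : Set (Wd S)}
variable {G : Type uG} [Group G] {ι : FreeGroup S →* G}

namespace Pl
variable {Q P : Pl Rw ι}

theorem lab_gg {e : Q.E} {e' : P.E} (hg : Q.gg e = P.gg e') (K : ℕ) (hl : ∀ k < K, Q.lab ((Q.φ ^ k) e) = P.lab ((P.φ ^ k) e')) :
    ∀ k ≤ K, Q.gg ((Q.φ ^ k) e) = P.gg ((P.φ ^ k) e') := by
  intro k
  induction k with
  | zero => intro _; exact hg
  | succ k ih =>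
    intro hk
    rw [pow_succ', pow_succ', Perm.mul_apply, Perm.mul_apply, Q.gφ, P.gφ, ih (by omega), hl k (by omega)]

theorem two_sides (h0 : SC Rw) {e : Q.E} {e' : P.E} (hg : Q.gg e = P.gg e') (K s : ℕ) (hs : 0 < s) (hsK : s < K)
    (hl : ∀ k < K, Q.lab ((Q.φ ^ k) e) = P.lab ((P.φ ^ k) e')) (n0 : Q.nf e) (n1 : Q.nf ((Q.φ ^ s) e))
    (n2 : Q.nf ((Q.φ ^ K) e)) (hc : ¬ Com Q P e) : False := by
  have hG := lab_gg hg K hl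
  refine Q.F.three h0 (fun k => (Q.φ ^ k) e) (fun k => iw (P.rw (P.φ ((P.φ ^ k) e')))) K s hs hsK ?_ n0 n1 ?_ ?_ ?_ ?_ ?_
  · intro k; first | (intro _; rw [pow_succ', Perm.mul_apply]) | rw [pow_succ', Perm.mul_apply]
  · show Q.nf (Q.φ ((Q.φ ^ (K - 1)) e))
    rw [← Perm.mul_apply, ← pow_succ', show K - 1 + 1 = K by omega]; exact n2
  · intro k _; exact h0.inv _ (P.F.Rm _)
  · intro k hk
    show (iw (P.rw (P.φ ((P.φ ^ k) e')))).head? = _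
    rw [P.F.Rr, iw_head _ _ (P.F.Rh _), hl k hk]
  · intro k hk
    show iw (P.rw (P.φ ((P.φ ^ k) e'))) = (iw (P.rw (P.φ ((P.φ ^ (k + 1)) e')))).rotate 1
    rw [P.F.Rr ((P.φ ^ (k + 1)) e'), iw_rot, pow_succ', Perm.mul_apply]
  · intro k hk hh
    have h1 := iw_inj hh
    rw [← Perm.mul_apply, ← pow_succ', ← Perm.mul_apply, ← pow_succ'] at h1
    exact hc ((com_pow (k + 1)).1 ⟨_, hG (k + 1) (by omega), h1.symm⟩)

theorem two_sides' (h0 : SC Rw) {e : Q.E} {e' : P.E} (hg : Q.gg e = P.gg e') (K s : ℕ) (hs : 0 < s) (hsK : s < K)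
    (hl : ∀ k < K, Q.lab ((Q.φ ^ k) e) = P.lab ((P.φ ^ k) e')) (n0 : P.nf e') (n1 : P.nf ((P.φ ^ s) e'))
    (n2 : P.nf ((P.φ ^ K) e')) (hc : ¬ Com Q P e) : False := by
  refine two_sides (Q := P) (P := Q) h0 hg.symm K s hs hsK (fun k hk => (hl k hk).symm) n0 n1 n2 ?_
  rintro ⟨e2, h2⟩
  have : e2 = e := by
    apply Q.inj
    · rw [← h2.1, hg]
    · rw [← h2.lab]; exact (hl 0 (by omega)).symm
  exact hc ⟨e', this ▸ h2.symm⟩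

theorem side_back (P : Pl Rw ι) {b : P.E} (j : ℕ) (hj : j < nx P.φ P.nf b) : P.α b = (P.φ ^ j) (P.α ((P.φ ^ j) b)) := by
  have h1 := P.F.op_pow b (nx P.φ P.nf b - 1) (by omega)
  have h2 := P.F.op_pow b (nx P.φ P.nf b - 1 - j) (by omega)
  rw [show nx P.φ P.nf b - 1 - (nx P.φ P.nf b - 1 - j) = j by omega] at h2
  rw [← h2, ← Perm.mul_apply, ← pow_add, show j + (nx P.φ P.nf b - 1 - j) = nx P.φ P.nf b - 1 by omega, h1]
  simp

theorem five (h0 : SC Rw) {d : Q.E} (hd : Q.nf d) (hc : Com Q P d)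
    (hn : ∀ i, nx Q.φ Q.nf d ≤ i → i < (Q.rw d).length → Com Q P (Q.α ((Q.φ ^ i) d))) : Com Q P (Q.α d) := by
  by_contra hcon
  obtain ⟨d', h⟩ := hc
  have hs0 := Q.F.nx_pos d
  have hslen : nx Q.φ Q.nf d < (Q.rw d).length := by
    rcases (Q.F.nx_le_len hd).lt_or_eq with hh | hh
    · exact hh
    · exfalso
      have h6 := Q.F.six d
      have : ({i ∈ range (Q.rw d).length | Q.nf ((Q.φ ^ i) d)} : Finset ℕ) ⊆ {0} := by
        intro i hi
        simp only [mem_filter, mem_range, mem_singleton] at hi ⊢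
        by_contra h00
        exact FS.nx_lt (by omega) (by omega) hi.2
      have := card_le_card this
      rw [h6] at this
      simp at this
  set s := nx Q.φ Q.nf d with hs
  have hlen : (P.rw d').length = (Q.rw d).length := by rw [h.2]
  have hinv : Com Q P (Q.α (Q.φ⁻¹ d)) := by
    rw [phi_inv]; exact hn _ (by omega) (by omega)
  have hq := h.inv.alpha hinv
  -- nf at d'
  have n0 : P.nf d' := by
    by_contra hnd
    have e1 : P.φ (P.α d') = P.α (P.φ⁻¹ d') := by
      apply P.inj
      · rw [gg_pi, gg_pii]
      · by_contra hh; exact hnd ((nf_lab h0 P d').2 hh)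
    have e2 : P.α d' = P.φ⁻¹ (P.α (P.φ⁻¹ d')) := by rw [← e1, pinv_apply]
    have e3 : Q.α d = Q.φ⁻¹ (Q.α (Q.φ⁻¹ d)) := by
      apply Q.inj
      · rw [hq.inv.1, ← e2, Q.gα, P.gα, h.1, h.lab]
      · rw [hq.inv.lab, ← e2, Q.F.labα, P.F.labα, h.lab]
    apply (nf_lab h0 Q d).1 hd
    rw [e3, papply_inv]
  have ns : P.nf ((P.φ ^ s) d') := by
    by_contra hnd
    have hy := h.pow s
    have hya := hy.alpha (hn s le_rfl hslen)
    have hnq : Q.nf ((Q.φ ^ s) d) := Q.F.nx_nf d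
    set y := (Q.φ ^ s) d
    set y' := (P.φ ^ s) d'
    apply (nf_lab h0 Q y).1 hnq
    rw [hya.phi.lab]
    have : ¬ P.lab (P.φ (P.α y')) ≠ P.lab (P.α (P.φ⁻¹ y')) := fun hh => hnd ((nf_lab h0 P y').2 hh)
    rw [not_not.1 this, P.F.labα, Q.F.labα, hy.inv.lab]
  have nfs : ∀ i < (Q.rw d).length, Q.nf ((Q.φ ^ i) d) → P.nf ((P.φ ^ i) d') := by
    intro i hi hni
    rcases lt_trichotomy i s with hh | hh | hh
    · rcases Nat.eq_zero_or_pos i with rfl | hi0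
      · exact n0
      · exact absurd hni (FS.nx_lt hi0 hh)
    · rw [hh]; exact ns
    · refine ((h.pow i).nf h0 (hn i hh.le hi) ?_).1 hni
      obtain ⟨j, rfl⟩ : ∃ j, i = j + 1 := ⟨i - 1, by omega⟩
      rw [pow_succ', Perm.mul_apply, pinv_apply]; exact hn j (by omega) (by omega)
  have nxs : nx P.φ P.nf d' = s := by
    apply FS.nx_eq hs0 ns
    intro j hj0 hjs hnj
    have hsub : ({i ∈ range (Q.rw d).length | Q.nf ((Q.φ ^ i) d)} : Finset ℕ) ⊆ {i ∈ range (P.rw d').length | P.nf ((P.φ ^ i) d')} := by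
      intro i hi
      simp only [mem_filter, mem_range] at hi ⊢
      exact ⟨by omega, nfs i hi.1 hi.2⟩
    have heq := eq_of_subset_of_card_le hsub (by rw [Q.F.six, P.F.six])
    have : j ∈ ({i ∈ range (P.rw d').length | P.nf ((P.φ ^ i) d')} : Finset ℕ) := by
      simp only [mem_filter, mem_range]; exact ⟨by omega, hnj⟩
    rw [← heq] at this
    simp only [mem_filter] at this
    exact FS.nx_lt hj0 hjs this.2
  -- the opposite face
  set e := FS.op Q.φ Q.α Q.nf d with he
  set e' := FS.op P.φ P.α P.nf d' with he'
  have hce : ¬ Com Q P e := by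
    intro hh
    apply hcon
    have := hh.pow (s - 1)
    rwa [Q.F.op_pow _ _ (by omega), ← hs, Nat.sub_self] at this
  have hge : Q.gg e = P.gg e' := by
    rw [he, he', FS.op, FS.op, nxs, ← hs, Q.gα, P.gα, (h.pow (s - 1)).1, (h.pow (s - 1)).lab]
  have hl1 : ∀ k < s, Q.lab ((Q.φ ^ k) e) = P.lab ((P.φ ^ k) e') := by
    intro k hk
    rw [Q.F.op_pow d k hk, P.F.op_pow d' k (by omega), Q.F.labα, P.F.labα, nxs, ← hs, (h.pow _).lab]
  have hb : (Q.φ ^ s) e = Q.φ (Q.α d) := Q.F.op_end d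
  have hb' : (P.φ ^ s) e' = P.φ (P.α d') := by rw [← nxs]; exact P.F.op_end d'
  have hab : Q.α (Q.φ (Q.α d)) = Q.φ⁻¹ (Q.α (Q.φ⁻¹ d)) := by
    apply Q.φ.injective
    rw [papply_inv]
    have := Q.F.v3 d hd
    have h2 : Q.φ⁻¹ d = Q.α (Q.φ (Q.α (Q.φ (Q.α d)))) := by
      apply Q.φ.injective; rw [papply_inv, this]
    rw [h2, Q.F.αα]
  have hab' : P.α (P.φ (P.α d')) = P.φ⁻¹ (P.α (P.φ⁻¹ d')) := by
    apply P.φ.injective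
    rw [papply_inv]
    have := P.F.v3 d' n0
    have h2 : P.φ⁻¹ d' = P.α (P.φ (P.α (P.φ (P.α d')))) := by
      apply P.φ.injective; rw [papply_inv, this]
    rw [h2, P.F.αα]
  set b := Q.φ (Q.α d) with hbd
  set b' := P.φ (P.α d') with hbd'
  have hSb : Same Q P (Q.α b) (P.α b') := by rw [hab, hab']; exact hq.inv
  have hback : ∀ j, Same Q P ((Q.φ⁻¹ ^ j) (Q.α b)) ((P.φ⁻¹ ^ j) (P.α b')) := by
    intro j
    induction j with
    | zero => exact hSb
    | succ j ih => rw [pow_succ', pow_succ']; exact ih.inv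
  have hl2 : ∀ j, j < nx Q.φ Q.nf b → j < nx P.φ P.nf b' → Q.lab ((Q.φ ^ j) b) = P.lab ((P.φ ^ j) b') := by
    intro j hj hj'
    have h1 := Q.side_back j hj
    have h2 := P.side_back j hj'
    have h3 := hback j
    rw [h1, h2, inv_pow, inv_pow, pinv_apply, pinv_apply] at h3
    have := h3.lab
    rw [Q.F.labα, P.F.labα] at this
    exact li_inj this
  have hl : ∀ k, k < s + nx Q.φ Q.nf b → k < s + nx P.φ P.nf b' → Q.lab ((Q.φ ^ k) e) = P.lab ((P.φ ^ k) e') := by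
    intro k hk hk'
    by_cases hks : k < s
    · exact hl1 k hks
    · obtain ⟨j, rfl⟩ : ∃ j, k = j + s := ⟨k - s, by omega⟩
      rw [pow_add, pow_add, Perm.mul_apply, Perm.mul_apply, hb, hb']
      exact hl2 j (by omega) (by omega)
  have p1 := Q.F.nx_pos b
  have p2 := P.F.nx_pos b'
  rcases le_total (nx Q.φ Q.nf b) (nx P.φ P.nf b') with hh | hh
  · refine two_sides h0 hge (s + nx Q.φ Q.nf b) s hs0 (by omega) (fun k hk => hl k hk (by omega)) (Q.F.op_nf d) ?_ ?_ hce
    · rw [hb, hbd, Q.F.nα]; exact hd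
    · rw [add_comm, pow_add, Perm.mul_apply, hb]; exact Q.F.nx_nf b
  · refine two_sides' h0 hge (s + nx P.φ P.nf b') s hs0 (by omega) (fun k hk => hl k (by omega) hk) (P.F.op_nf d') ?_ ?_ hce
    · rw [hb', hbd', P.F.nα]; exact n0
    · rw [add_comm, pow_add, Perm.mul_apply, hb']; exact P.F.nx_nf b'
end Pl

namespace Pl
variable {Q P : Pl Rw ι}

theorem face_pos (Q : Pl Rw ι) (v : ℤ × ℤ) (k : ZMod 6) (i : ℕ) : ∃ m j : ℕ, j < nx Q.φ Q.nf (Q.ξ v (k + m)) ∧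
    (Q.φ ^ i) (Q.ξ v k) = (Q.φ ^ j) (Q.ξ v (k + m)) ∧ #{l ∈ range (i + 1) | Q.nf ((Q.φ ^ l) (Q.ξ v k))} = m + 1 := by
  induction i with
  | zero =>
    refine ⟨0, 0, Q.F.nx_pos _, by simp, ?_⟩
    rw [zero_add, range_one, filter_singleton, if_pos (show Q.nf ((Q.φ ^ 0) (Q.ξ v k)) from Q.ξnf v k)]; rfl
  | succ i ih =>
    obtain ⟨m, j, h1, h2, h3⟩ := ih
    by_cases hj : j + 1 < nx Q.φ Q.nf (Q.ξ v (k + m))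
    · have e : (Q.φ ^ (i + 1)) (Q.ξ v k) = (Q.φ ^ (j + 1)) (Q.ξ v (k + m)) := by
        rw [pow_succ', pow_succ', Perm.mul_apply, Perm.mul_apply, h2]
      refine ⟨m, j + 1, hj, e, ?_⟩
      rw [range_add_one, filter_insert, if_neg, h3]
      rw [e]; exact FS.nx_lt (by omega) hj
    · have e : (Q.φ ^ (i + 1)) (Q.ξ v k) = Q.ξ v (k + (m + 1 : ℕ)) := by
        rw [pow_succ', Perm.mul_apply, h2, ← Perm.mul_apply, ← pow_succ', show j + 1 = nx Q.φ Q.nf (Q.ξ v (k + m)) by omega,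
          ← Q.ξφ]; push_cast; rw [add_assoc]
      refine ⟨m + 1, 0, Q.F.nx_pos _, e, ?_⟩
      rw [range_add_one, filter_insert, if_pos, card_insert_of_notMem (by simp), h3]
      rw [e]; exact Q.ξnf _ _

theorem five_cm (h0 : SC Rw) {v : ℤ × ℤ} {k : ZMod 6} (hv : Cm Q P v) (h : ∀ j, j ≠ k → Cm Q P (v + hx j)) : Cm Q P (v + hx k) := by
  rw [← cm_alpha v k 0 (Q.F.nx_pos _)]
  show Com Q P (Q.α (Q.ξ v k))
  refine five h0 (Q.ξnf v k) ((cm_iff v k).2 hv) ?_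
  intro i hi hil
  obtain ⟨m, j, h1, h2, h3⟩ := Q.face_pos v k i
  rw [h2, cm_alpha _ _ _ h1]
  apply h
  have hm5 : m + 1 ≤ 6 := by
    rw [← h3, ← Q.F.six (Q.ξ v k)]
    apply card_le_card
    intro l; simp only [mem_filter, mem_range]; rintro ⟨a, b⟩; exact ⟨by omega, b⟩
  have hm1 : 2 ≤ m + 1 := by
    have hp := Q.F.nx_pos (Q.ξ v k)
    rw [← h3]
    have : ({0, nx Q.φ Q.nf (Q.ξ v k)} : Finset ℕ) ⊆ ({l ∈ range (i + 1) | Q.nf ((Q.φ ^ l) (Q.ξ v k))} : Finset ℕ) := by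
      intro l
      simp only [mem_filter, mem_range, mem_insert, mem_singleton]
      rintro (rfl | rfl)
      · exact ⟨by omega, Q.ξnf _ _⟩
      · exact ⟨by omega, Q.F.nx_nf _⟩
    have := card_le_card this
    rwa [card_pair (by omega)] at this
  intro hh
  have : (m : ZMod 6) = 0 := by simpa using hh
  rw [ZMod.natCast_eq_zero_iff] at this
  omega

theorem nc_step (h0 : SC Rw) {v : ℤ × ℤ} (hv : ¬ Cm Q P v) (k : ZMod 6) :
    ¬ Cm Q P (v + hx k) ∨ ∃ j, j ≠ k + 3 ∧ ¬ Cm Q P (v + hx k + hx j) := by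
  by_contra hcon
  push Not at hcon
  apply hv
  have := five_cm h0 (k := k + 3) hcon.1 hcon.2
  rwa [hx_add3, add_neg_cancel_right] at this

theorem hx_tie : ∀ j k : ZMod 6, j ≠ k → hx j - hx k = hx (k + 2) ∨ hx j - hx k = hx (k - 2) ∨ hx j = - hx k ∨
  hx j + hx k = hx (k + 1) ∨ hx j + hx k = hx (k - 1) := by decide

theorem rowD (NC : ℤ × ℤ → Prop) (hE : ∀ v, NC v → ∀ k, NC (v + hx k) ∨ ∃ j, j ≠ k + 3 ∧ NC (v + hx k + hx j))
    (w : ℤ × ℤ) (hw : w ≠ 0) (K0 : ℤ) (hK : ∀ k, 2 * dt w (hx k) ≤ K0) (hc : ∀ v, -K0 ≤ dt w v → dt w v ≤ 0 → ¬ NC v)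
    (hex : ∃ v, NC v ∧ 0 < dt w v) : ∃ i, dt w (hx i) = 0 ∧ ∃ v0, NC v0 ∧ 0 < dt w v0 ∧ (∀ v, -K0 ≤ dt w v → dt w v < dt w v0 → ¬ NC v) ∧
      ∀ n : ℤ, NC (v0 + n • hx i) := by
  -- minimal level
  have hm : ∃ m : ℕ, 0 < m ∧ ∃ v, NC v ∧ dt w v = m := by
    obtain ⟨v, h1, h2⟩ := hex
    exact ⟨(dt w v).toNat, by omega, v, h1, by omega⟩
  obtain ⟨m, ⟨hm0, v0, hv0, hvm⟩, hmin⟩ : ∃ m : ℕ, (0 < m ∧ ∃ v, NC v ∧ dt w v = m) ∧ ∀ m' < m, ¬ (0 < m' ∧ ∃ v, NC v ∧ dt w v = m') :=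
    ⟨Nat.find hm, Nat.find_spec hm, fun m' h => Nat.find_min hm h⟩
  have hlow : ∀ v, -K0 ≤ dt w v → dt w v < m → ¬ NC v := by
    intro v h1 h2 h3
    by_cases h4 : dt w v ≤ 0
    · exact hc v h1 h4 h3
    · exact hmin (dt w v).toNat (by omega) ⟨by omega, v, h3, by omega⟩
  have neg3 : ∀ k, dt w (hx (k + 3)) = - dt w (hx k) := by
    intro k; rw [hx_add3]; simp [dt]; ring
  have hb : ∀ k, -K0 ≤ 2 * dt w (hx k) := by
    intro k; have := hK (k + 3); rw [neg3] at this; omega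
  have step : ∀ v, NC v → dt w v = m → ∀ k, dt w (hx k) < 0 → ∃ j, j ≠ k + 3 ∧ NC (v + hx k + hx j) ∧ 0 ≤ dt w (hx k) + dt w (hx j) := by
    intro v hv hvm k hk
    have hbk := hb k
    rcases hE v hv k with h | ⟨j, hj, h⟩
    · exfalso
      refine hlow _ ?_ ?_ h
      · rw [dt_add]; omega
      · rw [dt_add]; omega
    · refine ⟨j, hj, h, ?_⟩
      by_contra hh
      have hbj := hb j
      refine hlow _ ?_ ?_ h
      · rw [dt_add, dt_add]; omega
      · rw [dt_add, dt_add]; omega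
  -- minimal direction
  obtain ⟨k, hk⟩ : ∃ k : ZMod 6, ∀ j, dt w (hx k) ≤ dt w (hx j) := by
    obtain ⟨k, _, hk⟩ := exists_min_image (univ : Finset (ZMod 6)) (fun k => dt w (hx k)) ⟨0, mem_univ _⟩
    exact ⟨k, fun j => hk j (mem_univ _)⟩
  have hkneg : dt w (hx k) < 0 := by
    by_contra hh
    have a := hk 0
    have b := hk (0 + 3)
    have c := hk 1
    have d := hk (1 + 3)
    rw [neg3] at b d
    have e1 : dt w (hx 0) = 0 := by omega
    have e2 : dt w (hx 1) = 0 := by omega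
    rw [hx0] at e1; rw [hx1] at e2
    simp [dt] at e1 e2
    exact hw (by ext <;> simp [e1, e2])
  obtain ⟨j, hj, _, hj2⟩ := step v0 hv0 hvm k hkneg
  have hjk : dt w (hx j) = dt w (hx (k + 3)) := by
    have := hk (j + 3); rw [neg3] at this ⊢; omega
  have sub : ∀ u v, dt w (u - v) = dt w u - dt w v := by intro u v; simp [dt]; ring
  have hi0 : ∃ i, dt w (hx i) = 0 := by
    have hpos : 0 < dt w (hx (k + 3)) := by rw [neg3]; omega
    have hle : ∀ l, dt w (hx l) ≤ dt w (hx (k + 3)) := by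
      intro l; have := hk (l + 3); rw [neg3] at this ⊢; omega
    rcases hx_tie j (k + 3) hj with h | h | h | h | h
    · exact ⟨_, by rw [← h, sub, hjk]; ring⟩
    · exact ⟨_, by rw [← h, sub, hjk]; ring⟩
    · exfalso
      rw [h, ← hx_add3, neg3] at hjk; omega
    · exfalso
      have h1 := hle (k + 3 + 1)
      rw [← h, dt_add] at h1; omega
    · exfalso
      have h1 := hle (k + 3 - 1)
      rw [← h, dt_add] at h1; omega
  have hi1 : ∃ i, dt w (hx i) = 0 ∧ 0 < dt w (hx (i + 1)) := by
    obtain ⟨i, hi⟩ := hi0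
    have hne : dt w (hx (i + 1)) ≠ 0 := by
      intro h1
      obtain ⟨p, hp⟩ := coord i (hx k)
      rw [hp, dt_add, dt_smul, dt_smul, hi, h1] at hkneg
      simp at hkneg
    rcases lt_or_gt_of_ne hne with h | h
    · refine ⟨i + 3, by rw [neg3, hi]; rfl, ?_⟩
      rw [show i + 3 + 1 = i + 1 + 3 by ring, neg3]; omega
    · exact ⟨i, hi, h⟩
  obtain ⟨i, hi, hip⟩ := hi1
  have hi2 : dt w (hx (i + 2)) = dt w (hx (i + 1)) := by rw [hx_add2, sub, hi]; ring
  have cases6 : ∀ j : ZMod 6, j = i ∨ j = i + 1 ∨ j = i + 2 ∨ j = i + 3 ∨ j = i + 1 + 3 ∨ j = i + 2 + 3 := by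
    have : ∀ i j : ZMod 6, j = i ∨ j = i + 1 ∨ j = i + 2 ∨ j = i + 3 ∨ j = i + 1 + 3 ∨ j = i + 2 + 3 := by decide
    exact this i
  have hone : ∀ j, dt w (hx (i + 1)) ≤ dt w (hx j) → j = i + 1 ∨ j = i + 2 := by
    intro j hj
    rcases cases6 j with h | h | h | h | h | h
    · rw [h] at hj; omega
    · exact Or.inl h
    · exact Or.inr h
    · rw [h, neg3] at hj; omega
    · rw [h, neg3] at hj; omega
    · rw [h, neg3, hi2] at hj; omega
  have hplus : ∀ v, NC v → dt w v = m → NC (v + hx i) := by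
    intro v hv hvm
    obtain ⟨j, hj, h, hl⟩ := step v hv hvm (i + 2 + 3) (by rw [neg3]; omega)
    rw [neg3] at hl
    rcases hone j (by omega) with rfl | rfl
    · rw [hx_add3, hx_add2] at h
      convert h using 1; abel
    · exfalso; apply hj
      rw [add_assoc]; rw [show (3 : ZMod 6) + 3 = 0 by decide, add_zero]
  have hminus : ∀ v, NC v → dt w v = m → NC (v - hx i) := by
    intro v hv hvm
    obtain ⟨j, hj, h, hl⟩ := step v hv hvm (i + 1 + 3) (by rw [neg3]; omega)
    rw [neg3] at hl
    rcases hone j (by omega) with rfl | rfl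
    · exfalso; apply hj
      rw [add_assoc]; rw [show (3 : ZMod 6) + 3 = 0 by decide, add_zero]
    · rw [hx_add3, hx_add2] at h
      convert h using 1; abel
  refine ⟨i, hi, v0, hv0, by omega, fun v h1 h2 => hlow v h1 (by omega), ?_⟩
  have hrow : ∀ n : ℤ, dt w (v0 + n • hx i) = m := by
    intro n; rw [dt_add, dt_smul, hi, hvm]; ring
  intro n
  induction n using Int.induction_on with
  | zero => simpa using hv0
  | succ n ih => rw [add_smul, one_smul, ← add_assoc]; exact hplus _ ih (hrow _)
  | pred n ih => rw [sub_smul, one_smul, ← add_sub_assoc]; exact hminus _ ih (hrow _)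
end Pl

section
variable {E : Type*} {φ α : Perm E} {lab : E → S × Bool} {rw : E → Wd S} {nf : E → Prop}

theorem sub_pow (p : E → Prop) (φ : Perm E) (h : ∀ e, p (φ e) ↔ p e) (i : ℕ) (e : {e // p e}) :
    (((φ.subtypePerm h) ^ i) e).1 = (φ ^ i) e.1 := by
  rw [Perm.subtypePerm_pow]; rfl

/-- restriction to an invariant set -/
theorem FS.restr (F : FS Rw φ α lab rw nf) (p : E → Prop) (hφ : ∀ e, p (φ e) ↔ p e) (hα : ∀ e, p (α e) ↔ p e) :
    FS Rw (φ.subtypePerm hφ) (α.subtypePerm hα) (fun e : {e // p e} => lab e.1) (fun e => rw e.1) (fun e => nf e.1) where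
  αα d := Subtype.ext (F.αα _)
  labα d := F.labα _
  Rm d := F.Rm _
  Rh d := F.Rh _
  Rr d := F.Rr _
  Rp d := Subtype.ext (by rw [sub_pow]; exact F.Rp _)
  nα d := F.nα _
  v2 d h := Subtype.ext (F.v2 _ h)
  v3 d h := Subtype.ext (F.v3 _ h)
  six d := by rw [← F.six d.1]; congr 1; ext i; simp only [mem_filter, sub_pow]
  ne d := F.ne _
end

/-- the indicator chain of a cell -/
noncomputable def dlt {X : Type*} (st : S × Bool → X → X) (p0 : X) (ρ : Wd S) : X → Wd S → ℚ :=
  fun p r => (if p = p0 ∧ r = ρ then 1 else 0) - if run st (r.take 1) p = p0 ∧ iw (r.rotate 1) = ρ then 1 else 0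

theorem dlt_anti {X : Type*} {st : S × Bool → X → X} (hst : ∀ a x, st (li a) (st a x) = x) (p0 : X) (ρ) : Anti st (dlt st p0 ρ) := by
  intro x a t
  have e1 : run st ((iw (t ++ [a])).take 1) (st a x) = x := by
    rw [iw_append]; simp [iw, run, hst]
  have e2 : iw ((iw (t ++ [a])).rotate 1) = a :: t := by
    rw [iw_append]; simp [iw, Function.comp_def, li_li]
  have e3 : run st ((a :: t).take 1) x = st a x := by simp [run]
  have e4 : iw ((a :: t).rotate 1) = iw (t ++ [a]) := by simp
  simp only [dlt, e1, e2, e3, e4]; ring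

theorem plane_ex (h0 : SC Rw) (hR : ∀ r ∈ Rw, ι (FreeGroup.mk r) = 1)
    (hk : ∀ g, ι g = 1 → g ∈ Subgroup.normalClosure (FreeGroup.mk '' Rw))
    {x y : G} (h : Lat x y) (u v : FreeGroup S) (hu : ι u = x) (hv : ι v = y)
    (ls : List (Wd S × Wd S)) (hls : ∀ p ∈ ls, p.2 ∈ Rw)
    (hc : cprod ls = u * v * u⁻¹ * v⁻¹) : ∃ P : Pl Rw ι, ∀ g ρ,
      (P.Cell (g, ρ) ↔ cch (lst ι h) (cls h 1) ls (dlt (lst ι h) (cls h g) ρ) = 1) ∧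
      (P.Cell (g, iw ρ) ↔ cch (lst ι h) (cls h 1) ls (dlt (lst ι h) (cls h g) ρ) = -1) := by
  obtain ⟨D, _, φ, α, lab, rw, nf, pos, F, pφ, pα, hCh, e0, he0⟩ := torus_out h0 hR h u v hu hv ls hls hc
  have FL := F.lift hR
  set Φ := lift ι φ lab
  set A := lift ι α lab
  have hφ : ∀ e, Reach Φ A e0 (Φ e) ↔ Reach Φ A e0 e := fun e =>
    ⟨fun hr => hr.trans (FL.reach_symm (Reach.stφ Relation.ReflTransGen.refl)), fun hr => hr.stφ⟩
  have hα : ∀ e, Reach Φ A e0 (A e) ↔ Reach Φ A e0 e := fun e =>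
    ⟨fun hr => hr.trans (FL.reach_symm (Reach.stα Relation.ReflTransGen.refl)), fun hr => hr.stα⟩
  have FE := FL.restr (fun e => Reach Φ A e0 e) hφ hα
  have inj : ∀ e e' : {e // Reach Φ A e0 e}, e.1.2 = e'.1.2 → lab e.1.1 = lab e'.1.1 → e = e' := by
    intro e e' h1 h2
    exact Subtype.ext (FL.reach_inj h0 (ι := ι) hk (fun e => e.2) (fun d => rfl) (fun d => rfl) ((FL.reach_symm e.2).trans e'.2) h1 h2)
  have hr : ∀ e : {e // Reach Φ A e0 e}, Reach (Φ.subtypePerm hφ) (A.subtypePerm hα) ⟨e0, Relation.ReflTransGen.refl⟩ e := by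
    rintro ⟨e, he⟩
    induction he with
    | refl => exact Relation.ReflTransGen.refl
    | tail hb hc ih =>
      rcases hc with rfl | rfl
      · exact ih.stφ
      · exact ih.stα
  obtain ⟨i, hi⟩ : ∃ i, nf (((Φ ^ i) e0).1) := by
    have := FL.six e0
    obtain ⟨i, hi⟩ := card_pos.1 (by rw [this]; norm_num : 0 < #{i ∈ range (rw e0.1).length | nf (((Φ ^ i) e0).1)})
    exact ⟨i, (mem_filter.1 hi).2⟩
  have hri : Reach Φ A e0 ((Φ ^ i) e0) := Reach.pow Relation.ReflTransGen.refl i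
  obtain ⟨ξ, ξnf, ξφ, ξα, ξs⟩ := FE.hexc ⟨_, hri⟩ hi (fun e => (FE.reach_symm (hr ⟨_, hri⟩)).trans (hr e))
  let P : Pl Rw ι := ⟨{e // Reach Φ A e0 e}, Φ.subtypePerm hφ, A.subtypePerm hα, _, _, _, fun e => e.1.2, FE, fun d => rfl, fun d => rfl,
    inj, ξ, ξnf, ξφ, ξα, ξs⟩
  have hcell : ∀ g ρ, P.Cell (g, ρ) ↔ ∃ d, pos d = cls h g ∧ rw d = ρ := by
    intro g ρ
    constructor
    · rintro ⟨⟨⟨d, g'⟩, hd⟩, h1, h2⟩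
      have h1 : g' = g := h1
      subst h1
      exact ⟨d, (he0 _ _).2 hd, h2⟩
    · rintro ⟨d, h1, h2⟩
      exact ⟨⟨⟨d, g⟩, (he0 _ _).1 h1⟩, rfl, h2⟩
  have huniq : ∀ g ρ d d', pos d = cls h g → rw d = ρ → pos d' = cls h g → rw d' = ρ → d = d' := by
    intro g ρ d d' h1 h2 h3 h4
    have := P.rw_inj (d := ⟨⟨d, g⟩, (he0 _ _).1 h1⟩) (e := ⟨⟨d', g⟩, (he0 _ _).1 h3⟩) rfl (h2.trans h4.symm)
    exact congrArg (fun e => e.1.1) this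
  have hcount : ∀ g ρ, (∑ d, if pos d = cls h g ∧ rw d = ρ then (1 : ℚ) else 0) = if P.Cell (g, ρ) then 1 else 0 := by
    intro g ρ
    split_ifs with hh
    · obtain ⟨d, h1, h2⟩ := (hcell g ρ).1 hh
      rw [sum_eq_single d, if_pos ⟨h1, h2⟩]
      · intro b _ hb
        rw [if_neg]; rintro ⟨h3, h4⟩; exact hb (huniq g ρ b d h3 h4 h1 h2)
      · intro hd; exact absurd (mem_univ _) hd
    · apply sum_eq_zero
      intro d _
      rw [if_neg]; intro h1; exact hh ((hcell g ρ).2 ⟨d, h1⟩)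
  refine ⟨P, ?_⟩
  have key : ∀ g ρ, cch (lst ι h) (cls h 1) ls (dlt (lst ι h) (cls h g) ρ) = (if P.Cell (g, ρ) then 1 else 0) - if P.Cell (g, iw ρ) then 1 else 0 := by
    intro g ρ
    rw [← hCh _ (dlt_anti (lhst ι h) _ _), ← hcount g ρ, ← hcount g (iw ρ)]
    simp only [dlt, sum_sub_distrib]
    congr 1
    rw [← Equiv.sum_comp φ (fun d => if pos d = cls h g ∧ rw d = iw ρ then (1 : ℚ) else 0)]
    apply sum_congr rfl
    intro d _
    have e1 : run (lst ι h) ((rw d).take 1) (pos d) = pos (φ d) := by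
      have := F.Rh d
      rcases hd : rw d with _ | ⟨a, t⟩
      · rw [hd] at this; simp at this
      · rw [hd] at this
        have : a = lab d := by simpa using this
        rw [pφ, ← this]; simp [run]
    have e2 : iw ((rw d).rotate 1) = ρ ↔ rw (φ d) = iw ρ := by
      rw [F.Rr]
      constructor
      · rintro rfl; rw [iw_iw]
      · intro h; rw [h, iw_iw]
    rw [e1]; simp only [e2]
  intro g ρ
  rw [key]
  by_cases h1 : P.Cell (g, ρ) <;> by_cases h2 : P.Cell (g, iw ρ)
  · exact absurd h2 (fun h2 => P.cell_not g ρ h1 h2)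
  all_goals simp [h1, h2]; try norm_num

theorem fc_inv {X : Type*} {st : S × Bool → X → X} (hst : ∀ a x, st (li a) (st a x) = x) {f} (hf : Anti st f) {x : X}
    {r : Wd S} (hr : run st r x = x) : fc st f x (iw r) = - fc st f x r := by
  rw [fc, fc, iw_length, ← sum_range_reflect, ← sum_neg_distrib]
  apply sum_congr rfl
  intro i hi
  rw [mem_range] at hi
  obtain ⟨A, a, B, rfl, hA⟩ : ∃ A a B, r = A ++ a :: B ∧ A.length = i :=
    ⟨r.take i, r[i], r.drop (i + 1), by rw [← List.drop_eq_getElem_cons hi, List.take_append_drop], by simp; omega⟩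
  subst hA
  have e0 : (A ++ a :: B).length - 1 - A.length = (iw B).length := by simp <;> omega
  have e1 : iw (A ++ a :: B) = iw B ++ (li a :: iw A) := by
    rw [show A ++ a :: B = A ++ ([a] ++ B) from rfl, iw_append, iw_append]; simp [iw]
  rw [e0, e1, List.take_left, List.rotate_append_length_eq, List.take_left, List.rotate_append_length_eq]
  have e2 : run st (iw B) x = st a (run st A x) := by
    conv_lhs => rw [← hr, run_append]
    exact run_iw hst B _
  have e3 : (li a :: iw A) ++ iw B = iw ((B ++ A) ++ [a]) := by
    rw [iw_append, iw_append]; simp [iw]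
  rw [e2, e3, hf]; rfl

/-- the Cayley graph action -/
def gst (ι : FreeGroup S →* G) (a : S × Bool) (g : G) : G := g * gl ι a

theorem ghst (a : S × Bool) (g : G) : gst ι (li a) (gst ι a g) = g := by
  simp only [gst]; rw [mul_assoc, gl_li, mul_one]

theorem grun (l : Wd S) (g : G) : run (gst ι) l g = g * ι (FreeGroup.mk l) := by
  induction l generalizing g with
  | nil => rw [gl_nil, mul_one]; rfl
  | cons a l ih => rw [gl_cons, ← mul_assoc]; exact ih _

theorem anti_sh {F : G → Wd S → ℚ} (hF : Anti (gst ι) F) (y : G) : Anti (gst ι) (fun x => F (y * x)) := by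
  intro x a t
  have := hF (y * x) a t
  simp only [gst, mul_assoc] at this ⊢
  exact this

/-- the chain of a null-homotopy -/
def Rep (Rw : Set (Wd S)) (ι : FreeGroup S →* G) (g : FreeGroup S) (T : (G → Wd S → ℚ) → ℚ) : Prop :=
  ∃ ls : List (Wd S × Wd S), (∀ p ∈ ls, p.2 ∈ Rw) ∧ cprod ls = g ∧ ∀ F, Anti (gst ι) F → cch (gst ι) 1 ls F = T F

theorem Rep.congr {g : FreeGroup S} {T T' : (G → Wd S → ℚ) → ℚ} (h : Rep Rw ι g T) (hT : ∀ F, T F = T' F) : Rep Rw ι g T' := by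
  obtain ⟨ls, h1, h2, h3⟩ := h
  exact ⟨ls, h1, h2, fun F hF => (h3 F hF).trans (hT F)⟩

theorem Rep.one : Rep Rw ι 1 (fun _ => 0) := ⟨[], by simp, rfl, fun _ _ => rfl⟩

theorem Rep.mul {g g' : FreeGroup S} {T T' : (G → Wd S → ℚ) → ℚ} (h : Rep Rw ι g T) (h' : Rep Rw ι g' T') :
    Rep Rw ι (g * g') (fun F => T F + T' F) := by
  obtain ⟨ls, h1, h2, h3⟩ := h
  obtain ⟨ls', h1', h2', h3'⟩ := h'
  refine ⟨ls ++ ls', ?_, by rw [cprod_append, h2, h2'], fun F hF => by rw [cch_append, h3 F hF, h3' F hF]⟩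
  intro p hp
  rcases List.mem_append.1 hp with hp | hp
  · exact h1 p hp
  · exact h1' p hp

theorem Rep.conj {g : FreeGroup S} {T : (G → Wd S → ℚ) → ℚ} (h : Rep Rw ι g T) (w : FreeGroup S) :
    Rep Rw ι (w * g * w⁻¹) (fun F => T (fun x => F (ι w * x))) := by
  obtain ⟨ls, h1, h2, h3⟩ := h
  obtain ⟨w, rfl⟩ : ∃ l, FreeGroup.mk l = w := Quot.exists_rep w
  refine ⟨ls.map (fun p => (w ++ p.1, p.2)), ?_, ?_, ?_⟩
  · intro p hp
    obtain ⟨q, hq, rfl⟩ := List.mem_map.1 hp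
    exact h1 q hq
  · rw [← h2]
    clear h1 h2 h3
    induction ls with
    | nil => show (1 : FreeGroup S) = _ * 1 * _; group
    | cons p ls ih =>
      simp only [cprod, List.map_cons, List.prod_cons] at ih ⊢
      rw [ih, ← FreeGroup.mul_mk]; group
  · intro F hF
    beta_reduce
    rw [← h3 _ (anti_sh hF _)]
    simp only [cch, List.map_map]
    congr 1
    apply List.map_congr_left
    intro p _
    simp only [Function.comp, fc, grun, one_mul]
    apply sum_congr rfl
    intro i _
    rw [gl_app]; simp only [mul_assoc]

theorem Rep.inv (h0 : SC Rw) (hR : ∀ r ∈ Rw, ι (FreeGroup.mk r) = 1) {g : FreeGroup S} {T : (G → Wd S → ℚ) → ℚ} (h : Rep Rw ι g T) :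
    Rep Rw ι g⁻¹ (fun F => - T F) := by
  obtain ⟨ls, h1, h2, h3⟩ := h
  suffices H : ∃ ls' : List (Wd S × Wd S), (∀ p ∈ ls', p.2 ∈ Rw) ∧ cprod ls' = (cprod ls)⁻¹ ∧
      ∀ F, Anti (gst ι) F → cch (gst ι) 1 ls' F = - cch (gst ι) 1 ls F by
    obtain ⟨ls', a, b, c⟩ := H
    exact ⟨ls', a, by rw [b, h2], fun F hF => by rw [c F hF, h3 F hF]⟩
  clear h2 h3
  induction ls with
  | nil => exact ⟨[], by simp, by simp [cprod], fun F _ => by simp [cch]⟩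
  | cons p ls ih =>
    obtain ⟨ls', a, b, c⟩ := ih (fun q hq => h1 q (List.mem_cons_of_mem _ hq))
    have hp := h1 p List.mem_cons_self
    refine ⟨ls' ++ [(p.1, iw p.2)], ?_, ?_, ?_⟩
    · intro q hq
      rcases List.mem_append.1 hq with hq | hq
      · exact a q hq
      · rw [List.mem_singleton.1 hq]; exact h0.inv _ hp
    · rw [cprod_append, b]
      simp only [cprod, List.map_cons, List.map_nil, List.prod_cons, List.prod_nil, mk_iw]; group
    · intro F hF
      rw [cch_append, c F hF]
      simp only [cch, List.map_cons, List.map_nil, List.sum_cons, List.sum_nil, iw_iw]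
      rw [fc_inv ghst hF]
      · ring
      · rw [grun, hR _ hp, mul_one]

/-- Fox integration along a word -/
def Ew : List (Bool × Bool) → (FreeGroup Bool → Bool → ℚ) → ℚ
  | [], _ => 0
  | (s, true) :: u, f => f 1 s + Ew u (fun g t => f (FreeGroup.of s * g) t)
  | (s, false) :: u, f => - f (FreeGroup.of s)⁻¹ s + Ew u (fun g t => f ((FreeGroup.of s)⁻¹ * g) t)

theorem Ew_add (u f f') : Ew u (fun g s => f g s + f' g s) = Ew u f + Ew u f' := by
  induction u generalizing f f' with
  | nil => simp [Ew]
  | cons a u ih =>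
    obtain ⟨s, _ | _⟩ := a <;> simp only [Ew] <;> rw [ih] <;> ring

theorem Ew_smul (u f) (c : ℚ) : Ew u (fun g s => c * f g s) = c * Ew u f := by
  induction u generalizing f with
  | nil => simp [Ew]
  | cons a u ih =>
    obtain ⟨s, _ | _⟩ := a <;> simp only [Ew] <;> rw [ih] <;> ring

theorem Ew_neg (u f) : Ew u (fun g s => - f g s) = - Ew u f := by
  have := Ew_smul u f (-1); simpa using this

theorem Ew_zero (u) : Ew u (fun _ _ => 0) = 0 := by
  have := Ew_smul u (fun _ _ => 0) 0; simpa using this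

theorem Ew_sum {A : Type*} (u) (L : List A) (k : A → FreeGroup Bool → Bool → ℚ) :
    Ew u (fun g s => (L.map (fun c => k c g s)).sum) = (L.map (fun c => Ew u (k c))).sum := by
  induction L with
  | nil => simp [Ew_zero]
  | cons c L ih => simp only [List.map_cons, List.sum_cons, Ew_add, ih]

theorem Ew_append (u v f) : Ew (u ++ v) f = Ew u f + Ew v (fun g s => f (FreeGroup.mk u * g) s) := by
  induction u generalizing f with
  | nil => simp [Ew, ← FreeGroup.one_eq_mk]
  | cons a u ih =>
    have e : ∀ b : Bool × Bool, FreeGroup.mk (b :: u) = FreeGroup.mk [b] * FreeGroup.mk u := fun b => by rw [FreeGroup.mul_mk]; rfl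
    obtain ⟨s, _ | _⟩ := a
    · simp only [List.cons_append, Ew, ih, e, mul_assoc, add_assoc]
      congr
    · simp only [List.cons_append, Ew, ih, e, mul_assoc, add_assoc]
      congr

theorem rep_step (h0 : SC Rw) (hR : ∀ r ∈ Rw, ι (FreeGroup.mk r) = 1) (U : FreeGroup Bool →* FreeGroup S) (y : FreeGroup S)
    (T : Bool → (G → Wd S → ℚ) → ℚ)
    (hT : ∀ s, Rep Rw ι (U (FreeGroup.of s) * y * (U (FreeGroup.of s))⁻¹ * y⁻¹) (T s)) (u : List (Bool × Bool)) :
    Rep Rw ι (U (FreeGroup.mk u) * y * (U (FreeGroup.mk u))⁻¹ * y⁻¹) (fun F => Ew u (fun g s => T s (fun x => F (ι (U g) * x)))) := by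
  induction u with
  | nil =>
    have : Rep Rw ι (U (FreeGroup.mk []) * y * (U (FreeGroup.mk []))⁻¹ * y⁻¹) (fun _ => 0) := by
      rw [← FreeGroup.one_eq_mk, map_one]; convert (Rep.one : Rep Rw ι 1 _) using 1; group
    exact this
  | cons a u ih =>
    have e : ∀ b : Bool × Bool, FreeGroup.mk (b :: u) = FreeGroup.mk [b] * FreeGroup.mk u := fun b => by rw [FreeGroup.mul_mk]; rfl
    obtain ⟨s, _ | _⟩ := a
    · have e1 : FreeGroup.mk [(s, false)] = (FreeGroup.of s)⁻¹ := rfl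
      have := (ih.conj (U (FreeGroup.of s))⁻¹).mul (((hT s).inv h0 hR).conj (U (FreeGroup.of s))⁻¹)
      rw [e, e1, map_mul, map_inv]
      convert this using 1
      · group
      · funext F
        simp only [Ew, map_mul, map_inv, mul_assoc]
        ring
    · have e1 : FreeGroup.mk [(s, true)] = FreeGroup.of s := rfl
      have := (ih.conj (U (FreeGroup.of s))).mul (hT s)
      rw [e, e1, map_mul]
      convert this using 1
      · group
      · funext F
        simp only [Ew, map_mul, map_one, one_mul, mul_assoc]
        ring

theorem rep_comm (h0 : SC Rw) (hR : ∀ r ∈ Rw, ι (FreeGroup.mk r) = 1) (U V : FreeGroup Bool →* FreeGroup S)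
    (J : FreeGroup Bool × FreeGroup Bool →* G) (hU : ∀ g, ι (U g) = J (g, 1)) (hV : ∀ g, ι (V g) = J (1, g))
    (T : Bool → Bool → (G → Wd S → ℚ) → ℚ)
    (hT : ∀ s t, Rep Rw ι (U (FreeGroup.of s) * V (FreeGroup.of t) * (U (FreeGroup.of s))⁻¹ * (V (FreeGroup.of t))⁻¹) (T s t))
    (u w : List (Bool × Bool)) :
    Rep Rw ι (U (FreeGroup.mk u) * V (FreeGroup.mk w) * (U (FreeGroup.mk u))⁻¹ * (V (FreeGroup.mk w))⁻¹)
      (fun F => Ew u (fun g s => Ew w (fun g' t => T s t (fun x => F (J (g, g') * x))))) := by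
  have h1 : ∀ s, Rep Rw ι (U (FreeGroup.of s) * V (FreeGroup.mk w) * (U (FreeGroup.of s))⁻¹ * (V (FreeGroup.mk w))⁻¹)
      (fun F => Ew w (fun g' t => T s t (fun x => F (J (1, g') * x)))) := by
    intro s
    have h2 : ∀ t, Rep Rw ι (V (FreeGroup.of t) * U (FreeGroup.of s) * (V (FreeGroup.of t))⁻¹ * (U (FreeGroup.of s))⁻¹) (fun F => - T s t F) := by
      intro t
      convert (hT s t).inv h0 hR using 1; group
    have h3 := (rep_step h0 hR V _ _ h2 w).inv h0 hR
    simp only [Ew_neg, neg_neg, hV] at h3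
    convert h3 using 1; group
  have h4 := rep_step h0 hR U _ _ h1 u
  simp only [hU] at h4
  refine h4.congr ?_
  intro F
  simp only [← mul_assoc, ← map_mul, Prod.mk_mul_mk, one_mul, mul_one]

theorem cch_list {X : Type*} (st : S × Bool → X → X) (x0 : X) (ls : List (Wd S × Wd S)) :
    ∃ cs : List (X × Wd S), ∀ F, cch st x0 ls F = (cs.map fun c => F c.1 c.2).sum := by
  have h1 : ∀ (n : ℕ) (a : ℕ → X) (b : ℕ → Wd S), ∃ cs : List (X × Wd S), ∀ F : X → Wd S → ℚ,
      ∑ i ∈ range n, F (a i) (b i) = (cs.map fun c => F c.1 c.2).sum := by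
    intro n a b
    induction n with
    | zero => exact ⟨[], fun F => by simp⟩
    | succ n ih =>
      obtain ⟨cs, h⟩ := ih
      exact ⟨(a n, b n) :: cs, fun F => by rw [sum_range_succ, h]; simp [add_comm]⟩
  induction ls with
  | nil => exact ⟨[], fun F => by simp [cch]⟩
  | cons p ls ih =>
    obtain ⟨cs, h⟩ := ih
    obtain ⟨cs', h'⟩ := h1 (iw p.2).length (fun i => run st ((iw p.2).take i) (run st p.1 x0)) (fun i => (iw p.2).rotate i)
    refine ⟨cs' ++ cs, fun F => ?_⟩
    have := h F
    simp only [cch] at this ⊢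
    rw [List.map_cons, List.sum_cons, this, fc, h' F, List.map_append, List.sum_append]

/-- the winding numbers -/
noncomputable def eps (u : List (Bool × Bool)) (s : Bool) (H : FreeGroup Bool) : ℚ :=
  Ew u (fun g t => if t = s ∧ ∃ i : ℤ, H = FreeGroup.mk u ^ i * g then 1 else 0)

/-- the product kernel -/
noncomputable def KK (J : FreeGroup Bool × FreeGroup Bool →* G) (u w : List (Bool × Bool)) (s t : Bool) (x : G) : ℚ :=
  if h : ∃ H, J H = x then eps u s h.choose.1 * eps w t h.choose.2 else 0

theorem KK_J {J : FreeGroup Bool × FreeGroup Bool →* G} (hJ : Function.Injective J) (u w s t H) :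
    KK J u w s t (J H) = eps u s H.1 * eps w t H.2 := by
  have h : ∃ H', J H' = J H := ⟨H, rfl⟩
  rw [KK, dif_pos h, hJ h.choose_spec]

/-- the chain -/
noncomputable def CC (J : FreeGroup Bool × FreeGroup Bool →* G) (L : List ((Bool × Bool) × ℚ × G × Wd S))
    (u w : List (Bool × Bool)) (g : G) (ρ : Wd S) : ℚ :=
  (L.map fun e => if e.2.2.2 = ρ then e.2.1 * KK J u w e.1.1 e.1.2 (g * e.2.2.1⁻¹) else 0).sum

theorem lat_mem {J : FreeGroup Bool × FreeGroup Bool →* G} (hJ : Function.Injective J) {u w : FreeGroup Bool}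
    (h : Lat (J (u, 1)) (J (1, w))) (g g' : FreeGroup Bool) (c x : G) :
    cls h (J (g, g') * c) = cls h x ↔ ∃ H, J H = x * c⁻¹ ∧ (∃ i : ℤ, H.1 = u ^ i * g) ∧ ∃ i : ℤ, H.2 = w ^ i * g' := by
  have e : ∀ i j : ℤ, lam (J (u, 1)) (J (1, w)) i j * (J (g, g') * c) = J (u ^ i * g, w ^ j * g') * c := by
    intro i j
    rw [lam, ← map_zpow, ← map_zpow, ← map_mul, ← mul_assoc, ← map_mul]
    simp [Prod.pow_mk]
  rw [cls_eq]
  constructor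
  · rintro ⟨i, j, rfl⟩
    exact ⟨(u ^ i * g, w ^ j * g'), by rw [e, mul_inv_cancel_right], ⟨i, rfl⟩, ⟨j, rfl⟩⟩
  · rintro ⟨⟨H, H'⟩, h1, ⟨i, rfl⟩, ⟨j, rfl⟩⟩
    exact ⟨i, j, by rw [e, h1, inv_mul_cancel_right]⟩

theorem planes (h0 : SC Rw) (hR : ∀ r ∈ Rw, ι (FreeGroup.mk r) = 1)
    (hk : ∀ g, ι g = 1 → g ∈ Subgroup.normalClosure (FreeGroup.mk '' Rw)) (hs : Function.Surjective ι)
    {J : FreeGroup Bool × FreeGroup Bool →* G} (hJ : Function.Injective J) :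
    ∃ L : List ((Bool × Bool) × ℚ × G × Wd S), ∀ u w : List (Bool × Bool),
      Lat (J (FreeGroup.mk u, 1)) (J (1, FreeGroup.mk w)) → ∃ P : Pl Rw ι, ∀ g ρ,
        (P.Cell (g, ρ) ↔ CC J L u w g ρ = 1) ∧ (P.Cell (g, iw ρ) ↔ CC J L u w g ρ = -1) := by
  choose sc hsc using hs
  let U : FreeGroup Bool →* FreeGroup S := FreeGroup.lift fun s => sc (J (FreeGroup.of s, 1))
  let V : FreeGroup Bool →* FreeGroup S := FreeGroup.lift fun s => sc (J (1, FreeGroup.of s))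
  have hU : ∀ g, ι (U g) = J (g, 1) := by
    intro g
    have : ι.comp U = J.comp (MonoidHom.inl _ _) := by
      apply FreeGroup.ext_hom; intro a; simp [U, hsc]
    exact DFunLike.congr_fun this g
  have hV : ∀ g, ι (V g) = J (1, g) := by
    intro g
    have : ι.comp V = J.comp (MonoidHom.inr _ _) := by
      apply FreeGroup.ext_hom; intro a; simp [V, hsc]
    exact DFunLike.congr_fun this g
  have hls : ∀ s t, ∃ ls : List (Wd S × Wd S), (∀ p ∈ ls, p.2 ∈ Rw) ∧
      cprod ls = U (FreeGroup.of s) * V (FreeGroup.of t) * (U (FreeGroup.of s))⁻¹ * (V (FreeGroup.of t))⁻¹ := by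
    intro s t
    apply exists_ls h0 (hk _ _)
    simp only [map_mul, map_inv, hU, hV]
    simp only [← map_inv, ← map_mul]
    rw [← map_one J]; congr 1; ext <;> simp
  choose ls hls1 hls2 using hls
  have hcs := fun s t => cch_list (gst ι) 1 (ls s t)
  choose cs hcs using hcs
  let A : Bool × Bool → List ((Bool × Bool) × ℚ × G × Wd S) := fun st =>
    (cs st.1 st.2).map (fun c => (st, 1, c.1, c.2)) ++
      (cs st.1 st.2).map (fun c => (st, -1, run (gst ι) (c.2.take 1) c.1, iw (c.2.rotate 1)))
  refine ⟨A (false, false) ++ A (false, true) ++ A (true, false) ++ A (true, true), ?_⟩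
  intro u w h
  obtain ⟨l, hl1, hl2, hl3⟩ := rep_comm h0 hR U V J hU hV (fun s t F => cch (gst ι) 1 (ls s t) F)
    (fun s t => ⟨ls s t, hls1 s t, hls2 s t, fun F _ => rfl⟩) u w
  obtain ⟨P, hP⟩ := plane_ex h0 hR hk h _ _ (hU _) (hV _) l hl1 hl2
  refine ⟨P, fun g ρ => ?_⟩
  suffices key : cch (lst ι h) (cls h 1) l (dlt (lst ι h) (cls h g) ρ) = CC J (A (false, false) ++ A (false, true) ++ A (true, false) ++ A (true, true)) u w g ρ by
    rw [← key]; exact hP g ρ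
  have e1 : cch (lst ι h) (cls h 1) l (dlt (lst ι h) (cls h g) ρ) = cch (gst ι) 1 l (fun x r => dlt (lst ι h) (cls h g) ρ (cls h x) r) := by
    simp only [cch, fc, grun, lrun_cls]
  rw [e1, hl3]
  swap
  · intro x a t
    exact dlt_anti (lhst ι h) (cls h g) ρ (cls h x) a t
  have e2 : ∀ s t y, cch (gst ι) 1 (ls s t) (fun x r => dlt (lst ι h) (cls h g) ρ (cls h (y * x)) r) =
      ((A (false, false) ++ A (false, true) ++ A (true, false) ++ A (true, true)).map fun e =>
        if s = e.1.1 ∧ t = e.1.2 then (if e.2.2.2 = ρ then e.2.1 * (if cls h (y * e.2.2.1) = cls h g then 1 else 0) else 0) else 0).sum := by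
    intro s t y
    have e3 : cch (gst ι) 1 (ls s t) (fun x r => dlt (lst ι h) (cls h g) ρ (cls h (y * x)) r) =
      ((A (s, t)).map fun e => if e.2.2.2 = ρ then e.2.1 * (if cls h (y * e.2.2.1) = cls h g then (1 : ℚ) else 0) else 0).sum := by
      rw [hcs]
      simp only [A, List.map_append, List.sum_append, List.map_map]
      rw [← List.sum_map_add]
      congr 1
      apply List.map_congr_left
      intro c _
      simp only [Function.comp, dlt, lrun_cls, grun, mul_assoc]
      split_ifs <;> first | (norm_num; done) | (exfalso; tauto)
    rw [e3]
    have e4 : ∀ (st : Bool × Bool) (f : ℚ × G × Wd S → ℚ), ((A st).map fun e => if s = e.1.1 ∧ t = e.1.2 then f e.2 else 0).sum =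
        if s = st.1 ∧ t = st.2 then ((A st).map fun e => f e.2).sum else 0 := by
      intro st f
      have : ∀ e ∈ A st, e.1 = st := by
        intro e he
        simp only [A, List.mem_append, List.mem_map] at he
        rcases he with ⟨c, _, rfl⟩ | ⟨c, _, rfl⟩ <;> rfl
      rw [List.map_congr_left (g := fun e => if s = st.1 ∧ t = st.2 then f e.2 else 0) (fun e he => by rw [this e he])]
      split_ifs <;> simp
    simp only [List.map_append, List.sum_append]
    rw [e4 _ (fun e => if e.2.2 = ρ then e.1 * (if cls h (y * e.2.1) = cls h g then (1 : ℚ) else 0) else 0),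
      e4 _ (fun e => if e.2.2 = ρ then e.1 * (if cls h (y * e.2.1) = cls h g then (1 : ℚ) else 0) else 0),
      e4 _ (fun e => if e.2.2 = ρ then e.1 * (if cls h (y * e.2.1) = cls h g then (1 : ℚ) else 0) else 0),
      e4 _ (fun e => if e.2.2 = ρ then e.1 * (if cls h (y * e.2.1) = cls h g then (1 : ℚ) else 0) else 0)]
    cases s <;> cases t <;> simp
  simp only [e2, Ew_sum]
  rw [CC]
  congr 1
  apply List.map_congr_left
  rintro ⟨⟨s, t⟩, σ, c, ρ0⟩ _
  dsimp only
  by_cases hρ : ρ0 = ρ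
  swap
  · simp [hρ, Ew_zero]
  simp only [hρ, if_true]
  by_cases hH : ∃ H, J H = g * c⁻¹
  · obtain ⟨H, hH⟩ := hH
    rw [← hH, KK_J hJ]
    have e5 : ∀ g1 s1 g2 t1, (if s1 = s ∧ t1 = t then σ * (if cls h (J (g1, g2) * c) = cls h g then (1 : ℚ) else 0) else 0) =
        (σ * (if s1 = s ∧ ∃ i : ℤ, H.1 = FreeGroup.mk u ^ i * g1 then (1 : ℚ) else 0)) *
          (if t1 = t ∧ ∃ i : ℤ, H.2 = FreeGroup.mk w ^ i * g2 then (1 : ℚ) else 0) := by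
      intro g1 s1 g2 t1
      rw [lat_mem hJ]
      have : (∃ H', J H' = g * c⁻¹ ∧ (∃ i : ℤ, H'.1 = FreeGroup.mk u ^ i * g1) ∧ ∃ i : ℤ, H'.2 = FreeGroup.mk w ^ i * g2) ↔
          (∃ i : ℤ, H.1 = FreeGroup.mk u ^ i * g1) ∧ ∃ i : ℤ, H.2 = FreeGroup.mk w ^ i * g2 := by
        constructor
        · rintro ⟨H', h1, h2⟩
          rwa [hJ (h1.trans hH.symm)] at h2
        · exact fun h2 => ⟨H, hH, h2⟩
      rw [this]
      by_cases h1 : s1 = s <;> by_cases h2 : t1 = t <;> by_cases h3 : ∃ i : ℤ, H.1 = FreeGroup.mk u ^ i * g1 <;>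
        by_cases h4 : ∃ i : ℤ, H.2 = FreeGroup.mk w ^ i * g2 <;> simp only [h1, h2, h3, h4] <;> simp
    simp only [e5, Ew_smul]
    have e6 : ∀ (B : ℚ) (a : FreeGroup Bool → Bool → ℚ), Ew u (fun g s1 => (σ * a g s1) * B) = σ * (Ew u a * B) := by
      intro B a
      rw [show σ * (Ew u a * B) = (σ * B) * Ew u a by ring, ← Ew_smul]
      congr 1; funext g s1; ring
    exact e6 _ _
  · rw [KK, dif_neg hH]
    have e5 : ∀ g1 g2, ¬ (cls h (J (g1, g2) * c) = cls h g) := by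
      intro g1 g2
      rw [lat_mem hJ]
      rintro ⟨H, h1, _⟩; exact hH ⟨H, h1⟩
    simp only [e5, if_false, mul_zero, ite_self, Ew_zero]

end

section
open scoped Classical

theorem mk_rep (s : Bool) (n : ℕ) : FreeGroup.mk (List.replicate n (s, true)) = FreeGroup.of s ^ n := by
  induction n with
  | zero => rfl
  | succ n ih => rw [pow_succ', ← ih, List.replicate_succ, FreeGroup.of, FreeGroup.mul_mk]; rfl

theorem mk_rep' (s : Bool) (n : ℕ) : FreeGroup.mk (List.replicate n (s, false)) = (FreeGroup.of s)⁻¹ ^ n := by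
  induction n with
  | zero => rfl
  | succ n ih =>
    rw [pow_succ', ← ih, List.replicate_succ, show (FreeGroup.of s)⁻¹ = FreeGroup.mk [(s, false)] from rfl, FreeGroup.mul_mk]; rfl

theorem Ew_rep (s : Bool) (n : ℕ) (f) : Ew (List.replicate n (s, true)) f = ∑ i ∈ range n, f (FreeGroup.of s ^ i) s := by
  induction n generalizing f with
  | zero => rfl
  | succ n ih => rw [List.replicate_succ, Ew, ih, sum_range_succ']; simp only [pow_succ', pow_zero]; ring

theorem Ew_rep' (s : Bool) (n : ℕ) (f) : Ew (List.replicate n (s, false)) f = - ∑ i ∈ range n, f ((FreeGroup.of s)⁻¹ ^ (i + 1)) s := by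
  induction n generalizing f with
  | zero => simp [Ew]
  | succ n ih => rw [List.replicate_succ, Ew, ih, sum_range_succ']; simp only [pow_succ', pow_zero, mul_one]; ring

/-- exponent sums -/
def ex (s : Bool) : FreeGroup Bool →* Multiplicative ℤ := FreeGroup.lift fun t => Multiplicative.ofAdd (if t = s then 1 else 0)

/-- exponent sum as an integer -/
def es (s : Bool) (g : FreeGroup Bool) : ℤ := (ex s g).toAdd

theorem es_mul (s g h) : es s (g * h) = es s g + es s h := by simp [es]
theorem es_pow (s g) (n : ℕ) : es s (g ^ n) = n * es s g := by simp [es]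
theorem es_zpow (s g) (n : ℤ) : es s (g ^ n) = n * es s g := by simp [es]
theorem es_inv (s g) : es s g⁻¹ = - es s g := by simp [es]
theorem es_of (s t) : es s (FreeGroup.of t) = if t = s then 1 else 0 := by simp [es, ex]

/-- the generator word -/
def aw : List (Bool × Bool) := [(true, true)]

/-- the special word -/
def zw (n : ℕ) : List (Bool × Bool) := List.replicate n (true, true) ++ (List.replicate n (false, true) ++
  (List.replicate (2 * n) (true, false) ++ (List.replicate n (false, true) ++ List.replicate n (true, true))))

/-- the shift element -/
def pn (n : ℕ) : FreeGroup Bool := FreeGroup.of true ^ n * FreeGroup.of false ^ n * (FreeGroup.of true)⁻¹ ^ n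

theorem mk_zw (n : ℕ) : FreeGroup.mk (zw n) = FreeGroup.of true ^ n * (FreeGroup.of false ^ n * ((FreeGroup.of true)⁻¹ ^ (2 * n) *
    (FreeGroup.of false ^ n * FreeGroup.of true ^ n))) := by
  simp only [zw, ← FreeGroup.mul_mk, mk_rep, mk_rep']

theorem es_zw (n : ℕ) : es true (FreeGroup.mk (zw n)) = 0 ∧ es false (FreeGroup.mk (zw n)) = 2 * n := by
  rw [mk_zw]; simp [es_mul, es_pow, es_inv, es_of]; constructor <;> ring

theorem eps_inv (u : List (Bool × Bool)) (s H) (k : ℤ) : eps u s (FreeGroup.mk u ^ k * H) = eps u s H := by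
  rw [eps, eps]
  congr 1; funext g t
  have : (∃ i : ℤ, FreeGroup.mk u ^ k * H = FreeGroup.mk u ^ i * g) ↔ ∃ i : ℤ, H = FreeGroup.mk u ^ i * g := by
    constructor
    · rintro ⟨i, h⟩; exact ⟨-k + i, by rw [zpow_add, mul_assoc, ← h, zpow_neg, inv_mul_cancel_left]⟩
    · rintro ⟨i, rfl⟩; exact ⟨k + i, by rw [zpow_add, mul_assoc]⟩
  simp only [this]

theorem eps_a (s H) : eps aw s H = if s = true ∧ ∃ i : ℤ, H = FreeGroup.of true ^ i then 1 else 0 := by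
  have : FreeGroup.mk aw = FreeGroup.of true := rfl
  rw [eps, this]; simp only [aw, Ew, mul_one, add_zero, eq_comm (a := true) (b := s)]

/-- membership in a coset -/
def mz (n : ℕ) (H g : FreeGroup Bool) : Prop := ∃ i : ℤ, H = FreeGroup.mk (zw n) ^ i * g

theorem mz_def (n H g) : (∃ i : ℤ, H = FreeGroup.mk (zw n) ^ i * g) = mz n H g := rfl

theorem mz_es {n : ℕ} {H g : FreeGroup Bool} (h : mz n H g) : es true H = es true g ∧ ∃ i : ℤ, es false H = i * (2 * n) + es false g ∧
    H = FreeGroup.mk (zw n) ^ i * g := by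
  obtain ⟨i, rfl⟩ := h
  rw [es_mul, es_zpow, (es_zw n).1]
  refine ⟨by ring, i, ?_, rfl⟩
  rw [es_mul, es_zpow, (es_zw n).2]

theorem eps_true (n : ℕ) (H) : eps (zw n) true H = (∑ i ∈ range n, if mz n H (FreeGroup.of true ^ i) then 1 else 0) +
    (∑ i ∈ range n, if mz n H (FreeGroup.of true ^ ((i : ℤ) - n)) then 1 else 0) -
    ∑ i ∈ range (2 * n), if mz n H (pn n * FreeGroup.of true ^ ((n : ℤ) - 1 - i)) then 1 else 0 := by
  have e1 : ∀ i : ℕ, mz n H (FreeGroup.of true ^ n * (FreeGroup.of false ^ n * (FreeGroup.of true)⁻¹ ^ (i + 1))) ↔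
      mz n H (pn n * FreeGroup.of true ^ ((n : ℤ) - 1 - i)) := by
    intro i
    have : pn n * FreeGroup.of true ^ ((n : ℤ) - 1 - i) = FreeGroup.of true ^ n * (FreeGroup.of false ^ n * (FreeGroup.of true)⁻¹ ^ (i + 1)) := by
      rw [pn, show (n : ℤ) - 1 - i = n + -((i + 1 : ℕ) : ℤ) by push_cast; ring, zpow_add, zpow_neg, zpow_natCast, zpow_natCast, ← inv_pow]; group
    rw [this]
  have e2 : ∀ i : ℕ, mz n H (FreeGroup.of true ^ n * (FreeGroup.of false ^ n * ((FreeGroup.of true)⁻¹ ^ (2 * n) *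
      (FreeGroup.of false ^ n * FreeGroup.of true ^ i)))) ↔ mz n H (FreeGroup.of true ^ ((i : ℤ) - n)) := by
    intro i
    have : FreeGroup.of true ^ n * (FreeGroup.of false ^ n * ((FreeGroup.of true)⁻¹ ^ (2 * n) *
      (FreeGroup.of false ^ n * FreeGroup.of true ^ i))) = FreeGroup.mk (zw n) * FreeGroup.of true ^ ((i : ℤ) - n) := by
      rw [mk_zw, zpow_sub, zpow_natCast, zpow_natCast]; group
    rw [this]
    constructor
    · rintro ⟨k, h⟩; exact ⟨k + 1, by rw [h, zpow_add_one, mul_assoc]⟩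
    · rintro ⟨k, h⟩; exact ⟨k - 1, by rw [h, zpow_sub_one, mul_assoc, inv_mul_cancel_left]⟩
  rw [eps]
  nth_rewrite 1 [zw]
  simp only [Ew_append, Ew_rep, Ew_rep', mk_rep, mk_rep', mz_def, e1, e2]
  simp
  ring

theorem eps_false (n : ℕ) (H) : eps (zw n) false H = (∑ i ∈ range n, if mz n H (FreeGroup.of true ^ n * FreeGroup.of false ^ i) then 1 else 0) +
    ∑ i ∈ range n, if mz n H (FreeGroup.of true ^ n * (FreeGroup.of false ^ n * ((FreeGroup.of true)⁻¹ ^ (2 * n) * FreeGroup.of false ^ i))) then 1 else 0 := by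
  rw [eps]
  nth_rewrite 1 [zw]
  simp only [Ew_append, Ew_rep, Ew_rep', mk_rep, mk_rep', mz_def]
  simp

theorem sum_one (N : ℕ) (p : ℕ → Prop) [DecidablePred p] (k : ℕ) (hk : k < N) (h : ∀ i < N, p i ↔ i = k) : ∑ i ∈ range N, (if p i then (1 : ℚ) else 0) = 1 := by
  rw [sum_eq_single k, if_pos ((h k hk).2 rfl)]
  · intro b hb hbk; rw [if_neg]; intro hp; exact hbk ((h b (mem_range.1 hb)).1 hp)
  · intro hn; exact absurd (mem_range.2 hk) hn

theorem sum_none (N : ℕ) (p : ℕ → Prop) [DecidablePred p] (h : ∀ i < N, ¬ p i) : ∑ i ∈ range N, (if p i then (1 : ℚ) else 0) = 0 :=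
  sum_eq_zero fun i hi => if_neg (h i (mem_range.1 hi))

theorem es_pn (n : ℕ) : es true (pn n) = 0 ∧ es false (pn n) = n := by
  simp [pn, es_mul, es_pow, es_inv, es_of]

theorem ntri {n : ℕ} {b i r : ℤ} (hb : |b| < n) (hr : b = i * (2 * n) + r) : (r = 0 → i = 0) ∧ r ≠ n ∧ r ≠ -n := by
  rw [abs_lt] at hb
  refine ⟨fun h => ?_, fun h => ?_, fun h => ?_⟩ <;> subst h
  · rcases lt_trichotomy i 0 with h | h | h
    · nlinarith
    · exact h
    · nlinarith
  · rcases lt_or_ge i 0 with h | h <;> nlinarith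
  · rcases lt_or_ge i 1 with h | h <;> nlinarith

theorem ofz_inj {i j : ℤ} (h : FreeGroup.of true ^ i = FreeGroup.of true ^ j) : i = j := by
  have := congrArg (es true) h
  simpa [es_zpow, es_of] using this

theorem eps_false0 (n : ℕ) (H) (hH : |es true H| ≠ n) : eps (zw n) false H = 0 := by
  rw [eps_false, sum_none, sum_none, add_zero]
  · intro i _ h
    have := (mz_es h).1
    simp [es_mul, es_pow, es_inv, es_of] at this
    apply hH; rw [this, show (n : ℤ) + -(2 * n) = - n by ring, abs_neg, Nat.abs_cast]
  · intro i _ h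
    have := (mz_es h).1
    simp [es_mul, es_pow, es_inv, es_of] at this
    apply hH; rw [this, Nat.abs_cast]

theorem eps_z1 (n : ℕ) (s H) (h1 : |es true H| < n) (h2 : |es false H| < n) : eps (zw n) s H = eps aw s H := by
  rw [eps_a]
  cases s
  · rw [eps_false0 n H h1.ne]; simp
  rw [eps_true, sum_none (2 * n), sub_zero]
  swap
  · intro i _ h
    obtain ⟨-, j, h3, -⟩ := mz_es h
    have := (ntri h2 h3).2.1
    simp [es_mul, es_zpow, es_of, (es_pn n).2] at this
  have key : ∀ k : ℤ, mz n H (FreeGroup.of true ^ k) ↔ H = FreeGroup.of true ^ k := by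
    intro k
    constructor
    · intro h
      obtain ⟨-, j, h3, h4⟩ := mz_es h
      have := (ntri h2 h3).1 (by simp [es_zpow, es_of])
      rw [h4, this]; simp
    · rintro rfl; exact ⟨0, by simp⟩
  simp only [← zpow_natCast (FreeGroup.of true), key]
  by_cases hH : ∃ i : ℤ, H = FreeGroup.of true ^ i
  · obtain ⟨k, rfl⟩ := hH
    rw [if_pos ⟨by simp, k, rfl⟩]
    simp [es_zpow, es_of, abs_lt] at h1
    rcases lt_or_ge k 0 with hk | hk
    · rw [sum_none, sum_one _ _ (k + n).toNat, zero_add]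
      · omega
      · intro i _; constructor
        · intro h; have := ofz_inj h; omega
        · intro h; congr 1; omega
      · intro i _ h; have := ofz_inj h; omega
    · rw [sum_one _ _ k.toNat, sum_none, add_zero]
      · intro i _ h; have := ofz_inj h; omega
      · omega
      · intro i _; constructor
        · intro h; have := ofz_inj h; omega
        · intro h; congr 1; omega
  · rw [if_neg (fun h => hH h.2), sum_none, sum_none, add_zero]
    · intro i _ h; exact hH ⟨_, h⟩
    · intro i _ h; exact hH ⟨_, h⟩

theorem eps_z2 (n : ℕ) (s H) (h1 : |es true H| < n) (h2 : |es false H| < n) : eps (zw n) s (pn n * H) = - eps aw s H := by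
  rw [eps_a]
  have e1 : es true (pn n * H) = es true H := by rw [es_mul, (es_pn n).1, zero_add]
  have e2 : es false (pn n * H) = n + es false H := by rw [es_mul, (es_pn n).2]
  cases s
  · rw [eps_false0 n _ (by rw [e1]; exact h1.ne)]; simp
  have key : ∀ k : ℤ, ¬ mz n (pn n * H) (FreeGroup.of true ^ k) := by
    intro k h
    obtain ⟨-, j, h3, h4⟩ := mz_es h
    rw [e2] at h3
    have := (ntri (i := j) (r := -n + es false (FreeGroup.of true ^ k)) h2 (by linarith)).2.2
    simp [es_zpow, es_of] at this
  rw [eps_true, sum_none, sum_none, add_zero, zero_sub]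
  · congr 1
    have key : ∀ k : ℤ, mz n (pn n * H) (pn n * FreeGroup.of true ^ k) ↔ H = FreeGroup.of true ^ k := by
      intro k
      constructor
      · intro h
        obtain ⟨-, j, h3, h4⟩ := mz_es h
        have h5 : es false (pn n * FreeGroup.of true ^ k) = n := by simp [es_mul, es_zpow, es_of, (es_pn n).2]
        rw [e2, h5] at h3
        have := (ntri (r := 0) (i := j) h2 (by linarith)).1 rfl
        rw [this, zpow_zero, one_mul] at h4
        exact mul_left_cancel h4
      · rintro rfl; exact ⟨0, by simp⟩
    simp only [key]
    by_cases hH : ∃ i : ℤ, H = FreeGroup.of true ^ i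
    · obtain ⟨k, rfl⟩ := hH
      rw [if_pos ⟨by simp, k, rfl⟩]
      simp [es_zpow, es_of, abs_lt] at h1
      apply sum_one _ _ (n - 1 - k).toNat
      · omega
      · intro i _; constructor
        · intro h; have := ofz_inj h; omega
        · intro h; congr 1; omega
    · rw [if_neg (fun h => hH h.2), sum_none]
      intro i _ h; exact hH ⟨_, h⟩
  · intro i _; exact key _
  · intro i _; rw [← zpow_natCast]; exact key _

theorem eps_far (n : ℕ) (s H) (h1 : n < |es true H|) : eps (zw n) s H = 0 := by
  cases s
  · exact eps_false0 n H h1.ne'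
  rw [lt_abs] at h1
  rw [eps_true, sum_none, sum_none, sum_none]
  · simp
  all_goals
    intro i hi h
    have := (mz_es h).1
    simp [es_mul, es_pow, es_zpow, es_of, (es_pn n).1] at this
    omega

end

section
open scoped Classical
universe uG uS
variable {S : Type uS}
variable {G : Type uG} [Group G]
variable {J : FreeGroup Bool × FreeGroup Bool →* G} {L : List ((Bool × Bool) × ℚ × G × Wd S)}

theorem CC_rel (hJ : Function.Injective J) {u w u' w' : List (Bool × Bool)} {x y x' y' : FreeGroup Bool} {q : ℚ} {g : G} (ρ)
    (h : ∀ e ∈ L, ∀ H, J H = g * e.2.2.1⁻¹ → ∀ s t, eps u s (x * H.1) * eps w t (y * H.2) = q * (eps u' s (x' * H.1) * eps w' t (y' * H.2))) :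
    CC J L u w (J (x, y) * g) ρ = q * CC J L u' w' (J (x', y') * g) ρ := by
  rw [CC, CC, ← List.sum_map_mul_left]
  congr 1
  refine List.map_congr_left fun e he => ?_
  split_ifs
  · by_cases hH : ∃ H, J H = g * e.2.2.1⁻¹
    · obtain ⟨H, hH⟩ := hH
      rw [mul_assoc, ← hH, ← map_mul, KK_J hJ, mul_assoc, ← hH, ← map_mul, KK_J hJ]
      simp only [Prod.fst_mul, Prod.snd_mul, h e he H hH]; ring
    · have : ∀ a b c d z, KK J a b c d (J z * g * e.2.2.1⁻¹) = 0 := by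
        intro a b c d z
        rw [KK, dif_neg]
        rintro ⟨H, h'⟩
        exact hH ⟨z⁻¹ * H, by rw [map_mul, h', map_inv]; group⟩
      rw [this, this]; ring
  · ring

theorem bnd (hJ : Function.Injective J) (L : List ((Bool × Bool) × ℚ × G × Wd S)) (g : G) :
    ∀ᶠ n : ℕ in Filter.atTop, ∀ e ∈ L, ∀ H, J H = g * e.2.2.1⁻¹ → ∀ s, |es s H.1| < n ∧ |es s H.2| < n := by
  refine (Filter.eventually_all_finite (L.finite_toSet)).2 fun e _ => ?_
  by_cases hH : ∃ H, J H = g * e.2.2.1⁻¹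
  · obtain ⟨H, hH⟩ := hH
    filter_upwards [Filter.eventually_gt_atTop (|es true H.1| + |es true H.2| + |es false H.1| + |es false H.2|).toNat] with n hn H' h' s
    obtain rfl := hJ (h'.trans hH.symm)
    have := abs_nonneg (es true H'.1); have := abs_nonneg (es true H'.2)
    have := abs_nonneg (es false H'.1); have := abs_nonneg (es false H'.2)
    cases s <;> constructor <;> omega
  · exact Filter.Eventually.of_forall fun n H h' => absurd ⟨H, h'⟩ hH

theorem ev1 (hJ : Function.Injective J) (g : G) : ∀ᶠ n : ℕ in Filter.atTop, ∀ w y ρ,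
    CC J L (zw n) w (J (1, y) * g) ρ = CC J L aw w (J (1, y) * g) ρ ∧
    CC J L (zw n) w (J (pn n, y) * g) ρ = - CC J L aw w (J (1, y) * g) ρ := by
  filter_upwards [bnd hJ L g] with n hn w y ρ
  constructor
  · rw [← one_mul (CC J L aw _ _ _)]
    refine CC_rel hJ ρ fun e he H hH s t => ?_
    rw [one_mul, one_mul, eps_z1 n s _ (hn e he H hH _).1 (hn e he H hH _).1]
  · rw [← neg_one_mul]
    refine CC_rel hJ ρ fun e he H hH s t => ?_
    rw [eps_z2 n s _ (hn e he H hH _).1 (hn e he H hH _).1, one_mul]; ring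

theorem ev2 (hJ : Function.Injective J) (g : G) : ∀ᶠ n : ℕ in Filter.atTop, ∀ u x ρ,
    CC J L u (zw n) (J (x, 1) * g) ρ = CC J L u aw (J (x, 1) * g) ρ := by
  filter_upwards [bnd hJ L g] with n hn u x ρ
  rw [← one_mul (CC J L u aw _ _)]
  refine CC_rel hJ ρ fun e he H hH s t => ?_
  rw [one_mul, one_mul, eps_z1 n t _ (hn e he H hH _).2 (hn e he H hH _).2]

theorem far1 (hJ : Function.Injective J) (n : ℕ) (g : G) : ∀ᶠ i : ℕ in Filter.atTop, ∀ w y ρ,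
    CC J L (zw n) w (J (FreeGroup.of true ^ i, y) * g) ρ = 0 := by
  obtain ⟨N, hN⟩ := (bnd hJ L g).exists
  filter_upwards [Filter.eventually_gt_atTop (n + N)] with i hi w y ρ
  rw [← zero_mul (CC J L aw w (J (1, y) * g) ρ)]
  refine CC_rel hJ ρ fun e he H hH s t => ?_
  rw [eps_far n s]; · ring
  have := abs_lt.1 (hN e he H hH true).1
  rw [es_mul, es_pow, es_of, if_pos rfl, lt_abs]; left; omega

theorem far2 (hJ : Function.Injective J) (n : ℕ) (g : G) : ∀ᶠ i : ℕ in Filter.atTop, ∀ u x ρ,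
    CC J L u (zw n) (J (x, FreeGroup.of true ^ i) * g) ρ = 0 := by
  obtain ⟨N, hN⟩ := (bnd hJ L g).exists
  filter_upwards [Filter.eventually_gt_atTop (n + N)] with i hi u x ρ
  rw [← zero_mul (CC J L u aw (J (x, 1) * g) ρ)]
  refine CC_rel hJ ρ fun e he H hH s t => ?_
  rw [eps_far n t]; · ring
  have := abs_lt.1 (hN e he H hH true).2
  rw [es_mul, es_pow, es_of, if_pos rfl, lt_abs]; left; omega

theorem CC_inv (hJ : Function.Injective J) (u w : List (Bool × Bool)) (i j : ℤ) (g : G) (ρ) :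
    CC J L u w (J (FreeGroup.mk u ^ i, FreeGroup.mk w ^ j) * g) ρ = CC J L u w g ρ := by
  have := CC_rel (L := L) hJ (u := u) (w := w) (u' := u) (w' := w) (x := FreeGroup.mk u ^ i) (y := FreeGroup.mk w ^ j)
    (x' := 1) (y' := 1) (q := 1) (g := g) ρ fun e he H hH s t => by simp only [eps_inv, one_mul]
  rwa [one_mul, ← Prod.one_eq_mk, map_one, one_mul] at this

theorem lat_of (hJ : Function.Injective J) {x y : FreeGroup Bool} (s t : Bool) (hx : es s x ≠ 0) (hy : es t y ≠ 0) :
    Lat (J (x, 1)) (J (1, y)) := by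
  refine ⟨by rw [Commute, SemiconjBy, ← map_mul, ← map_mul]; simp, fun i j h => ?_⟩
  rw [← map_zpow, ← map_zpow, ← map_mul, map_eq_one_iff J hJ] at h
  simp only [Prod.pow_mk, one_zpow, Prod.mk_mul_mk, mul_one, one_mul, Prod.mk_eq_one] at h
  have h1 := congrArg (es s) h.1
  have h2 := congrArg (es t) h.2
  rw [es_zpow, show es s 1 = 0 from by simp [es]] at h1
  rw [es_zpow, show es t 1 = 0 from by simp [es]] at h2
  exact ⟨(mul_eq_zero.1 h1).resolve_right hx, (mul_eq_zero.1 h2).resolve_right hy⟩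

end

section
open scoped Classical
universe uG uS
variable {S : Type uS}
variable {Rw : Set (Wd S)}
variable {G : Type uG} [Group G] {ι : FreeGroup S →* G}

namespace Pl
variable {Q P P' P'' : Pl Rw ι}

theorem dt_rt (o u v) : dt (rt o u) (rt o v) = dt u v := by
  have h := dt_hx o
  simp only [dt, rt, Prod.fst_add, Prod.snd_add, Prod.smul_fst, Prod.smul_snd, smul_eq_mul] at *
  linear_combination (u.1 * v.2 - u.2 * v.1) * h

theorem dt_rf (u v) : dt (rf u) (rf v) = - dt u v := by simp [dt, rf]; ring
theorem dt_hx1 : ∀ i j, dt (hx i) (hx j) ≠ 0 → dt (hx i) (hx j) * dt (hx i) (hx j) = 1 := by decide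
theorem sm_dt (u w) (c : ℤ) : dt (c • u) w = c * dt u w := by simp [dt]; ring
theorem rt_inv (o v) : rt o (rt (-o) v) = v := by rw [rt_rt, neg_add_cancel, rt_zero]
theorem dt_z {u a b : ℤ × ℤ} (hu : u ≠ 0) (ha : dt u a = 0) (hb : dt u b = 0) : dt a b = 0 := by
  by_contra h
  apply hu
  simp only [dt] at *
  have h1 : u.1 * (a.1 * b.2 - a.2 * b.1) = 0 := by linear_combination -b.1 * ha + a.1 * hb
  have h2 : u.2 * (a.1 * b.2 - a.2 * b.1) = 0 := by linear_combination -b.2 * ha + a.2 * hb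
  exact Prod.ext ((mul_eq_zero.1 h1).resolve_right h) ((mul_eq_zero.1 h2).resolve_right h)
theorem ne0 {a t : ℤ × ℤ} (h : dt a t ≠ 0) : a ≠ 0 ∧ t ≠ 0 :=
  ⟨by rintro rfl; simp [dt] at h, by rintro rfl; simp [dt] at h⟩
theorem par_hx {t : ℤ × ℤ} {i : ZMod 6} (h : dt t (hx i) = 0) : ∃ c : ℤ, t = c • hx i := by
  obtain ⟨p, hp⟩ := coord i t
  rw [dt_comm, h] at hp
  exact ⟨p, by simpa using hp⟩

theorem strip_fin {a t : ℤ × ℤ} (h : dt a t ≠ 0) (K : ℤ) : ∃ B : Set (ℤ × ℤ), B.Finite ∧ ∀ v, |dt t v| ≤ K → ∃ b ∈ B, ∃ m : ℤ, v = b + m • t := by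
  refine ⟨(fun v => (dt t v, dt a v)) ⁻¹' (Set.Icc (-K) K ×ˢ Set.Icc 0 |dt a t|),
    ((Set.finite_Icc _ _).prod (Set.finite_Icc _ _)).preimage ?_, fun v hv => ?_⟩
  · intro u _ v _ e
    simp only [Prod.mk.injEq] at e
    have hs : ∀ x, dt x (u - v) = dt x u - dt x v := by intro x; simp [dt]; ring
    have h1 : dt t (u - v) = 0 := by rw [hs, e.1, sub_self]
    have h2 : dt a (u - v) = 0 := by rw [hs, e.2, sub_self]
    by_contra hne
    rw [dt_comm] at h1 h2
    exact h (dt_z (sub_ne_zero.2 hne) (neg_eq_zero.1 h2) (neg_eq_zero.1 h1))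
  · refine ⟨v + (-(dt a v / dt a t)) • t, ?_, dt a v / dt a t, by simp⟩
    have h1 := Int.emod_nonneg (dt a v) h
    have h2 := Int.emod_lt_abs (dt a v) h
    have h3 := Int.emod_add_mul_ediv (dt a v) (dt a t)
    simp only [Set.mem_preimage, Set.mem_prod, Set.mem_Icc, dt_add, dt_smul, dt_self, mul_zero, add_zero]
    refine ⟨abs_le.1 hv, ?_, ?_⟩ <;> nlinarith

theorem strip_ev {Pr : ℕ → G → Prop} {X : G} {a t : ℤ × ℤ} (ht : Tv P X t) (hd : dt a t ≠ 0)
    (h : ∀ g, ∀ᶠ n in Filter.atTop, ∀ m : ℤ, Pr n (X ^ m * g)) (K : ℤ) :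
    ∀ᶠ n in Filter.atTop, ∀ v, |dt t v| ≤ K → Pr n (P.gg (P.ξ v 0)) := by
  obtain ⟨B, hB, hv⟩ := strip_fin hd K
  filter_upwards [(Filter.eventually_all_finite hB).2 fun b _ => h (P.gg (P.ξ b 0))] with n hn v hK
  obtain ⟨b, hb, m, rfl⟩ := hv v hK
  rw [((ht.zpow m) b 0).1]
  exact hn b hb m

theorem cm_cell (p : G) (v) : Cm (Q.tr p) P v ↔ P.Cell (p * Q.gg (Q.ξ v 0), Q.rw (Q.ξ v 0)) :=
  ⟨fun ⟨e, h⟩ => ⟨e, h.1.symm, h.2.symm⟩, fun ⟨e, h⟩ => ⟨e, h.1.symm, h.2.symm⟩⟩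
theorem cm_cell1 (v) : Cm Q P v ↔ P.Cell (Q.gg (Q.ξ v 0), Q.rw (Q.ξ v 0)) :=
  ⟨fun ⟨e, h⟩ => ⟨e, h.1.symm, h.2.symm⟩, fun ⟨e, h⟩ => ⟨e, h.1.symm, h.2.symm⟩⟩

theorem row_ex (h0 : SC Rw) {w a : ℤ × ℤ} {K : ℤ} (hK : ∀ k, 2 * |dt w (hx k)| ≤ K) (hc : ∀ v, |dt w v| ≤ K → Cm Q P v)
    (ha : dt w a ≠ 0) (hf : ∃ i : ℕ, ¬ Cm Q P (i • a)) : ∃ w', (w' = w ∨ w' = -w) ∧ ∃ j, dt w (hx j) = 0 ∧ ∃ v0, 0 < dt w' v0 ∧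
      (∀ v, -K ≤ dt w' v → dt w' v < dt w' v0 → Cm Q P v) ∧ ∀ n : ℤ, ¬ Cm Q P (v0 + n • hx j) := by
  have hng : ∀ v, dt (-w) v = - dt w v := by intro v; simp [dt]; ring
  obtain ⟨w', hw', hpos⟩ : ∃ w', (w' = w ∨ w' = -w) ∧ 0 < dt w' a := by
    rcases lt_or_gt_of_ne ha with h | h
    · exact ⟨-w, Or.inr rfl, by rw [hng]; omega⟩
    · exact ⟨w, Or.inl rfl, h⟩
  have hab : ∀ v, |dt w' v| = |dt w v| := by
    intro v; rcases hw' with rfl | rfl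
    · rfl
    · rw [hng, abs_neg]
  obtain ⟨i, hi⟩ := hf
  have hK0 : 0 ≤ K := (by positivity : (0:ℤ) ≤ 2 * |dt w (hx 0)|).trans (hK 0)
  obtain ⟨j, hj, v0, _, h2, h3, h4⟩ := rowD (fun v => ¬ Cm Q P v) (fun v hv k => nc_step h0 hv k) w' (ne0 hpos.ne').1 K
    (fun k => by have := hK k; rw [← hab] at this; have := le_abs_self (dt w' (hx k)); omega)
    (fun v h1 h2 => not_not.2 (hc v (by rw [← hab, abs_le]; omega)))
    ⟨i • a, hi, by
      rw [← natCast_zsmul, dt_smul]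
      refine mul_pos ?_ hpos
      rcases Nat.eq_zero_or_pos i with rfl | h
      · exact absurd (hc _ (by simpa [dt] using hK0)) hi
      · exact_mod_cast h⟩
  refine ⟨w', hw', j, ?_, v0, h2, fun v a b => not_not.1 (h3 v a b), h4⟩
  rw [← abs_eq_zero, ← hab, hj, abs_zero]

theorem match_ex (h0 : SC Rw) {t : ℤ × ℤ} {c : ℤ} {i : ZMod 6} (ht : t = c • hx i) {K M : ℤ} (hM : 0 ≤ M)
    (hK : ∀ k, M + |dt t (hx k)| ≤ K) (hc : ∀ v, |dt t v| ≤ K → Cm Q P v) : ∃ o s, ∀ v, |dt t v| ≤ M → Mt Q P o s v := by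
  have he : ∀ v, dt t v = c * dt (hx i) v := fun v => by rw [ht, sm_dt]
  have hm : ∀ q q' : ℤ, |q| ≤ |q'| → |c * q'| ≤ M → |c * q| ≤ M := fun q q' h1 h2 => by
    rw [abs_mul] at *; exact (mul_le_mul_of_nonneg_left h1 (abs_nonneg _)).trans h2
  obtain ⟨o, s, h⟩ := matching h0 i (fun q => |c * q| ≤ M) (by simpa using hM) (fun q h => hm _ _ (by rw [abs_of_nonneg h, abs_of_nonneg] <;> omega))
    (fun q h => hm _ _ (by rw [abs_of_nonpos h, abs_of_nonpos] <;> omega)) (Q := Q) (P := P) fun v hv => by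
      rw [← he] at hv
      refine ⟨hc v ?_, fun k => hc _ ?_⟩
      · have := hK 0; have := abs_nonneg (dt t (hx 0)); omega
      · rw [dt_add]; exact (abs_add_le _ _).trans ((add_le_add_left hv _).trans (hK k))
  exact ⟨o, s, fun v hv => h v (by rwa [← he])⟩

theorem match_tv (h0 : SC Rw) {x y X : G} (hL : Lat x y) {m n : ℤ} (hm : m ≠ 0) (hn : n ≠ 0) {b b' t u : ℤ × ℤ} (hx : Tv P (x ^ m) b) (hy : Tv P (y ^ n) b')
    (ht : Tv Q X t) (hu : Tv P X u) {o s} (h1 : Mt Q P o s 0) (h2 : Mt Q P o s t) : rt o t = u := by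
  have e1 := h1 0
  have e2 := h2 0
  have hq := ht 0 0
  have hp := hu (rt o 0 + s) (0 + o)
  rw [zero_add] at hq
  have e3 : Same Q P (Q.ξ t 0) (P.ξ (rt o 0 + s + u) (0 + o)) := ⟨by rw [hq.1, hp.1, e1.1], by rw [hq.2, hp.2, e1.2]⟩
  have h := e2.uniq e3
  have hz : rt o 0 = 0 := by simp [rt]
  simp only [hz, zero_add] at h
  rw [show rt o t + s = (s + u) + (rt o t - u) by abel] at h
  exact sub_eq_zero.1 (no_per h0 hL hm hn hx hy h)

/-- a row of non-common cells propagates along the matched strip -/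
theorem meet {t a z w v0 s : ℤ × ℤ} {c : ℤ} {i j o : ZMod 6} (ht : t = c • hx i) (hz : dt z (rt o t) ≠ 0) (hzj : dt z (hx j) = 0)
    (hw : w = z ∨ w = -z) {K : ℤ} (hK : |dt z (rt o a)| ≤ K) (h2 : 0 < dt w v0) (h3 : ∀ v, -K ≤ dt w v → dt w v < dt w v0 → Cm P' P'' v)
    (h4 : ∀ n : ℤ, ¬ Cm P' P'' (v0 + n • hx j))
    (hi : ∀ v, dt t v = 0 → ∀ e : ℤ, (e = 1 ∨ e = -1) → Cm P' P'' (rt o (v + e • a) + s) → Cm P' P'' (rt o v + s)) : dt (hx j) (rt o a) = 0 := by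
  have hng : ∀ v, dt (-z) v = - dt z v := by intro v; simp [dt]; ring
  refine dt_z (ne0 hz).1 hzj ?_
  by_contra hne
  have hwa : dt w (rt o a) ≠ 0 ∧ |dt w (rt o a)| ≤ K ∧ dt w (hx j) = 0 := by
    rcases hw with rfl | rfl
    · exact ⟨hne, hK, hzj⟩
    · rw [hng, abs_neg, hng, hzj]; exact ⟨neg_ne_zero.2 hne, hK, neg_zero⟩
  obtain ⟨e, he, hneg⟩ : ∃ e : ℤ, (e = 1 ∨ e = -1) ∧ e * dt w (rt o a) < 0 ∧ -K ≤ e * dt w (rt o a) := by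
    have := abs_le.1 hwa.2.1
    rcases lt_or_gt_of_ne hwa.1 with h | h
    · exact ⟨1, Or.inl rfl, by omega, by omega⟩
    · exact ⟨-1, Or.inr rfl, by omega, by omega⟩
  have hd : dt (hx (i + o)) (hx j) ≠ 0 := by
    intro h
    apply hz
    rw [ht, rt_smul, rt_hx, dt_smul]
    rcases hx_par (i + o) j with h' | h' | h'
    · rw [h', hzj, mul_zero]
    · rw [h', show dt z (-hx j) = - dt z (hx j) by simp [dt]; ring, hzj]; ring
    · exact absurd h h'
  have hd1 := dt_hx1 _ _ hd
  set δ := dt (hx (i + o)) (hx j)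
  let n : ℤ := - (dt (hx (i + o)) (v0 - s) * δ)
  let v := rt (-o) (v0 + n • hx j - s)
  have hv : rt o v + s = v0 + n • hx j := by simp only [v, rt_inv, sub_add_cancel]
  have hv0 : dt t v = 0 := by
    rw [ht, sm_dt, ← dt_rt o, rt_hx, eq_sub_of_add_eq hv, show v0 + n • hx j - s = (v0 - s) + n • hx j by abel, dt_add, dt_smul]
    simp only [n]; linear_combination -c * dt (hx (i + o)) (v0 - s) * hd1
  refine h4 n (hv ▸ hi v hv0 e he (h3 _ ?_ ?_))
  all_goals
    rw [rt_add, show rt o v + rt o (e • a) + s = (rt o v + s) + rt o (e • a) by abel, hv, rt_smul, dt_add, dt_add, dt_smul, dt_smul, hwa.2.2]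
    omega

theorem final6 : ∀ i j o : ZMod 6, dt (hx (j - o)) (hx (i + (i + o) - j)) = 0 → hx i = hx (j - o) ∨ hx i = - hx (j - o) := by decide
end Pl

end

section
open scoped Classical
universe uG uS
variable {S : Type uS}
variable {Rw : Set (Wd S)}
variable {G : Type uG} [Group G] {ι : FreeGroup S →* G}
variable {J : FreeGroup Bool × FreeGroup Bool →* G} {L : List ((Bool × Bool) × ℚ × G × Wd S)}

namespace Pl
variable {Q P P' P'' : Pl Rw ι}

theorem Jl (x : FreeGroup Bool) (k : ℤ) : J (x, 1) ^ k = J (x ^ k, 1) := by rw [← map_zpow, Prod.pow_mk, one_zpow]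
theorem Jr (x : FreeGroup Bool) (k : ℤ) : J (1, x) ^ k = J (1, x ^ k) := by rw [← map_zpow, Prod.pow_mk, one_zpow]

/-- the data attached to one of the two copies of the first plane -/
structure Sd (J : FreeGroup Bool × FreeGroup Bool →* G) (L : List ((Bool × Bool) × ℚ × G × Wd S)) (Q : Pl Rw ι)
    (q : ℚ) (n : ℕ) (x : FreeGroup Bool) (K : ℤ) (a t : ℤ × ℤ) : Prop where
  qq : q * q = 1
  cell : ∀ g ρ, Q.Cell (g, ρ) → CC J L aw aw g ρ = q
  ta : Tv Q (J (FreeGroup.of true, 1) ^ (6 : ℤ)) a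
  tt : Tv Q (J (1, FreeGroup.of true) ^ (6 : ℤ)) t
  st : ∀ v, |dt t v| ≤ K → ∀ w ρ, CC J L (zw n) w (J (x, 1) * Q.gg (Q.ξ v 0)) ρ = q * CC J L aw w (Q.gg (Q.ξ v 0)) ρ
  hK : ∀ k, |dt t a| + |dt t (hx k)| ≤ K

variable {q : ℚ} {n m : ℕ} {x : FreeGroup Bool} {K : ℤ} {a t : ℤ × ℤ}

theorem Sd.cm (h : Sd J L Q q n x K a t) (hP : ∀ g ρ, P'.Cell (g, ρ) ↔ CC J L (zw n) aw g ρ = 1) (v) (hv : |dt t v| ≤ K) :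
    Cm (Q.tr (J (x, 1))) P' v := by
  rw [cm_cell, hP, h.st v hv, h.cell _ _ ⟨_, rfl, rfl⟩, h.qq]

theorem Sd.mt (h0 : SC Rw) (h : Sd J L Q q n x K a t) (hP : ∀ g ρ, P'.Cell (g, ρ) ↔ CC J L (zw n) aw g ρ = 1)
    {c : ℤ} {i : ZMod 6} (ht : t = c • hx i) {y : G} (hL : Lat y (J (1, FreeGroup.of true))) {z u} (hz : Tv P' (y ^ (6 : ℤ)) z)
    (hu : Tv P' (J (1, FreeGroup.of true) ^ (6 : ℤ)) u) :
    ∃ o s, (∀ v, |dt t v| ≤ |dt t a| → Mt (Q.tr (J (x, 1))) P' o s v) ∧ rt o t = u := by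
  obtain ⟨o, s, hM⟩ := match_ex h0 ht (abs_nonneg _) h.hK (fun v hv => h.cm hP v hv)
  refine ⟨o, s, hM, match_tv h0 hL (by decide) (by decide) hz hu ?_ hu (hM 0 (by simp [dt])) (hM t (by simp [dt_self]))⟩
  have := h.tt.tr (p := J (x, 1))
  rwa [Jr, ← map_mul, ← map_inv, ← map_mul, show ((x, 1) * (1, FreeGroup.of true ^ (6 : ℤ)) * (x, 1)⁻¹ : FreeGroup Bool × FreeGroup Bool) =
    (1, FreeGroup.of true ^ (6 : ℤ)) by ext <;> simp, ← Jr] at this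

theorem Sd.hi (hJ : Function.Injective J) (h : Sd J L Q q n x K a t) (hP : ∀ g ρ, P''.Cell (g, ρ) ↔ CC J L (zw n) (zw m) g ρ = 1) {o s}
    (hM : ∀ v, |dt t v| ≤ |dt t a| → Mt (Q.tr (J (x, 1))) P' o s v) (v) (hv : dt t v = 0) (e : ℤ) (he : e = 1 ∨ e = -1)
    (hc : Cm P' P'' (rt o (v + e • a) + s)) : Cm P' P'' (rt o v + s) := by
  have key : ∀ v, |dt t v| ≤ |dt t a| → (Cm P' P'' (rt o v + s) ↔ q * CC J L aw (zw m) (Q.gg (Q.ξ v 0)) (Q.rw (Q.ξ v 0)) = 1) := by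
    intro v hv
    rw [← h.st v (by have := h.hK 0; have := abs_nonneg (dt t (hx 0)); omega), ← hP, ← cm_iff _ (0 + o)]
    have e := hM v hv 0
    have e1 : J (x, 1) * Q.gg (Q.ξ v 0) = _ := e.1
    have e2 : Q.rw (Q.ξ v 0) = _ := e.2
    rw [e1, e2]
    exact ⟨fun ⟨e, h⟩ => ⟨e, h.1.symm, h.2.symm⟩, fun ⟨e, h⟩ => ⟨e, h.1.symm, h.2.symm⟩⟩
  rw [key _ (by rw [hv, abs_zero]; exact abs_nonneg _)]
  rw [key _ (by rw [dt_add, hv, dt_smul, zero_add]; rcases he with rfl | rfl <;> simp)] at hc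
  have ht := h.ta.zpow e v 0
  rw [ht.1, ht.2, ← zpow_mul, Jl] at hc
  have := CC_inv (L := L) hJ aw (zw m) (6 * e) 0 (Q.gg (Q.ξ v 0)) (Q.rw (Q.ξ v 0))
  rw [zpow_zero, show FreeGroup.mk aw = FreeGroup.of true from rfl] at this
  rwa [this] at hc

theorem tv6 (h0 : SC Rw) (hJ : Function.Injective J) {u w : List (Bool × Bool)} (hP : ∀ g ρ, P.Cell (g, ρ) ↔ CC J L u w g ρ = 1) :
    (∃ a, Tv P (J (FreeGroup.mk u, 1) ^ (6 : ℤ)) a) ∧ ∃ t, Tv P (J (1, FreeGroup.mk w) ^ (6 : ℤ)) t := by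
  rw [zpow_ofNat, zpow_ofNat]
  constructor
  · refine act6 h0 _ fun g r h => ?_
    have := CC_inv (L := L) hJ u w 1 0 g r
    rw [zpow_one, zpow_zero] at this
    rw [hP] at *; rwa [this]
  · refine act6 h0 _ fun g r h => ?_
    have := CC_inv (L := L) hJ u w 0 1 g r
    rw [zpow_one, zpow_zero] at this
    rw [hP] at *; rwa [this]

theorem bd_ex (s : Finset ℤ) : ∃ K : ℤ, ∀ x ∈ s, x ≤ K := s.bddAbove

theorem no_J (h0 : SC Rw) (hR : ∀ r ∈ Rw, ι (FreeGroup.mk r) = 1)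
    (hk : ∀ g, ι g = 1 → g ∈ Subgroup.normalClosure (FreeGroup.mk '' Rw)) (hs : Function.Surjective ι)
    (hJ : Function.Injective J) : False := by
  obtain ⟨L, hpl⟩ := planes h0 hR hk hs hJ
  have ea : es true (FreeGroup.mk aw) ≠ 0 := by rw [show FreeGroup.mk aw = FreeGroup.of true from rfl, es_of]; decide
  have ez : ∀ n : ℕ, 0 < n → es false (FreeGroup.mk (zw n)) ≠ 0 := fun n hn => by rw [(es_zw n).2]; omega
  -- the first plane
  obtain ⟨P, hP⟩ := hpl aw aw (lat_of hJ true true ea ea)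
  obtain ⟨⟨a, ta⟩, t, tt⟩ := tv6 h0 hJ (fun g ρ => (hP g ρ).1)
  have hat := tv_indep (lat_of hJ true true ea ea) (by decide) (by decide) ta tt
  rw [show FreeGroup.mk aw = FreeGroup.of true from rfl] at ta tt
  have hta : dt t a ≠ 0 := by rw [dt_comm]; exact neg_ne_zero.2 hat
  obtain ⟨K, hK⟩ : ∃ K : ℤ, ∀ k, 2 * |dt t (hx k)| ≤ K ∧ |dt t a| + |dt t (hx k)| ≤ K := by
    obtain ⟨K, h⟩ := bd_ex (univ.image fun k => 2 * |dt t (hx k)| + |dt t a|)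
    refine ⟨K, fun k => ?_⟩
    have := h _ (mem_image_of_mem _ (mem_univ k))
    have := abs_nonneg (dt t a); have := abs_nonneg (dt t (hx k))
    constructor <;> omega
  have tam := ta.mir h0
  have ttm := tt.mir h0
  have hst : ∀ {Q : Pl Rw ι} {a t}, Tv Q (J (1, FreeGroup.of true) ^ (6 : ℤ)) t → dt a t ≠ 0 → ∀ᶠ n in Filter.atTop, ∀ v, |dt t v| ≤ K →
      ∀ w ρ, CC J L (zw n) w (Q.gg (Q.ξ v 0)) ρ = CC J L aw w (Q.gg (Q.ξ v 0)) ρ ∧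
      CC J L (zw n) w (J (pn n, 1) * Q.gg (Q.ξ v 0)) ρ = - CC J L aw w (Q.gg (Q.ξ v 0)) ρ := by
    intro Q a t ht hd
    refine strip_ev (Pr := fun n g => ∀ w ρ, CC J L (zw n) w g ρ = CC J L aw w g ρ ∧
      CC J L (zw n) w (J (pn n, 1) * g) ρ = - CC J L aw w g ρ) ht hd (fun g => ?_) K
    filter_upwards [ev1 (L := L) hJ g] with n hn m w ρ
    rw [← zpow_mul, Jr, ← mul_assoc, ← map_mul]
    simpa using hn w (FreeGroup.of true ^ (6 * m)) ρ
  obtain ⟨n, ⟨hn1, hn2⟩, hn0⟩ := (((hst tt hat).and (hst ttm (a := rf a) (by rw [dt_rf]; exact neg_ne_zero.2 hat))).and (Filter.eventually_gt_atTop 0)).exists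
  have s1 : Sd J L P 1 n 1 K a t := ⟨by norm_num, fun g ρ => (hP g ρ).1.1, ta, tt, fun v hv w ρ => by
    rw [← Prod.one_eq_mk, map_one, one_mul, one_mul]; exact (hn1 v hv w ρ).1, fun k => (hK k).2⟩
  have s2 : Sd J L (P.mir h0) (-1) n (pn n) K (rf a) (rf t) := ⟨by norm_num, fun g ρ h => (hP g ρ).2.1 ((cell_mir _ _ _ _).1 h), tam, ttm,
    fun v hv w ρ => by rw [neg_one_mul]; exact (hn2 v hv w ρ).2, fun k => by
      have := (hK (-k)).2
      rw [← rf_rf (hx k), dt_rf, dt_rf, rf_hx, abs_neg, abs_neg]; exact this⟩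
  -- the second plane
  have hL' := lat_of hJ false true (ez n hn0) ea
  obtain ⟨P', hP'⟩ := hpl (zw n) aw hL'
  obtain ⟨⟨z, tz⟩, t', tt'⟩ := tv6 h0 hJ (fun g ρ => (hP' g ρ).1)
  have hzt := tv_indep hL' (by decide) (by decide) tz tt'
  rw [show FreeGroup.mk aw = FreeGroup.of true from rfl] at tt' hL'
  obtain ⟨_, _, i, hi, _⟩ := row_ex (Q := P.tr (J (1, 1))) (P := P') h0 (fun k => (hK k).1) (fun v hv => s1.cm (fun g ρ => (hP' g ρ).1) v hv) hta (by
    obtain ⟨i, hi⟩ := (far1 (L := L) hJ n (P.gg (P.ξ 0 0))).exists_forall_of_atTop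
    refine ⟨i, ?_⟩
    have h := ta.npow i 0 0
    rw [zero_add] at h
    rw [cm_cell, (hP' _ _).1, h.1, h.2, ← zpow_natCast, ← zpow_mul, Jl, ← Prod.one_eq_mk, map_one, one_mul,
      show (6 : ℤ) * i = ((6 * i : ℕ) : ℤ) by push_cast; ring, zpow_natCast, hi _ (by omega)]
    norm_num)
  obtain ⟨c, hc⟩ := par_hx hi
  have hc2 : rf t = c • hx (-i) := by rw [hc, rf_smul, rf_hx]
  obtain ⟨o1, r1, m1, e1⟩ := s1.mt h0 (fun g ρ => (hP' g ρ).1) hc hL' tz tt'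
  obtain ⟨o2, r2, m2, e2⟩ := s2.mt h0 (fun g ρ => (hP' g ρ).1) hc2 hL' tz tt'
  have ho : o2 = i + (i + o1) := by
    have hc0 : c ≠ 0 := by rintro rfl; rw [zero_smul] at hc; exact (ne0 hat).2 hc
    have := e1.trans e2.symm
    rw [hc2, hc, rt_smul, rt_smul, rt_hx, rt_hx] at this
    have := hx_inj _ _ (smul_right_injective _ hc0 this)
    linear_combination -this
  -- the third plane
  obtain ⟨K', hK'⟩ : ∃ K : ℤ, (∀ k, 2 * |dt z (hx k)| ≤ K) ∧ |dt z (rt o1 a)| ≤ K ∧ |dt z (rt o2 (rf a))| ≤ K := by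
    obtain ⟨K, h⟩ := bd_ex ((univ.image fun k => 2 * |dt z (hx k)|) ∪ {|dt z (rt o1 a)|, |dt z (rt o2 (rf a))|})
    exact ⟨K, fun k => h _ (mem_union_left _ (mem_image_of_mem _ (mem_univ k))), h _ (by simp), h _ (by simp)⟩
  have htz : dt t' z ≠ 0 := by rw [dt_comm]; exact neg_ne_zero.2 hzt
  obtain ⟨m, hm, hm0⟩ := ((strip_ev (Pr := fun m g => ∀ ρ, CC J L (zw n) (zw m) g ρ = CC J L (zw n) aw g ρ) tz htz (fun g => by
    filter_upwards [ev2 (L := L) hJ g] with m hm k ρ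
    rw [← zpow_mul, Jl]; exact hm _ _ ρ) K').and (Filter.eventually_gt_atTop 0)).exists
  obtain ⟨P'', hP''⟩ := hpl (zw n) (zw m) (lat_of hJ false false (ez n hn0) (ez m hm0))
  obtain ⟨w, hw, j, hj, v0, h2, h3, h4⟩ := row_ex (Q := P') (P := P'') h0 hK'.1 (fun v hv => by
    rw [cm_cell1, (hP'' _ _).1, hm v hv, ← (hP' _ _).1]; exact ⟨_, rfl, rfl⟩) hzt (by
    obtain ⟨i, hi⟩ := (far2 (L := L) hJ m (P'.gg (P'.ξ 0 0))).exists_forall_of_atTop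
    refine ⟨i, ?_⟩
    have h := tt'.npow i 0 0
    rw [zero_add] at h
    rw [cm_cell1, (hP'' _ _).1, h.1, h.2, ← zpow_natCast, ← zpow_mul, Jr,
      show (6 : ℤ) * i = ((6 * i : ℕ) : ℤ) by push_cast; ring, zpow_natCast, hi _ (by omega)]
    norm_num)
  have f1 := meet hc (e1 ▸ hzt) hj hw hK'.2.1 h2 h3 h4 (s1.hi hJ (fun g ρ => (hP'' g ρ).1) m1)
  have f2 := meet hc2 (e2 ▸ hzt) hj hw hK'.2.2 h2 h3 h4 (s2.hi hJ (fun g ρ => (hP'' g ρ).1) m2)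
  rw [← sub_add_cancel j o1, ← rt_hx, dt_rt] at f1
  rw [← sub_add_cancel j o2, ← rt_hx, dt_rt, ← rf_rf (hx _), dt_rf, rf_hx, neg_sub, neg_eq_zero, ho] at f2
  apply hat
  rw [dt_comm] at f1 f2
  have := final6 i j o1 (dt_z (ne0 hat).1 (neg_eq_zero.1 f1) (neg_eq_zero.1 f2))
  rw [hc, dt_smul]
  rcases this with h | h
  · rw [h, neg_eq_zero.1 f1, mul_zero]
  · rw [h, show dt a (-hx (j - o1)) = - dt a (hx (j - o1)) by simp [dt]; ring, f1, mul_zero]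
end Pl

end
end C6

/-- A C(6) small-cancellation group contains no subgroup isomorphic to the
product of two free groups of rank at least two. -/
theorem c6_no_subgroup_free_prod_free {S : Type*} [DecidableEq S]
    (R : Set (FreeGroup S)) (hSym : FG.Symmetrized R) (hC6 : FG.C6 R) :
    ∀ (A B : Type) [Nontrivial A] [Nontrivial B],
      ¬ ∃ H : Subgroup (PresentedGroup R),
          Nonempty (H ≃* (FreeGroup A × FreeGroup B)) := by
  rintro A B _ _ ⟨H, ⟨e⟩⟩
  have emb : ∀ (A : Type) [Nontrivial A], ∃ f : FreeGroup Bool →* FreeGroup A, Function.Injective f := by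
    intro A _
    obtain ⟨a, b, hab⟩ := exists_pair_ne A
    exact ⟨FreeGroup.map fun s : Bool => if s then a else b, FreeGroup.map_injective fun s t h => by
      cases s <;> cases t <;> simp_all [eq_comm]⟩
  obtain ⟨f, hf⟩ := emb A
  obtain ⟨f', hf'⟩ := emb B
  have hi : FreeGroup.mk '' (FreeGroup.toWord '' R) = R := by
    rw [Set.image_image]; simp [FreeGroup.mk_toWord]
  refine C6.Pl.no_J (Rw := FreeGroup.toWord '' R) (ι := PresentedGroup.mk R)
    (J := H.subtype.comp (e.symm.toMonoidHom.comp (f.prodMap f'))) (C6.sc_of_FG hSym hC6) ?_ ?_ (PresentedGroup.mk_surjective R) ?_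
  · rintro _ ⟨r, hr, rfl⟩
    rw [FreeGroup.mk_toWord]
    exact PresentedGroup.one_of_mem hr
  · intro g hg
    rw [hi]
    exact (QuotientGroup.eq_one_iff g).1 hg
  · exact H.subtype_injective.comp (e.symm.injective.comp (hf.prodMap hf'))
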